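/- Let S be a closed surface and X ⊆ S a shielded continuum such that the frontier of every complementary domain of X is locally connected. Then X is indecomposable if and only if there exists a sequence (Uₙ) of complementary domains of X satisfying the double-pass condition with crosscuts (i.e., the double-pass condition in which genuine crosscuts are used in place of generalized crosscuts). -/

import Mathlib

open Set Metric Filter Topology

/-- A space is locally homeomorphic to ℝ²: every point has an open
neighborhood homeomorphic to the Euclidean plane. -/
def LocallyEuclidean2 (S : Type*) [TopologicalSpace S] : Prop :=
  ∀ x : S, ∃ U : Set S, IsOpen U ∧ x ∈ U ∧
    Nonempty (U ≃ₜ EuclideanSpace ℝ (Fin 2))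

section Defs

variable {S : Type*} [TopologicalSpace S]

/-- A continuum: a nonempty compact connected subset. -/
def IsContinuum (X : Set S) : Prop := IsCompact X ∧ IsConnected X

/-- A complementary domain of `X`: a connected component of the complement of `X`. -/
def IsComplementaryDomain (X U : Set S) : Prop :=
  ∃ x, x ∉ X ∧ U = connectedComponentIn Xᶜ x

/-- A proper subcontinuum of `X`. -/
def IsProperSubcontinuum (X A : Set S) : Prop :=
  A.Nonempty ∧ IsClosed A ∧ IsConnected A ∧ A ⊆ X ∧ A ≠ X

/-- `X` is decomposable: the union of two proper subcontinua. -/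
def IsDecomposable (X : Set S) : Prop :=
  ∃ A B, IsProperSubcontinuum X A ∧ IsProperSubcontinuum X B ∧ A ∪ B = X

/-- `X` is the essential union of three proper subcontinua. -/
def IsEssentialUnionOfThree (X : Set S) : Prop :=
  ∃ X₁ X₂ X₃, IsProperSubcontinuum X X₁ ∧ IsProperSubcontinuum X X₂ ∧
    IsProperSubcontinuum X X₃ ∧ X₁ ∪ X₂ ∪ X₃ = X ∧
    ¬ X₁ ⊆ X₂ ∪ X₃ ∧ ¬ X₂ ⊆ X₁ ∪ X₃ ∧ ¬ X₃ ⊆ X₁ ∪ X₂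

/-- `X` is 2-indecomposable: decomposable but not the essential union of
three proper subcontinua. -/
def Is2Indecomposable (X : Set S) : Prop :=
  IsDecomposable X ∧ ¬ IsEssentialUnionOfThree X

/-- `X` is shielded: no complementary domain has frontier equal to `X`. -/
def IsShielded (X : Set S) : Prop :=
  ∀ U, IsComplementaryDomain X U → frontier U ≠ X

/-- A generalized crosscut of `U`. -/
def IsGenCrosscut (U A : Set S) : Prop :=
  A ⊆ U ∧ Nonempty (A ≃ₜ Set.Ioo (0:ℝ) 1) ∧ closure A \ A ⊆ frontier U

/-- `T` is a shadow of the (generalized) crosscut `A` of `U`. -/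
def IsShadowOf (U A T : Set S) : Prop :=
  ∃ x ∈ U \ A, T = closure (connectedComponentIn (U \ A) x) ∩ frontier U

/-- An arc with endpoints `a` and `b`. -/
def IsArcFrom (A : Set S) (a b : S) : Prop :=
  ∃ f : Set.Icc (0:ℝ) 1 → S, Continuous f ∧ Function.Injective f ∧
    Set.range f = A ∧ f ⟨0, by norm_num⟩ = a ∧ f ⟨1, by norm_num⟩ = b

/-- A crosscut of `U`: a copy of `(0,1)` in `U` whose closure is an arc
meeting the frontier of `U` exactly at the endpoints of the arc. -/
def IsCrosscut (U K : Set S) : Prop :=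
  K ⊆ U ∧ Nonempty (K ≃ₜ Set.Ioo (0:ℝ) 1) ∧
    ∃ a b, IsArcFrom (closure K) a b ∧ closure K ∩ frontier U = {a, b}

/-- A closed disk: a set homeomorphic to the closed unit disk in ℝ². -/
def IsClosedDisk (D : Set S) : Prop :=
  Nonempty (D ≃ₜ Metric.closedBall (0 : EuclideanSpace ℝ (Fin 2)) 1)

/-- A cat's cradle between `d₁` and `d₃`: a family of arcs from `d₁` to `d₃`
whose interiors are pairwise disjoint. -/
def IsCatsCradle {ι : Type*} (d₁ d₃ : S) (A : ι → Set S) : Prop :=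
  (∀ i, IsArcFrom (A i) d₁ d₃) ∧
    Pairwise fun i j => (A i \ {d₁, d₃}) ∩ (A j \ {d₁, d₃}) = ∅

/-- A cat's cradle between `d₁` and `d₃` through `D₂`. -/
def IsCatsCradleThrough {ι : Type*} (d₁ d₃ : S) (D₂ : Set S) (A : ι → Set S) : Prop :=
  IsCatsCradle d₁ d₃ A ∧ D₂ ∩ {d₁, d₃} = ∅ ∧ ∀ i, (A i ∩ D₂).Nonempty

/-- A chord of the closed disk `D`: an arc in `D` meeting the frontier of `D`
exactly at its two endpoints. -/
def IsChord (D A : Set S) : Prop :=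
  ∃ a b, IsArcFrom A a b ∧ A ⊆ D ∧ A ∩ frontier D = {a, b}

/-- A sequence of pairwise disjoint chords of `D` is linearly ordered if each
middle chord separates the earlier ones from the later ones in `D`. -/
def LinearlyOrderedChords (D : Set S) (A : ℕ → Set S) : Prop :=
  (Pairwise fun i j => Disjoint (A i) (A j)) ∧
    ∀ i j k, i < j → j < k → ∀ x ∈ A i, ∀ y ∈ A k,
      connectedComponentIn (D \ A j) x ≠ connectedComponentIn (D \ A j) y

end Defs

section MetricDefs

variable {S : Type*} [MetricSpace S]

/-- Convergence of a sequence of sets to `X` in the Hausdorff metric. -/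
def HausdorffConvergesTo (A : ℕ → Set S) (X : Set S) : Prop :=
  Tendsto (fun n => hausdorffDist (A n) X) atTop (𝓝 0)

/-- The double-pass condition for a sequence of domains. -/
def DoublePassCondition (X : Set S) (U : ℕ → Set S) : Prop :=
  ∀ K : ℕ → Set S, (∀ n, IsGenCrosscut (U n) (K n)) →
    ∃ Sh : ℕ → Set S, (∀ n, IsShadowOf (U n) (K n) (Sh n)) ∧ HausdorffConvergesTo Sh X

/-- The double-pass condition with (genuine) crosscuts. -/
def DoublePassConditionCrosscuts (X : Set S) (U : ℕ → Set S) : Prop :=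
  ∀ K : ℕ → Set S, (∀ n, IsCrosscut (U n) (K n)) →
    ∃ Sh : ℕ → Set S, (∀ n, IsShadowOf (U n) (K n) (Sh n)) ∧ HausdorffConvergesTo Sh X

end MetricDefs

open Set Metric Filter Topology

/-- The circle. -/
abbrev Circ1 := AddCircle (1:ℝ)

section Lift
variable {S : Type*} [TopologicalSpace S]

def LiftOn (f : S → Circ1) (Z : Set S) : Prop :=
  ∃ θ : S → ℝ, ContinuousOn θ Z ∧ ∀ x ∈ Z, ((θ x : ℝ) : Circ1) = f x

def Liftable (Z : Set S) : Prop := ∀ f : S → Circ1, ContinuousOn f Z → LiftOn f Z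

lemma LiftOn.mono {f : S → Circ1} {Z Z' : Set S} (h : LiftOn f Z) (hs : Z' ⊆ Z) : LiftOn f Z' := by
  obtain ⟨θ, h1, h2⟩ := h
  exact ⟨θ, h1.mono hs, fun x hx => h2 x (hs hx)⟩

lemma LiftOn.congr {f g : S → Circ1} {Z : Set S} (h : LiftOn f Z) (hs : EqOn f g Z) : LiftOn g Z := by
  obtain ⟨θ, h1, h2⟩ := h
  exact ⟨θ, h1, fun x hx => (h2 x hx).trans (hs hx)⟩

lemma coe_circ_eq_iff (a b : ℝ) : ((a : ℝ) : Circ1) = (b : Circ1) ↔ ∃ n : ℤ, a = b + n := by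
  rw [← sub_eq_zero, ← AddCircle.coe_sub, AddCircle.coe_eq_zero_iff]
  constructor
  · rintro ⟨n, hn⟩
    exact ⟨n, by simp at hn; linarith⟩
  · rintro ⟨n, hn⟩
    exact ⟨n, by simp; linarith⟩

lemma coe_circ_int (n : ℤ) : (((n:ℝ)) : Circ1) = 0 := by
  rw [AddCircle.coe_eq_zero_iff]; exact ⟨n, by simp⟩

lemma continuous_coe_circ : Continuous ((↑) : ℝ → Circ1) := AddCircle.continuous_mk' 1

lemma isDiscrete_range_int : IsDiscrete (range ((↑) : ℤ → ℝ)) :=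
  Int.isClosedEmbedding_coe_real.isEmbedding.isDiscrete_range

lemma lift_unique {Z : Set S} (hZ : IsPreconnected Z) {θ θ' : S → ℝ} (h : ContinuousOn θ Z)
    (h' : ContinuousOn θ' Z) (he : ∀ x ∈ Z, ((θ x : ℝ) : Circ1) = (θ' x : Circ1)) :
    ∃ n : ℤ, ∀ x ∈ Z, θ x = θ' x + n := by
  have hm : MapsTo (fun x => θ x - θ' x) Z (range ((↑) : ℤ → ℝ)) := by
    intro x hx
    obtain ⟨n, hn⟩ := (coe_circ_eq_iff _ _).1 (he x hx)
    exact ⟨n, by simp [hn]⟩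
  obtain ⟨y, ⟨n, rfl⟩, hy⟩ := hZ.eqOn_const_of_mapsTo isDiscrete_range_int (h.sub h') hm ⟨0, 0, by simp⟩
  refine ⟨n, fun x hx => ?_⟩
  have := hy hx
  simp at this
  linarith

lemma lift_const {Z : Set S} (hZ : IsPreconnected Z) {θ : S → ℝ} (h : ContinuousOn θ Z)
    (he : ∀ x ∈ Z, ((θ x : ℝ) : Circ1) = 0) {x y : S} (hx : x ∈ Z) (hy : y ∈ Z) : θ x = θ y := by
  obtain ⟨n, hn⟩ := lift_unique hZ h (continuousOn_const (c := (0:ℝ))) (by simpa using he)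
  rw [hn x hx, hn y hy]

lemma liftOn_of_homotopy {f : S → Circ1} {Z : Set S} (h : ℝ → S → S)
    (hc : ContinuousOn (fun p : ℝ × S => h p.1 p.2) (Icc 0 1 ×ˢ Z))
    (hm : ∀ t ∈ Icc (0:ℝ) 1, ∀ x ∈ Z, h t x ∈ Z) (h1 : ∀ x ∈ Z, h 1 x = x)
    (a : Circ1) (h0 : ∀ x ∈ Z, f (h 0 x) = a) (hf : ContinuousOn f Z) : LiftOn f Z := by
  classical
  have hH : Continuous (fun p : unitInterval × Z => f (h p.1 p.2)) := by
    have h2 : Continuous (fun p : unitInterval × Z => h p.1 p.2) := by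
      refine hc.comp_continuous (f := fun p : unitInterval × Z => (((p.1:ℝ), (p.2:S)) : ℝ × S)) (by fun_prop) ?_
      intro p
      exact ⟨p.1.2, p.2.2⟩
    exact hf.comp_continuous h2 (fun p => hm _ p.1.2 _ p.2.2)
  obtain ⟨r, rfl⟩ := QuotientAddGroup.mk_surjective a
  have cov := AddCircle.isCoveringMap_coe (1:ℝ)
  let H : C(unitInterval × Z, Circ1) := ⟨_, hH⟩
  let g : C(Z, ℝ) := ContinuousMap.const _ r
  have H0 : ∀ a, H (0, a) = QuotientAddGroup.mk (g a) := by
    intro a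
    simpa [H, g] using h0 a a.2
  let L := cov.liftHomotopy H g H0
  have hL := cov.liftHomotopy_lifts H g H0
  refine ⟨fun x => if hx : x ∈ Z then L (1, ⟨x, hx⟩) else 0, ?_, ?_⟩
  · rw [continuousOn_iff_continuous_domRestrict]
    have : Continuous (fun x : Z => L (1, x)) := by fun_prop
    convert this using 2 with x
    simp
  · intro x hx
    have := congrFun hL (1, ⟨x, hx⟩)
    simp only [hx, dite_true]
    refine Eq.trans this ?_
    simp [H, h1 x hx]

/-- Images of star-shaped sets are liftable. -/
lemma liftable_star {E : Type*} [AddCommGroup E] [Module ℝ E] [TopologicalSpace E]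
    [ContinuousSMul ℝ E] [IsTopologicalAddGroup E] {Z : Set E} {p : E}
    (hs : StarConvex ℝ p Z) : Liftable Z := by
  intro f hf
  refine liftOn_of_homotopy (fun t x => p + t • (x - p)) (by fun_prop) ?_ (by simp) (f p) (by simp) hf
  intro t ht x hx
  exact hs.add_smul_sub_mem hx ht.1 ht.2

lemma continuousOn_invFun_range {E : Type*} [TopologicalSpace E] [Nonempty E] {φ : E → S}
    (hφ : IsEmbedding φ) : ContinuousOn (Function.invFun φ) (range φ) := by
  rintro _ ⟨x, rfl⟩
  rw [ContinuousWithinAt, Function.leftInverse_invFun hφ.injective, hφ.toIsInducing.tendsto_nhds_iff]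
  refine (tendsto_id'.2 nhdsWithin_le_nhds : Tendsto id (𝓝[range φ] (φ x)) (𝓝 (φ x))).congr' ?_
  filter_upwards [self_mem_nhdsWithin]
  rintro _ ⟨y, rfl⟩
  simp [Function.leftInverse_invFun hφ.injective y]

lemma Liftable.image {E : Type*} [TopologicalSpace E] {Z : Set E} (hZ : Liftable Z) {φ : E → S}
    (hφ : IsEmbedding φ) : Liftable (φ '' Z) := by
  classical
  intro f hf
  obtain ⟨θ, h1, h2⟩ := hZ (f ∘ φ) (hf.comp hφ.continuous.continuousOn (mapsTo_image _ _))
  rcases Z.eq_empty_or_nonempty with rfl | ⟨z0, hz0⟩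
  · exact ⟨fun _ => 0, by simp, by simp⟩
  have : Nonempty E := ⟨z0⟩
  have hinv : ∀ x, Function.invFun φ (φ x) = x := Function.leftInverse_invFun hφ.injective
  refine ⟨θ ∘ Function.invFun φ, ?_, ?_⟩
  · refine h1.comp ((continuousOn_invFun_range hφ).mono (image_subset_range _ _)) ?_
    rintro _ ⟨x, hx, rfl⟩
    rw [hinv]; exact hx
  · rintro _ ⟨x, hx, rfl⟩
    simp only [Function.comp, hinv]
    exact h2 x hx

end Lift

open Set Metric Filter Topology

section Charts
set_option linter.unusedSectionVars false
variable {S : Type*} [TopologicalSpace S]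

lemma exists_chart (hS : LocallyEuclidean2 S) (x : S) {N : Set S} (hN : N ∈ 𝓝 x) :
    ∃ Ω : ℂ → S, IsOpenEmbedding Ω ∧ Ω 0 = x ∧ range Ω ⊆ N := by
  obtain ⟨U, hU, hx, ⟨e⟩⟩ := hS x
  let g : ℂ → S := Subtype.val ∘ e.symm ∘ Complex.orthonormalBasisOneI.repr.toHomeomorph
  have hg : IsOpenEmbedding g :=
    hU.isOpenEmbedding_subtypeVal.comp (e.symm.isOpenEmbedding.comp (Homeomorph.isOpenEmbedding _))
  let z0 : ℂ := Complex.orthonormalBasisOneI.repr.toHomeomorph.symm (e ⟨x, hx⟩)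
  have hz0 : g z0 = x := by
    simp only [g, z0, Function.comp, Homeomorph.apply_symm_apply, Homeomorph.symm_apply_apply]
  have : g ⁻¹' N ∈ 𝓝 z0 := hg.continuous.continuousAt.preimage_mem_nhds (by rw [hz0]; exact hN)
  obtain ⟨r, hr, hb⟩ := Metric.mem_nhds_iff.1 this
  let b := OpenPartialHomeomorph.univBall z0 r
  have hb' : IsOpenEmbedding b := b.isOpenEmbedding (OpenPartialHomeomorph.univBall_source z0 r)
  refine ⟨g ∘ b, hg.comp hb', by simp [b, hz0], ?_⟩
  rintro _ ⟨w, rfl⟩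
  apply hb
  rw [← OpenPartialHomeomorph.univBall_target z0 hr]
  exact b.map_source (by rw [OpenPartialHomeomorph.univBall_source]; trivial)

lemma exists_move (u : ℂ) (hu : ‖u‖ ≤ 1/2) :
    ∃ m : ℂ ≃ₜ ℂ, m 0 = u ∧ ∀ z, 1 ≤ ‖z‖ → m z = z := by
  let f : ℂ → ℂ := fun z => z + ((max 0 (1 - ‖z‖) : ℝ) : ℂ) * u
  have hf : ApproximatesLinearOn f ((ContinuousLinearEquiv.refl ℝ ℂ : ℂ ≃L[ℝ] ℂ) : ℂ →L[ℝ] ℂ) univ (1/2) := by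
    intro x _ y _
    have h1 : f x - f y - (x - y) = (((max 0 (1 - ‖x‖)) - max 0 (1 - ‖y‖) : ℝ) : ℂ) * u := by
      simp only [f]; push_cast; ring
    have h2 : |max 0 (1 - ‖x‖) - max 0 (1 - ‖y‖)| ≤ ‖x - y‖ := by
      have := abs_max_sub_max_le_abs (1 - ‖x‖) (1 - ‖y‖) 0
      rw [max_comm 0, max_comm 0]
      refine this.trans ?_
      have h3 := abs_norm_sub_norm_le y x
      rw [norm_sub_rev y x] at h3
      have : 1 - ‖x‖ - (1 - ‖y‖) = ‖y‖ - ‖x‖ := by ring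
      rw [this]; exact h3
    simp only [ContinuousLinearEquiv.coe_coe, ContinuousLinearEquiv.coe_refl', id]
    rw [h1, norm_mul, Complex.norm_real, Real.norm_eq_abs]
    push_cast
    have := mul_le_mul h2 hu (norm_nonneg _) (norm_nonneg _)
    linarith
  have hc : Subsingleton ℂ ∨ (1/2 : NNReal) < ‖((ContinuousLinearEquiv.refl ℝ ℂ).symm : ℂ →L[ℝ] ℂ)‖₊⁻¹ := by
    right
    have : ‖((ContinuousLinearEquiv.refl ℝ ℂ).symm : ℂ →L[ℝ] ℂ)‖₊ = 1 := by
      ext; simp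
    rw [this, ← NNReal.coe_lt_coe]; push_cast; norm_num
  refine ⟨hf.toHomeomorph f hc, ?_, ?_⟩
  · change f 0 = u
    simp [f]
  · intro z hz
    change f z = z
    simp [f, hz]

open Classical in
noncomputable def chartExt (Ω : ℂ → S) (g : ℂ → ℂ) (x : S) : S :=
  if x ∈ range Ω then Ω (g (Function.invFun Ω x)) else x

lemma chartExt_apply {Ω : ℂ → S} (hΩ : Function.Injective Ω) (g : ℂ → ℂ) (z : ℂ) :
    chartExt Ω g (Ω z) = Ω (g z) := by
  simp [chartExt, Function.leftInverse_invFun hΩ z]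

lemma chartExt_off {Ω : ℂ → S} (g : ℂ → ℂ) {x : S} (hx : x ∉ range Ω) :
    chartExt Ω g x = x := by
  simp only [chartExt, hx, if_false]

lemma chartExt_continuous [T2Space S] {Ω : ℂ → S} (hΩ : IsOpenEmbedding Ω) {g : ℂ → ℂ}
    (hg : Continuous g) (h1 : ∀ z, 1 ≤ ‖z‖ → g z = z) : Continuous (chartExt Ω g) := by
  have hcl : IsClosed (Ω '' closedBall 0 1) :=
    ((isCompact_closedBall _ _).image hΩ.continuous).isClosed
  have hop : IsOpen (Ω '' ball 0 1) := hΩ.isOpenMap _ isOpen_ball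
  have h : (Ω '' closedBall 0 1) ∪ (Ω '' ball 0 1)ᶜ = univ := by
    rw [eq_univ_iff_forall]; intro x
    by_cases hx : x ∈ Ω '' ball 0 1
    · exact Or.inl (image_mono ball_subset_closedBall hx)
    · exact Or.inr hx
  rw [← continuousOn_univ, ← h]
  refine ContinuousOn.union_of_isClosed ?_ ?_ hcl hop.isClosed_compl
  · have : ContinuousOn (fun x => Ω (g (Function.invFun Ω x))) (range Ω) :=
      (hΩ.continuous.comp hg).comp_continuousOn (continuousOn_invFun_range hΩ.isEmbedding)
    refine (this.mono (image_subset_range _ _)).congr ?_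
    rintro _ ⟨z, _, rfl⟩
    simp [chartExt]
  · refine continuousOn_id.congr ?_
    intro x hx
    by_cases hr : x ∈ range Ω
    · obtain ⟨z, rfl⟩ := hr
      rw [chartExt_apply hΩ.injective, h1]; rfl
      by_contra hlt
      exact hx ⟨z, by simpa using hlt, rfl⟩
    · rw [chartExt_off g hr]; rfl

lemma chart_move [T2Space S] {Ω : ℂ → S} (hΩ : IsOpenEmbedding Ω) (u : ℂ) (hu : ‖u‖ ≤ 1/2) :
    ∃ h : S ≃ₜ S, h (Ω 0) = Ω u ∧ ∀ x ∉ range Ω, h x = x := by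
  obtain ⟨m, hm0, hm1⟩ := exists_move u hu
  have hm2 : ∀ z, 1 ≤ ‖z‖ → m.symm z = z := fun z hz => by
    rw [m.symm_apply_eq, hm1 z hz]
  refine ⟨⟨⟨chartExt Ω m, chartExt Ω m.symm, ?_, ?_⟩, chartExt_continuous hΩ m.continuous hm1,
    chartExt_continuous hΩ m.symm.continuous hm2⟩, ?_, ?_⟩
  · intro x
    by_cases hr : x ∈ range Ω
    · obtain ⟨z, rfl⟩ := hr
      simp [chartExt_apply hΩ.injective]
    · simp [chartExt_off _ hr]
  · intro x
    by_cases hr : x ∈ range Ω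
    · obtain ⟨z, rfl⟩ := hr
      simp [chartExt_apply hΩ.injective]
    · simp [chartExt_off _ hr]
  · simp [chartExt_apply hΩ.injective, hm0]
  · intro x hr
    simp [chartExt_off _ hr]

lemma homogeneous [T2Space S] (hS : LocallyEuclidean2 S) {O : Set S} (hO : IsOpen O)
    (hc : IsPreconnected O) {x y : S} (hx : x ∈ O) (hy : y ∈ O) :
    ∃ h : S ≃ₜ S, h x = y ∧ ∀ z ∉ O, h z = z := by
  refine hc.induction₂ (fun x y => ∃ h : S ≃ₜ S, h x = y ∧ ∀ z ∉ O, h z = z) ?_ ?_ ?_ hx hy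
  · intro x hx
    obtain ⟨Ω, hΩ, h0, hr⟩ := exists_chart hS x (hO.mem_nhds hx)
    have : Ω '' ball 0 (1/2) ∈ 𝓝 x := (hΩ.isOpenMap _ isOpen_ball).mem_nhds ⟨0, by simp, h0⟩
    refine mem_nhdsWithin_of_mem_nhds (mem_of_superset this ?_)
    rintro _ ⟨u, hu, rfl⟩
    obtain ⟨h, h1, h2⟩ := chart_move hΩ u (by simpa using (mem_ball_zero_iff.1 hu).le)
    exact ⟨h, h0 ▸ h1, fun z hz => h2 z (fun hz' => hz (hr hz'))⟩
  · rintro x y z _ _ _ ⟨h, h1, h2⟩ ⟨h', h1', h2'⟩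
    exact ⟨h.trans h', by simp [h1, h1'], fun w hw => by simp [h2 w hw, h2' w hw]⟩
  · rintro x y _ _ ⟨h, h1, h2⟩
    exact ⟨h.symm, by simp [← h1], fun w hw => by rw [h.symm_apply_eq, h2 w hw]⟩

lemma isPreconnected_compl_point_complex (p : ℂ) : IsPreconnected ({p}ᶜ : Set ℂ) :=
  (isConnected_compl_singleton_of_one_lt_rank (by rw [Complex.rank_real_complex]; norm_num) p).isPreconnected

lemma preconnected_diff_point [T1Space S] (hS : LocallyEuclidean2 S) {O : Set S} (hO : IsOpen O)
    (hc : IsPreconnected O) (x : S) : IsPreconnected (O \ {x}) := by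
  by_cases hx : x ∈ O
  swap
  · rwa [sdiff_singleton_eq_self hx]
  obtain ⟨Ω, hΩ, h0, hr⟩ := exists_chart hS x (hO.mem_nhds hx)
  have hD : IsPreconnected (Ω '' {0}ᶜ) :=
    (isPreconnected_compl_point_complex 0).image _ hΩ.continuous.continuousOn
  have hDO : Ω '' {0}ᶜ ⊆ O \ {x} := by
    rintro _ ⟨z, hz, rfl⟩
    refine ⟨hr ⟨z, rfl⟩, ?_⟩
    rw [mem_singleton_iff, ← h0]
    exact fun h => hz (hΩ.injective h)
  have key : ∀ u v : Set S, IsOpen u → IsOpen v → O \ {x} ⊆ u ∪ v → ((O \ {x}) ∩ v).Nonempty →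
      Ω '' {0}ᶜ ⊆ u → ((O \ {x}) ∩ (u ∩ v)).Nonempty := by
    intro u v hu hv huv hne hsub
    obtain ⟨y, hyO, hy1, hy2⟩ := hc (u ∪ range Ω) (v \ {x}) (hu.union hΩ.isOpen_range)
      (hv.sdiff isClosed_singleton) (by
        intro w hw
        by_cases hwx : w = x
        · left; right; rw [hwx, ← h0]; exact ⟨0, rfl⟩
        · rcases huv ⟨hw, hwx⟩ with h | h
          · left; left; exact h
          · right; exact ⟨h, hwx⟩) ⟨x, hx, Or.inr (h0 ▸ ⟨0, rfl⟩)⟩ (by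
        obtain ⟨w, hw, hw2⟩ := hne
        exact ⟨w, hw.1, hw2, hw.2⟩)
    refine ⟨y, ⟨hyO, hy2.2⟩, ?_, hy2.1⟩
    rcases hy1 with h | ⟨z, rfl⟩
    · exact h
    · refine hsub ⟨z, ?_, rfl⟩
      rintro rfl
      exact hy2.2 h0
  intro u v hu hv huv hu1 hv1
  by_cases h : Ω '' {0}ᶜ ⊆ u
  · exact key u v hu hv huv hv1 h
  by_cases h' : Ω '' {0}ᶜ ⊆ v
  · rw [inter_comm u v]
    exact key v u hv hu (by rwa [union_comm]) hu1 h'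
  rw [not_subset] at h h'
  obtain ⟨a, ha, ha'⟩ := h
  obtain ⟨b, hb, hb'⟩ := h'
  obtain ⟨y, hy, hy2⟩ := hD u v hu hv (hDO.trans huv)
    ⟨b, hb, (huv (hDO hb)).resolve_right hb'⟩ ⟨a, ha, (huv (hDO ha)).resolve_left ha'⟩
  exact ⟨y, hDO hy, hy2⟩

lemma preconnected_diff_finite [T1Space S] (hS : LocallyEuclidean2 S) {O : Set S} (hO : IsOpen O)
    (hc : IsPreconnected O) {F : Set S} (hF : F.Finite) : IsPreconnected (O \ F) := by
  induction F, hF using Set.Finite.induction_on with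
  | empty => simpa using hc
  | @insert a s ha hs ih =>
    have : O \ insert a s = (O \ s) \ {a} := by ext; simp; tauto
    rw [this]
    exact preconnected_diff_point hS (hO.sdiff hs.isClosed) ih a

/-- Any two points of a connected open set lie in one chart. -/
lemma common_chart [T2Space S] (hS : LocallyEuclidean2 S) {O : Set S} (hO : IsOpen O)
    (hc : IsPreconnected O) {x y : S} (hx : x ∈ O) (hy : y ∈ O) (hxy : x ≠ y) :
    ∃ φ : ℂ → S, IsOpenEmbedding φ ∧ range φ ⊆ O ∧ φ 0 = x ∧ φ 1 = y := by
  obtain ⟨Ω, hΩ, h0, hr⟩ := exists_chart hS x (hO.mem_nhds hx)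
  have h10 : Ω 1 ≠ x := by
    rw [← h0]; intro h; simpa using hΩ.injective h
  obtain ⟨h, h1, h2⟩ := homogeneous hS (hO.sdiff isClosed_singleton)
    (preconnected_diff_point hS hO hc x) (x := Ω 1) (y := y) ⟨hr ⟨1, rfl⟩, h10⟩ ⟨hy, hxy.symm⟩
  refine ⟨h ∘ Ω, h.isOpenEmbedding.comp hΩ, ?_, ?_, by simp [h1]⟩
  · rintro _ ⟨z, rfl⟩
    by_contra hn
    simp only [Function.comp] at hn
    have h3 : h (h (Ω z)) = h (Ω z) := h2 _ (fun hh => hn hh.1)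
    have h4 := h.injective h3
    rw [h4] at hn
    exact hn (hr ⟨z, rfl⟩)
  · simp only [Function.comp, h0]
    exact h2 x (by simp)

end Charts

open Set Metric Filter Topology

section Rank
variable {S : Type*} [MetricSpace S]

/-- Every point of `D` has arbitrarily small relative neighborhoods that are preconnected and
liftable. -/
def NiceSet (D : Set S) : Prop :=
  ∀ x ∈ D, ∀ N ∈ 𝓝 x, ∃ V ⊆ N ∩ D, V ∈ 𝓝[D] x ∧ IsPreconnected V ∧ Liftable V

lemma int_dependent {ι : Type*} [Fintype ι] {m : ℕ} (hm : Fintype.card ι < m) (n : Fin m → ι → ℤ) :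
    ∃ c : Fin m → ℤ, c ≠ 0 ∧ ∀ i, ∑ a, c a * n a i = 0 := by
  have h : ¬ LinearIndependent ℤ n := by
    intro h
    have := h.fintype_card_le_finrank
    simp at this
    omega
  rw [Fintype.not_linearIndependent_iff] at h
  obtain ⟨g, hg, i, hi⟩ := h
  refine ⟨g, fun h => hi (by rw [h]; rfl), fun j => ?_⟩
  have := congrFun hg j
  simpa using this

theorem rank_lemma {D : Set S} (hD : IsCompact D) (hn : NiceSet D) :
    ∃ N : ℕ, ∀ m > N, ∀ f : Fin m → S → Circ1, (∀ a, ContinuousOn (f a) D) →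
      ∃ c : Fin m → ℤ, c ≠ 0 ∧ LiftOn (fun x => ∑ a, c a • f a x) D := by
  classical
  have h1 : ∀ x ∈ D, ∃ V ⊆ D, V ∈ 𝓝[D] x ∧ Liftable V := fun x hx => by
    obtain ⟨V, h, h', _, h''⟩ := hn x hx univ univ_mem
    exact ⟨V, fun y hy => (h hy).2, h', h''⟩
  choose! W hWD hW hWl using h1
  have h2 : ∀ x ∈ D, ∃ O, IsOpen O ∧ x ∈ O ∧ O ∩ D ⊆ W x := fun x hx => by
    obtain ⟨O, h, h', h''⟩ := mem_nhdsWithin.1 (hW x hx)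
    exact ⟨O, h, h', h''⟩
  choose! O hO hxO hOW using h2
  obtain ⟨δ, hδ, hL⟩ := lebesgue_number_lemma_of_metric (c := fun x : D => O x) hD
    (fun x => hO x x.2) (fun x hx => mem_iUnion.2 ⟨⟨x, hx⟩, hxO x hx⟩)
  have h3 : ∀ x ∈ D, ∃ V, V ⊆ ball x (δ/4) ∩ D ∧ V ∈ 𝓝[D] x ∧ IsPreconnected V := fun x hx => by
    obtain ⟨V, h, h', h'', _⟩ := hn x hx _ (ball_mem_nhds x (by positivity : 0 < δ/4))
    exact ⟨V, h, h', h''⟩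
  choose! V hVs hV hVc using h3
  obtain ⟨t, htD, htc⟩ := hD.elim_nhdsWithin_subcover V hV
  refine ⟨Fintype.card (t × t), fun m hm f hf => ?_⟩
  let C : t → Set S := fun i => closure (V i)
  have hCc : ∀ i, IsPreconnected (C i) := fun i => (hVc i (htD i i.2)).closure
  have hCD : ∀ i, C i ⊆ D := fun i => closure_minimal (fun y hy => (hVs i (htD i i.2) hy).2) hD.isClosed
  have hCb : ∀ i, C i ⊆ closedBall i (δ/4) := fun i =>
    closure_minimal (fun y hy => ball_subset_closedBall (hVs i (htD i i.2) hy).1) isClosed_closedBall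
  have hθ : ∀ (a : Fin m) (i : t), ∃ θ : S → ℝ, ContinuousOn θ (ball (i:S) δ ∩ D) ∧
      ∀ x ∈ ball (i:S) δ ∩ D, ((θ x : ℝ) : Circ1) = f a x := by
    intro a i
    obtain ⟨x, hx⟩ := hL i (htD i i.2)
    obtain ⟨θ, h, h'⟩ := hWl x x.2 (f a) ((hf a).mono (hWD x x.2))
    have hs : ball (i:S) δ ∩ D ⊆ W x := fun y hy => hOW x x.2 ⟨hx hy.1, hy.2⟩
    exact ⟨θ, h.mono hs, fun y hy => h' y (hs hy)⟩
  choose θ hθc hθf using hθ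
  have hCi : ∀ i, C i ⊆ ball (i:S) δ ∩ D := fun i y hy =>
    ⟨mem_ball.2 (lt_of_le_of_lt (mem_closedBall.1 (hCb i hy)) (by linarith)), hCD i hy⟩
  have hCij : ∀ i j, (C i ∩ C j).Nonempty → C j ⊆ ball (i:S) δ ∩ D := by
    rintro i j ⟨z, hz1, hz2⟩ y hy
    refine ⟨?_, hCD j hy⟩
    have e1 := hCb i hz1
    have e2 := hCb j hz2
    have e3 := hCb j hy
    rw [mem_closedBall] at e1 e2 e3
    rw [mem_ball]
    have e4 := dist_triangle y j i
    have e5 := dist_triangle_left (j:S) i z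
    linarith
  have hnn : ∀ (a : Fin m) (p : t × t), ∃ n : ℤ, (C p.1 ∩ C p.2).Nonempty →
      ∀ x ∈ C p.2, θ a p.1 x = θ a p.2 x + n := by
    rintro a ⟨i, j⟩
    by_cases h : (C i ∩ C j).Nonempty
    · obtain ⟨n, hn⟩ := lift_unique (hCc j) ((hθc a i).mono (hCij i j h)) ((hθc a j).mono (hCi j))
        (fun x hx => by rw [hθf a i x (hCij i j h hx), hθf a j x (hCi j hx)])
      exact ⟨n, fun _ => hn⟩
    · exact ⟨0, fun h' => absurd h' h⟩
  choose n hnn using hnn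
  obtain ⟨c, hc, hcn⟩ := int_dependent hm n
  refine ⟨c, hc, ?_⟩
  let Θ : t → S → ℝ := fun i x => ∑ a, (c a : ℝ) * θ a i x
  have hΘ : ∀ i j x, x ∈ C i → x ∈ C j → Θ i x = Θ j x := by
    intro i j x hi hj
    have : Θ i x = Θ j x + ((∑ a, c a * n a (i, j) : ℤ) : ℝ) := by
      simp only [Θ]
      push_cast
      rw [← Finset.sum_add_distrib]
      refine Finset.sum_congr rfl fun a _ => ?_
      rw [hnn a (i, j) ⟨x, hi, hj⟩ x hj]
      ring
    rw [this, hcn]; simp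
  let Ψ : S → ℝ := fun x => if h : ∃ i, x ∈ C i then Θ h.choose x else 0
  have hΨ : ∀ i, ∀ x ∈ C i, Ψ x = Θ i x := by
    intro i x hx
    have h : ∃ i, x ∈ C i := ⟨i, hx⟩
    simp only [Ψ, h, dite_true]
    exact hΘ _ _ _ h.choose_spec hx
  have hcov : ⋃ i, C i = D := by
    apply subset_antisymm (iUnion_subset hCD)
    intro x hx
    obtain ⟨y, hy, hxy⟩ := mem_iUnion₂.1 (htc hx)
    exact mem_iUnion.2 ⟨⟨y, hy⟩, subset_closure hxy⟩
  refine ⟨Ψ, ?_, ?_⟩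
  · rw [← hcov]
    refine LocallyFinite.continuousOn_iUnion (locallyFinite_of_finite C) (fun i => isClosed_closure) fun i => ?_
    refine ContinuousOn.congr ?_ (hΨ i)
    refine continuousOn_finsetSum _ fun a _ => ?_
    exact continuousOn_const.mul ((hθc a i).mono (hCi i))
  · intro x hx
    rw [← hcov] at hx
    obtain ⟨i, hi⟩ := mem_iUnion.1 hx
    rw [hΨ i x hi]
    refine (map_sum (QuotientAddGroup.mk' (AddSubgroup.zmultiples (1:ℝ))) _ _).trans ?_
    refine Finset.sum_congr rfl fun a _ => ?_
    rw [← hθf a i x (hCi i hi), ← zsmul_eq_mul]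
    rfl

end Rank

open Set Metric Filter Topology

def obox : Set ℂ := {z | |z.re| < 1 ∧ |z.im| < 1}

lemma isOpen_obox : IsOpen obox := by
  apply IsOpen.and
  · exact isOpen_lt (by fun_prop) (by fun_prop)
  · exact isOpen_lt (by fun_prop) (by fun_prop)

def cbox : Set ℂ := {z | |z.re| ≤ 1 ∧ |z.im| ≤ 1}

lemma isClosed_cbox : IsClosed cbox := by
  apply IsClosed.and
  · exact isClosed_le (by fun_prop) (by fun_prop)
  · exact isClosed_le (by fun_prop) (by fun_prop)

lemma obox_subset_cbox : obox ⊆ cbox := fun _ h => ⟨h.1.le, h.2.le⟩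

lemma cbox_subset : cbox ⊆ closedBall 0 2 := by
  intro z hz
  rw [mem_closedBall_zero_iff]
  have := Complex.norm_le_abs_re_add_abs_im z
  linarith [hz.1, hz.2]

lemma isCompact_cbox : IsCompact cbox :=
  (isCompact_closedBall (0:ℂ) 2).of_isClosed_subset isClosed_cbox cbox_subset

lemma star_aux {a b t ε : ℝ} (ha : |a| ≤ 1) (hε1 : ε ≤ 1) (hε : |a| < 1 → ε ≤ 1 - |a|) (hab : |b - a| < ε)
    (hb : 1 ≤ |b|) (h0 : 0 ≤ t) : 1 ≤ |a + t * (b - a)| := by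
  have ha1 : |a| = 1 := by
    by_contra h
    have h2 := hε (lt_of_le_of_ne ha h)
    have := abs_sub_abs_le_abs_sub b a
    linarith
  rw [abs_lt] at hab
  rcases (abs_eq zero_le_one).1 ha1 with rfl | rfl
  · have : 1 ≤ b := by
      rcases le_abs.1 hb with h | h <;> linarith
    have h3 : 0 ≤ t * (b - 1) := mul_nonneg h0 (by linarith)
    rw [le_abs]; left; linarith
  · have : b ≤ -1 := by
      rcases le_abs.1 hb with h | h <;> linarith
    have h3 : 0 ≤ t * (-1 - b) := mul_nonneg h0 (by linarith)
    rw [le_abs]; right; nlinarith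

lemma star_box {z : ℂ} (hz : z ∈ cbox) {ε : ℝ} (hε1 : ε ≤ 1) (h1 : |z.re| < 1 → ε ≤ 1 - |z.re|)
    (h2 : |z.im| < 1 → ε ≤ 1 - |z.im|) : StarConvex ℝ z (ball z ε \ obox) := by
  rintro w ⟨hw, hwo⟩ a b ha hb hab
  refine ⟨convex_ball z ε (mem_ball_self (dist_nonneg.trans_lt (mem_ball.1 hw))) hw ha hb hab, ?_⟩
  intro hmem
  rw [mem_ball, dist_eq_norm] at hw
  have hre := (Complex.abs_re_le_norm (w - z)).trans_lt hw
  have him := (Complex.abs_im_le_norm (w - z)).trans_lt hw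
  rw [Complex.sub_re] at hre
  rw [Complex.sub_im] at him
  have e1 : (a • z + b • w).re = z.re + b * (w.re - z.re) := by
    simp; rw [← eq_sub_iff_add_eq] at hab; rw [hab]; ring
  have e2 : (a • z + b • w).im = z.im + b * (w.im - z.im) := by
    simp; rw [← eq_sub_iff_add_eq] at hab; rw [hab]; ring
  have hm1 := hmem.1
  have hm2 := hmem.2
  rw [e1] at hm1
  rw [e2] at hm2
  by_cases h : |w.re| < 1
  · have h' : 1 ≤ |w.im| := not_lt.1 fun h' => hwo ⟨h, h'⟩
    exact absurd (star_aux hz.2 hε1 h2 him h' hb) (not_le.2 hm2)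
  · exact absurd (star_aux hz.1 hε1 h1 hre (not_lt.1 h) hb) (not_le.2 hm1)

section Nice
variable {S : Type*} [MetricSpace S]

lemma nice_at_interior (hS : LocallyEuclidean2 S) {D : Set S} {x : S} (hx : D ∈ 𝓝 x) {N : Set S}
    (hN : N ∈ 𝓝 x) : ∃ V ⊆ N ∩ D, V ∈ 𝓝[D] x ∧ IsPreconnected V ∧ Liftable V := by
  obtain ⟨Ω, hΩ, h0, hr⟩ := exists_chart hS x (inter_mem hN hx)
  refine ⟨range Ω, hr, mem_nhdsWithin_of_mem_nhds (hΩ.isOpen_range.mem_nhds ⟨0, h0⟩),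
    isPreconnected_range hΩ.continuous, ?_⟩
  rw [← image_univ]
  exact (liftable_star (p := 0) (starConvex_univ 0)).image hΩ.isEmbedding

lemma nice_univ (hS : LocallyEuclidean2 S) : NiceSet (univ : Set S) := fun _ _ _ hN =>
  nice_at_interior hS univ_mem hN

lemma nice_compl_box (hS : LocallyEuclidean2 S) {Ω : ℂ → S} (hΩ : IsOpenEmbedding Ω) :
    NiceSet ((Ω '' obox)ᶜ) := by
  intro x hx N hN
  by_cases hx' : x ∈ Ω '' cbox
  swap
  · refine nice_at_interior hS ?_ hN
    have : IsClosed (Ω '' cbox) := (isCompact_cbox.image hΩ.continuous).isClosed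
    exact mem_of_superset (this.isOpen_compl.mem_nhds hx') (compl_subset_compl.2 (image_mono obox_subset_cbox))
  obtain ⟨z, hz, rfl⟩ := hx'
  have hN' : Ω ⁻¹' N ∈ 𝓝 z := hΩ.continuous.continuousAt.preimage_mem_nhds hN
  obtain ⟨r, hr, hb⟩ := Metric.mem_nhds_iff.1 hN'
  have hex : ∀ a : ℝ, ∃ e > 0, |a| < 1 → e ≤ 1 - |a| := fun a => by
    by_cases h : |a| < 1
    · exact ⟨1 - |a|, by linarith, fun _ => le_rfl⟩
    · exact ⟨1, one_pos, fun h' => absurd h' h⟩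
  obtain ⟨e1, he1, h1⟩ := hex z.re
  obtain ⟨e2, he2, h2⟩ := hex z.im
  let ε := min (min r 1) (min e1 e2)
  have hε : 0 < ε := lt_min (lt_min hr one_pos) (lt_min he1 he2)
  have hst := star_box hz (ε := ε) ((min_le_left _ _).trans (min_le_right _ _))
    (fun h => ((min_le_right _ _).trans (min_le_left _ _)).trans (h1 h))
    (fun h => ((min_le_right _ _).trans (min_le_right _ _)).trans (h2 h))
  have hzb : z ∉ obox := fun h => hx ⟨z, h, rfl⟩
  refine ⟨Ω '' (ball z ε \ obox), ?_, ?_, ?_, (liftable_star hst).image hΩ.isEmbedding⟩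
  · rintro _ ⟨w, hw, rfl⟩
    refine ⟨hb (ball_subset_ball ((min_le_left _ _).trans (min_le_left _ _)) hw.1), ?_⟩
    rintro ⟨w', hw', he⟩
    exact hw.2 (hΩ.injective he ▸ hw')
  · rw [mem_nhdsWithin]
    refine ⟨Ω '' ball z ε, hΩ.isOpenMap _ isOpen_ball, ⟨z, mem_ball_self hε, rfl⟩, ?_⟩
    rintro _ ⟨⟨w, hw, rfl⟩, hw2⟩
    exact ⟨w, ⟨hw, fun h => hw2 ⟨w, h, rfl⟩⟩, rfl⟩
  · exact (hst.isPathConnected ⟨mem_ball_self hε, hzb⟩).isConnected.isPreconnected.image _ hΩ.continuous.continuousOn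

lemma preconnected_compl_box (hS : LocallyEuclidean2 S) [PreconnectedSpace S] {Ω : ℂ → S} (hΩ : IsOpenEmbedding Ω) :
    IsPreconnected ((Ω '' obox)ᶜ) := by
  have hbc : IsPreconnected (obox)ᶜ := by
    have : (obox)ᶜ = (fun z : ℂ => ((max 1 (1 / max |z.re| |z.im|) : ℝ) : ℂ) * z) '' {0}ᶜ := by
      ext z
      have hob : ∀ z : ℂ, z ∈ oboxᶜ ↔ 1 ≤ max |z.re| |z.im| := fun z => by
        rw [← not_lt, max_lt_iff]; rfl
      constructor
      · intro hz
        have h1 := (hob z).1 hz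
        refine ⟨z, fun h => ?_, ?_⟩
        · rw [mem_singleton_iff] at h
          rw [h] at h1; simp at h1; linarith
        · have : max 1 (1 / max |z.re| |z.im|) = 1 := max_eq_left (by
            rw [div_le_one (by linarith)]; exact h1)
          simp only [this]; simp
      · rintro ⟨w, hw, rfl⟩
        rw [hob]
        have hn : 0 < max |w.re| |w.im| := by
          by_contra h
          rw [not_lt, max_le_iff] at h
          exact hw (Complex.ext (abs_nonpos_iff.1 h.1) (abs_nonpos_iff.1 h.2))
        have hpos : 0 < max 1 (1 / max |w.re| |w.im|) := lt_max_of_lt_left one_pos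
        simp only [Complex.re_ofReal_mul, Complex.im_ofReal_mul, abs_mul, abs_of_pos hpos]
        rw [← mul_max_of_nonneg _ _ hpos.le]
        calc (1:ℝ) = 1 / max |w.re| |w.im| * max |w.re| |w.im| := by field_simp
          _ ≤ _ := mul_le_mul_of_nonneg_right (le_max_right _ _) hn.le
    rw [this]
    refine (isPreconnected_compl_point_complex 0).image _ ?_
    refine ContinuousOn.mul (Complex.continuous_ofReal.comp_continuousOn (ContinuousOn.sup continuousOn_const
      (ContinuousOn.div continuousOn_const (by fun_prop) ?_))) continuousOn_id
    intro w hw h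
    have h3 := max_le_iff.1 h.le
    exact hw (Complex.ext (abs_nonpos_iff.1 h3.1) (abs_nonpos_iff.1 h3.2))
  have hA : IsPreconnected (Ω '' oboxᶜ) := hbc.image _ hΩ.continuous.continuousOn
  have hAD : Ω '' oboxᶜ ⊆ (Ω '' obox)ᶜ := by
    rintro _ ⟨z, hz, rfl⟩ ⟨w, hw, he⟩
    exact hz (hΩ.injective he ▸ hw)
  have hcl : IsClosed (Ω '' cbox) := (isCompact_cbox.image hΩ.continuous).isClosed
  have key : ∀ u v : Set S, IsOpen u → IsOpen v → (Ω '' obox)ᶜ ⊆ u ∪ v → ((Ω '' obox)ᶜ ∩ v).Nonempty →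
      Ω '' oboxᶜ ⊆ u → ((Ω '' obox)ᶜ ∩ (u ∩ v)).Nonempty := by
    intro u v hu hv huv hne hsub
    by_contra hcon
    obtain ⟨y, hyO, hy1, hy2⟩ := isPreconnected_univ (u ∪ range Ω) (v \ (Ω '' cbox)) (hu.union hΩ.isOpen_range)
      (hv.sdiff hcl) (by
        intro w hw
        by_cases hwx : w ∈ range Ω
        · left; right; exact hwx
        · rcases huv (fun h => hwx (image_subset_range _ _ h)) with h | h
          · left; left; exact h
          · right; exact ⟨h, fun h => hwx (image_subset_range _ _ h)⟩) ⟨Ω 0, trivial, Or.inr ⟨0, rfl⟩⟩ (by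
        obtain ⟨w, hw, hw2⟩ := hne
        refine ⟨w, trivial, hw2, fun ⟨z, hz, he⟩ => hcon ⟨w, hw, hsub ⟨z, ?_, he⟩, hw2⟩⟩
        exact fun h => hw ⟨z, h, he⟩)
    apply hcon
    have hyb : y ∉ Ω '' obox := fun h => hy2.2 (image_mono obox_subset_cbox h)
    refine ⟨y, hyb, ?_, hy2.1⟩
    rcases hy1 with h | ⟨z, rfl⟩
    · exact h
    · exact hsub ⟨z, fun h => hyb ⟨z, h, rfl⟩, rfl⟩
  intro u v hu hv huv hu1 hv1
  by_cases h : Ω '' oboxᶜ ⊆ u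
  · exact key u v hu hv huv hv1 h
  by_cases h' : Ω '' oboxᶜ ⊆ v
  · rw [inter_comm u v]
    exact key v u hv hu (by rwa [union_comm]) hu1 h'
  rw [not_subset] at h h'
  obtain ⟨a, ha, ha'⟩ := h
  obtain ⟨b, hb, hb'⟩ := h'
  obtain ⟨y, hy, hy2⟩ := hA u v hu hv (hAD.trans huv)
    ⟨b, hb, (huv (hAD hb)).resolve_right hb'⟩ ⟨a, ha, (huv (hAD ha)).resolve_left ha'⟩
  exact ⟨y, hAD hy, hy2⟩

end Nice

open Set Metric Filter Topology

/-- `E` splits into `n` disjoint nonempty closed pieces. -/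
def SplitN {S : Type*} [TopologicalSpace S] (n : ℕ) (E : Set S) : Prop :=
  ∃ F : Fin n → Set S, (∀ i, IsClosed (F i)) ∧ (∀ i, (F i).Nonempty) ∧
    (∀ i j, i ≠ j → Disjoint (F i) (F j)) ∧ (⋃ i, F i) = E

/-- maps to the circle have rank at most `N` modulo liftable ones -/
def RankLe {S : Type*} [MetricSpace S] (N : ℕ) (D : Set S) : Prop :=
  ∀ m > N, ∀ f : Fin m → S → Circ1, (∀ a, ContinuousOn (f a) D) →
    ∃ c : Fin m → ℤ, c ≠ 0 ∧ LiftOn (fun x => ∑ a, c a • f a x) D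

lemma multicoh {S : Type*} [MetricSpace S] {D : Set S} {N : ℕ} (hN : RankLe N D) :
    ∀ A B : Set S, IsClosed A → IsClosed B → IsPreconnected A → IsPreconnected B →
      A ∪ B = D → ¬ SplitN (N + 2) (A ∩ B) := by
  classical
  rintro A B hA hB hAc hBc hAB ⟨F, hFc, hFn, hFd, hFU⟩
  have hu : ∀ i : Fin (N+1), ∃ u : C(S, ℝ), (∀ x ∈ F i.succ, u x = 1) ∧
      ∀ j, j ≠ i.succ → ∀ x ∈ F j, u x = 0 := by
    intro i
    obtain ⟨u, h0, h1, -⟩ := exists_continuous_zero_one_of_isClosed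
      (s := ⋃ j ∈ ({i.succ}ᶜ : Set (Fin (N+2))), F j) (t := F i.succ)
      ((Set.toFinite _).isClosed_biUnion fun j _ => hFc j) (hFc _) (by
        rw [Set.disjoint_iUnion₂_left]
        intro j hj
        exact hFd _ _ hj)
    exact ⟨u, fun x hx => h1 hx, fun j hj x hx => h0 (mem_biUnion (x := j) hj hx)⟩
  choose u hu1 hu0 using hu
  have hcoe : ∀ i, ∀ x ∈ A ∩ B, ((u i x : ℝ) : Circ1) = 0 := by
    intro i x hx
    rw [← hFU, mem_iUnion] at hx
    obtain ⟨j, hj⟩ := hx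
    by_cases h : j = i.succ
    · subst h
      rw [hu1 i x hj]
      simp
    · rw [hu0 i j h x hj]; rfl
  let f : Fin (N+1) → S → Circ1 := fun i x => if x ∈ A then ((u i x : ℝ) : Circ1) else 0
  have hfA : ∀ i, ∀ x ∈ A, f i x = ((u i x : ℝ) : Circ1) := fun i x hx => if_pos hx
  have hfB : ∀ i, ∀ x ∈ B, f i x = 0 := fun i x hx => by
    by_cases h : x ∈ A
    · rw [hfA i x h, hcoe i x ⟨h, hx⟩]
    · exact if_neg h
  obtain ⟨c, hc0, θ, hθc, hθ⟩ := hN (N+1) (Nat.lt_succ_self N) f (by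
    intro i
    rw [← hAB]
    refine ContinuousOn.union_of_isClosed ?_ ?_ hA hB
    · exact (continuous_coe_circ.comp (u i).continuous).continuousOn.congr (hfA i)
    · exact continuousOn_const.congr (hfB i))
  apply hc0
  have hAD : A ⊆ D := hAB ▸ subset_union_left
  have hBD : B ⊆ D := hAB ▸ subset_union_right
  have hFA : ∀ j, F j ⊆ A ∩ B := fun j => hFU ▸ subset_iUnion F j
  obtain ⟨n, hn⟩ := lift_unique hAc (θ := θ) (θ' := fun x => ∑ a, c a • u a x)
    (hθc.mono hAD) (by fun_prop) (by
      intro x hx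
      rw [hθ x (hAD hx)]
      simp only
      have : (((∑ a, c a • u a x : ℝ)) : Circ1) = ∑ a, c a • ((u a x : ℝ) : Circ1) := by
        exact (map_sum (QuotientAddGroup.mk' (AddSubgroup.zmultiples (1:ℝ))) _ _).trans
          (Finset.sum_congr rfl fun a _ => (map_zsmul (QuotientAddGroup.mk' (AddSubgroup.zmultiples (1:ℝ))) _ _))
      rw [this]
      exact Finset.sum_congr rfl fun a _ => by rw [hfA a x hx])
  funext i
  obtain ⟨e, he⟩ := hFn i.succ
  obtain ⟨e0, he0⟩ := hFn 0
  have h1 := lift_const hBc (θ := θ) (hθc.mono hBD) (by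
    intro x hx
    rw [hθ x (hBD hx)]
    simp [hfB _ x hx]) (hFA _ he).2 (hFA _ he0).2
  rw [hn e (hFA _ he).1, hn e0 (hFA _ he0).1] at h1
  have s1 : ∑ a, c a • u a e = (c i : ℝ) := by
    rw [Finset.sum_eq_single i]
    · rw [hu1 i e he]; simp
    · intro b _ hb
      rw [hu0 b i.succ (fun h => hb (Fin.succ_injective _ h).symm) e he]; simp
    · simp
  have s2 : ∑ a, c a • u a e0 = (0:ℝ) := by
    apply Finset.sum_eq_zero
    intro b _
    rw [hu0 b 0 (Fin.succ_ne_zero b).symm e0 he0]; simp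
  rw [s1, s2] at h1
  simpa using h1

open Set Metric Filter Topology

section Cont
variable {S : Type*} [TopologicalSpace S]

lemma union_clopen_preconnected {Z A u v : Set S} (hZ : IsPreconnected Z) (hA : IsPreconnected A)
    (hAZ : A ⊆ Z) (hu : IsOpen u) (hv : IsOpen v) (hc : Z \ A ⊆ u ∪ v)
    (hd : ∀ x ∈ Z \ A, x ∈ u → x ∉ v) : IsPreconnected (A ∪ (Z ∩ u)) := by
  have key : ∀ G1 G2 : Set S, IsOpen G1 → IsOpen G2 → A ∪ (Z ∩ u) ⊆ G1 ∪ G2 →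
      ((A ∪ (Z ∩ u)) ∩ G1).Nonempty → ((A ∪ (Z ∩ u)) ∩ G2).Nonempty → A ⊆ G1 →
      ((A ∪ (Z ∩ u)) ∩ (G1 ∩ G2)).Nonempty := by
    intro G1 G2 h1 h2 hcov hn1 hn2 hAG
    by_contra hcon
    have hno : ∀ x, x ∈ A ∪ (Z ∩ u) → x ∈ G1 → x ∉ G2 := fun x hx a b => hcon ⟨x, hx, a, b⟩
    obtain ⟨y, hy, hy1, hy2⟩ := hZ (G1 ∪ v) (G2 ∩ u) (h1.union hv) (h2.inter hu) (by
      intro z hz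
      by_cases hzA : z ∈ A
      · exact Or.inl (Or.inl (hAG hzA))
      rcases hc ⟨hz, hzA⟩ with h | h
      · rcases hcov (Or.inr ⟨hz, h⟩) with h' | h'
        · exact Or.inl (Or.inl h')
        · exact Or.inr ⟨h', h⟩
      · exact Or.inl (Or.inr h)) (by
      obtain ⟨z, hz, hz1⟩ := hn1
      exact ⟨z, hz.elim (fun h => hAZ h) (fun h => h.1), Or.inl hz1⟩) (by
      obtain ⟨z, hz, hz1⟩ := hn2
      rcases hz with h | h
      · exact absurd hz1 (hno z (Or.inl h) (hAG h))
      · exact ⟨z, h.1, hz1, h.2⟩)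
    rcases hy1 with h | h
    · exact hno y (Or.inr ⟨hy, hy2.2⟩) h hy2.1
    · by_cases hyA : y ∈ A
      · exact hno y (Or.inl hyA) (hAG hyA) hy2.1
      · exact hd y ⟨hy, hyA⟩ hy2.2 h
  intro G1 G2 h1 h2 hcov hn1 hn2
  by_contra hcon
  have hA2 : A ⊆ G1 ∨ A ⊆ G2 := by
    by_contra hne
    rw [not_or, not_subset, not_subset] at hne
    obtain ⟨⟨x, hx, hx'⟩, y, hy, hy'⟩ := hne
    have hcA : A ⊆ G1 ∪ G2 := subset_union_left.trans hcov
    obtain ⟨z, hz, hz'⟩ := hA G1 G2 h1 h2 hcA ⟨y, hy, (hcA hy).resolve_right hy'⟩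
      ⟨x, hx, (hcA hx).resolve_left hx'⟩
    exact hcon ⟨z, Or.inl hz, hz'⟩
  rcases hA2 with h | h
  · exact hcon (key G1 G2 h1 h2 hcov hn1 hn2 h)
  · rw [inter_comm G1 G2] at hcon
    exact hcon (key G2 G1 h2 h1 (by rwa [union_comm G2 G1]) hn2 hn1 h)

variable [T2Space S]

/-- Cut lemma in compact Hausdorff sets. -/
lemma comp_sep {F Q : Set S} (hF : IsCompact F) {x : S} (hx : x ∈ F) (hQ : IsClosed Q)
    (hd : Disjoint (connectedComponentIn F x) Q) :
    ∃ M N : Set S, IsClosed M ∧ IsClosed N ∧ M ∪ N = F ∧ Disjoint M N ∧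
      connectedComponentIn F x ⊆ M ∧ Q ∩ F ⊆ N := by
  have : CompactSpace F := isCompact_iff_compactSpace.1 hF
  let x' : F := ⟨x, hx⟩
  have hcomp : connectedComponentIn F x = (↑) '' connectedComponent x' := connectedComponentIn_eq_image hx
  have h1 : connectedComponent x' ⊆ ((↑) ⁻¹' Qᶜ : Set F) := by
    intro y hy hyQ
    exact (disjoint_left.1 hd) (hcomp ▸ ⟨y, hy, rfl⟩) hyQ
  rw [connectedComponent_eq_iInter_isClopen] at h1
  have : Nonempty { s : Set F // IsClopen s ∧ x' ∈ s } := ⟨⟨univ, isClopen_univ, mem_univ _⟩⟩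
  obtain ⟨Z, hZ⟩ := exists_subset_nhds_of_isCompact' (ι := { s : Set F // IsClopen s ∧ x' ∈ s })
    (V := fun s => (s : Set F)) (U := ((↑) ⁻¹' Qᶜ : Set F)) (by
      rintro ⟨s, hs, hxs⟩ ⟨t, ht, hxt⟩
      exact ⟨⟨s ∩ t, hs.inter ht, hxs, hxt⟩, inter_subset_left, inter_subset_right⟩)
    (fun i => i.2.1.isClosed.isCompact) (fun i => i.2.1.isClosed) (by
      intro y hy
      exact (hQ.isOpen_compl.preimage continuous_subtype_val).mem_nhds (h1 hy))
  refine ⟨(↑) '' (Z : Set F), (↑) '' ((Z : Set F)ᶜ), ?_, ?_, ?_, ?_, ?_, ?_⟩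
  · exact (Z.2.1.isClosed.isCompact.image continuous_subtype_val).isClosed
  · exact (Z.2.1.compl.isClosed.isCompact.image continuous_subtype_val).isClosed
  · rw [← image_union, union_compl_self, image_univ, Subtype.range_coe]
  · exact (disjoint_image_iff Subtype.val_injective).2 disjoint_compl_right
  · rw [hcomp]
    apply image_mono
    exact Z.2.1.connectedComponent_subset Z.2.2
  · rintro y ⟨hyQ, hyF⟩
    exact ⟨⟨y, hyF⟩, fun h => hZ h hyQ, rfl⟩

/-- Boundary bumping. -/
lemma bdry_bump {X O : Set S} (hX : IsCompact X) (hXc : IsPreconnected X) (hO : IsOpen O)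
    (hXO : (X ∩ O).Nonempty) {x : S} (hx : x ∈ X \ O) :
    (connectedComponentIn (X \ O) x ∩ closure (X ∩ O)).Nonempty := by
  by_contra hcon
  obtain ⟨M, N, hM, hN, hMN, hd, h1, h2⟩ := comp_sep (hX.diff hO) hx (isClosed_closure (s := X ∩ O))
    (by rwa [disjoint_iff_inter_eq_empty, ← not_nonempty_iff_eq_empty])
  have hxM : x ∈ M := h1 (mem_connectedComponentIn hx)
  have hMX : M ⊆ X \ O := hMN ▸ subset_union_left
  rw [isPreconnected_closed_iff] at hXc
  obtain ⟨y, hy, hy1, hy2⟩ := hXc M (N ∪ closure (X ∩ O)) hM (hN.union isClosed_closure) (by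
    intro z hz
    by_cases h : z ∈ O
    · exact Or.inr (Or.inr (subset_closure ⟨hz, h⟩))
    · have hzz : z ∈ M ∪ N := by rw [hMN]; exact ⟨hz, h⟩
      rcases hzz with h' | h'
      · exact Or.inl h'
      · exact Or.inr (Or.inl h')) ⟨x, hx.1, hxM⟩ (by
    obtain ⟨z, hz⟩ := hXO
    exact ⟨z, hz.1, Or.inr (subset_closure hz)⟩)
  rcases hy2 with h | h
  · exact disjoint_left.1 hd hy1 h
  · exact disjoint_left.1 hd hy1 (h2 ⟨h, hMX hy1⟩)

end Cont

open Set Metric Filter Topology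

section Indec
variable {S : Type*} [TopologicalSpace S] [T2Space S]

lemma isClosed_compIn {F : Set S} (hF : IsClosed F) (x : S) : IsClosed (connectedComponentIn F x) := by
  by_cases hx : x ∈ F
  · rw [← closure_subset_iff_isClosed]
    exact isPreconnected_connectedComponentIn.closure.subset_connectedComponentIn
      (subset_closure (mem_connectedComponentIn hx))
      (closure_minimal (connectedComponentIn_subset _ _) hF)
  · rw [connectedComponentIn_eq_empty hx]; exact isClosed_empty

lemma inter_open_infinite {X O : Set S} (hX : IsClosed X) (hXc : IsPreconnected X) (hn : X.Nontrivial)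
    (hO : IsOpen O) (hXO : (X ∩ O).Nonempty) : (X ∩ O).Infinite := by
  intro hf
  by_cases h : (X \ O).Nonempty
  · rw [isPreconnected_closed_iff] at hXc
    obtain ⟨y, hy, hy1, hy2⟩ := hXc (X ∩ O) (X \ O) hf.isClosed (hX.sdiff hO) (by
      intro z hz; by_cases h : z ∈ O
      · exact Or.inl ⟨hz, h⟩
      · exact Or.inr ⟨hz, h⟩) (by rwa [← inter_assoc, inter_self]) (by
        obtain ⟨z, hz⟩ := h
        exact ⟨z, hz.1, hz⟩)
    exact hy2.2 hy1.2
  · rw [not_nonempty_iff_eq_empty, sdiff_eq_empty] at h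
    rw [inter_eq_left.2 h] at hf
    exact (hXc.infinite_of_nontrivial hn) hf

/-- nondegenerate indecomposable continuum -/
structure Indec (X : Set S) : Prop where
  cpt : IsCompact X
  conn : IsPreconnected X
  indec : ¬ IsDecomposable X
  nontriv : X.Nontrivial

variable {X : Set S}

lemma Indec.closed (h : Indec X) : IsClosed X := h.cpt.isClosed

lemma Indec.dense (h : Indec X) {A : Set S} (hA : IsClosed A) (hAc : IsPreconnected A)
    (hAX : A ⊆ X) (hne : A ≠ X) : X ⊆ closure (X \ A) := by
  by_cases hAe : A.Nonempty
  swap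
  · rw [not_nonempty_iff_eq_empty] at hAe
    rw [hAe, sdiff_empty]; exact subset_closure
  have hXA : (X \ A).Nonempty := by
    rw [nonempty_iff_ne_empty]; intro h'
    exact hne (hAX.antisymm (sdiff_eq_empty.1 h'))
  by_cases hc : IsPreconnected (X \ A)
  · by_contra hcon
    have hs : closure (X \ A) ⊆ X := closure_minimal sdiff_subset h.closed
    refine h.indec ⟨A, closure (X \ A), ⟨hAe, hA, ⟨hAe, hAc⟩, hAX, hne⟩,
      ⟨hXA.closure, isClosed_closure, ⟨hXA.closure, hc.closure⟩, hs, fun h' => hcon h'.ge⟩, ?_⟩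
    apply (union_subset hAX hs).antisymm
    intro x hx
    by_cases hxA : x ∈ A
    · exact Or.inl hxA
    · exact Or.inr (subset_closure ⟨hx, hxA⟩)
  · exfalso
    rw [IsPreconnected] at hc
    push Not at hc
    obtain ⟨u, v, hu, hv, huv, hnu, hnv, he⟩ := hc
    have hdis : ∀ x ∈ X \ A, x ∈ u → x ∉ v := fun x hx h1 h2 => by
      have : x ∈ (X \ A) ∩ (u ∩ v) := ⟨hx, h1, h2⟩
      rw [he] at this; exact this
    have cl : ∀ u v : Set S, IsOpen u → IsOpen v → X \ A ⊆ u ∪ v → (∀ x ∈ X \ A, x ∈ u → x ∉ v) →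
        ((X \ A) ∩ v).Nonempty → IsProperSubcontinuum X (A ∪ (X ∩ u)) := by
      intro u v hu hv huv hdis hnv
      have he : A ∪ (X ∩ u) = X \ (v \ A) := by
        ext x
        constructor
        · rintro (hx | hx)
          · exact ⟨hAX hx, fun h => h.2 hx⟩
          · exact ⟨hx.1, fun h => hdis x ⟨hx.1, h.2⟩ hx.2 h.1⟩
        · rintro ⟨hx, hx2⟩
          by_cases hxA : x ∈ A
          · exact Or.inl hxA
          · rcases huv ⟨hx, hxA⟩ with h | h
            · exact Or.inr ⟨hx, h⟩
            · exact absurd ⟨h, hxA⟩ hx2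
      have hnon : (A ∪ (X ∩ u)).Nonempty := hAe.mono subset_union_left
      refine ⟨hnon, ?_, ⟨hnon, union_clopen_preconnected h.conn hAc hAX hu hv huv hdis⟩, ?_, ?_⟩
      · rw [he]; exact h.closed.sdiff (hv.sdiff hA)
      · exact union_subset hAX inter_subset_left
      · rw [he]; intro h'
        obtain ⟨z, hz, hz2⟩ := hnv
        rw [← h'] at hz
        exact hz.1.2 ⟨hz2, hz.2⟩
    refine h.indec ⟨_, _, cl u v hu hv huv hdis hnv, cl v u hv hu (by rwa [union_comm])
      (fun x hx h1 h2 => hdis x hx h2 h1) hnu, ?_⟩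
    apply (union_subset (union_subset hAX inter_subset_left) (union_subset hAX inter_subset_left)).antisymm
    intro x hx
    by_cases hxA : x ∈ A
    · exact Or.inl (Or.inl hxA)
    · rcases huv ⟨hx, hxA⟩ with h | h
      · exact Or.inl (Or.inr ⟨hx, h⟩)
      · exact Or.inr (Or.inr ⟨hx, h⟩)

/-- removing finitely many proper subcontinua keeps relatively open nonempty -/
lemma Indec.finite_avoid (h : Indec X) {ι : Type*} (s : Finset ι) (C : ι → Set S)
    (hC : ∀ i ∈ s, IsClosed (C i) ∧ IsPreconnected (C i) ∧ C i ⊆ X ∧ C i ≠ X) {O : Set S} (hO : IsOpen O)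
    (hXO : (X ∩ O).Nonempty) : ((X ∩ O) \ ⋃ i ∈ s, C i).Nonempty := by
  classical
  induction s using Finset.induction_on generalizing O with
  | empty => simpa using hXO
  | insert a s ha ih =>
    obtain ⟨h1, h2, h3, h4⟩ := hC a (Finset.mem_insert_self _ _)
    obtain ⟨x, hx, hxO⟩ := hXO
    obtain ⟨y, hyO, hy⟩ := mem_closure_iff.1 (h.dense h1 h2 h3 h4 hx) O hO hxO
    obtain ⟨z, hz, hz'⟩ := ih (fun i hi => hC i (Finset.mem_insert_of_mem hi)) (O := O \ C a) (hO.sdiff h1)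
      ⟨y, hy.1, hyO, hy.2⟩
    refine ⟨z, ⟨hz.1, hz.2.1⟩, ?_⟩
    rw [Finset.set_biUnion_insert]
    rintro (h | h)
    · exact hz.2.2 h
    · exact hz' h

lemma Indec.finite_cover (h : Indec X) {ι : Type*} [Finite ι] (C : ι → Set S)
    (hC : ∀ i, IsClosed (C i) ∧ IsPreconnected (C i) ∧ C i ⊆ X) {O : Set S} (hO : IsOpen O)
    (hXO : (X ∩ O).Nonempty) (hcov : X ∩ O ⊆ ⋃ i, C i) : ∃ i, C i = X := by
  by_contra! hcon
  have := Fintype.ofFinite ι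
  obtain ⟨x, hx, hx'⟩ := h.finite_avoid Finset.univ C (fun i _ => ⟨(hC i).1, (hC i).2.1, (hC i).2.2, hcon i⟩) hO hXO
  apply hx'
  simpa using hcov hx

lemma Indec.exists_sub1 [RegularSpace S] (h : Indec X) {x : S} (hx : x ∈ X) {O : Set S} (hO : IsOpen O)
    (hXO : (X ∩ O).Nonempty) : ∃ P : Set S, IsClosed P ∧ IsPreconnected P ∧ P ⊆ X ∧ P ≠ X ∧ x ∈ P ∧ (P ∩ O).Nonempty := by
  by_cases hxO : x ∈ O
  · refine ⟨{x}, isClosed_singleton, isPreconnected_singleton, by simpa using hx, ?_, rfl, x, rfl, hxO⟩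
    intro he
    have := h.nontriv
    rw [← he] at this
    exact not_nontrivial_singleton this
  obtain ⟨y, hy, hyO⟩ := hXO
  obtain ⟨t, ht, htc, htO⟩ := exists_mem_nhds_isClosed_subset (hO.mem_nhds hyO)
  have hyI : y ∈ interior t := mem_interior_iff_mem_nhds.2 ht
  have hxI : x ∈ X \ interior t := ⟨hx, fun h => hxO (htO (interior_subset h))⟩
  refine ⟨connectedComponentIn (X \ interior t) x, ?_, isPreconnected_connectedComponentIn,
    (connectedComponentIn_subset _ _).trans sdiff_subset, ?_, mem_connectedComponentIn hxI, ?_⟩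
  · exact isClosed_compIn (h.closed.sdiff isOpen_interior) x
  · intro he
    rw [← he] at hy
    exact (connectedComponentIn_subset _ _ hy).2 hyI
  · obtain ⟨z, hz, hz2⟩ := bdry_bump h.cpt h.conn isOpen_interior ⟨y, hy, hyI⟩ hxI
    refine ⟨z, hz, htO ?_⟩
    exact closure_minimal (inter_subset_right.trans interior_subset) htc hz2

lemma Indec.exists_sub [RegularSpace S] (h : Indec X) {x : S} (hx : x ∈ X) {ι : Type*} [Finite ι] (O : ι → Set S)
    (hO : ∀ i, IsOpen (O i)) (hXO : ∀ i, (X ∩ O i).Nonempty) :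
    ∃ P : Set S, IsClosed P ∧ IsPreconnected P ∧ P ⊆ X ∧ P ≠ X ∧ x ∈ P ∧ ∀ i, (P ∩ O i).Nonempty := by
  choose P h1 h2 h3 h4 h5 h6 using fun i => h.exists_sub1 hx (hO i) (hXO i)
  refine ⟨{x} ∪ ⋃ i, P i, isClosed_singleton.union (isClosed_iUnion_of_finite h1), ?_, ?_, ?_, Or.inl rfl, ?_⟩
  · have e2 : {x} ∪ ⋃ i, P i = ⋃₀ (insert {x} (range P)) := by
      rw [sUnion_insert, sUnion_range]
    rw [e2]
    refine isPreconnected_sUnion x _ ?_ ?_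
    · rintro s (rfl | ⟨i, rfl⟩)
      · rfl
      · exact h5 i
    · rintro s (rfl | ⟨i, rfl⟩)
      · exact isPreconnected_singleton
      · exact h2 i
  · exact union_subset (by simpa using hx) (iUnion_subset h3)
  · intro he
    have hP : ∀ i : Option ι, IsClosed (i.elim {x} P) ∧ IsPreconnected (i.elim {x} P) ∧ i.elim {x} P ⊆ X := by
      rintro (_ | i)
      · exact ⟨isClosed_singleton, isPreconnected_singleton, by simpa using hx⟩
      · exact ⟨h1 i, h2 i, h3 i⟩
    obtain ⟨i, hi⟩ := h.finite_cover (fun i : Option ι => i.elim {x} P) hP isOpen_univ ⟨x, hx, trivial⟩ (by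
      rw [inter_univ]
      intro z hz
      rw [← he] at hz
      rcases hz with hz | hz
      · exact mem_iUnion.2 ⟨none, hz⟩
      · obtain ⟨i, hi⟩ := mem_iUnion.1 hz
        exact mem_iUnion.2 ⟨some i, hi⟩)
    rcases i with _ | i
    · have := h.nontriv
      rw [← hi] at this
      exact not_nontrivial_singleton this
    · exact h4 i hi
  · intro i
    obtain ⟨z, hz, hz'⟩ := h6 i
    exact ⟨z, Or.inr (mem_iUnion.2 ⟨i, hz⟩), hz'⟩

end Indec

open Set Metric Filter Topology

section FCsec
variable {S : Type*} [TopologicalSpace S]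

/-- union of `m` closed preconnected sets -/
def FC (m : ℕ) (E : Set S) : Prop :=
  ∃ C : Fin m → Set S, (∀ i, IsClosed (C i) ∧ IsPreconnected (C i)) ∧ (⋃ i, C i) = E

lemma fc_of_not_split {n : ℕ} (hn : 2 ≤ n) {E : Set S} (hE : IsClosed E) (h : ¬ SplitN n E) : FC n E := by
  classical
  have hex : ∃ k < n, SplitN k E ∧ ¬ SplitN (k+1) E := by
    by_contra! hcon
    have h1 : SplitN 1 E ∨ SplitN 0 E := by
      by_cases he : E.Nonempty
      · left
        refine ⟨fun _ => E, fun _ => hE, fun _ => he, fun i j hij => absurd (Subsingleton.elim i j) hij, ?_⟩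
        exact iUnion_const _
      · right
        rw [not_nonempty_iff_eq_empty] at he
        exact ⟨fun _ => E, fun i => i.elim0, fun i => i.elim0, fun i => i.elim0, by rw [he]; simp⟩
    have h2 : SplitN 1 E := h1.elim id fun h => hcon 0 (by omega) h
    have h3 : ∀ k, k + 1 ≤ n → SplitN (k+1) E := by
      intro k
      induction k with
      | zero => intro _; exact h2
      | succ k ih => intro hk; exact hcon (k+1) (by omega) (ih (by omega))
    obtain ⟨m, rfl⟩ : ∃ m, n = m + 1 := ⟨n - 1, by omega⟩
    exact h (h3 m le_rfl)
  obtain ⟨k, hk, ⟨F, h1, h2, h3, h4⟩, hns⟩ := hex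
  have hpc : ∀ i, IsPreconnected (F i) := by
    intro i
    by_contra hc
    rw [isPreconnected_closed_iff] at hc
    push Not at hc
    obtain ⟨u, v, hu, hv, huv, hnu, hnv, he⟩ := hc
    apply hns
    let F' : Fin k → Set S := Function.update F i (F i ∩ u)
    have hF' : ∀ j, F' j ⊆ F j := by
      intro j
      by_cases hj : j = i
      · subst hj; simp [F']
      · simp [F', hj]
    have hdv : ∀ j, Disjoint (F i ∩ v) (F' j) := by
      intro j
      by_cases hj : j = i
      · subst hj
        simp only [F', Function.update_self]
        rw [disjoint_left]
        intro x hx hx'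
        have : x ∈ F j ∩ (u ∩ v) := ⟨hx.1, hx'.2, hx.2⟩
        rw [he] at this; exact this
      · exact (h3 i j (Ne.symm hj)).mono inter_subset_left (hF' j)
    refine ⟨Fin.cons (F i ∩ v) F', ?_, ?_, ?_, ?_⟩
    · intro j
      refine Fin.cases ?_ (fun j => ?_) j
      · exact (h1 i).inter hv
      · rw [Fin.cons_succ]
        by_cases hj : j = i
        · subst hj; simpa [F'] using (h1 j).inter hu
        · simpa [F', hj] using h1 j
    · intro j
      refine Fin.cases ?_ (fun j => ?_) j
      · exact hnv
      · rw [Fin.cons_succ]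
        by_cases hj : j = i
        · subst hj; simpa [F'] using hnu
        · simpa [F', hj] using h2 j
    · intro a b
      refine Fin.cases ?_ (fun a => ?_) a <;> refine Fin.cases ?_ (fun b => ?_) b
      · intro h; exact absurd rfl h
      · intro _; simpa using hdv b
      · intro _; simpa using (hdv a).symm
      · intro hab
        simp only [Fin.cons_succ]
        exact (h3 a b (fun h => hab (by rw [h]))).mono (hF' a) (hF' b)
    · rw [← h4]
      ext x
      rw [mem_iUnion, mem_iUnion, Fin.exists_fin_succ]
      simp only [Fin.cons_zero, Fin.cons_succ]
      constructor
      · rintro (h | ⟨j, h⟩)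
        · exact ⟨i, h.1⟩
        · exact ⟨j, hF' j h⟩
      · rintro ⟨j, h⟩
        by_cases hj : j = i
        · subst hj
          rcases huv h with h' | h'
          · right; exact ⟨j, by simpa [F'] using ⟨h, h'⟩⟩
          · left; exact ⟨h, h'⟩
        · right; exact ⟨j, by simpa [F', hj] using h⟩
  refine ⟨fun i => if hi : (i:ℕ) < k then F ⟨i, hi⟩ else ∅, fun i => ?_, ?_⟩
  · by_cases hi : (i:ℕ) < k
    · simp only [hi, dif_pos]; exact ⟨h1 _, hpc _⟩
    · simp only [hi, dif_neg, not_false_iff]; exact ⟨isClosed_empty, isPreconnected_empty⟩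
  · rw [← h4]
    ext x
    simp only [mem_iUnion]
    constructor
    · rintro ⟨i, hi⟩
      by_cases hik : (i:ℕ) < k
      · rw [dif_pos hik] at hi; exact ⟨_, hi⟩
      · rw [dif_neg hik] at hi; exact hi.elim
    · rintro ⟨i, hi⟩
      refine ⟨⟨i, i.2.trans hk⟩, ?_⟩
      rw [dif_pos i.2]; exact hi

/-- ultrafilter limit of sets -/
def ULim (C : ℕ → Set S) : Set S :=
  {x | ∀ O : Set S, IsOpen O → x ∈ O → ∀ᶠ n in (hyperfilter ℕ : Filter ℕ), (C n ∩ O).Nonempty}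

lemma not_mem_ulim {C : ℕ → Set S} {x : S} (h : x ∉ ULim C) :
    ∃ O, IsOpen O ∧ x ∈ O ∧ ∀ᶠ n in (hyperfilter ℕ : Filter ℕ), C n ∩ O = ∅ := by
  simp only [ULim, mem_ofPred_eq, not_forall] at h
  obtain ⟨O, hO, hx, h⟩ := h
  refine ⟨O, hO, hx, ?_⟩
  rw [← Ultrafilter.eventually_not] at h
  simpa only [not_nonempty_iff_eq_empty] using h

lemma isClosed_ulim (C : ℕ → Set S) : IsClosed (ULim C) := by
  rw [← isOpen_compl_iff, isOpen_iff_forall_mem_open]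
  intro x hx
  obtain ⟨O, hO, hxO, h⟩ := not_mem_ulim hx
  refine ⟨O, fun y hy hy' => ?_, hO, hxO⟩
  obtain ⟨n, hn, hn'⟩ := ((hy' O hO hy).and h).exists
  rw [hn'] at hn; exact not_nonempty_empty hn

lemma ulim_subset {C : ℕ → Set S} {X : Set S} (hX : IsClosed X) (h : ∀ n, C n ⊆ X) : ULim C ⊆ X := by
  intro x hx
  by_contra hxX
  obtain ⟨n, y, hy, hy'⟩ := (hx Xᶜ hX.isOpen_compl hxX).exists
  exact hy' (h n hy)

lemma ulim_mono {C C' : ℕ → Set S} (h : ∀ n, C n ⊆ C' n) : ULim C ⊆ ULim C' := fun _ hx O hO hxO =>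
  (hx O hO hxO).mono fun n hn => hn.mono (inter_subset_inter_left _ (h n))

lemma ulim_iUnion {ι : Type*} [Finite ι] (C : ι → ℕ → Set S) :
    ULim (fun n => ⋃ i, C i n) ⊆ ⋃ i, ULim (C i) := by
  intro x hx
  by_contra hcon
  simp only [mem_iUnion, not_exists] at hcon
  choose O hO hxO h using fun i => not_mem_ulim (hcon i)
  have h1 := hx (⋂ i, O i) (isOpen_iInter_of_finite hO) (mem_iInter.2 hxO)
  obtain ⟨n, ⟨y, hy, hy'⟩, hn'⟩ := (h1.and (eventually_all.2 h)).exists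
  obtain ⟨i, hi⟩ := mem_iUnion.1 hy
  have : y ∈ C i n ∩ O i := ⟨hi, mem_iInter.1 hy' i⟩
  rw [hn' i] at this; exact this

lemma ulim_eventually_subset [CompactSpace S] {C : ℕ → Set S} {O : Set S} (hO : IsOpen O) (h : ULim C ⊆ O) :
    ∀ᶠ n in (hyperfilter ℕ : Filter ℕ), C n ⊆ O := by
  have hc : IsCompact Oᶜ := hO.isClosed_compl.isCompact
  have hn : ∀ x ∈ Oᶜ, x ∉ ULim C := fun x hx hx' => hx (h hx')
  have : ∀ᶠ n in (hyperfilter ℕ : Filter ℕ), C n ∩ Oᶜ = ∅ := by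
    refine hc.induction_on (p := fun s => ∀ᶠ n in (hyperfilter ℕ : Filter ℕ), C n ∩ s = ∅) (by simp) ?_ ?_ ?_
    · intro s t hst ht
      exact ht.mono fun n hn => subset_eq_empty (inter_subset_inter_right _ hst) hn
    · intro s t hs ht
      filter_upwards [hs, ht] with n h1 h2
      rw [inter_union_distrib_left, h1, h2, union_empty]
    · intro x hx
      obtain ⟨O', hO', hxO', h'⟩ := not_mem_ulim (hn x hx)
      exact ⟨O', mem_nhdsWithin_of_mem_nhds (hO'.mem_nhds hxO'), h'⟩
  filter_upwards [this] with n hn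
  rwa [← disjoint_iff_inter_eq_empty, disjoint_compl_right_iff_subset] at hn

lemma ulim_preconn [CompactSpace S] [T2Space S] {C : ℕ → Set S} (h : ∀ n, IsPreconnected (C n)) :
    IsPreconnected (ULim C) := by
  have hcl := isClosed_ulim C
  rw [isPreconnected_closed_iff]
  intro u v hu hv huv ⟨a, ha, hau⟩ ⟨b, hb, hbv⟩
  by_contra hcon
  obtain ⟨O1, O2, h1, h2, hs1, hs2, hd⟩ := normal_separation (hcl.inter hu) (hcl.inter hv) (by
    rw [disjoint_left]; rintro x ⟨hx, hxu⟩ ⟨_, hxv⟩; exact hcon ⟨x, hx, hxu, hxv⟩)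
  have e1 := ulim_eventually_subset (h1.union h2) (C := C) (by
    intro x hx
    rcases huv hx with h | h
    · exact Or.inl (hs1 ⟨hx, h⟩)
    · exact Or.inr (hs2 ⟨hx, h⟩))
  obtain ⟨n, ⟨e1, e2⟩, e3⟩ := ((e1.and (ha O1 h1 (hs1 ⟨ha, hau⟩))).and (hb O2 h2 (hs2 ⟨hb, hbv⟩))).exists
  obtain ⟨y, -, hy1, hy2⟩ := h n O1 O2 h1 h2 e1 e2 e3
  exact disjoint_left.1 hd hy1 hy2

lemma Indec.ulim_fc [CompactSpace S] [T2Space S] {X : Set S} (hX : Indec X) {ι : Type*} [Finite ι]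
    {m : ℕ} (E : ι → ℕ → Set S) (hE : ∀ i n, FC m (E i n)) (hEX : ∀ i n, E i n ⊆ X)
    (hXE : X ⊆ ULim (fun n => ⋃ i, E i n)) : ∃ i, X ⊆ ULim (E i) := by
  choose C hC hCE using hE
  have hCX : ∀ i n j, C i n j ⊆ X := fun i n j => (subset_iUnion _ j).trans ((hCE i n).subset.trans (hEX i n))
  obtain ⟨⟨i, j⟩, hij⟩ := hX.finite_cover (ι := ι × Fin m) (fun p => ULim (fun n => C p.1 n p.2))
    (fun p => ⟨isClosed_ulim _, ulim_preconn fun n => (hC _ _ _).2, ulim_subset hX.closed fun n => hCX _ _ _⟩)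
    isOpen_univ (by rw [inter_univ]; exact hX.nontriv.nonempty) (by
      rw [inter_univ]
      refine hXE.trans ((ulim_mono ?_).trans (ulim_iUnion (fun (p : ι × Fin m) n => C p.1 n p.2)))
      intro n x hx
      obtain ⟨i, hi⟩ := mem_iUnion.1 hx
      rw [← hCE i n] at hi
      obtain ⟨j, hj⟩ := mem_iUnion.1 hi
      exact mem_iUnion.2 ⟨(i, j), hj⟩)
  refine ⟨i, hij.ge.trans (ulim_mono fun n => ?_)⟩
  rw [← hCE i n]; exact subset_iUnion (C i n) j

end FCsec

open Set Metric Filter Topology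

section Uniform
variable {S : Type*} [MetricSpace S]

lemma isOpenEmbedding_scale {Ω : ℂ → S} (hΩ : IsOpenEmbedding Ω) {l : ℝ} (hl : 0 < l) :
    IsOpenEmbedding (fun z : ℂ => Ω ((l:ℂ) * z)) :=
  hΩ.comp (Homeomorph.mulLeft₀ (l:ℂ) (by exact_mod_cast hl.ne')).isOpenEmbedding

noncomputable def bnorm (z : ℂ) : ℝ := max |z.re| |z.im|

lemma continuous_bnorm : Continuous bnorm := by unfold bnorm; fun_prop

lemma mem_obox_iff {z : ℂ} : z ∈ obox ↔ bnorm z < 1 := max_lt_iff.symm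

lemma mem_cbox_iff {z : ℂ} : z ∈ cbox ↔ bnorm z ≤ 1 := max_le_iff.symm

lemma bnorm_mul {a : ℝ} (ha : 0 ≤ a) (z : ℂ) : bnorm ((a:ℂ) * z) = a * bnorm z := by
  simp only [bnorm, Complex.re_ofReal_mul, Complex.im_ofReal_mul, abs_mul, abs_of_nonneg ha]
  rw [← mul_max_of_nonneg _ _ ha]

lemma bnorm_nonneg (z : ℂ) : 0 ≤ bnorm z := le_max_of_le_left (abs_nonneg _)

noncomputable def push (t : ℝ) (z : ℂ) : ℂ := ((max 1 ((1 - t) / bnorm z) : ℝ) : ℂ) * z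

lemma push_id {t : ℝ} (ht : t ∈ Icc (0:ℝ) 1) {z : ℂ} (hz : 1 ≤ bnorm z) : push t z = z := by
  have : max 1 ((1 - t) / bnorm z) = 1 := max_eq_left (by
    rw [div_le_one (by linarith)]; linarith [ht.1])
  rw [push, this]; simp

lemma push_one (z : ℂ) : push 1 z = z := by simp [push]

lemma bnorm_push (t : ℝ) (z : ℂ) : bnorm (push t z) = max 1 ((1 - t) / bnorm z) * bnorm z :=
  bnorm_mul (zero_le_one.trans (le_max_left _ _)) z

lemma le_bnorm_push (t : ℝ) (z : ℂ) : bnorm z ≤ bnorm (push t z) := by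
  rw [bnorm_push]
  exact le_mul_of_one_le_left (bnorm_nonneg z) (le_max_left _ _)

lemma one_le_push {z : ℂ} (hz : 0 < bnorm z) : 1 ≤ bnorm (push 0 z) := by
  rw [bnorm_push]
  calc (1:ℝ) = ((1 - 0) / bnorm z) * bnorm z := by field_simp; norm_num
    _ ≤ _ := mul_le_mul_of_nonneg_right (le_max_right _ _) hz.le

lemma continuousOn_push : ContinuousOn (fun p : ℝ × ℂ => push p.1 p.2) {p | 0 < bnorm p.2} := by
  unfold push
  refine ContinuousOn.mul (Complex.continuous_ofReal.comp_continuousOn (ContinuousOn.sup continuousOn_const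
      (ContinuousOn.div (by fun_prop) (continuous_bnorm.comp continuous_snd).continuousOn ?_))) continuousOn_snd
  intro p hp
  exact ne_of_gt hp

set_option maxHeartbeats 1000000 in
lemma rank_scale {Ω : ℂ → S} (hΩ : IsOpenEmbedding Ω) {N : ℕ} (hN : RankLe N ((Ω '' obox)ᶜ))
    {l : ℝ} (hl : 0 < l) (hl1 : l ≤ 1) : RankLe N (((fun z : ℂ => Ω ((l:ℂ) * z)) '' obox)ᶜ) := by
  set Dl := ((fun z : ℂ => Ω ((l:ℂ) * z)) '' obox)ᶜ with hDl
  have hmemD : ∀ z : ℂ, Ω z ∈ Dl ↔ l ≤ bnorm z := by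
    intro z
    rw [hDl, mem_compl_iff, not_iff_comm, not_le]
    constructor
    · intro h
      refine ⟨((l⁻¹ : ℝ) : ℂ) * z, ?_, ?_⟩
      · rw [mem_obox_iff, bnorm_mul (inv_nonneg.2 hl.le), inv_mul_lt_iff₀ hl]; linarith
      · simp only
        congr 1
        push_cast
        rw [← mul_assoc, mul_inv_cancel₀ (by exact_mod_cast hl.ne'), one_mul]
    · rintro ⟨w, hw, he⟩
      rw [← hΩ.injective he, bnorm_mul hl.le]
      have := mem_obox_iff.1 hw
      nlinarith
  have hmem1 : ∀ z : ℂ, Ω z ∈ (Ω '' obox)ᶜ ↔ 1 ≤ bnorm z := by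
    intro z
    rw [mem_compl_iff, not_iff_comm, not_le, ← mem_obox_iff, hΩ.injective.mem_set_image]
  have hDD : (Ω '' obox)ᶜ ⊆ Dl := by
    intro x hx
    by_cases hr : x ∈ range Ω
    · obtain ⟨z, rfl⟩ := hr
      exact (hmemD z).2 (hl1.trans ((hmem1 z).1 hx))
    · rintro ⟨w, hw, rfl⟩; exact hr ⟨_, rfl⟩
  let h : ℝ → S → S := fun t => chartExt Ω (push t)
  have happ : ∀ t z, h t (Ω z) = Ω (push t z) := fun t z => chartExt_apply hΩ.injective _ z
  have hid : ∀ t ∈ Icc (0:ℝ) 1, ∀ x ∈ (Ω '' obox)ᶜ, h t x = x := by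
    intro t ht x hx
    by_cases hr : x ∈ range Ω
    · obtain ⟨z, rfl⟩ := hr
      rw [happ, push_id ht ((hmem1 z).1 hx)]
    · exact chartExt_off _ hr
  have hc : ContinuousOn (fun p : ℝ × S => h p.1 p.2) (Icc 0 1 ×ˢ Dl) := by
    have hsub : (Icc (0:ℝ) 1 ×ˢ Dl) ⊆ (Icc (0:ℝ) 1 ×ˢ (Ω '' (cbox ∩ {z | l ≤ bnorm z}))) ∪ (Icc (0:ℝ) 1 ×ˢ (Ω '' obox)ᶜ) := by
      rintro ⟨t, x⟩ ⟨ht, hx⟩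
      by_cases hx1 : x ∈ Ω '' obox
      · obtain ⟨z, hz, rfl⟩ := hx1
        exact Or.inl ⟨ht, z, ⟨obox_subset_cbox hz, (hmemD z).1 hx⟩, rfl⟩
      · exact Or.inr ⟨ht, hx1⟩
    refine ContinuousOn.mono (ContinuousOn.union_of_isClosed ?_ ?_ ?_ ?_) hsub
    · have hinv := continuousOn_invFun_range hΩ.isEmbedding
      have : ContinuousOn (fun p : ℝ × S => Ω (push p.1 (Function.invFun Ω p.2)))
          (Icc (0:ℝ) 1 ×ˢ (Ω '' (cbox ∩ {z | l ≤ bnorm z}))) := by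
        have hi2 : ContinuousOn (fun p : ℝ × S => Function.invFun Ω p.2)
            (Icc (0:ℝ) 1 ×ˢ (Ω '' (cbox ∩ {z | l ≤ bnorm z}))) := by
          refine ContinuousOn.comp (t := range Ω) (g := Function.invFun Ω) (f := fun p : ℝ × S => p.2) hinv
            continuousOn_snd ?_
          rintro ⟨t, x⟩ ⟨ht, z, hz, hx⟩
          exact ⟨z, hx⟩
        have hi3 : ContinuousOn (fun p : ℝ × S => (p.1, Function.invFun Ω p.2))
            (Icc (0:ℝ) 1 ×ˢ (Ω '' (cbox ∩ {z | l ≤ bnorm z}))) := ContinuousOn.prodMk continuousOn_fst hi2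
        have hi4 : ContinuousOn (fun p : ℝ × S => push p.1 (Function.invFun Ω p.2))
            (Icc (0:ℝ) 1 ×ˢ (Ω '' (cbox ∩ {z | l ≤ bnorm z}))) := by
          refine ContinuousOn.comp (g := fun p : ℝ × ℂ => push p.1 p.2)
            (f := fun p : ℝ × S => (p.1, Function.invFun Ω p.2)) continuousOn_push hi3 ?_
          rintro ⟨t, x⟩ ⟨ht, z, hz, hx⟩
          simp only at hx
          subst hx
          simp only [mem_ofPred_eq, Function.leftInverse_invFun hΩ.injective z]
          exact hl.trans_le hz.2
        exact hΩ.continuous.comp_continuousOn hi4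
      refine this.congr ?_
      rintro ⟨t, x⟩ ⟨ht, z, hz, hx⟩
      simp only at hx
      subst hx
      simp only [happ, Function.leftInverse_invFun hΩ.injective z]
    · refine continuousOn_snd.congr ?_
      rintro ⟨t, x⟩ ⟨ht, hx⟩
      exact hid t ht x hx
    · refine isClosed_Icc.prod (IsCompact.isClosed ?_)
      exact (isCompact_cbox.inter_right (isClosed_le continuous_const continuous_bnorm)).image hΩ.continuous
    · exact isClosed_Icc.prod (hΩ.isOpenMap _ isOpen_obox).isClosed_compl
  have hm : ∀ t ∈ Icc (0:ℝ) 1, ∀ x ∈ Dl, h t x ∈ Dl := by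
    intro t ht x hx
    by_cases hr : x ∈ range Ω
    · obtain ⟨z, rfl⟩ := hr
      rw [happ, hmemD]
      exact ((hmemD z).1 hx).trans (le_bnorm_push t z)
    · rw [show h t x = x from chartExt_off _ hr]; exact hx
  have hm0 : ∀ x ∈ Dl, h 0 x ∈ (Ω '' obox)ᶜ := by
    intro x hx
    by_cases hr : x ∈ range Ω
    · obtain ⟨z, rfl⟩ := hr
      rw [happ, hmem1]
      exact one_le_push (hl.trans_le ((hmemD z).1 hx))
    · rw [show h 0 x = x from chartExt_off _ hr]
      rintro ⟨w, hw, rfl⟩; exact hr ⟨_, rfl⟩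
  have hc0 : ContinuousOn (h 0) Dl :=
    hc.comp (f := fun x : S => ((0:ℝ), x)) (by fun_prop) (fun x hx => ⟨by simp, hx⟩)
  intro m hmN f hf
  obtain ⟨c, hc', θ, hθ, hθ'⟩ := hN m hmN f (fun a => (hf a).mono hDD)
  refine ⟨c, hc', ?_⟩
  set F : S → Circ1 := fun x => ∑ a, c a • f a x with hF
  have hFc : ContinuousOn F Dl := continuousOn_finsetSum _ fun a _ => (hf a).const_smul (c a)
  obtain ⟨η, hη, hη'⟩ := liftOn_of_homotopy (f := fun x => F x - F (h 0 x)) h hc hm (by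
      intro x hx
      by_cases hr : x ∈ range Ω
      · obtain ⟨z, rfl⟩ := hr
        rw [happ, push_one]
      · exact chartExt_off _ hr) 0 (by
      intro x hx
      rw [hid 0 (by simp) _ (hm0 x hx), sub_self]) (hFc.sub (hFc.comp hc0 fun x hx => hDD (hm0 x hx)))
  refine ⟨fun x => η x + θ (h 0 x), hη.add (hθ.comp hc0 hm0), ?_⟩
  intro x hx
  rw [AddCircle.coe_add, hη' x hx, hθ' _ (hm0 x hx)]
  simp [hF]

end Uniform

open Set Metric Filter Topology

section Dom
variable {S : Type*} [MetricSpace S]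

lemma locConn (hS : LocallyEuclidean2 S) : LocallyConnectedSpace S := by
  rw [locallyConnectedSpace_iff_subsets_isOpen_isConnected]
  intro x U hU
  obtain ⟨Ω, hΩ, h0, hr⟩ := exists_chart hS x hU
  exact ⟨range Ω, hr, hΩ.isOpen_range, ⟨0, h0⟩, isConnected_range hΩ.continuous⟩

variable {X U V : Set S}

lemma dom_open (hS : LocallyEuclidean2 S) (hX : IsClosed X) (hU : IsComplementaryDomain X U) : IsOpen U := by
  have := locConn hS
  obtain ⟨x, hx, rfl⟩ := hU
  exact hX.isOpen_compl.connectedComponentIn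

lemma dom_conn (hU : IsComplementaryDomain X U) : IsConnected U := by
  obtain ⟨x, hx, rfl⟩ := hU
  exact isConnected_connectedComponentIn_iff.2 hx

lemma dom_sub (hU : IsComplementaryDomain X U) : U ⊆ Xᶜ := by
  obtain ⟨x, hx, rfl⟩ := hU
  exact connectedComponentIn_subset _ _

lemma dom_max (hU : IsComplementaryDomain X U) {C : Set S} (hC : IsPreconnected C) (hCX : C ⊆ Xᶜ)
    (hne : (C ∩ U).Nonempty) : C ⊆ U := by
  obtain ⟨x, hx, rfl⟩ := hU
  obtain ⟨y, hy, hy'⟩ := hne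
  rw [connectedComponentIn_eq hy']
  exact hC.subset_connectedComponentIn hy hCX

lemma dom_eq (hU : IsComplementaryDomain X U) (hV : IsComplementaryDomain X V) (hne : (U ∩ V).Nonempty) : U = V :=
  (dom_max hV (dom_conn hU).isPreconnected (dom_sub hU) hne).antisymm
    (dom_max hU (dom_conn hV).isPreconnected (dom_sub hV) (by rwa [inter_comm]))

lemma exists_dom {x : S} (hx : x ∉ X) : ∃ U, IsComplementaryDomain X U ∧ x ∈ U :=
  ⟨_, ⟨x, hx, rfl⟩, mem_connectedComponentIn hx⟩

lemma dom_frontier (hS : LocallyEuclidean2 S) (hX : IsClosed X) (hU : IsComplementaryDomain X U) :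
    frontier U ⊆ X := by
  intro x hx
  by_contra hxX
  obtain ⟨V, hV, hxV⟩ := exists_dom hxX
  have hUV : U = V := by
    refine dom_eq hU hV ?_
    obtain ⟨y, hy, hy'⟩ := mem_closure_iff.1 hx.1 V (dom_open hS hX hV) hxV
    exact ⟨y, hy', hy⟩
  subst hUV
  exact hx.2 (by rwa [(dom_open hS hX hU).interior_eq])

lemma dom_compl_preconn [PreconnectedSpace S] (hS : LocallyEuclidean2 S) (hX : IsClosed X) (hXc : IsPreconnected X)
    (hU : IsComplementaryDomain X U) : IsPreconnected Uᶜ := by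
  have hcl : closure U ⊆ U ∪ X := by
    rw [closure_eq_self_union_frontier]
    exact union_subset_union_right _ (dom_frontier hS hX hU)
  have : Uᶜ = X ∪ (univ ∩ (closure U ∪ X)ᶜ) := by
    ext x
    simp only [mem_compl_iff, mem_union, univ_inter, not_or]
    constructor
    · intro hx
      by_cases hxX : x ∈ X
      · exact Or.inl hxX
      · exact Or.inr ⟨fun h => (hcl h).elim hx hxX, hxX⟩
    · rintro (h | h)
      · exact fun h' => dom_sub hU h' h
      · exact fun h' => h.1 (subset_closure h')
  rw [this]
  refine union_clopen_preconnected isPreconnected_univ hXc (subset_univ _)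
    (isClosed_closure.union hX).isOpen_compl (dom_open hS hX hU) ?_ ?_
  · rintro x ⟨-, hx⟩
    by_cases hxU : x ∈ U
    · exact Or.inr hxU
    · exact Or.inl fun h => h.elim (fun h => (hcl h).elim hxU hx) hx
  · rintro x hx h1 h2
    exact h1 (Or.inl (subset_closure h2))

lemma dom_frontier_eq (hS : LocallyEuclidean2 S) (hX : IsClosed X) (hU : IsComplementaryDomain X U) :
    closure U ∩ Uᶜ = frontier U := by
  rw [frontier, (dom_open hS hX hU).interior_eq]; rfl

lemma dom_frontier_fc [PreconnectedSpace S] (hS : LocallyEuclidean2 S) (hX : IsClosed X) (hXc : IsPreconnected X)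
    (hU : IsComplementaryDomain X U) {N : ℕ} (hN : RankLe N (univ : Set S)) : FC (N + 2) (frontier U) := by
  refine fc_of_not_split (by omega) isClosed_frontier ?_
  rw [← dom_frontier_eq hS hX hU]
  refine multicoh hN _ _ isClosed_closure (dom_open hS hX hU).isClosed_compl
    (dom_conn hU).isPreconnected.closure (dom_compl_preconn hS hX hXc hU) ?_
  rw [eq_univ_iff_forall]; intro x
  by_cases h : x ∈ U
  · exact Or.inl (subset_closure h)
  · exact Or.inr h

lemma open_conn_meets_frontier {H U : Set S} (hH : IsPreconnected H) (h1 : (H ∩ U).Nonempty)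
    (h2 : (H \ U).Nonempty) : (frontier U ∩ H).Nonempty := by
  by_contra hcon
  rw [not_nonempty_iff_eq_empty, ← disjoint_iff_inter_eq_empty, disjoint_left] at hcon
  obtain ⟨x, hx, hxU⟩ := h1
  obtain ⟨y, hy, hyU⟩ := h2
  have key : ∀ z ∈ H, z ∈ closure U → z ∈ interior U := fun z hz hc => by
    by_contra hi
    exact hcon ⟨hc, hi⟩ hz
  obtain ⟨z, hz, hz1, hz2⟩ := hH (interior U) (closure U)ᶜ isOpen_interior isClosed_closure.isOpen_compl
    (fun z hz => by
      by_cases hc : z ∈ closure U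
      · exact Or.inl (key z hz hc)
      · exact Or.inr hc) ⟨x, hx, key x hx (subset_closure hxU)⟩
    ⟨y, hy, fun h => hyU (interior_subset (key y hy h))⟩
  exact hz2 (subset_closure (interior_subset hz1))

lemma separator {D F : Set S} (hD : IsClosed D) (hF : IsCompact F) (hFD : F ⊆ D) (hDc : IsPreconnected D) (hn : NiceSet D)
    {N : ℕ} (hN : RankLe N D) {w1 w2 : S} (hw1 : w1 ∈ F) (hw2 : w2 ∈ F) (hw : w2 ∉ connectedComponentIn F w1)
    {ι : Type*} (H : ι → Set S) (hHc : ∀ l, IsPreconnected (H l)) (hHD : ∀ l, H l ⊆ D)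
    (h1 : ∀ l, (connectedComponentIn F w1 ∩ H l).Nonempty) (h2 : ∀ l, (connectedComponentIn F w2 ∩ H l).Nonempty) :
    ∃ J : Set S, IsClosed J ∧ Disjoint J F ∧ J ⊆ D ∧ ¬ SplitN (N + 2) J ∧ ∀ l, (J ∩ H l).Nonempty := by
  obtain ⟨M, N', hM, hN', hMN, hd, hPM, hQN⟩ := comp_sep hF hw1 (isClosed_singleton (x := w2))
    (by rw [disjoint_singleton_right]; exact hw)
  have hw2N : w2 ∈ N' := hQN ⟨rfl, hw2⟩
  set P := connectedComponentIn F w1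
  set Q := connectedComponentIn F w2
  have hQN' : Q ⊆ N' := by
    intro y hy
    have hyF := connectedComponentIn_subset _ _ hy
    rw [← hMN] at hyF
    refine hyF.resolve_left fun hyM => ?_
    have hpc := isPreconnected_connectedComponentIn (F := F) (x := w2)
    rw [isPreconnected_closed_iff] at hpc
    obtain ⟨z, -, hz, hz'⟩ := hpc M N' hM hN' (hMN ▸ connectedComponentIn_subset _ _) ⟨y, hy, hyM⟩
      ⟨w2, mem_connectedComponentIn hw2, hw2N⟩
    exact disjoint_left.1 hd hz hz'
  obtain ⟨O, hO, hMO, hON⟩ := normal_exists_closure_subset hM hN'.isOpen_compl (disjoint_left.1 hd)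
  have hMF : M ⊆ F := hMN ▸ subset_union_left
  have hNF : N' ⊆ F := hMN ▸ subset_union_right
  have hw1M : w1 ∈ M := hPM (mem_connectedComponentIn hw1)
  have hw1' : w1 ∈ D ∩ closure O := ⟨hFD hw1, subset_closure (hMO hw1M)⟩
  set C := connectedComponentIn (D ∩ closure O) w1
  have hCcl : IsClosed C := isClosed_compIn (hD.inter isClosed_closure) _
  have hCsub : C ⊆ D ∩ closure O := connectedComponentIn_subset _ _
  have hPC : P ⊆ C := isPreconnected_connectedComponentIn.subset_connectedComponentIn (mem_connectedComponentIn hw1)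
    (fun y hy => ⟨hFD (connectedComponentIn_subset _ _ hy), subset_closure (hMO (hPM hy))⟩)
  have hQC : Q ⊆ D \ C := fun y hy => ⟨hFD (connectedComponentIn_subset _ _ hy), fun h => hON (hCsub h).2 (hQN' hy)⟩
  set R := connectedComponentIn (D \ C) w2
  have hQR : Q ⊆ R := isPreconnected_connectedComponentIn.subset_connectedComponentIn (mem_connectedComponentIn hw2) hQC
  have hRsub : R ⊆ D \ C := connectedComponentIn_subset _ _
  -- local structure
  have hloc : ∀ x ∈ D \ C, ∃ W, W ∪ Dᶜ ∈ 𝓝 x ∧ W ⊆ D \ C ∧ IsPreconnected W ∧ x ∈ W := by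
    intro x hx
    obtain ⟨W, hW, hW', hWc, -⟩ := hn x hx.1 Cᶜ (hCcl.isOpen_compl.mem_nhds hx.2)
    refine ⟨W, ?_, fun y hy => ⟨(hW hy).2, (hW hy).1⟩, hWc, mem_of_mem_nhdsWithin hx.1 hW'⟩
    rw [mem_nhdsWithin_iff_eventually] at hW'
    filter_upwards [hW'] with y hy
    by_cases h : y ∈ D
    · exact Or.inl (hy h)
    · exact Or.inr h
  have hu : ∀ x ∈ R, x ∈ interior (R ∪ Dᶜ) := by
    intro x hx
    obtain ⟨W, hW, hWs, hWc, hxW⟩ := hloc x (hRsub hx)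
    rw [mem_interior_iff_mem_nhds]
    refine mem_of_superset hW (union_subset_union_left _ ?_)
    have : R = connectedComponentIn (D \ C) x := connectedComponentIn_eq hx
    rw [this]
    exact hWc.subset_connectedComponentIn hxW hWs
  have hv : ∀ x ∈ (D \ C) \ R, x ∈ interior (((D \ C) \ R) ∪ Dᶜ) := by
    intro x hx
    obtain ⟨W, hW, hWs, hWc, hxW⟩ := hloc x hx.1
    rw [mem_interior_iff_mem_nhds]
    refine mem_of_superset hW (union_subset_union_left _ ?_)
    refine fun y hy => ⟨hWs hy, fun hyR => hx.2 ?_⟩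
    have : R = connectedComponentIn (D \ C) y := connectedComponentIn_eq hyR
    rw [this]
    exact hWc.subset_connectedComponentIn hy hWs hxW
  have hclR : closure R ⊆ R ∪ C := by
    intro x hx
    have hxD : x ∈ D := closure_minimal (hRsub.trans sdiff_subset) hD hx
    by_contra hcon
    rw [mem_union, not_or] at hcon
    obtain ⟨y, hy, hyR⟩ := mem_closure_iff.1 hx _ isOpen_interior (hv x ⟨⟨hxD, hcon.2⟩, hcon.1⟩)
    rcases interior_subset hy with h | h
    · exact h.2 hyR
    · exact h (hRsub hyR).1
  have hBeq : D \ R = C ∪ (D ∩ interior (((D \ C) \ R) ∪ Dᶜ)) := by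
    ext x
    constructor
    · rintro ⟨hx, hxR⟩
      by_cases hxC : x ∈ C
      · exact Or.inl hxC
      · exact Or.inr ⟨hx, hv x ⟨⟨hx, hxC⟩, hxR⟩⟩
    · rintro (h | ⟨h, h'⟩)
      · exact ⟨(hCsub h).1, fun hR => (hRsub hR).2 h⟩
      · rcases interior_subset h' with h2 | h2
        · exact ⟨h, h2.2⟩
        · exact absurd h h2
  have hBc : IsPreconnected (D \ R) := by
    rw [hBeq]
    refine union_clopen_preconnected hDc isPreconnected_connectedComponentIn (hCsub.trans inter_subset_left)
      isOpen_interior (isOpen_interior (s := R ∪ Dᶜ)) ?_ ?_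
    · intro x hx
      by_cases hxR : x ∈ R
      · exact Or.inr (hu x hxR)
      · exact Or.inl (hv x ⟨hx, hxR⟩)
    · intro x hx h1 h2
      rcases interior_subset h1 with h | h
      · rcases interior_subset h2 with h' | h'
        · exact h.2 h'
        · exact h' hx.1
      · exact h hx.1
  have hBcl : IsClosed (D \ R) := by
    have : D \ R = D \ interior (R ∪ Dᶜ) := by
      ext x
      constructor
      · rintro ⟨hx, hxR⟩
        exact ⟨hx, fun h => (interior_subset h).elim hxR (fun h => h hx)⟩
      · rintro ⟨hx, hx'⟩
        exact ⟨hx, fun h => hx' (hu x h)⟩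
    rw [this]; exact hD.sdiff isOpen_interior
  have hclRD : closure R ⊆ D := closure_minimal (hRsub.trans sdiff_subset) hD
  refine ⟨closure R ∩ (D \ R), isClosed_closure.inter hBcl, ?_, inter_subset_left.trans hclRD, ?_, ?_⟩
  · rw [disjoint_left]
    rintro x ⟨hx, hxD, hxR⟩ hxF
    have hxC : x ∈ C := (hclR hx).resolve_left hxR
    have hxM : x ∈ M := by
      rw [← hMN] at hxF
      exact hxF.resolve_right fun h => hON (hCsub hxC).2 h
    obtain ⟨W, hW, hW', hWc, -⟩ := hn x hxD O (hO.mem_nhds (hMO hxM))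
    have hxW : x ∈ W := mem_of_mem_nhdsWithin hxD hW'
    have hWC : W ⊆ C := by
      have : C = connectedComponentIn (D ∩ closure O) x := connectedComponentIn_eq hxC
      rw [this]
      exact hWc.subset_connectedComponentIn hxW fun y hy => ⟨(hW hy).2, subset_closure (hW hy).1⟩
    have hcl : x ∈ closure R := hx
    rw [mem_closure_iff_nhds] at hcl
    rw [mem_nhdsWithin_iff_exists_mem_nhds_inter] at hW'
    obtain ⟨u, hu1, hu2⟩ := hW'
    obtain ⟨y, hy1, hy2⟩ := hcl u hu1
    exact (hRsub hy2).2 (hWC (hu2 ⟨hy1, (hRsub hy2).1⟩))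
  · refine multicoh hN _ _ isClosed_closure hBcl isPreconnected_connectedComponentIn.closure hBc ?_
    apply (union_subset hclRD sdiff_subset).antisymm
    intro x hx
    by_cases h : x ∈ R
    · exact Or.inl (subset_closure h)
    · exact Or.inr ⟨hx, h⟩
  · intro l
    obtain ⟨a, ha, ha'⟩ := h1 l
    obtain ⟨b, hb, hb'⟩ := h2 l
    obtain ⟨x, hx, hx1, hx2⟩ := (isPreconnected_closed_iff.1 (hHc l)) (closure R) (D \ R) isClosed_closure hBcl (by
      intro x hx
      by_cases h : x ∈ R
      · exact Or.inl (subset_closure h)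
      · exact Or.inr ⟨hHD l hx, h⟩) ⟨b, hb', subset_closure (hQR hb)⟩
      ⟨a, ha', hHD l ha', fun h => (hRsub h).2 (hPC ha)⟩
    exact ⟨x, ⟨hx1, hx2⟩, hx⟩

lemma few_domains (hS : LocallyEuclidean2 S) (hX : IsClosed X) {J : Set S} (hJ : IsClosed J) (hd : Disjoint J X)
    (hne : J.Nonempty) {n : ℕ} (hs : ¬ SplitN (n + 1) J) :
    ∃ V : Fin n → Set S, (∀ i, IsComplementaryDomain X (V i)) ∧ J ⊆ ⋃ i, V i := by
  classical
  set 𝒟 : Set (Set S) := {U | IsComplementaryDomain X U ∧ (J ∩ U).Nonempty} with h𝒟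
  have hJcov : ∀ x ∈ J, ∃ U ∈ 𝒟, x ∈ U := fun x hx => by
    obtain ⟨U, hU, hxU⟩ := exists_dom (disjoint_left.1 hd hx)
    exact ⟨U, ⟨hU, x, hx, hxU⟩, hxU⟩
  by_cases hc : 𝒟.encard ≤ n
  · have hfin : 𝒟.Finite := finite_of_encard_le_coe hc
    obtain ⟨x, hx⟩ := hne
    obtain ⟨U0, hU0, -⟩ := hJcov x hx
    have hcard : hfin.toFinset.card ≤ n := by
      rw [hfin.encard_eq_coe_toFinset_card] at hc
      exact_mod_cast hc
    obtain ⟨e⟩ : Nonempty (hfin.toFinset ↪ Fin n) := Function.Embedding.nonempty_of_card_le (by simpa using hcard)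
    have : Nonempty hfin.toFinset := ⟨⟨U0, by simpa using hU0⟩⟩
    refine ⟨fun i => (Function.invFun e i : hfin.toFinset), fun i => ?_, ?_⟩
    · have := (Function.invFun e i : hfin.toFinset).2
      rw [Finite.mem_toFinset] at this
      exact this.1
    · intro x hx
      obtain ⟨U, hU, hxU⟩ := hJcov x hx
      refine mem_iUnion.2 ⟨e ⟨U, by simpa using hU⟩, ?_⟩
      rw [Function.leftInverse_invFun e.injective]
      exact hxU
  · exfalso
    apply hs
    have hc' : ((n + 1 : ℕ) : ℕ∞) ≤ 𝒟.encard := by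
      push_cast
      exact Order.add_one_le_of_lt (not_le.1 hc)
    obtain ⟨t, ht, htc⟩ := exists_subset_encard_eq hc'
    have htf : t.Finite := finite_of_encard_eq_coe htc
    have htcard : htf.toFinset.card = n + 1 := by
      rw [htf.encard_eq_coe_toFinset_card] at htc
      exact_mod_cast htc
    let e := (Finset.equivFinOfCardEq htcard).symm
    have hV : ∀ i, ((e i : Set S)) ∈ 𝒟 := fun i => ht (htf.mem_toFinset.1 (e i).2)
    let V : Fin (n+1) → Set S := fun i => (e i : Set S)
    have hVd : ∀ i j, i ≠ j → Disjoint (V i) (V j) := by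
      intro i j hij
      rw [disjoint_iff_inter_eq_empty, ← not_nonempty_iff_eq_empty]
      intro h
      exact hij (e.injective (Subtype.ext (dom_eq (hV i).1 (hV j).1 h)))
    have hVo : ∀ i, IsOpen (V i) := fun i => dom_open hS hX (hV i).1
    have hcl : ∀ i, IsClosed (J ∩ V i) := by
      intro i
      have : J ∩ V i = J ∩ closure (V i) := by
        apply (inter_subset_inter_right _ subset_closure).antisymm
        rintro x ⟨hx, hx'⟩
        refine ⟨hx, ?_⟩
        rw [closure_eq_self_union_frontier] at hx'
        exact hx'.resolve_right fun h => disjoint_left.1 hd hx (dom_frontier hS hX (hV i).1 h)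
      rw [this]; exact hJ.inter isClosed_closure
    refine ⟨Fin.cons (J \ ⋃ i : Fin n, V i.succ) (fun i => J ∩ V i.succ), ?_, ?_, ?_, ?_⟩
    · intro i
      refine Fin.cases ?_ (fun i => ?_) i
      · exact hJ.sdiff (isOpen_iUnion fun i => hVo _)
      · exact hcl _
    · intro i
      refine Fin.cases ?_ (fun i => ?_) i
      · obtain ⟨x, hx, hx'⟩ := (hV 0).2
        refine ⟨x, hx, fun h => ?_⟩
        obtain ⟨i, hi⟩ := mem_iUnion.1 h
        exact disjoint_left.1 (hVd 0 i.succ (Fin.succ_ne_zero i).symm) hx' hi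
      · exact (hV i.succ).2
    · intro a b
      have h0 : ∀ a : Fin n, Disjoint (J \ ⋃ i : Fin n, V i.succ) (J ∩ V a.succ) := fun a => by
        rw [disjoint_left]; rintro x ⟨-, hx⟩ ⟨-, hx'⟩
        exact hx (mem_iUnion.2 ⟨a, hx'⟩)
      refine Fin.cases ?_ (fun a => ?_) a <;> refine Fin.cases ?_ (fun b => ?_) b
      · intro h; exact absurd rfl h
      · intro _; exact h0 b
      · intro _; exact (h0 a).symm
      · intro hab
        exact (hVd _ _ hab).mono inter_subset_right inter_subset_right
    · ext x
      rw [mem_iUnion, Fin.exists_fin_succ]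
      simp only [Fin.cons_zero, Fin.cons_succ]
      constructor
      · rintro (h | ⟨i, h⟩)
        · exact h.1
        · exact h.1
      · intro hx
        by_cases h : x ∈ ⋃ i : Fin n, V i.succ
        · obtain ⟨i, hi⟩ := mem_iUnion.1 h
          exact Or.inr ⟨i, hx, hi⟩
        · exact Or.inl ⟨hx, h⟩

end Dom

open Set Metric Filter Topology

section SeqDom
variable {S : Type*} [MetricSpace S]

lemma isClosed_compMeets {F Q : Set S} (hF : IsCompact F) (hQ : IsClosed Q) :
    IsClosed {x | x ∈ F ∧ (connectedComponentIn F x ∩ Q).Nonempty} := by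
  rw [← isOpen_compl_iff, isOpen_iff_mem_nhds]
  intro y hy
  by_cases hyF : y ∈ F
  swap
  · exact mem_of_superset (hF.isClosed.isOpen_compl.mem_nhds hyF) fun z hz h => hz h.1
  have hd : Disjoint (connectedComponentIn F y) Q := by
    rw [disjoint_iff_inter_eq_empty, ← not_nonempty_iff_eq_empty]
    exact fun h => hy ⟨hyF, h⟩
  obtain ⟨M, N, hM, hN, hMN, hdis, h1, h2⟩ := comp_sep hF hyF hQ hd
  have hyM : y ∈ M := h1 (mem_connectedComponentIn hyF)
  refine mem_of_superset (hN.isOpen_compl.mem_nhds (disjoint_left.1 hdis hyM)) ?_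
  rintro z hz ⟨hzF, q, hq, hqQ⟩
  have hzM : z ∈ M := by
    have := hzF
    rw [← hMN] at this
    exact this.resolve_right hz
  have hqN : q ∈ N := h2 ⟨hqQ, connectedComponentIn_subset _ _ hq⟩
  obtain ⟨p, -, hp, hp'⟩ := isPreconnected_closed_iff.1 (isPreconnected_connectedComponentIn (F := F) (x := z)) M N hM hN
    (hMN ▸ connectedComponentIn_subset _ _) ⟨z, mem_connectedComponentIn hzF, hzM⟩ ⟨q, hq, hqN⟩
  exact disjoint_left.1 hdis hp hp'

lemma scale_small {Ω : ℂ → S} (hΩ : Continuous Ω) {O : Set S} (hO : O ∈ 𝓝 (Ω 0)) :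
    ∃ l : ℝ, 0 < l ∧ l ≤ 1 ∧ ∀ l', 0 < l' → l' ≤ l → ((fun z : ℂ => Ω ((l' : ℂ) * z)) '' obox) ⊆ O := by
  have h1 : Ω ⁻¹' O ∈ 𝓝 (0:ℂ) := hΩ.continuousAt hO
  obtain ⟨ε, hε, hb⟩ := Metric.mem_nhds_iff.1 h1
  refine ⟨min 1 (ε/4), by positivity, min_le_left _ _, ?_⟩
  rintro l' hl hl' _ ⟨z, hz, rfl⟩
  apply hb
  rw [mem_ball_zero_iff, norm_mul, Complex.norm_real, Real.norm_of_nonneg hl.le]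
  have h2 : ‖z‖ ≤ 2 := by simpa using cbox_subset (obox_subset_cbox hz)
  have h3 := hl'.trans (min_le_right _ _)
  nlinarith [norm_nonneg z]

lemma zero_mem_obox : (0:ℂ) ∈ obox := by simp [obox]

variable [CompactSpace S] [ConnectedSpace S] {X : Set S}

lemma family_few (hS : LocallyEuclidean2 S) (hI : Indec X) : ∃ N : ℕ, ∀ (k : Finset S), k.Nonempty → ∀ (H : S → Set S),
    (∀ l ∈ k, IsOpen (H l)) → (∀ l ∈ k, (X ∩ H l).Nonempty) →
    ∃ V : Fin (N + 1) → Set S, (∀ i, IsComplementaryDomain X (V i)) ∧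
      ∀ l ∈ k, ∃ i, (frontier (V i) ∩ H l).Nonempty := by
  classical
  obtain ⟨x0, hx0⟩ := hI.nontriv.nonempty
  obtain ⟨Ω0, hΩ0, h00, -⟩ := exists_chart hS x0 univ_mem
  have hDc : IsCompact ((Ω0 '' obox)ᶜ) := ((hΩ0.isOpenMap _ isOpen_obox).isClosed_compl).isCompact
  obtain ⟨N, hN⟩ := rank_lemma hDc (nice_compl_box hS hΩ0)
  refine ⟨N, fun k hk H hHo hHX => ?_⟩
  have hpick : ∀ l : k, ∃ Ω : ℂ → S, IsOpenEmbedding Ω ∧ Ω 0 ∈ X ∧ range Ω ⊆ H l \ {x0} := by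
    intro l
    have hinf := inter_open_infinite hI.closed hI.conn hI.nontriv (hHo l l.2) (hHX l l.2)
    obtain ⟨x, hx, hxx⟩ := hinf.exists_notMem_finset {x0}
    obtain ⟨Ω, h1, h2, h3⟩ := exists_chart hS x
      (((hHo l l.2).sdiff (isClosed_singleton (x := x0))).mem_nhds ⟨hx.2, by simpa using hxx⟩)
    exact ⟨Ω, h1, h2 ▸ hx.1, h3⟩
  choose Ω hΩ hΩX hΩr using hpick
  have hcl : IsClosed (⋃ l, Ω l '' closedBall 0 1) :=
    isClosed_iUnion_of_finite fun l => ((isCompact_closedBall _ _).image (hΩ l).continuous).isClosed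
  have hx0n : (⋃ l, Ω l '' closedBall 0 1)ᶜ ∈ 𝓝 (Ω0 0) := by
    refine hcl.isOpen_compl.mem_nhds ?_
    rw [h00]
    intro h
    obtain ⟨l, z, hz, h⟩ := mem_iUnion.1 h
    exact (hΩr l (mem_range_self z)).2 h
  obtain ⟨l0, hl0, hl1, hlG⟩ := scale_small hΩ0.continuous hx0n
  let s : ℕ → ℝ := fun j => l0 / (j + 1)
  have hs0 : ∀ j, 0 < s j := fun j => by positivity
  have hsl : ∀ j, s j ≤ l0 := fun j => div_le_self hl0.le (by linarith [(Nat.cast_nonneg j : (0:ℝ) ≤ j)])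
  let G : ℕ → Set S := fun j => (fun z : ℂ => Ω0 ((s j : ℂ) * z)) '' obox
  have hGe : ∀ j, IsOpenEmbedding (fun z : ℂ => Ω0 ((s j : ℂ) * z)) := fun j => isOpenEmbedding_scale hΩ0 (hs0 j)
  have hGo : ∀ j, IsOpen (G j) := fun j => (hGe j).isOpenMap _ isOpen_obox
  have hx0G : ∀ j, x0 ∈ G j := fun j => ⟨0, zero_mem_obox, by simp [h00]⟩
  have hGrank : ∀ j, RankLe N (G j)ᶜ := fun j => rank_scale hΩ0 hN (hs0 j) ((hsl j).trans hl1)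
  have hFc : ∀ j, IsCompact (X \ G j) := fun j => hI.cpt.diff (hGo j)
  let Y : ℕ → Set S := fun j => {x | x ∈ X \ G j ∧
    ∀ l, (connectedComponentIn (X \ G j) x ∩ Ω l '' closedBall 0 (1/2)).Nonempty}
  have hYcl : ∀ j, IsClosed (Y j) := by
    intro j
    have : Y j = (X \ G j) ∩ ⋂ l, {x | x ∈ X \ G j ∧ (connectedComponentIn (X \ G j) x ∩ Ω l '' closedBall 0 (1/2)).Nonempty} := by
      ext x
      simp only [Y, mem_inter_iff, mem_iInter, mem_ofPred_eq]
      constructor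
      · exact fun h => ⟨h.1, fun l => ⟨h.1, h.2 l⟩⟩
      · exact fun h => ⟨h.1, fun l => (h.2 l).2⟩
    rw [this]
    refine (hFc j).isClosed.inter (isClosed_iInter fun l => isClosed_compMeets (hFc j) ?_)
    exact ((isCompact_closedBall _ _).image (hΩ l).continuous).isClosed
  let Kp : TopologicalSpace.countableBasis S → Set S := fun B =>
    if x0 ∉ (B : Set S) ∧ (X ∩ (B : Set S)).Nonempty then connectedComponentIn (X \ B) x0 else ∅
  have hKpcl : ∀ B, IsClosed (Kp B) := by
    intro B
    simp only [Kp]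
    split_ifs
    · exact isClosed_compIn (hI.closed.sdiff (TopologicalSpace.isOpen_of_mem_countableBasis B.2)) _
    · exact isClosed_empty
  -- cover
  have hcov : ∀ x ∈ X, (∃ B, x ∈ Kp B) ∨ ∃ j, x ∈ Y j := by
    intro x hx
    obtain ⟨P, hPcl, hPc, hPX, hPne, hxP, hPm⟩ := hI.exists_sub hx (fun l => Ω l '' ball 0 (1/2))
      (fun l => (hΩ l).isOpenMap _ isOpen_ball) (fun l => ⟨Ω l 0, hΩX l, ⟨0, by simp, rfl⟩⟩)
    by_cases hx0P : x0 ∈ P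
    · left
      obtain ⟨y, hyX, hyP⟩ := not_subset.1 fun h => hPne (hPX.antisymm h)
      obtain ⟨B, hB, hyB, hBP⟩ := (TopologicalSpace.isBasis_countableBasis S).exists_subset_of_mem_open
        (show y ∈ Pᶜ from hyP) hPcl.isOpen_compl
      refine ⟨⟨B, hB⟩, ?_⟩
      have hcond : x0 ∉ B ∧ (X ∩ B).Nonempty := ⟨fun h => hBP h hx0P, ⟨y, hyX, hyB⟩⟩
      simp only [Kp]
      rw [if_pos hcond]
      have hPB : P ⊆ X \ B := fun z hz => ⟨hPX hz, fun h => hBP h hz⟩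
      exact hPc.subset_connectedComponentIn hx0P hPB hxP
    · right
      obtain ⟨l1, hl1, -, hlP⟩ := scale_small hΩ0.continuous (O := Pᶜ) (hPcl.isOpen_compl.mem_nhds (h00 ▸ hx0P))
      obtain ⟨j, hj⟩ := exists_nat_gt (l0 / l1)
      have hjl : s j ≤ l1 := by
        simp only [s]
        rw [div_le_iff₀ (by positivity)]
        rw [div_lt_iff₀ hl1] at hj
        nlinarith
      have hGP := hlP (s j) (hs0 j) hjl
      have hPF : P ⊆ X \ G j := fun z hz => ⟨hPX hz, fun h => hGP h hz⟩
      refine ⟨j, hPF hxP, fun l => ?_⟩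
      obtain ⟨z, hzP, hz⟩ := hPm l
      exact ⟨z, (hPc.subset_connectedComponentIn hxP hPF hzP), (image_mono (f := Ω l) ball_subset_closedBall hz)⟩
  have : CompactSpace X := isCompact_iff_compactSpace.1 hI.cpt
  have : Nonempty X := ⟨⟨x0, hx0⟩⟩
  let C : (TopologicalSpace.countableBasis S) ⊕ ℕ → Set X := fun i => Subtype.val ⁻¹' (Sum.elim Kp Y i)
  have hCc : Countable (TopologicalSpace.countableBasis S) := (TopologicalSpace.countable_countableBasis S).to_subtype
  obtain ⟨i, hi⟩ := nonempty_interior_of_iUnion_of_closed (f := C) (by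
    rintro (B | j)
    · exact (hKpcl B).preimage continuous_subtype_val
    · exact (hYcl j).preimage continuous_subtype_val) (by
    rw [eq_univ_iff_forall]
    rintro ⟨x, hx⟩
    rcases hcov x hx with ⟨B, hB⟩ | ⟨j, hj⟩
    · exact mem_iUnion.2 ⟨Sum.inl B, hB⟩
    · exact mem_iUnion.2 ⟨Sum.inr j, hj⟩)
  obtain ⟨⟨w1, hw1X⟩, hw1⟩ := hi
  obtain ⟨W, hW, hWi⟩ := isOpen_induced_iff.1 (isOpen_interior (s := C i))
  have hWC : ∀ x ∈ X, x ∈ W → x ∈ Sum.elim Kp Y i := by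
    intro x hx hxW
    have : (⟨x, hx⟩ : X) ∈ interior (C i) := by rw [← hWi]; exact hxW
    exact (interior_subset this : (⟨x, hx⟩ : X) ∈ C i)
  have hw1W : w1 ∈ W := by
    have := hw1; rw [← hWi] at this; exact this
  rcases i with B | j
  · exfalso
    have hmem := hWC w1 hw1X hw1W
    simp only [Sum.elim_inl, Kp] at hmem hWC
    split_ifs at hmem hWC with hcond
    · obtain ⟨y, hyX, hyB⟩ := hcond.2
      have := hI.dense (A := connectedComponentIn (X \ B) x0)
        (isClosed_compIn (hI.closed.sdiff (TopologicalSpace.isOpen_of_mem_countableBasis B.2)) _)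
        isPreconnected_connectedComponentIn ((connectedComponentIn_subset _ _).trans sdiff_subset)
        (fun h => (connectedComponentIn_subset _ _ (h.symm.subset hyX)).2 hyB)
      obtain ⟨z, hzW, hzX, hz⟩ := mem_closure_iff.1 (this hw1X) W hW hw1W
      exact hz (hWC z hzX hzW)
    · exact hmem
  · have hYW : ∀ x ∈ X, x ∈ W → x ∈ Y j := hWC
    have hY1 := hYW w1 hw1X hw1W
    have := hI.dense (A := connectedComponentIn (X \ G j) w1) (isClosed_compIn (hFc j).isClosed _)
        isPreconnected_connectedComponentIn ((connectedComponentIn_subset _ _).trans sdiff_subset)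
        (fun h => (connectedComponentIn_subset _ _ (h.symm.subset hx0)).2 (hx0G j))
    obtain ⟨w2, hw2W, hw2X, hw2⟩ := mem_closure_iff.1 (this hw1X) W hW hw1W
    have hY2 := hYW w2 hw2X hw2W
    have hsub : ∀ l, Ω l '' closedBall 0 (1/2) ⊆ Ω l '' ball 0 1 := fun l =>
      image_mono (closedBall_subset_ball (by norm_num))
    obtain ⟨J, hJ, hJF, hJD, hJs, hJm⟩ := separator (D := (G j)ᶜ) (F := X \ G j) (hGo j).isClosed_compl (hFc j)
      (fun x hx => hx.2) (preconnected_compl_box hS (hGe j)) (nice_compl_box hS (hGe j)) (hGrank j) hY1.1 hY2.1 hw2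
      (fun l => Ω l '' ball 0 1) (fun l => (convex_ball _ _).isPreconnected.image _ (hΩ l).continuous.continuousOn)
      (fun l x hx hxG => hlG (s j) (hs0 j) (hsl j) hxG (mem_iUnion.2 ⟨l, image_mono ball_subset_closedBall hx⟩))
      (fun l => (hY1.2 l).mono (inter_subset_inter_right _ (hsub l)))
      (fun l => (hY2.2 l).mono (inter_subset_inter_right _ (hsub l)))
    have hJX : Disjoint J X := by
      rw [disjoint_left] at hJF ⊢
      exact fun x hx hxX => hJF hx ⟨hxX, hJD hx⟩
    obtain ⟨l1, hl1⟩ := hk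
    obtain ⟨V, hV, hJV⟩ := few_domains hS hI.closed hJ hJX ((hJm ⟨l1, hl1⟩).mono inter_subset_left) hJs
    refine ⟨V, hV, fun l hl => ?_⟩
    obtain ⟨x, hx, hxb⟩ := hJm ⟨l, hl⟩
    obtain ⟨i, hi⟩ := mem_iUnion.1 (hJV hx)
    refine ⟨i, ?_⟩
    refine (open_conn_meets_frontier (H := Ω ⟨l, hl⟩ '' ball 0 1)
      ((convex_ball _ _).isPreconnected.image _ (hΩ _).continuous.continuousOn) ⟨x, hxb, hi⟩
      ⟨Ω ⟨l, hl⟩ 0, ⟨0, by simp, rfl⟩, fun h => dom_sub (hV i) h (hΩX _)⟩).mono ?_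
    refine inter_subset_inter_right _ ?_
    rintro _ ⟨z, -, rfl⟩
    exact (hΩr ⟨l, hl⟩ (mem_range_self z)).1

lemma exists_seq (hS : LocallyEuclidean2 S) (hI : Indec X) : ∃ U : ℕ → Set S, (∀ n, IsComplementaryDomain X (U n)) ∧
    ∀ O, IsOpen O → (X ∩ O).Nonempty → ∀ᶠ n in atTop, (frontier (U n) ∩ O).Nonempty := by
  classical
  obtain ⟨M, hM⟩ := rank_lemma isCompact_univ (nice_univ hS)
  obtain ⟨N, hN⟩ := family_few hS hI
  obtain ⟨x0, hx0⟩ := hI.nontriv.nonempty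
  have hnet : ∀ n : ℕ, ∃ t : Finset S, t.Nonempty ∧ (∀ x ∈ t, x ∈ X) ∧ ∀ x ∈ X, ∃ y ∈ t, dist x y < 1 / ((n:ℝ) + 1) := by
    intro n
    obtain ⟨t, ht, htf, hc⟩ := hI.cpt.finite_cover_balls (e := 1 / ((n:ℝ) + 1)) (by positivity)
    refine ⟨htf.toFinset, ?_, fun x hx => ht (by simpa using hx), fun x hx => ?_⟩
    · obtain ⟨y, hy, -⟩ := mem_iUnion₂.1 (hc hx0)
      exact ⟨y, by simpa using hy⟩
    · obtain ⟨y, hy, h⟩ := mem_iUnion₂.1 (hc hx)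
      exact ⟨y, by simpa using hy, h⟩
  choose t htne htX htc using hnet
  have hpos : ∀ n : ℕ, (0:ℝ) < 1 / ((n:ℝ) + 1) := fun n => by positivity
  -- eventually the balls around a net point near x are inside O
  have hev : ∀ x ∈ X, ∀ O, IsOpen O → x ∈ O → ∀ᶠ n in atTop, ∃ y ∈ t n, ball y (1 / ((n:ℝ) + 1)) ⊆ O := by
    intro x hx O hO hxO
    obtain ⟨ε, hε, hb⟩ := Metric.isOpen_iff.1 hO x hxO
    have h1 := tendsto_one_div_add_atTop_nhds_zero_nat (𝕜 := ℝ)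
    filter_upwards [h1.eventually (gt_mem_nhds (show (0:ℝ) < ε/2 by positivity))] with n hn
    obtain ⟨y, hy, hd⟩ := htc n x hx
    refine ⟨y, hy, fun z hz => hb ?_⟩
    rw [mem_ball] at hz ⊢
    have := dist_triangle z y x
    rw [dist_comm y x] at this
    linarith
  have hballX : ∀ n, ∀ y ∈ t n, (X ∩ ball y (1 / ((n:ℝ) + 1))).Nonempty := fun n y hy =>
    ⟨y, htX n y hy, mem_ball_self (hpos n)⟩
  choose V hV hVm using fun n => hN (t n) (htne n) (fun y => ball y (1 / ((n:ℝ) + 1))) (fun _ _ => isOpen_ball) (hballX n)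
  obtain ⟨i, hi⟩ := hI.ulim_fc (fun (i : Fin (N+1)) n => frontier (V n i))
    (fun i n => dom_frontier_fc hS hI.closed hI.conn (hV n i) hM)
    (fun i n => dom_frontier hS hI.closed (hV n i)) (by
      intro x hx O hO hxO
      refine (Nat.hyperfilter_le_atTop ((hev x hx O hO hxO).mono ?_))
      rintro n ⟨y, hy, hyO⟩
      obtain ⟨i, z, hz, hzb⟩ := hVm n y hy
      exact ⟨z, mem_iUnion.2 ⟨i, hz⟩, hyO hzb⟩)
  have hone : ∀ m, ∃ n, ∀ y ∈ t m, (frontier (V n i) ∩ ball y (1 / ((m:ℝ) + 1))).Nonempty := by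
    intro m
    have : ∀ᶠ n in (hyperfilter ℕ : Filter ℕ), ∀ y ∈ t m, (frontier (V n i) ∩ ball y (1 / ((m:ℝ) + 1))).Nonempty := by
      rw [Filter.eventually_all_finset]
      intro y hy
      exact hi (htX m y hy) _ isOpen_ball (mem_ball_self (hpos m))
    exact this.exists
  choose g hg using hone
  refine ⟨fun m => V (g m) i, fun m => hV _ _, ?_⟩
  rintro O hO ⟨x, hx, hxO⟩
  filter_upwards [hev x hx O hO hxO] with m hm
  obtain ⟨y, hy, hyO⟩ := hm
  exact (hg m y hy).mono (inter_subset_inter_right _ hyO)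

end SeqDom

open Set Metric Filter Topology

section Fwd

lemma split_merge {S : Type*} [TopologicalSpace S] {E C : Set S} (hC : IsClosed C) (hCn : C.Nonempty) {n : ℕ} (hE : SplitN (n + 2) E) {p q : S}
    (hCE : C ∩ E ⊆ {p, q}) : SplitN (n + 1) (C ∪ E) := by
  classical
  obtain ⟨F, h1, h2, h3, h4⟩ := hE
  have hcard : Fintype.card (Fin n) ≤ Fintype.card {j // p ∉ F j ∧ q ∉ F j} := by
    have hp : ((Finset.univ : Finset (Fin (n+2))).filter fun j => p ∈ F j).card ≤ 1 := by
      rw [Finset.card_le_one]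
      intro i hi j hj
      by_contra hij
      exact disjoint_left.1 (h3 i j hij) (Finset.mem_filter.1 hi).2 (Finset.mem_filter.1 hj).2
    have hq : ((Finset.univ : Finset (Fin (n+2))).filter fun j => q ∈ F j).card ≤ 1 := by
      rw [Finset.card_le_one]
      intro i hi j hj
      by_contra hij
      exact disjoint_left.1 (h3 i j hij) (Finset.mem_filter.1 hi).2 (Finset.mem_filter.1 hj).2
    rw [Fintype.card_subtype, Fintype.card_fin]
    have hun : (Finset.univ : Finset (Fin (n+2))) ⊆ (Finset.univ.filter fun j => p ∉ F j ∧ q ∉ F j) ∪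
        ((Finset.univ.filter fun j => p ∈ F j) ∪ (Finset.univ.filter fun j => q ∈ F j)) := by
      intro j _
      simp only [Finset.mem_union, Finset.mem_filter, Finset.mem_univ, true_and]
      tauto
    have := Finset.card_le_card hun
    rw [Finset.card_univ, Fintype.card_fin] at this
    have h5 := Finset.card_union_le (Finset.univ.filter fun j => p ∉ F j ∧ q ∉ F j)
        ((Finset.univ.filter fun j => p ∈ F j) ∪ (Finset.univ.filter fun j => q ∈ F j))
    have h6 := Finset.card_union_le (Finset.univ.filter fun j => p ∈ F j) (Finset.univ.filter fun j => q ∈ F j)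
    omega
  obtain ⟨e⟩ := Function.Embedding.nonempty_of_card_le hcard
  have hCF : ∀ i, Disjoint C (F (e i)) := by
    intro i
    rw [disjoint_left]
    intro x hx hxF
    rcases hCE ⟨hx, h4 ▸ mem_iUnion.2 ⟨_, hxF⟩⟩ with rfl | rfl
    · exact (e i).2.1 hxF
    · exact (e i).2.2 hxF
  set F0 : Set S := C ∪ ⋃ j ∈ {j | ∀ i, (e i : Fin (n+2)) ≠ j}, F j with hF0
  have hF0d : ∀ i, Disjoint F0 (F (e i)) := by
    intro i
    rw [hF0, disjoint_union_left]
    refine ⟨hCF i, ?_⟩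
    rw [disjoint_iUnion₂_left]
    intro j hj
    exact h3 _ _ (fun h => hj i h.symm)
  refine ⟨Fin.cons F0 (fun i => F (e i)), ?_, ?_, ?_, ?_⟩
  · intro i
    refine Fin.cases ?_ (fun i => ?_) i
    · exact hC.union ((Set.toFinite _).isClosed_biUnion fun j _ => h1 j)
    · exact h1 _
  · intro i
    refine Fin.cases ?_ (fun i => ?_) i
    · exact hCn.mono subset_union_left
    · exact h2 _
  · intro a b
    refine Fin.cases ?_ (fun a => ?_) a <;> refine Fin.cases ?_ (fun b => ?_) b
    · intro h; exact absurd rfl h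
    · intro _; exact hF0d b
    · intro _; exact (hF0d a).symm
    · intro hab
      exact h3 _ _ fun h => hab (congrArg Fin.succ (e.injective (Subtype.ext h)))
  · ext x
    rw [mem_iUnion, Fin.exists_fin_succ]
    simp only [Fin.cons_zero, Fin.cons_succ]
    rw [← h4]
    constructor
    · rintro ((h | h) | ⟨i, h⟩)
      · exact Or.inl h
      · obtain ⟨j, -, hj⟩ := mem_iUnion₂.1 h
        exact Or.inr (mem_iUnion.2 ⟨j, hj⟩)
      · exact Or.inr (mem_iUnion.2 ⟨_, h⟩)
    · rintro (h | h)
      · exact Or.inl (Or.inl h)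
      · obtain ⟨j, hj⟩ := mem_iUnion.1 h
        by_cases hje : ∀ i, (e i : Fin (n+2)) ≠ j
        · exact Or.inl (Or.inr (mem_iUnion₂.2 ⟨j, hje, hj⟩))
        · push Not at hje
          obtain ⟨i, rfl⟩ := hje
          exact Or.inr ⟨i, hj⟩

variable {S : Type*} [MetricSpace S]

/-- the facts about crosscuts that we need -/
lemma crosscut_facts {U K : Set S} (hU : IsOpen U) (hK : IsCrosscut U K) :
    ∃ a b, closure K ∩ frontier U = {a, b} ∧ IsPreconnected (closure K) ∧ closure K ∩ U = K ∧ IsPreconnected K := by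
  obtain ⟨hKU, ⟨e⟩, a, b, ⟨f, hf, hfi, hfr, hf0, hf1⟩, hab⟩ := hK
  have hKc : IsPreconnected K := by
    have : PreconnectedSpace (Ioo (0:ℝ) 1) := isPreconnected_iff_preconnectedSpace.1 isPreconnected_Ioo
    rw [isPreconnected_iff_preconnectedSpace]
    exact ⟨by
      rw [← e.symm.surjective.range_eq]
      exact isPreconnected_range e.symm.continuous⟩
  have hemb : IsEmbedding f := (hf.isClosedEmbedding hfi).isEmbedding
  refine ⟨a, b, hab, ?_, ?_, hKc⟩
  · exact hKc.closure
  have hKr : K ⊆ range f := hfr ▸ subset_closure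
  have hpre : IsPreconnected (f ⁻¹' K) := by
    rw [← hemb.toIsInducing.isPreconnected_image, image_preimage_eq_of_subset hKr]
    exact hKc
  apply Subset.antisymm
  swap
  · exact fun x hx => ⟨subset_closure hx, hKU hx⟩
  rintro x ⟨hx, hxU⟩
  rw [← hfr] at hx
  obtain ⟨s, rfl⟩ := hx
  have hfrU : ∀ y ∈ closure K ∩ frontier U, y ∉ U := fun y hy hyU => by
    have := hy.2.2
    rw [hU.interior_eq] at this
    exact this hyU
  have ha : a ∉ U := hfrU a (by rw [hab]; simp)
  have hb : b ∉ U := hfrU b (by rw [hab]; simp)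
  have hs0 : s ≠ ⟨0, by norm_num⟩ := by rintro rfl; exact ha (hf0 ▸ hxU)
  have hs1 : s ≠ ⟨1, by norm_num⟩ := by rintro rfl; exact hb (hf1 ▸ hxU)
  have hs0' : (0:ℝ) < s := lt_of_le_of_ne s.2.1 fun h => hs0 (Subtype.ext h.symm)
  have hs1' : (s:ℝ) < 1 := lt_of_le_of_ne s.2.2 fun h => hs1 (Subtype.ext h)
  have hdense : ∀ O : Set (Icc (0:ℝ) 1), IsOpen O → O.Nonempty → ∃ t ∈ O, f t ∈ K := by
    rintro O hO ⟨t, ht⟩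
    obtain ⟨W, hW, rfl⟩ := hemb.toIsInducing.isOpen_iff.1 hO
    have : f t ∈ closure K := hfr ▸ mem_range_self t
    obtain ⟨y, hyW, hyK⟩ := mem_closure_iff.1 this W hW ht
    obtain ⟨t', rfl⟩ := hKr hyK
    exact ⟨t', hyW, hyK⟩
  obtain ⟨t1, ht1, hk1⟩ := hdense (Iio s) isOpen_Iio ⟨⟨0, by norm_num⟩, hs0'⟩
  obtain ⟨t2, ht2, hk2⟩ := hdense (Ioi s) isOpen_Ioi ⟨⟨1, by norm_num⟩, hs1'⟩
  exact hpre.Icc_subset (a := t1) (b := t2) hk1 hk2 ⟨le_of_lt ht1, le_of_lt ht2⟩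

lemma crosscut_diff_nonempty (hS : LocallyEuclidean2 S) {U K : Set S} (hU : IsOpen U) (hUc : IsPreconnected U)
    (hK : IsCrosscut U K) : (U \ K).Nonempty := by
  by_contra hcon
  rw [not_nonempty_iff_eq_empty, sdiff_eq_empty] at hcon
  obtain ⟨hKU, ⟨e⟩, -⟩ := hK
  have hUK : K = U := hKU.antisymm hcon
  subst hUK
  let m : Ioo (0:ℝ) 1 := ⟨1/2, by norm_num, by norm_num⟩
  have h1 := preconnected_diff_point hS hU hUc (e.symm m)
  have h2 : IsPreconnected ((fun x : K => ((e x : Ioo (0:ℝ) 1) : ℝ)) '' (Subtype.val ⁻¹' (K \ {(e.symm m : S)}))) := by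
    refine IsPreconnected.image ?_ _ (by fun_prop)
    rw [← Topology.IsInducing.subtypeVal.isPreconnected_image, image_preimage_eq_of_subset]
    · exact h1
    · rw [Subtype.range_coe]; exact sdiff_subset
  have key : ∀ t : Ioo (0:ℝ) 1, t ≠ m → (t:ℝ) ∈ (fun x : K => ((e x : Ioo (0:ℝ) 1) : ℝ)) '' (Subtype.val ⁻¹' (K \ {(e.symm m : S)})) := by
    intro t ht
    refine ⟨e.symm t, ⟨(e.symm t).2, ?_⟩, by simp⟩
    intro h
    exact ht (e.symm.injective (Subtype.ext h))
  have ha := key ⟨1/4, by norm_num, by norm_num⟩ (by intro h; have := congrArg Subtype.val h; norm_num [m] at this)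
  have hb := key ⟨3/4, by norm_num, by norm_num⟩ (by intro h; have := congrArg Subtype.val h; norm_num [m] at this)
  obtain ⟨x, ⟨hx, hx'⟩, hxe⟩ := h2.Icc_subset ha hb (show (1/2:ℝ) ∈ Icc (1/4:ℝ) (3/4) by constructor <;> norm_num)
  apply hx'
  have : e x = m := Subtype.ext hxe
  rw [← this]; simp

variable [CompactSpace S] [ConnectedSpace S] {X : Set S}

/-- union of the components of `U \ K` whose shadow misses `H` -/
def missW (U K H : Set S) : Set S :=
  {x | x ∈ U \ K ∧ closure (connectedComponentIn (U \ K) x) ∩ frontier U ∩ H = ∅}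

lemma comp_closure_sub (hS : LocallyEuclidean2 S) {U K : Set S} (hO : IsOpen (U \ K)) {x y : S}
    (hy : y ∈ closure (connectedComponentIn (U \ K) x)) (hyU : y ∈ U \ K) : y ∈ connectedComponentIn (U \ K) x := by
  have := locConn hS
  have ho : IsOpen (connectedComponentIn (U \ K) y) := hO.connectedComponentIn
  obtain ⟨z, hz, hz'⟩ := mem_closure_iff.1 hy _ ho (mem_connectedComponentIn hyU)
  rw [connectedComponentIn_eq hz', ← connectedComponentIn_eq hz]
  exact mem_connectedComponentIn hyU

lemma missing_fc (hS : LocallyEuclidean2 S) (hX : IsClosed X) (hXc : IsPreconnected X) {U K H : Set S}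
    (hU : IsComplementaryDomain X U) {a b : S} (hab : closure K ∩ frontier U = {a, b}) (hKc : IsPreconnected (closure K))
    (hKU : closure K ∩ U = K) (hKp : IsPreconnected K) {N : ℕ} (hN : RankLe N (univ : Set S)) :
    FC (N + 3) ((closure (missW U K H) ∩ frontier U) ∪ {a, b}) := by
  have hUo := dom_open hS hX hU
  have hUK : U \ K = U \ closure K := by
    ext x
    refine ⟨fun h => ⟨h.1, fun h' => h.2 (hKU ▸ ⟨h', h.1⟩)⟩, fun h => ⟨h.1, fun h' => h.2 (subset_closure h')⟩⟩
  have hO : IsOpen (U \ K) := by rw [hUK]; exact hUo.sdiff isClosed_closure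
  have hlc := locConn hS
  have hcomp : ∀ x ∈ U \ K, ∀ y ∈ connectedComponentIn (U \ K) x, (x ∈ missW U K H ↔ y ∈ missW U K H) := by
    intro x hx y hy
    simp only [missW, mem_ofPred_eq]
    rw [connectedComponentIn_eq hy]
    have := connectedComponentIn_subset _ _ hy
    tauto
  have hW1 : missW U K H ⊆ U \ K := fun x hx => hx.1
  set W := missW U K H with hWdef
  have hWo : IsOpen W := by
    rw [isOpen_iff_mem_nhds]
    intro x hx
    refine mem_of_superset (hO.connectedComponentIn.mem_nhds (mem_connectedComponentIn hx.1)) fun y hy => ?_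
    exact (hcomp x hx.1 y hy).1 hx
  have hVo : IsOpen ((U \ K) \ W) := by
    rw [isOpen_iff_mem_nhds]
    intro x hx
    refine mem_of_superset (hO.connectedComponentIn.mem_nhds (mem_connectedComponentIn hx.1)) fun y hy => ?_
    exact ⟨connectedComponentIn_subset _ _ hy, fun h => hx.2 ((hcomp x hx.1 y hy).2 h)⟩
  have hKsub : K ⊆ U := by rw [← hKU]; exact inter_subset_right
  have hP : IsPreconnected (K ∪ (U ∩ W)) := union_clopen_preconnected (dom_conn hU).isPreconnected hKp hKsub hWo hVo
    (fun x hx => by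
      by_cases h : x ∈ W
      · exact Or.inl h
      · exact Or.inr ⟨hx, h⟩) (fun x _ h h' => h'.2 h)
  have haa : a ∈ closure K ∩ frontier U := by rw [hab]; simp
  have hnU : ∀ y ∈ frontier U, y ∉ U := fun y hy hyU => by
    have := hy.2
    rw [hUo.interior_eq] at this
    exact this hyU
  have hA : IsPreconnected (Uᶜ ∪ closure K) :=
    (dom_compl_preconn hS hX hXc hU).union a (hnU a haa.2) haa.1 hKc
  have hR : IsPreconnected ((Uᶜ ∪ closure K) ∪ (univ ∩ ((U \ K) \ W))) :=
    union_clopen_preconnected isPreconnected_univ hA (subset_univ _) hVo hWo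
      (fun x hx => by
        have hx2 := hx.2
        simp only [mem_union, mem_compl_iff, not_or, not_not] at hx2
        by_cases h : x ∈ W
        · exact Or.inr h
        · exact Or.inl ⟨⟨hx2.1, fun h => hx2.2 (subset_closure h)⟩, h⟩) (fun x _ h h' => h.2 h')
  have hReq : (Uᶜ ∪ closure K) ∪ (univ ∩ ((U \ K) \ W)) = Wᶜ := by
    ext x
    constructor
    · rintro ((h | h) | h)
      · exact fun h' => h (hW1 h').1
      · intro h'
        have := hW1 h'
        rw [hUK] at this
        exact this.2 h
      · exact h.2.2
    · intro h
      by_cases hxU : x ∈ U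
      · by_cases hxK : x ∈ K
        · exact Or.inl (Or.inr (subset_closure hxK))
        · exact Or.inr ⟨mem_univ _, ⟨hxU, hxK⟩, h⟩
      · exact Or.inl (Or.inl hxU)
  rw [hReq] at hR
  have hm := multicoh hN _ _ isClosed_closure hWo.isClosed_compl hP.closure hR (by
    rw [eq_univ_iff_forall]
    intro x
    by_cases h : x ∈ W
    · exact Or.inl (subset_closure (Or.inr ⟨(hW1 h).1, h⟩))
    · exact Or.inr h)
  have hclW : closure W ⊆ W ∪ (frontier U ∪ closure K) := by
    intro x hx
    by_contra hcon
    simp only [mem_union, not_or] at hcon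
    have hxU : x ∈ U := by
      have h1 : x ∈ closure U := closure_mono (hW1.trans sdiff_subset) hx
      rw [closure_eq_self_union_frontier] at h1
      exact h1.resolve_right hcon.2.1
    obtain ⟨y, hy, hy'⟩ := mem_closure_iff.1 hx _ hVo ⟨⟨hxU, fun h => hcon.2.2 (subset_closure h)⟩, hcon.1⟩
    exact hy.2 hy'
  have heq : closure (K ∪ (U ∩ W)) ∩ Wᶜ = closure K ∪ ((closure W ∩ frontier U) ∪ {a, b}) := by
    rw [inter_eq_right.2 (hW1.trans sdiff_subset), closure_union]
    ext x
    constructor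
    · rintro ⟨h | h, h'⟩
      · exact Or.inl h
      · rcases hclW h with h1 | h1 | h1
        · exact absurd h1 h'
        · exact Or.inr (Or.inl ⟨h, h1⟩)
        · exact Or.inl h1
    · rintro (h | h | h)
      · exact ⟨Or.inl h, hReq ▸ Or.inl (Or.inr h)⟩
      · exact ⟨Or.inr h.1, fun hw => hnU x h.2 (hW1 hw).1⟩
      · rw [← hab] at h
        exact ⟨Or.inl h.1, hReq ▸ Or.inl (Or.inr h.1)⟩
  rw [heq] at hm
  refine fc_of_not_split (by omega) ?_ fun hs => hm ?_
  · exact (isClosed_closure.inter isClosed_frontier).union (by simp)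
  · refine split_merge (n := N + 1) (p := a) (q := b) isClosed_closure ⟨a, haa.1⟩ hs ?_
    rintro x ⟨hx, h | h⟩
    · rw [← hab]; exact ⟨hx, h.2⟩
    · exact h

lemma missing_inter (hS : LocallyEuclidean2 S) {U K H : Set S} (hUo : IsOpen U) {a b : S}
    (hab : closure K ∩ frontier U = {a, b}) (hKU : closure K ∩ U = K) (hH : IsOpen H) :
    ((closure (missW U K H) ∩ frontier U) ∪ {a, b}) ∩ H ⊆ {a, b} := by
  rintro z ⟨h | h, hzH⟩
  swap
  · exact h
  by_contra hz
  have hzK : z ∉ closure K := fun h' => hz (hab ▸ ⟨h', h.2⟩)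
  have hUK : U \ K = U \ closure K := by
    ext x
    refine ⟨fun h => ⟨h.1, fun h' => h.2 (hKU ▸ ⟨h', h.1⟩)⟩, fun h => ⟨h.1, fun h' => h.2 (subset_closure h')⟩⟩
  have hO : IsOpen (U \ K) := by rw [hUK]; exact hUo.sdiff isClosed_closure
  obtain ⟨Ω, hΩ, h0, hr⟩ := exists_chart hS z ((hH.sdiff (isClosed_closure (s := K))).mem_nhds ⟨hzH, hzK⟩)
  obtain ⟨x, hx, hxW⟩ := mem_closure_iff.1 h.1 _ hΩ.isOpen_range ⟨0, h0⟩
  set V := connectedComponentIn (U \ K) x with hV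
  have hzU : z ∉ U := by
    have := h.2.2
    rwa [hUo.interior_eq] at this
  obtain ⟨y, hyf, hyr⟩ := open_conn_meets_frontier (U := V) (isPreconnected_range hΩ.continuous)
    ⟨x, hx, mem_connectedComponentIn hxW.1⟩ ⟨z, ⟨0, h0⟩, fun h' => hzU (connectedComponentIn_subset _ _ h').1⟩
  have hyU : y ∉ U := by
    intro hyU
    have h1 : y ∈ U \ K := ⟨hyU, fun h => (hr hyr).2 (subset_closure h)⟩
    have h2 := comp_closure_sub hS hO hyf.1 h1
    have := locConn hS
    have h3 : IsOpen V := hO.connectedComponentIn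
    exact hyf.2 (by rwa [h3.interior_eq])
  have hyF : y ∈ frontier U := by
    refine ⟨closure_mono ((connectedComponentIn_subset _ _).trans sdiff_subset) hyf.1, ?_⟩
    rwa [hUo.interior_eq]
  have : y ∈ closure V ∩ frontier U ∩ H := ⟨⟨hyf.1, hyF⟩, (hr hyr).1⟩
  rw [hxW.2] at this
  exact this

lemma fwd_eps (hS : LocallyEuclidean2 S) (hI : Indec X) {U : ℕ → Set S} (hU : ∀ n, IsComplementaryDomain X (U n))
    (hUX : ∀ O, IsOpen O → (X ∩ O).Nonempty → ∀ᶠ n in atTop, (frontier (U n) ∩ O).Nonempty) {K : ℕ → Set S}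
    (hK : ∀ n, IsCrosscut (U n) (K n)) {ε : ℝ} (hε : 0 < ε) :
    ∀ᶠ n in atTop, ∃ x ∈ U n \ K n, hausdorffDist (closure (connectedComponentIn (U n \ K n) x) ∩ frontier (U n)) X ≤ ε := by
  classical
  by_contra hcon
  rw [not_eventually] at hcon
  obtain ⟨φ, hφ, hbad⟩ := extraction_of_frequently_atTop hcon
  obtain ⟨N, hN⟩ := rank_lemma isCompact_univ (nice_univ hS)
  obtain ⟨t, ht, htf, hc⟩ := hI.cpt.finite_cover_balls (e := ε/2) (by positivity)
  obtain ⟨x0, hx0⟩ := hI.nontriv.nonempty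
  have hUo : ∀ n, IsOpen (U n) := fun n => dom_open hS hI.closed (hU n)
  choose a b hab hKc hKU hKp using fun n => crosscut_facts (hUo n) (hK n)
  have : Finite t := htf
  have hbad' : ∀ k, ∀ x ∈ U (φ k) \ K (φ k), ∃ y : t, x ∈ missW (U (φ k)) (K (φ k)) (ball (y:S) (ε/2)) := by
    intro k x hx
    by_contra hno
    push Not at hno
    have hm : ∀ y ∈ t, (closure (connectedComponentIn (U (φ k) \ K (φ k)) x) ∩ frontier (U (φ k)) ∩ ball y (ε/2)).Nonempty := by
      intro y hy
      rw [nonempty_iff_ne_empty]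
      exact fun h => hno ⟨y, hy⟩ ⟨hx, h⟩
    refine hbad k ⟨x, hx, hausdorffDist_le_of_mem_dist hε.le ?_ ?_⟩
    · intro z hz
      exact ⟨z, dom_frontier hS hI.closed (hU _) hz.2, by simpa using hε.le⟩
    · intro z hz
      obtain ⟨y, hy, hzy⟩ := mem_iUnion₂.1 (hc hz)
      obtain ⟨w, hw, hwy⟩ := hm y hy
      refine ⟨w, hw, ?_⟩
      rw [mem_ball] at hzy hwy
      have := dist_triangle_right z w y
      linarith
  obtain ⟨⟨y, hy⟩, hyE⟩ := hI.ulim_fc (fun (y : t) k => (closure (missW (U (φ k)) (K (φ k)) (ball (y:S) (ε/2))) ∩ frontier (U (φ k))) ∪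
      {a (φ k), b (φ k)}) (fun y k => missing_fc hS hI.closed hI.conn (hU _) (hab _) (hKc _) (hKU _) (hKp _) hN) (by
      intro y k
      refine union_subset (inter_subset_right.trans (dom_frontier hS hI.closed (hU _))) ?_
      rw [← hab]
      exact inter_subset_right.trans (dom_frontier hS hI.closed (hU _))) (by
      intro x hx O hO hxO
      have h1 := hφ.tendsto_atTop.eventually (hUX O hO ⟨x, hx, hxO⟩)
      refine Nat.hyperfilter_le_atTop (h1.mono ?_)
      rintro k ⟨z, hz, hzO⟩
      refine ⟨z, ?_, hzO⟩
      obtain ⟨y0, hy0, -⟩ := mem_iUnion₂.1 (hc hx0)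
      by_cases hzK : z ∈ closure (K (φ k))
      · exact mem_iUnion.2 ⟨⟨y0, hy0⟩, Or.inr (by rw [← hab]; exact ⟨hzK, hz⟩)⟩
      · have hsub : U (φ k) ⊆ closure (K (φ k)) ∪ ⋃ y : t, closure (missW (U (φ k)) (K (φ k)) (ball (y:S) (ε/2))) := by
          intro w hw
          by_cases hwK : w ∈ K (φ k)
          · exact Or.inl (subset_closure hwK)
          · obtain ⟨y, hy⟩ := hbad' k w ⟨hw, hwK⟩
            exact Or.inr (mem_iUnion.2 ⟨y, subset_closure hy⟩)
        have h2 := closure_minimal hsub (isClosed_closure.union (isClosed_iUnion_of_finite fun _ => isClosed_closure)) hz.1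
        obtain ⟨y, hy⟩ := mem_iUnion.1 (h2.resolve_left hzK)
        exact mem_iUnion.2 ⟨y, Or.inl ⟨hy, hz⟩⟩)
  have hinf := inter_open_infinite hI.closed hI.conn hI.nontriv (isOpen_ball (x := y) (ε := ε/2)) ⟨y, ht hy, by simpa using hε⟩
  obtain ⟨s, hs, hsc⟩ := hinf.exists_subset_card_eq 3
  obtain ⟨p, q, r, hpq, hpr, hqr, rfl⟩ := Finset.card_eq_three.1 hsc
  have hmem : ∀ z ∈ ({p, q, r} : Finset S), z ∈ X ∩ ball y (ε/2) := fun z hz => hs hz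
  have hsep : ∃ δ > 0, δ ≤ dist p q ∧ δ ≤ dist p r ∧ δ ≤ dist q r :=
    ⟨min (dist p q) (min (dist p r) (dist q r)), by
      simp only [gt_iff_lt, lt_min_iff, dist_pos]; exact ⟨hpq, hpr, hqr⟩, min_le_left _ _,
      (min_le_right _ _).trans (min_le_left _ _), (min_le_right _ _).trans (min_le_right _ _)⟩
  obtain ⟨δ, hδ, h1, h2, h3⟩ := hsep
  have hall : ∀ z ∈ ({p, q, r} : Finset S), ∀ᶠ k in (hyperfilter ℕ : Filter ℕ),
      a (φ k) ∈ ball z (δ/2) ∨ b (φ k) ∈ ball z (δ/2) := by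
    intro z hz
    have := hyE (hmem z hz).1 (ball z (δ/2) ∩ ball y (ε/2)) (isOpen_ball.inter isOpen_ball)
      ⟨mem_ball_self (by positivity), (hmem z hz).2⟩
    filter_upwards [this] with k hk
    obtain ⟨w, hw, hw1, hw2⟩ := hk
    rcases missing_inter hS (hUo _) (hab _) (hKU _) isOpen_ball ⟨hw, hw2⟩ with rfl | rfl
    · exact Or.inl hw1
    · exact Or.inr hw1
  obtain ⟨k, kp, kq, kr⟩ := ((hall p (by simp)).and ((hall q (by simp)).and (hall r (by simp)))).exists
  have hexcl : ∀ c x y : S, c ∈ ball x (δ/2) → c ∈ ball y (δ/2) → δ ≤ dist x y → False := by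
    intro c x y hx hy h
    rw [mem_ball'] at hx
    rw [mem_ball] at hy
    have := dist_triangle x c y
    linarith
  rcases kp with kp | kp <;> rcases kq with kq | kq <;> rcases kr with kr | kr <;>
    first
    | exact hexcl _ _ _ kp kq h1
    | exact hexcl _ _ _ kp kr h2
    | exact hexcl _ _ _ kq kr h3

lemma forward (hS : LocallyEuclidean2 S) (hI : Indec X) :
    ∃ U : ℕ → Set S, (∀ n, IsComplementaryDomain X (U n)) ∧ DoublePassConditionCrosscuts X U := by
  obtain ⟨U, hU, hUX⟩ := exists_seq hS hI
  refine ⟨U, hU, fun K hK => ?_⟩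
  have hpick : ∀ n, ∃ x ∈ U n \ K n, ∀ y ∈ U n \ K n,
      hausdorffDist (closure (connectedComponentIn (U n \ K n) x) ∩ frontier (U n)) X ≤
      hausdorffDist (closure (connectedComponentIn (U n \ K n) y) ∩ frontier (U n)) X + 1 / ((n:ℝ) + 1) := by
    intro n
    set g := fun y => hausdorffDist (closure (connectedComponentIn (U n \ K n) y) ∩ frontier (U n)) X
    have hne : (g '' (U n \ K n)).Nonempty :=
      (crosscut_diff_nonempty hS (dom_open hS hI.closed (hU n)) (dom_conn (hU n)).isPreconnected (hK n)).image _
    have hb : BddBelow (g '' (U n \ K n)) := ⟨0, by rintro _ ⟨x, -, rfl⟩; exact hausdorffDist_nonneg⟩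
    obtain ⟨_, ⟨x, hx, rfl⟩, hlt⟩ := exists_lt_of_csInf_lt hne
      (show sInf (g '' (U n \ K n)) < sInf (g '' (U n \ K n)) + 1 / ((n:ℝ) + 1) by linarith [show (0:ℝ) < 1 / ((n:ℝ) + 1) by positivity])
    refine ⟨x, hx, fun y hy => ?_⟩
    have := csInf_le hb (mem_image_of_mem g hy)
    exact hlt.le.trans (by linarith)
  choose x hx hxm using hpick
  refine ⟨_, fun n => ⟨x n, hx n, rfl⟩, ?_⟩
  rw [HausdorffConvergesTo, Metric.tendsto_nhds]
  intro ε hε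
  have h1 := (tendsto_one_div_add_atTop_nhds_zero_nat (𝕜 := ℝ)).eventually (gt_mem_nhds (show (0:ℝ) < ε/2 by positivity))
  filter_upwards [h1, fwd_eps hS hI hU hUX hK (show (0:ℝ) < ε/2 by positivity)] with n hn ⟨y, hy, hyd⟩
  rw [Real.dist_0_eq_abs, abs_of_nonneg hausdorffDist_nonneg]
  have := hxm n y hy
  linarith

end Fwd

open Set Metric Filter Topology

section Spot

noncomputable def F0 (z : ℂ) : Circ1 := if |z.re| + |z.im| < 1 then (((1 + z.re / (1 - |z.im|)) / 2 : ℝ) : Circ1) else 0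

lemma F0_eq {z : ℂ} (hz : |z.im| < 1) :
    F0 z = (((1 + max (-1) (min 1 (z.re / (1 - |z.im|)))) / 2 : ℝ) : Circ1) := by
  have hp : 0 < 1 - |z.im| := by linarith
  rw [F0]
  split_ifs with h
  · have h1 : |z.re / (1 - |z.im|)| < 1 := by
      rw [abs_div, abs_of_pos hp, div_lt_one hp]; linarith
    rw [abs_lt] at h1
    rw [min_eq_right h1.2.le, max_eq_right h1.1.le]
  · rcases le_total 0 z.re with h0 | h0
    · rw [abs_of_nonneg h0] at h
      have : 1 ≤ z.re / (1 - |z.im|) := by rw [le_div_iff₀ hp]; linarith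
      rw [min_eq_left this, max_eq_right (by norm_num)]
      have h1 : ((1 + 1) / 2 : ℝ) = ((1 : ℤ) : ℝ) := by norm_num
      rw [h1]
      exact (coe_circ_int 1).symm
    · rw [abs_of_nonpos h0] at h
      have : z.re / (1 - |z.im|) ≤ -1 := by rw [div_le_iff₀ hp]; linarith
      rw [min_eq_right (by linarith), max_eq_left this]
      simp

lemma F0_zero {z : ℂ} (hz : 1 ≤ |z.re| + |z.im|) : F0 z = 0 := by
  rw [F0, if_neg (not_lt.2 hz)]

lemma F0_zero_norm {z : ℂ} (hz : 1 ≤ ‖z‖) : F0 z = 0 :=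
  F0_zero (hz.trans (Complex.norm_le_abs_re_add_abs_im z))

lemma F0_real (x : ℝ) : F0 (x : ℂ) = (((1 + max (-1) (min 1 x)) / 2 : ℝ) : Circ1) := by
  rw [F0_eq (by simp)]; simp

lemma continuousOn_F0 : ContinuousOn F0 {Complex.I, -Complex.I}ᶜ := by
  intro z hz
  apply ContinuousAt.continuousWithinAt
  by_cases h : |z.im| < 1
  · have hev : ∀ᶠ w : ℂ in 𝓝 z, F0 w = (((1 + max (-1) (min 1 (w.re / (1 - |w.im|)))) / 2 : ℝ) : Circ1) := by
      have ho : IsOpen {w : ℂ | |w.im| < 1} := isOpen_lt (by fun_prop) (by fun_prop)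
      filter_upwards [ho.mem_nhds h] with w hw
      exact F0_eq hw
    refine ContinuousAt.congr ?_ (hev.mono fun _ h => h.symm)
    refine continuous_coe_circ.continuousAt.comp (f := fun w : ℂ => (1 + max (-1) (min 1 (w.re / (1 - |w.im|)))) / 2) ?_
    have hne : 1 - |z.im| ≠ 0 := by linarith
    have h1 : ContinuousAt (fun w : ℂ => w.re / (1 - |w.im|)) z :=
      ContinuousAt.div (by fun_prop) (by fun_prop) hne
    have h2 : ContinuousAt (fun w : ℂ => max (-1) (min 1 (w.re / (1 - |w.im|)))) z :=
      continuousAt_const.max (continuousAt_const.min h1)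
    fun_prop
  · have h1 : 1 < |z.re| + |z.im| := by
      push Not at h
      rcases h.lt_or_eq with h2 | h2
      · linarith [abs_nonneg z.re]
      · have : z.re ≠ 0 := by
          intro h0
          apply hz
          rcases eq_or_eq_neg_of_abs_eq h2.symm with h3 | h3
          · left; apply Complex.ext <;> simp [h0, h3]
          · right; apply Complex.ext <;> simp [h0, h3]
        have := abs_pos.2 this
        linarith
    have ho : IsOpen {w : ℂ | 1 < |w.re| + |w.im|} := isOpen_lt (by fun_prop) (by fun_prop)
    refine ContinuousAt.congr (continuousAt_const (y := (0:Circ1))) ?_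
    filter_upwards [ho.mem_nhds h1] with w hw
    exact (F0_zero (le_of_lt hw)).symm

lemma not_liftOn_F0 {r : ℝ} (hr : 0 < r) : ¬ LiftOn F0 (ball Complex.I r \ {Complex.I}) := by
  rintro ⟨θ, hθ, he⟩
  obtain ⟨h, hh0, hh1, hhr⟩ : ∃ h : ℝ, 0 < h ∧ h < 1 ∧ 2 * h < r := ⟨min (1/2) (r/3), by positivity,
    (min_le_left _ _).trans_lt (by norm_num), by linarith [min_le_right (1/2) (r/3)]⟩
  let p : ℝ → ℝ → ℂ := fun x y => ⟨x, 1 + y⟩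
  have hp : Continuous (fun q : ℝ × ℝ => p q.1 q.2) := by
    have : (fun q : ℝ × ℝ => p q.1 q.2) = fun q : ℝ × ℝ => (q.1 : ℂ) + ((1 + q.2 : ℝ) : ℂ) * Complex.I := by
      ext q; apply Complex.ext <;> simp [p]
    rw [this]; fun_prop
  have hmem : ∀ x y : ℝ, |x| ≤ h → |y| ≤ h → (x ≠ 0 ∨ y ≠ 0) → p x y ∈ ball Complex.I r \ {Complex.I} := by
    intro x y hx hy hne
    constructor
    · rw [mem_ball, dist_eq_norm]
      have := Complex.norm_le_abs_re_add_abs_im (p x y - Complex.I)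
      simp [p] at this
      linarith
    · intro hc
      have h1 := congrArg Complex.re hc
      have h2 := congrArg Complex.im hc
      simp [p] at h1 h2
      tauto
  let Z1 : Set ℂ := (fun x : ℝ => p x (-h)) '' Icc (-h) h
  have hZ1 : IsPreconnected Z1 := isPreconnected_Icc.image _
    (hp.comp (by fun_prop : Continuous fun x : ℝ => (x, -h))).continuousOn
  have hZ1s : Z1 ⊆ ball Complex.I r \ {Complex.I} := by
    rintro _ ⟨x, hx, rfl⟩
    exact hmem _ _ (abs_le.2 hx) (by rw [abs_neg, abs_of_pos hh0]) (Or.inr (by simpa using hh0.ne'))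
  obtain ⟨n, hn⟩ := lift_unique hZ1 (hθ.mono hZ1s) (θ' := fun z => (1 + z.re / h) / 2)
    (by fun_prop) (by
      intro z hz
      rw [he z (hZ1s hz)]
      obtain ⟨x, hx, rfl⟩ := hz
      have him : |(p x (-h)).im| = 1 - h := by simp only [p]; rw [abs_of_pos] <;> linarith
      rw [F0_eq (by rw [him]; linarith), him]
      have h1 : |x / h| ≤ 1 := by
        rw [abs_div, abs_of_pos hh0, div_le_one hh0]; exact abs_le.2 hx
      rw [abs_le] at h1
      simp only [p, sub_sub_cancel]
      rw [min_eq_right h1.2, max_eq_right h1.1])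
  let Zl : Set ℂ := (fun y : ℝ => p (-h) y) '' Icc (-h) h
  let Zr : Set ℂ := (fun y : ℝ => p h y) '' Icc (-h) h
  let Zt : Set ℂ := (fun x : ℝ => p x h) '' Icc (-h) h
  have hc1 : IsPreconnected Zl := isPreconnected_Icc.image _
    (hp.comp (by fun_prop : Continuous fun y : ℝ => (-h, y))).continuousOn
  have hc2 : IsPreconnected Zr := isPreconnected_Icc.image _
    (hp.comp (by fun_prop : Continuous fun y : ℝ => (h, y))).continuousOn
  have hc3 : IsPreconnected Zt := isPreconnected_Icc.image _
    (hp.comp (by fun_prop : Continuous fun x : ℝ => (x, h))).continuousOn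
  have hle : -h ≤ h := by linarith
  have hZ : IsPreconnected ((Zl ∪ Zt) ∪ Zr) := by
    refine IsPreconnected.union (p h h) (Or.inr ⟨h, ⟨hle, le_rfl⟩, rfl⟩) ⟨h, ⟨hle, le_rfl⟩, rfl⟩ ?_ hc2
    exact IsPreconnected.union (p (-h) h) ⟨h, ⟨hle, le_rfl⟩, rfl⟩ ⟨-h, ⟨le_rfl, hle⟩, rfl⟩ hc1 hc3
  have hZs : (Zl ∪ Zt) ∪ Zr ⊆ ball Complex.I r \ {Complex.I} := by
    rintro _ ((⟨y, hy, rfl⟩ | ⟨y, hy, rfl⟩) | ⟨y, hy, rfl⟩)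
    · exact hmem _ _ (by rw [abs_neg, abs_of_pos hh0]) (abs_le.2 hy) (Or.inl (by simpa using hh0.ne'))
    · exact hmem _ _ (abs_le.2 hy) (by rw [abs_of_pos hh0]) (Or.inr hh0.ne')
    · exact hmem _ _ (by rw [abs_of_pos hh0]) (abs_le.2 hy) (Or.inl hh0.ne')
  have hconst := lift_const hZ (hθ.mono hZs) (by
    intro z hz
    rw [he z (hZs hz)]
    apply F0_zero
    rcases hz with (⟨y, hy, rfl⟩ | ⟨y, hy, rfl⟩) | ⟨y, hy, rfl⟩
    · simp only [p]; rw [abs_neg, abs_of_pos hh0]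
      have := le_abs_self (1 + y); linarith [hy.1]
    · simp only [p]
      have := le_abs_self (1 + h); linarith [abs_nonneg y]
    · simp only [p]; rw [abs_of_pos hh0]
      have := le_abs_self (1 + y); linarith [hy.1])
    (x := p (-h) (-h)) (y := p h (-h)) (Or.inl (Or.inl ⟨-h, ⟨le_rfl, hle⟩, rfl⟩)) (Or.inr ⟨-h, ⟨le_rfl, hle⟩, rfl⟩)
  have e1 := hn _ (⟨-h, ⟨le_rfl, hle⟩, rfl⟩ : p (-h) (-h) ∈ Z1)
  have e2 := hn _ (⟨h, ⟨hle, le_rfl⟩, rfl⟩ : p h (-h) ∈ Z1)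
  simp only [p] at e1 e2 hconst
  rw [hconst, e2, div_self hh0.ne', neg_div, div_self hh0.ne'] at e1
  linarith

variable {S : Type*} [MetricSpace S]

open Classical in
noncomputable def spotF (ψ : ℂ → S) (x : S) : Circ1 := if x ∈ range ψ then F0 (Function.invFun ψ x) else 0

lemma spotF_apply {ψ : ℂ → S} (hψ : IsOpenEmbedding ψ) (z : ℂ) : spotF ψ (ψ z) = F0 z := by
  rw [spotF, if_pos (mem_range_self z), Function.leftInverse_invFun hψ.injective]

lemma spotF_off {ψ : ℂ → S} {x : S} (hx : x ∉ range ψ) : spotF ψ x = 0 := by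
  rw [spotF, if_neg hx]

lemma continuousOn_spotF {ψ : ℂ → S} (hψ : IsOpenEmbedding ψ) :
    ContinuousOn (spotF ψ) {ψ Complex.I, ψ (-Complex.I)}ᶜ := by
  intro x hx
  apply ContinuousAt.continuousWithinAt
  by_cases h : x ∈ range ψ
  · obtain ⟨z, rfl⟩ := h
    rw [← hψ.continuousAt_iff]
    have : spotF ψ ∘ ψ = F0 := funext fun z => spotF_apply hψ z
    rw [this]
    refine continuousOn_F0.continuousAt (IsOpen.mem_nhds (by
      exact (Set.toFinite _).isClosed.isOpen_compl) ?_)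
    intro hz
    apply hx
    rcases hz with rfl | rfl
    · exact Or.inl rfl
    · exact Or.inr rfl
  · have hcl : IsClosed (ψ '' closedBall 0 1) := ((isCompact_closedBall _ _).image hψ.continuous).isClosed
    refine ContinuousAt.congr (continuousAt_const (y := (0:Circ1))) ?_
    filter_upwards [hcl.isOpen_compl.mem_nhds (fun h' => h (image_subset_range _ _ h'))] with y hy
    by_cases hyr : y ∈ range ψ
    · obtain ⟨z, rfl⟩ := hyr
      rw [spotF_apply hψ, F0_zero_norm]
      by_contra hc
      exact hy ⟨z, by simpa using (not_le.1 hc).le, rfl⟩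
    · rw [spotF_off hyr]

lemma move (hS : LocallyEuclidean2 S) {ψ : ℂ → S} (hψ : IsOpenEmbedding ψ) {Y E : Set S} (hY : IsClosed Y) (hE : IsOpen E)
    (h1Y : ψ Complex.I ∉ Y) (h2Y : ψ (-Complex.I) ∉ Y)
    (h1 : (connectedComponentIn Yᶜ (ψ Complex.I) ∩ E).Nonempty)
    (h2 : (connectedComponentIn Yᶜ (ψ (-Complex.I)) ∩ E).Nonempty) :
    ∃ f : S → Circ1, ContinuousOn f Eᶜ ∧ ∀ x ∈ Y, f x = spotF ψ x := by
  have hlc := locConn hS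
  set C1 := connectedComponentIn Yᶜ (ψ Complex.I)
  set C2 := connectedComponentIn Yᶜ (ψ (-Complex.I))
  have hne : ψ Complex.I ≠ ψ (-Complex.I) := by
    intro h
    have := congrArg Complex.im (hψ.injective h)
    norm_num at this
  have hC1o : IsOpen C1 := hY.isOpen_compl.connectedComponentIn
  have hC2o : IsOpen C2 := hY.isOpen_compl.connectedComponentIn
  obtain ⟨x1, hx1, hx1E⟩ := h1
  obtain ⟨x2, ⟨hx2, hx2E⟩, hx21⟩ : ∃ x2 ∈ C2 ∩ E, x2 ≠ x1 := by
    obtain ⟨y, hy⟩ := h2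
    obtain ⟨Ω, hΩ, h0, hr⟩ := exists_chart hS y ((hC2o.inter hE).mem_nhds hy)
    by_cases hc : Ω 0 = x1
    · refine ⟨Ω 1, hr (mem_range_self _), fun h => ?_⟩
      have := hΩ.injective (h.trans hc.symm)
      norm_num at this
    · exact ⟨Ω 0, hr (mem_range_self _), hc⟩
  obtain ⟨g1, hg1, hg1'⟩ := homogeneous hS hC1o isPreconnected_connectedComponentIn hx1
    (mem_connectedComponentIn (F := Yᶜ) h1Y)
  have hg1x2 : g1 x2 ∈ C2 := by
    by_cases hx2C : x2 ∈ C1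
    · have h12 : C1 = C2 := by
        rw [show C1 = _ from connectedComponentIn_eq hx2C, ← show C2 = _ from connectedComponentIn_eq hx2]
      rw [← h12]
      by_contra hcon
      have := g1.injective (hg1' _ hcon)
      rw [this] at hcon
      exact hcon hx2C
    · rwa [hg1' _ hx2C]
  have hg1ne : g1 x2 ≠ ψ Complex.I := by
    rw [← hg1]; exact fun h => hx21 (g1.injective h)
  obtain ⟨g2, hg2, hg2'⟩ := homogeneous hS (hC2o.sdiff (isClosed_singleton (x := ψ Complex.I)))
    (preconnected_diff_point hS hC2o isPreconnected_connectedComponentIn _) (x := g1 x2) (y := ψ (-Complex.I))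
    ⟨hg1x2, hg1ne⟩ ⟨mem_connectedComponentIn (F := Yᶜ) h2Y, hne.symm⟩
  refine ⟨fun x => spotF ψ (g2 (g1 x)), ?_, ?_⟩
  · refine (continuousOn_spotF hψ).comp (by fun_prop) ?_
    rintro x hx (h | h)
    · have h3 : g2 (ψ Complex.I) = ψ Complex.I := hg2' _ (fun h => h.2 rfl)
      rw [← h3, ← hg1] at h
      have := g1.injective (g2.injective h)
      exact hx (this ▸ hx1E)
    · rw [mem_singleton_iff, ← hg2] at h
      have := g1.injective (g2.injective h)
      exact hx (this ▸ hx2E)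
  · intro x hx
    have e1 : g1 x = x := hg1' _ fun h => connectedComponentIn_subset _ _ h hx
    have e2 : g2 x = x := hg2' _ fun h => connectedComponentIn_subset _ _ h.1 hx
    simp only [e1, e2]

end Spot

open Set Metric Filter Topology
set_option linter.unusedSectionVars false

section FlatSec

noncomputable def mu (l : ℝ) (z : ℂ) : ℂ := (l : ℂ) * OpenPartialHomeomorph.univUnitBall z

lemma mu_emb {l : ℝ} (hl : 0 < l) : IsOpenEmbedding (mu l) := by
  have h1 : IsOpenEmbedding (OpenPartialHomeomorph.univUnitBall : ℂ → ℂ) :=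
    OpenPartialHomeomorph.to_isOpenEmbedding _ rfl
  exact (isOpenEmbedding_scale (Ω := id) IsOpenEmbedding.id hl).comp h1

lemma mu_zero (l : ℝ) : mu l 0 = 0 := by simp [mu]

lemma mu_norm {l : ℝ} (hl : 0 < l) (z : ℂ) : ‖mu l z‖ < l := by
  have h : (OpenPartialHomeomorph.univUnitBall z : ℂ) ∈ ball (0:ℂ) 1 :=
    (OpenPartialHomeomorph.univUnitBall (E := ℂ)).map_source (mem_univ z)
  rw [mem_ball_zero_iff] at h
  rw [mu, norm_mul, Complex.norm_real, Real.norm_of_nonneg hl.le]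
  nlinarith

lemma mu_eq (l : ℝ) (z : ℂ) : mu l z = ((l * (√(1 + ‖z‖ ^ 2))⁻¹ : ℝ) : ℂ) * z := by
  rw [mu, OpenPartialHomeomorph.univUnitBall_apply]
  push_cast
  rw [Complex.real_smul]; push_cast; ring

lemma mu_im {l : ℝ} (hl : 0 < l) (z : ℂ) : (mu l z).im = 0 ↔ z.im = 0 := by
  rw [mu_eq, Complex.im_ofReal_mul, mul_eq_zero]
  have : 0 < l * (√(1 + ‖z‖ ^ 2))⁻¹ := by positivity
  exact ⟨fun h => h.resolve_left this.ne', Or.inr⟩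

variable {S : Type*} [MetricSpace S]

/-- `H` is flat at `x`. -/
def Flat (H : Set S) (x : S) : Prop :=
  ∃ ψ : ℂ → S, IsOpenEmbedding ψ ∧ ψ 0 = x ∧ ∀ z, ψ z ∈ H ↔ z.im = 0

lemma Flat.shrink {H : Set S} {x : S} (h : Flat H x) {N : Set S} (hN : N ∈ 𝓝 x) :
    ∃ ψ : ℂ → S, IsOpenEmbedding ψ ∧ ψ 0 = x ∧ (∀ z, ψ z ∈ H ↔ z.im = 0) ∧ range ψ ⊆ N := by
  obtain ⟨ψ, hψ, h0, hH⟩ := h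
  have h1 : ψ ⁻¹' N ∈ 𝓝 (0:ℂ) := hψ.continuous.continuousAt (by rwa [h0])
  obtain ⟨l, hl, hb⟩ := Metric.mem_nhds_iff.1 h1
  refine ⟨ψ ∘ mu l, hψ.comp (mu_emb hl), by simp [mu_zero, h0], fun z => ?_, ?_⟩
  · rw [Function.comp, hH, mu_im hl]
  · rintro _ ⟨z, rfl⟩
    exact hb (by simpa using mu_norm hl z)

lemma Flat.congr {H H' : Set S} {x : S} (h : Flat H x) (hN : ∀ᶠ y in 𝓝 x, (y ∈ H ↔ y ∈ H')) : Flat H' x := by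
  obtain ⟨ψ, hψ, h0, hH, hr⟩ := h.shrink hN
  exact ⟨ψ, hψ, h0, fun z => by rw [← hH]; exact (hr (mem_range_self z)).symm⟩

lemma Flat.mem {H : Set S} {x : S} (h : Flat H x) : x ∈ H := by
  obtain ⟨ψ, hψ, h0, hH⟩ := h
  rw [← h0, hH]; rfl

/-- the open arc -/
def arc (c : ℝ → S) : Set S := c '' Ioo 0 1

structure TArc (c : ℝ → S) : Prop where
  cont : ContinuousOn c (Icc 0 1)
  inj : InjOn c (Ioo 0 1)
  left : c 0 ∉ arc c
  right : c 1 ∉ arc c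
  flat : ∃ Φ : Set ℝ, Φ.Finite ∧ ∀ t ∈ Ioo (0:ℝ) 1 \ Φ, Flat (arc c) (c t)

lemma image_Icc01 (c : ℝ → S) : c '' Icc 0 1 = insert (c 0) (insert (c 1) (arc c)) := by
  rw [arc, ← image_insert_eq, ← image_insert_eq]
  congr 1
  ext t; simp only [mem_Icc, mem_insert_iff, mem_Ioo]
  constructor
  · rintro ⟨h0, h1⟩
    rcases h0.eq_or_lt with h | h
    · left; exact h.symm
    · rcases h1.eq_or_lt with h' | h'
      · right; left; exact h'
      · right; right; exact ⟨h, h'⟩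
  · rintro (rfl | rfl | h)
    · norm_num
    · norm_num
    · exact ⟨h.1.le, h.2.le⟩

lemma arc_subset (c : ℝ → S) : arc c ⊆ c '' Icc 0 1 := image_mono Ioo_subset_Icc_self

lemma TArc.isCompact {c : ℝ → S} (h : TArc c) : IsCompact (c '' Icc 0 1) :=
  isCompact_Icc.image_of_continuousOn h.cont

/-- a parameter point is at positive distance from the rest -/
lemma TArc.inj' {c : ℝ → S} (h : TArc c) {s t : ℝ} (hs : s ∈ Ioo (0:ℝ) 1) (ht : t ∈ Icc (0:ℝ) 1) (he : c s = c t) : s = t := by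
  rcases ht.1.eq_or_lt with h0 | h0
  · exact absurd ⟨s, hs, he.trans (by rw [h0])⟩ h.left
  · rcases ht.2.eq_or_lt with h1 | h1
    · exact absurd ⟨s, hs, he.trans (by rw [h1])⟩ h.right
    · exact h.inj hs ⟨h0, h1⟩ he

lemma TArc.away {c : ℝ → S} (h : TArc c) {t : ℝ} (ht : t ∈ Ioo (0:ℝ) 1) {O : Set ℝ} (hO : O ∈ 𝓝 t) :
    ∀ᶠ y in 𝓝 (c t), ∀ s ∈ Icc (0:ℝ) 1, c s = y → s ∈ O := by
  obtain ⟨O', hO', hOo, htO⟩ := _root_.mem_nhds_iff.1 hO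
  have hcp : IsCompact (c '' (Icc 0 1 \ O')) := (isCompact_Icc.diff hOo).image_of_continuousOn (h.cont.mono sdiff_subset)
  have hn : c t ∉ c '' (Icc 0 1 \ O') := by
    rintro ⟨s, hs, he⟩
    exact hs.2 ((h.inj' ht hs.1 he.symm) ▸ htO)
  filter_upwards [hcp.isClosed.isOpen_compl.mem_nhds hn] with y hy s hs he
  by_contra hc
  exact hy ⟨s, ⟨hs, fun h => hc (hO' h)⟩, he⟩

/-- subarc from parameter `a` to parameter `b` (maybe reversed) -/
noncomputable def subarc (c : ℝ → S) (a b : ℝ) (t : ℝ) : S := c (a + (b - a) * t)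

lemma subarc_zero (c : ℝ → S) (a b : ℝ) : subarc c a b 0 = c a := by simp [subarc]
lemma subarc_one (c : ℝ → S) (a b : ℝ) : subarc c a b 1 = c b := by simp [subarc]

lemma seg_mem_Ioo {a b t : ℝ} (hab : a ≠ b) (ht : t ∈ Ioo (0:ℝ) 1) : a + (b - a) * t ∈ Ioo (min a b) (max a b) := by
  rcases lt_or_gt_of_ne hab with h | h
  · rw [min_eq_left h.le, max_eq_right h.le]
    constructor <;> nlinarith [ht.1, ht.2]
  · rw [min_eq_right h.le, max_eq_left h.le]
    constructor <;> nlinarith [ht.1, ht.2]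

lemma seg_inv {a b s : ℝ} (hab : a ≠ b) (hs : s ∈ Ioo (min a b) (max a b)) :
    ∃ t ∈ Ioo (0:ℝ) 1, a + (b - a) * t = s := by
  have hd : b - a ≠ 0 := sub_ne_zero.2 hab.symm
  refine ⟨(s - a) / (b - a), ?_, by field_simp; ring⟩
  rcases lt_or_gt_of_ne hab with h | h
  · rw [min_eq_left h.le, max_eq_right h.le] at hs
    have : 0 < b - a := by linarith
    exact ⟨div_pos (by linarith [hs.1]) this, by rw [div_lt_one this]; linarith [hs.2]⟩
  · rw [min_eq_right h.le, max_eq_left h.le] at hs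
    have : b - a < 0 := by linarith
    exact ⟨div_pos_of_neg_of_neg (by linarith [hs.2]) this, by rw [div_lt_one_of_neg this]; linarith [hs.1]⟩

lemma arc_subarc (c : ℝ → S) {a b : ℝ} (hab : a ≠ b) : arc (subarc c a b) = c '' Ioo (min a b) (max a b) := by
  ext x; constructor
  · rintro ⟨t, ht, rfl⟩
    exact ⟨_, seg_mem_Ioo hab ht, rfl⟩
  · rintro ⟨s, hs, rfl⟩
    obtain ⟨t, ht, rfl⟩ := seg_inv hab hs
    exact ⟨t, ht, rfl⟩

lemma arc_subarc_sub {c : ℝ → S} {a b : ℝ} (hab : a ≠ b) (ha : a ∈ Icc (0:ℝ) 1) (hb : b ∈ Icc (0:ℝ) 1) :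
    arc (subarc c a b) ⊆ arc c := by
  rw [arc_subarc c hab]
  apply image_mono
  apply Ioo_subset_Ioo
  · exact le_min ha.1 hb.1
  · exact max_le ha.2 hb.2

lemma TArc.sub {c : ℝ → S} (h : TArc c) {a b : ℝ} (hab : a ≠ b) (ha : a ∈ Icc (0:ℝ) 1) (hb : b ∈ Icc (0:ℝ) 1) :
    TArc (subarc c a b) := by
  have hI : Ioo (min a b) (max a b) ⊆ Ioo 0 1 := Ioo_subset_Ioo (le_min ha.1 hb.1) (max_le ha.2 hb.2)
  have hd : b - a ≠ 0 := sub_ne_zero.2 hab.symm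
  refine ⟨?_, ?_, ?_, ?_, ?_⟩
  · refine h.cont.comp (by fun_prop) fun t ht => ?_
    have := (convex_Icc (0:ℝ) 1) ha hb (a := 1 - t) (b := t) (by linarith [ht.2]) ht.1 (by ring)
    simp only [smul_eq_mul] at this
    convert this using 1; ring
  · intro s hs t ht he
    have := h.inj (hI (seg_mem_Ioo hab hs)) (hI (seg_mem_Ioo hab ht)) he
    have h2 : (b - a) * s = (b - a) * t := by linarith
    exact mul_left_cancel₀ hd h2
  · rw [arc_subarc c hab, subarc_zero]
    rintro ⟨s, hs, he⟩
    have := h.inj' (hI hs) ha he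
    rw [this] at hs
    rcases lt_or_gt_of_ne hab with h | h
    · rw [min_eq_left h.le] at hs; exact lt_irrefl _ hs.1
    · rw [max_eq_left h.le] at hs; exact lt_irrefl _ hs.2
  · rw [arc_subarc c hab, subarc_one]
    rintro ⟨s, hs, he⟩
    have := h.inj' (hI hs) hb he
    rw [this] at hs
    rcases lt_or_gt_of_ne hab with h | h
    · rw [max_eq_right h.le] at hs; exact lt_irrefl _ hs.2
    · rw [min_eq_right h.le] at hs; exact lt_irrefl _ hs.1
  · obtain ⟨Φ, hΦ, hf⟩ := h.flat
    refine ⟨(fun t => a + (b - a) * t) ⁻¹' Φ, hΦ.preimage ?_, ?_⟩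
    · intro s _ t _ he
      have h2 : (b - a) * s = (b - a) * t := by simp only at he; linarith
      exact mul_left_cancel₀ hd h2
    · rintro t ⟨ht, htΦ⟩
      have hm := seg_mem_Ioo hab ht
      refine (hf _ ⟨hI hm, htΦ⟩).congr ?_
      filter_upwards [h.away (hI hm) (isOpen_Ioo.mem_nhds hm)] with y hy
      rw [arc_subarc c hab]
      constructor
      · rintro ⟨s, hs, rfl⟩
        exact ⟨s, hy s (Ioo_subset_Icc_self hs) rfl, rfl⟩
      · rintro ⟨s, hs, rfl⟩
        exact ⟨s, hI hs, rfl⟩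

/-- concatenation -/
noncomputable def cat (c γ : ℝ → S) (t : ℝ) : S := if t ≤ 1/2 then c (2 * t) else γ (2 * t - 1)

lemma cat_zero (c γ : ℝ → S) : cat c γ 0 = c 0 := by simp [cat]
lemma cat_one (c γ : ℝ → S) : cat c γ 1 = γ 1 := by
  rw [cat, if_neg (by norm_num)]; norm_num

lemma arc_cat (c γ : ℝ → S) : arc (cat c γ) = arc c ∪ arc γ ∪ {c 1} := by
  ext x; constructor
  · rintro ⟨t, ht, rfl⟩
    rcases lt_trichotomy t (1/2) with h | h | h
    · left; left; rw [cat, if_pos h.le]; exact ⟨2 * t, ⟨by linarith [ht.1], by linarith⟩, rfl⟩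
    · right; rw [cat, if_pos h.le, h]; norm_num
    · left; right; rw [cat, if_neg (not_le.2 h)]; exact ⟨2 * t - 1, ⟨by linarith [ht.1], by linarith [ht.2]⟩, rfl⟩
  · rintro ((⟨t, ht, rfl⟩ | ⟨t, ht, rfl⟩) | h)
    · refine ⟨t / 2, ⟨by linarith [ht.1], by linarith [ht.2]⟩, ?_⟩
      rw [cat, if_pos (by linarith [ht.2])]; congr 1; ring
    · refine ⟨(t + 1) / 2, ⟨by linarith [ht.1], by linarith [ht.2]⟩, ?_⟩
      rw [cat, if_neg (by linarith [ht.1])]; congr 1; ring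
    · refine ⟨1/2, by norm_num, ?_⟩
      rw [mem_singleton_iff.1 h, cat, if_pos le_rfl]; norm_num

lemma TArc.cat {c γ : ℝ → S} (hc : TArc c) (hγ : TArc γ) (hj : c 1 = γ 0) (hd : Disjoint (arc c) (arc γ))
    (h0 : c 0 ∉ arc γ) (h01 : c 0 ≠ c 1) (h1 : γ 1 ∉ arc c) (h11 : γ 1 ≠ γ 0) : TArc (cat c γ) := by
  refine ⟨?_, ?_, ?_, ?_, ?_⟩
  · have : Icc (0:ℝ) 1 = Icc 0 (1/2) ∪ Icc (1/2) 1 := (Icc_union_Icc_eq_Icc (by norm_num) (by norm_num)).symm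
    rw [this]
    refine ContinuousOn.union_of_isClosed ?_ ?_ isClosed_Icc isClosed_Icc
    · refine ContinuousOn.congr (f := fun t => c (2 * t)) (hc.cont.comp (by fun_prop) fun t ht => ⟨by linarith [ht.1], by linarith [ht.2]⟩) ?_
      intro t ht
      simp only [_root_.cat]; rw [if_pos ht.2]
    · refine ContinuousOn.congr (f := fun t => γ (2 * t - 1)) (hγ.cont.comp (by fun_prop) fun t ht => ⟨by linarith [ht.1], by linarith [ht.2]⟩) ?_
      intro t ht
      simp only [_root_.cat]
      split_ifs with h
      · have : t = 1/2 := le_antisymm h ht.1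
        rw [this]; norm_num; exact hj
      · rfl
  · intro s hs t ht he
    simp only [_root_.cat] at he
    have key : ∀ s ∈ Ioo (0:ℝ) 1, ∀ t ∈ Ioo (0:ℝ) 1, s ≤ 1/2 → ¬ t ≤ 1/2 → c (2 * s) ≠ γ (2 * t - 1) := by
      intro s hs t ht h1 h2 he
      rw [not_le] at h2
      have hγm : γ (2 * t - 1) ∈ arc γ := ⟨2 * t - 1, ⟨by linarith, by linarith [ht.2]⟩, rfl⟩
      rcases h1.eq_or_lt with h | h
      · rw [h] at he; norm_num at he; rw [hj] at he
        exact hγ.left (he ▸ hγm)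
      · exact hd.le_bot ⟨⟨2 * s, ⟨by linarith [hs.1], by linarith⟩, rfl⟩, he ▸ hγm⟩
    split_ifs at he with h1 h2 h2
    · rcases h1.eq_or_lt with h | h
      · have := hc.inj' (s := 2 * t) (t := 2 * s)
        rcases h2.eq_or_lt with h' | h'
        · rw [h, h']
        · have := hc.inj' (s := 2 * t) (t := 2 * s) ⟨by linarith [ht.1], by linarith⟩ ⟨by linarith [hs.1], by linarith⟩ he.symm
          linarith
      · have := hc.inj' (s := 2 * s) (t := 2 * t) ⟨by linarith [hs.1], by linarith⟩ ⟨by linarith [ht.1], by linarith⟩ he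
        linarith
    · exact absurd he (key s hs t ht h1 h2)
    · exact absurd he.symm (key t ht s hs h2 h1)
    · rw [not_le] at h1 h2
      have := hγ.inj (x₁ := 2 * s - 1) (x₂ := 2 * t - 1) ⟨by linarith, by linarith [hs.2]⟩ ⟨by linarith, by linarith [ht.2]⟩ he
      linarith
  · rw [arc_cat, cat_zero]
    rintro ((h | h) | h)
    · exact hc.left h
    · exact h0 h
    · exact h01 h
  · rw [arc_cat, cat_one]
    rintro ((h | h) | h)
    · exact h1 h
    · exact hγ.right h
    · exact h11 (h.trans hj)
  · obtain ⟨Φ, hΦ, hf⟩ := hc.flat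
    obtain ⟨Φ', hΦ', hf'⟩ := hγ.flat
    refine ⟨insert (1/2) ((fun t => 2 * t) ⁻¹' Φ ∪ (fun t => 2 * t - 1) ⁻¹' Φ'), ?_, ?_⟩
    · refine ((hΦ.preimage ?_).union (hΦ'.preimage ?_)).insert _
      · intro s _ t _ he; simp only at he; linarith
      · intro s _ t _ he; simp only at he; linarith
    · rintro t ⟨ht, htΦ⟩
      simp only [mem_insert_iff, mem_union, mem_preimage, not_or] at htΦ
      rw [arc_cat]
      simp only [_root_.cat]
      split_ifs with h
      · have hlt : t < 1/2 := lt_of_le_of_ne h htΦ.1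
        have hm : 2 * t ∈ Ioo (0:ℝ) 1 := ⟨by linarith [ht.1], by linarith⟩
        refine (hf _ ⟨hm, htΦ.2.1⟩).congr ?_
        have hn : c (2 * t) ∉ γ '' Icc 0 1 := by
          rw [image_Icc01]
          rintro (h | h | h)
          · exact hc.right (hj ▸ h ▸ ⟨_, hm, rfl⟩)
          · exact h1 (h ▸ ⟨_, hm, rfl⟩)
          · exact hd.le_bot ⟨⟨_, hm, rfl⟩, h⟩
        filter_upwards [hγ.isCompact.isClosed.isOpen_compl.mem_nhds hn] with y hy
        constructor
        · exact fun h => Or.inl (Or.inl h)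
        · rintro ((h | h) | h)
          · exact h
          · exact absurd (arc_subset _ h) hy
          · exact absurd ⟨0, by norm_num, by rw [← hj]; exact h.symm⟩ hy
      · rw [not_le] at h
        have hm : 2 * t - 1 ∈ Ioo (0:ℝ) 1 := ⟨by linarith [ht.1], by linarith [ht.2]⟩
        refine (hf' _ ⟨hm, htΦ.2.2⟩).congr ?_
        have hn : γ (2 * t - 1) ∉ c '' Icc 0 1 := by
          rw [image_Icc01]
          rintro (h | h | h)
          · exact h0 (h ▸ ⟨_, hm, rfl⟩)
          · exact hγ.left (hj ▸ h ▸ ⟨_, hm, rfl⟩)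
          · exact hd.le_bot ⟨h, ⟨_, hm, rfl⟩⟩
        filter_upwards [hc.isCompact.isClosed.isOpen_compl.mem_nhds hn] with y hy
        constructor
        · exact fun h => Or.inl (Or.inr h)
        · rintro ((h | h) | h)
          · exact absurd (arc_subset _ h) hy
          · exact h
          · exact absurd ⟨1, by norm_num, h.symm⟩ hy

end FlatSec

open Set Metric Filter Topology
set_option linter.unusedSectionVars false

section SpotArc
variable {S : Type*} [MetricSpace S]

lemma spot_arc {c : ℝ → S} (h : TArc c) {ψ : ℂ → S} (hψ : IsOpenEmbedding ψ)
    (hK : ∀ z, ψ z ∈ arc c ↔ z.im = 0) (h0 : c 0 ∉ range ψ) (h1 : c 1 ∉ range ψ) :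
    ∃ t1 t2 : ℝ, 0 < t1 ∧ t1 < t2 ∧ t2 < 1 ∧ c '' Icc t1 t2 ⊆ ψ '' closedBall 0 1 ∧
      (∀ t ∈ Icc (0:ℝ) 1, t ∉ Ioo t1 t2 → spotF ψ (c t) = 0) ∧
      ∃ σ : ℝ, (σ = 1 ∨ σ = -1) ∧ ∀ m : ℤ, ∀ l : ℝ → ℝ, ContinuousOn l (Icc t1 t2) →
        (∀ t ∈ Icc t1 t2, ((l t : ℝ) : Circ1) = m • spotF ψ (c t)) → l t2 - l t1 = σ * m := by
  have hex : ∀ x : ℝ, ∃ t ∈ Ioo (0:ℝ) 1, c t = ψ x := fun x => (hK x).2 (by simp)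
  choose τ hτI hτ using hex
  have hτc : Continuous τ := by
    rw [continuous_iff_continuousAt]
    intro x O hO
    have h2 : Tendsto (fun x : ℝ => ψ x) (𝓝 x) (𝓝 (c (τ x))) := by
      rw [hτ x]
      exact (hψ.continuous.comp Complex.continuous_ofReal).continuousAt
    have h3 := h2.eventually (h.away (hτI x) hO)
    rw [mem_map]
    filter_upwards [h3] with x' hx'
    exact hx' _ (Ioo_subset_Icc_self (hτI x')) (hτ x')
  have hτi : Function.Injective τ := by
    intro x y hxy
    have := (hτ x).symm.trans ((congrArg c hxy).trans (hτ y))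
    exact Complex.ofReal_injective (hψ.injective this)
  obtain ⟨e, he, hm⟩ : ∃ e : ℝ, (e = 1 ∨ e = -1) ∧ StrictMono (fun x => τ (e * x)) := by
    rcases hτc.strictMono_of_inj hτi with hm | hm
    · exact ⟨1, Or.inl rfl, by simpa using hm⟩
    · refine ⟨-1, Or.inr rfl, fun x y hxy => hm (by linarith)⟩
  have hee : e * e = 1 := by rcases he with rfl | rfl <;> norm_num
  have hea : |e| = 1 := by rcases he with rfl | rfl <;> norm_num
  set υ : ℝ → ℝ := fun x => τ (e * x) with hυ
  have hυc : Continuous υ := by fun_prop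
  have hsurj : ∀ t ∈ Icc (υ (-1)) (υ 1), ∃ x ∈ Icc (-1:ℝ) 1, υ x = t :=
    intermediate_value_Icc (by norm_num) hυc.continuousOn
  refine ⟨υ (-1), υ 1, (hτI _).1, hm (by norm_num), (hτI _).2, ?_, ?_, e, he, ?_⟩
  · rintro _ ⟨t, ht, rfl⟩
    obtain ⟨x, hx, rfl⟩ := hsurj t ht
    refine ⟨((e * x : ℝ) : ℂ), ?_, (hτ _).symm⟩
    rw [mem_closedBall_zero_iff, Complex.norm_real, Real.norm_eq_abs, abs_mul, hea, one_mul]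
    exact abs_le.2 hx
  · intro t ht htn
    by_cases hr : c t ∈ range ψ
    · have htI : t ∈ Ioo (0:ℝ) 1 := by
        refine ⟨lt_of_le_of_ne ht.1 ?_, lt_of_le_of_ne ht.2 ?_⟩
        · rintro rfl; exact h0 hr
        · rintro rfl; exact h1 hr
      obtain ⟨z, hz⟩ := hr
      have him := (hK z).1 (hz ▸ ⟨t, htI, rfl⟩)
      have hzr : ((e * (e * z.re) : ℝ) : ℂ) = z := by
        rw [← mul_assoc, hee, one_mul]; apply Complex.ext <;> simp [him]
      have htu : υ (e * z.re) = t := by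
        apply h.inj (hτI _) htI
        rw [hτ, hzr, hz]
      rw [← hz, spotF_apply hψ, F0_zero]
      by_contra hc
      rw [him, abs_zero, add_zero, not_le] at hc
      have h3 : |e * z.re| < 1 := by rwa [abs_mul, hea, one_mul]
      rw [abs_lt] at h3
      exact htn (htu ▸ ⟨hm h3.1, hm h3.2⟩)
    · exact spotF_off hr
  · intro m l hl hle
    obtain ⟨n, hn⟩ := lift_unique (Z := Icc (-1:ℝ) 1) isPreconnected_Icc (θ := fun x => l (υ x))
      (θ' := fun x => m * ((1 + e * x) / 2)) (hl.comp hυc.continuousOn fun x hx => ⟨hm.monotone hx.1, hm.monotone hx.2⟩)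
      (by fun_prop) (by
        intro x hx
        rw [hle _ ⟨hm.monotone hx.1, hm.monotone hx.2⟩, hτ, spotF_apply hψ, F0_real]
        have h3 : |e * x| ≤ 1 := by rw [abs_mul, hea, one_mul]; exact abs_le.2 hx
        rw [abs_le] at h3
        rw [min_eq_right h3.2, max_eq_right h3.1, ← zsmul_eq_mul, AddCircle.coe_zsmul])
    have e1 := hn (-1) (by norm_num)
    have e2 := hn 1 (by norm_num)
    rw [e1, e2]; ring

lemma spotA {c : ℝ → S} (h : TArc c) {ψ : ℂ → S} (hψ : IsOpenEmbedding ψ)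
    (hK : ∀ z, ψ z ∈ arc c ↔ z.im = 0) (h0 : c 0 ∉ range ψ) (h1 : c 1 ∉ range ψ)
    {θ : S → ℝ} {m : ℤ} (hθ : ContinuousOn θ (c '' Icc 0 1))
    (he : ∀ x ∈ c '' Icc 0 1, ((θ x : ℝ) : Circ1) = m • spotF ψ x) (heq : θ (c 0) = θ (c 1)) : m = 0 := by
  obtain ⟨t1, t2, h01, h12, h21, -, hz, σ, hσ, hl⟩ := spot_arc h hψ hK h0 h1
  have hc : ContinuousOn (fun t => θ (c t)) (Icc 0 1) := hθ.comp h.cont fun t ht => mem_image_of_mem _ ht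
  have hs1 : Icc t1 t2 ⊆ Icc 0 1 := Icc_subset_Icc h01.le h21.le
  have h3 := hl m (fun t => θ (c t)) (hc.mono hs1) (fun t ht => he _ ⟨t, hs1 ht, rfl⟩)
  have h4 : θ (c 0) = θ (c t1) := by
    have hs : Icc 0 t1 ⊆ Icc 0 1 := Icc_subset_Icc le_rfl (by linarith)
    refine lift_const (Z := Icc 0 t1) isPreconnected_Icc (θ := fun t => θ (c t)) (hc.mono hs) ?_ ⟨le_rfl, h01.le⟩ ⟨h01.le, le_rfl⟩
    intro t ht
    rw [he _ ⟨t, hs ht, rfl⟩, hz t (hs ht) (fun h => not_lt.2 ht.2 h.1), smul_zero]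
  have h5 : θ (c t2) = θ (c 1) := by
    have hs : Icc t2 1 ⊆ Icc 0 1 := Icc_subset_Icc (by linarith) le_rfl
    refine lift_const (Z := Icc t2 1) isPreconnected_Icc (θ := fun t => θ (c t)) (hc.mono hs) ?_ ⟨le_rfl, h21.le⟩ ⟨h21.le, le_rfl⟩
    intro t ht
    rw [he _ ⟨t, hs ht, rfl⟩, hz t (hs ht) (fun h => not_lt.2 ht.1 h.2), smul_zero]
  have h6 : (m:ℝ) = 0 := by
    rcases hσ with rfl | rfl <;> linarith
  exact_mod_cast h6

structure Cut (U : Set S) (c : ℝ → S) : Prop where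
  tarc : TArc c
  sub : arc c ⊆ U
  left : c 0 ∉ U
  right : c 1 ∉ U

lemma Cut.closed {U : Set S} {c : ℝ → S} (h : Cut U c) (hU : IsOpen U) : IsClosed (Uᶜ ∪ arc c) := by
  have : Uᶜ ∪ arc c = Uᶜ ∪ c '' Icc 0 1 := by
    rw [image_Icc01]
    ext x; simp only [mem_union, mem_insert_iff, mem_compl_iff]
    constructor
    · tauto
    · rintro (h' | rfl | rfl | h')
      · exact Or.inl h'
      · exact Or.inl h.left
      · exact Or.inl h.right
      · exact Or.inr h'
  rw [this]
  exact hU.isClosed_compl.union h.tarc.isCompact.isClosed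

lemma Cut.compl_eq {U : Set S} {c : ℝ → S} : (Uᶜ ∪ arc c)ᶜ = U \ arc c := by
  ext x; simp

lemma Cut.open {U : Set S} {c : ℝ → S} (h : Cut U c) (hU : IsOpen U) : IsOpen (U \ arc c) := by
  rw [← Cut.compl_eq]; exact (h.closed hU).isOpen_compl

/-- the two sides of `K` never both reach `E` -/
def SepK (U K E : Set S) : Prop :=
  ∀ ψ : ℂ → S, IsOpenEmbedding ψ → range ψ ⊆ U → (∀ z, ψ z ∈ K ↔ z.im = 0) →
    ¬ ((connectedComponentIn (U \ K) (ψ Complex.I) ∩ E).Nonempty ∧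
       (connectedComponentIn (U \ K) (ψ (-Complex.I)) ∩ E).Nonempty)

def Nonexc (U E B : Set S) : Prop :=
  ∀ c : ℝ → S, Cut U c → c 0 ∈ B → c 1 ∈ B → Disjoint (arc c) E → SepK U (arc c) E

lemma cut_move (hS : LocallyEuclidean2 S) {U E : Set S} (hU : IsOpen U) (hE : IsOpen E) {c : ℝ → S} (hc : Cut U c)
    {ψ : ℂ → S} (hψ : IsOpenEmbedding ψ) (hψU : range ψ ⊆ U) (hK : ∀ z, ψ z ∈ arc c ↔ z.im = 0)
    (h1 : (connectedComponentIn (U \ arc c) (ψ Complex.I) ∩ E).Nonempty)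
    (h2 : (connectedComponentIn (U \ arc c) (ψ (-Complex.I)) ∩ E).Nonempty) :
    ∃ f : S → Circ1, ContinuousOn f Eᶜ ∧ (∀ x ∈ arc c, f x = spotF ψ x) ∧ ∀ x ∉ U, f x = 0 := by
  rw [← Cut.compl_eq] at h1 h2
  obtain ⟨f, hf, hfY⟩ := move hS hψ (hc.closed hU) hE (by
    rintro (h | h)
    · exact h (hψU (mem_range_self _))
    · have := (hK _).1 h; norm_num at this) (by
    rintro (h | h)
    · exact h (hψU (mem_range_self _))
    · have := (hK _).1 h; norm_num at this) h1 h2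
  refine ⟨f, hf, fun x hx => hfY x (Or.inr hx), fun x hx => ?_⟩
  rw [hfY x (Or.inl hx), spotF_off fun h => hx (hψU h)]

lemma sep_small (hS : LocallyEuclidean2 S) {U Δ Z : Set S} (hU : IsOpen U) (hΔ : IsClosed Δ) (hL : Liftable Δ)
    {c : ℝ → S} (hc : Cut U c) (hcΔ : arc c ⊆ Δ) (hZ : IsPreconnected Z) (hZU : Disjoint Z U) (hZΔ : Z ⊆ Δ)
    (h0 : c 0 ∈ Z) (h1 : c 1 ∈ Z) : SepK U (arc c) Δᶜ := by
  rintro ψ hψ hψU hK ⟨h2, h3⟩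
  obtain ⟨f, hf, hfc, hf0⟩ := cut_move hS hU hΔ.isOpen_compl hc hψ hψU hK h2 h3
  rw [compl_compl] at hf
  obtain ⟨θ, hθ, hθf⟩ := hL f hf
  have hsub : c '' Icc 0 1 ⊆ Δ := by
    rw [image_Icc01]
    rintro x (rfl | rfl | hx)
    · exact hZΔ h0
    · exact hZΔ h1
    · exact hcΔ hx
  have hoff : ∀ x ∉ U, spotF ψ x = 0 := fun x hx => spotF_off fun h => hx (hψU h)
  have := spotA hc.tarc hψ hK (fun h => hc.left (hψU h)) (fun h => hc.right (hψU h)) (θ := θ) (m := 1) (hθ.mono hsub) (by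
    intro x hx
    rw [hθf x (hsub hx), one_smul]
    rw [image_Icc01] at hx
    rcases hx with rfl | rfl | hx
    · rw [hf0 _ hc.left, hoff _ hc.left]
    · rw [hf0 _ hc.right, hoff _ hc.right]
    · exact hfc x hx)
    (lift_const hZ (hθ.mono hZΔ) (fun x hx => by
      rw [hθf x (hZΔ hx), hf0 x fun h => hZU.le_bot ⟨hx, h⟩]) h0 h1)
  norm_num at this

lemma exc_finite (hS : LocallyEuclidean2 S) {X E B : Set S} (hX : IsClosed X) (hE : IsOpen E) {N : ℕ} (hN : RankLe N Eᶜ)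
    (hBX : B ⊆ X) (hB : IsPreconnected B) (hBE : Disjoint B E) :
    {U | IsComplementaryDomain X U ∧ ¬ Nonexc U E B}.Finite := by
  classical
  by_contra hinf
  rw [← Set.Infinite] at hinf
  obtain ⟨V, hV⟩ : ∃ V : Fin (N+1) ↪ Set S, ∀ i, V i ∈ {U | IsComplementaryDomain X U ∧ ¬ Nonexc U E B} := by
    have := hinf.to_subtype
    let e := (Infinite.natEmbedding {U | IsComplementaryDomain X U ∧ ¬ Nonexc U E B})
    exact ⟨⟨fun i => (e i.1).1, fun i j hij => Fin.ext (e.injective (Subtype.ext hij))⟩, fun i => (e i.1).2⟩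
  have hVo : ∀ i, IsOpen (V i) := fun i => dom_open hS hX (hV i).1
  have hb : ∀ i, ∃ c ψ, ∃ f : S → Circ1, Cut (V i) c ∧ c 0 ∈ B ∧ c 1 ∈ B ∧ Disjoint (arc c) E ∧ IsOpenEmbedding ψ ∧ range ψ ⊆ V i ∧
      (∀ z, ψ z ∈ arc c ↔ z.im = 0) ∧ ContinuousOn f Eᶜ ∧ (∀ x ∈ arc c, f x = spotF ψ x) ∧ ∀ x ∉ V i, f x = 0 := by
    intro i
    have h2 := (hV i).2
    simp only [Nonexc, SepK, not_forall, not_not] at h2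
    obtain ⟨c, hc, h0, h1, hd, ψ, hψ, hψU, hK, h3, h4⟩ := h2
    obtain ⟨f, hf⟩ := cut_move hS (hVo i) hE hc hψ hψU hK h3 h4
    exact ⟨c, ψ, f, hc, h0, h1, hd, hψ, hψU, hK, hf⟩
  choose c ψ f hc h0 h1 hd hψ hψU hK hf hfc hf0 using hb
  obtain ⟨m, hm, θ, hθ, hθf⟩ := hN (N+1) (Nat.lt_succ_self N) f hf
  apply hm
  funext i
  have hBV : ∀ j, ∀ x ∈ B, x ∉ V j := fun j x hx h => dom_sub (hV j).1 h (hBX hx)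
  have hsub : c i '' Icc 0 1 ⊆ Eᶜ := by
    rw [image_Icc01]
    rintro x (rfl | rfl | hx)
    · exact fun h => hBE.le_bot ⟨h0 i, h⟩
    · exact fun h => hBE.le_bot ⟨h1 i, h⟩
    · exact fun h => (hd i).le_bot ⟨hx, h⟩
  have hdis : ∀ j, j ≠ i → ∀ x ∈ V i, x ∉ V j := by
    intro j hj x hx hxj
    apply hj
    apply V.injective
    exact dom_eq (hV j).1 (hV i).1 ⟨x, hxj, hx⟩
  have hfi : ∀ x ∈ c i '' Icc 0 1, f i x = spotF (ψ i) x := by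
    rw [image_Icc01]
    rintro x (rfl | rfl | hx)
    · rw [hf0 i _ (hc i).left, spotF_off fun h => (hc i).left (hψU i h)]
    · rw [hf0 i _ (hc i).right, spotF_off fun h => (hc i).right (hψU i h)]
    · exact hfc i x hx
  refine spotA (hc i).tarc (hψ i) (hK i) (fun h => (hc i).left (hψU i h)) (fun h => (hc i).right (hψU i h)) (θ := θ) (hθ.mono hsub) ?_ ?_
  · intro x hx
    rw [hθf x (hsub hx)]
    beta_reduce
    rw [Finset.sum_eq_single i, hfi x hx]
    · intro j _ hj
      have : x ∉ V j := by
        rw [image_Icc01] at hx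
        rcases hx with rfl | rfl | hx
        · exact hBV j _ (h0 i)
        · exact hBV j _ (h1 i)
        · exact hdis j hj x ((hc i).sub hx)
      rw [hf0 j x this, smul_zero]
    · simp
  · have hBE' : B ⊆ Eᶜ := fun x hx h => hBE.le_bot ⟨hx, h⟩
    refine lift_const hB (hθ.mono hBE') (fun x hx => ?_) (h0 i) (h1 i)
    rw [hθf x (hBE' hx)]
    exact Finset.sum_eq_zero fun j _ => by rw [hf0 j x (hBV j x hx), smul_zero]

end SpotArc

open Set Metric Filter Topology
set_option linter.unusedSectionVars false

section Jump

def NoJump {T α : Type*} [TopologicalSpace T] (f : T → α) (H : Set T) (x : T) : Prop :=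
  ∃ a, ∀ᶠ y in 𝓝 x, y ∉ H → f y = a

lemma NoJump.eventually {T α : Type*} [TopologicalSpace T] {f : T → α} {H : Set T} {x : T} (h : NoJump f H x) :
    ∀ᶠ y in 𝓝 x, NoJump f H y := by
  obtain ⟨a, ha⟩ := h
  filter_upwards [eventually_eventually_nhds.2 ha] with y hy using ⟨a, hy⟩

lemma nojump_unique {T α : Type*} [TopologicalSpace T] {f : T → α} {H : Set T} {x : T} (hx : x ∈ closure Hᶜ) {a b : α}
    (ha : ∀ᶠ y in 𝓝 x, y ∉ H → f y = a) (hb : ∀ᶠ y in 𝓝 x, y ∉ H → f y = b) : a = b := by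
  obtain ⟨y, hy, hyH⟩ := mem_closure_iff_nhds.1 hx _ (ha.and hb)
  rw [← hy.1 hyH, hy.2 hyH]

lemma nojump_const {T α : Type*} [TopologicalSpace T] {f : T → α} {H Γ : Set T} (hΓ : IsPreconnected Γ)
    (h : ∀ x ∈ Γ, NoJump f H x) (hcl : ∀ x ∈ Γ, x ∈ closure Hᶜ) {x y : T} (hx : x ∈ Γ) (hy : y ∈ Γ) (hxH : x ∉ H)
    (hyH : y ∉ H) : f x = f y := by
  classical
  letI : TopologicalSpace α := ⊥
  haveI : DiscreteTopology α := ⟨rfl⟩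
  let g : T → α := fun z => if hz : z ∈ Γ then (h z hz).choose else f x
  have hg : ∀ z ∈ Γ, ∀ᶠ y in 𝓝 z, y ∉ H → f y = g z := by
    intro z hz
    simp only [g, dif_pos hz]
    exact (h z hz).choose_spec
  have hgc : ContinuousOn g Γ := by
    intro z hz
    refine ContinuousWithinAt.congr_of_eventuallyEq (f := fun _ => g z) continuousWithinAt_const ?_ rfl
    filter_upwards [self_mem_nhdsWithin, mem_nhdsWithin_of_mem_nhds (eventually_eventually_nhds.2 (hg z hz))] with w hw hw2
    exact nojump_unique (hcl w hw) (hg w hw) hw2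
  rw [(hg x hx).self_of_nhds hxH, (hg y hy).self_of_nhds hyH]
  exact hΓ.constant hgc hx hy

variable {S : Type*} [MetricSpace S] {α : Type*}

/-- `f` is locally constant off `K` near `x` -/
def LocOff (f : S → α) (K : Set S) (x : S) : Prop := ∀ᶠ y in 𝓝 x, y ∉ K → ∀ᶠ w in 𝓝 y, f w = f y

lemma half_conn (s : ℝ) : IsPreconnected {z : ℂ | 0 < s * z.im} := by
  apply Convex.isPreconnected
  have : {z : ℂ | 0 < s * z.im} = (fun z : ℂ => s * z.im) ⁻¹' Ioi 0 := rfl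
  rw [this]
  refine (convex_Ioi (0:ℝ)).is_linear_preimage ⟨fun x y => by simp [mul_add], fun c x => by simp; ring⟩

lemma spot_sides {f : S → α} {K : Set S} {ψ : ℂ → S} (hψ : IsOpenEmbedding ψ) (hK : ∀ z, ψ z ∈ K ↔ z.im = 0)
    (hf : ∀ z, ψ z ∉ K → ∀ᶠ w in 𝓝 (ψ z), f w = f (ψ z)) :
    (∀ z : ℂ, 0 < z.im → f (ψ z) = f (ψ Complex.I)) ∧ (∀ z : ℂ, z.im < 0 → f (ψ z) = f (ψ (-Complex.I))) ∧
    ∀ x : ℝ, (NoJump f K (ψ x) ↔ f (ψ Complex.I) = f (ψ (-Complex.I))) := by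
  have key : ∀ s : ℝ, s ≠ 0 → ∀ z w : ℂ, 0 < s * z.im → 0 < s * w.im → f (ψ z) = f (ψ w) := by
    intro s hs z w hz hw
    letI : TopologicalSpace α := ⊥
    haveI : DiscreteTopology α := ⟨rfl⟩
    refine (half_conn s).constant (f := fun z => f (ψ z)) ?_ hz hw
    intro u hu
    apply ContinuousAt.continuousWithinAt
    have hne : ψ u ∉ K := by
      rw [hK]; intro h; simp [h] at hu
    have h2 : ∀ᶠ v in 𝓝 u, f (ψ v) = f (ψ u) := hψ.continuous.continuousAt.eventually (hf u hne)
    exact ContinuousAt.congr (f := fun _ => f (ψ u)) continuousAt_const (h2.mono fun v hv => hv.symm)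
  have h1 : ∀ z : ℂ, 0 < z.im → f (ψ z) = f (ψ Complex.I) := fun z hz => key 1 one_ne_zero _ _ (by simpa using hz) (by simp)
  have h2 : ∀ z : ℂ, z.im < 0 → f (ψ z) = f (ψ (-Complex.I)) := fun z hz => key (-1) (by norm_num) _ _ (by simpa using hz) (by simp)
  refine ⟨h1, h2, fun x => ⟨?_, ?_⟩⟩
  · rintro ⟨a, ha⟩
    have h3 : ∀ᶠ v in 𝓝 (x:ℂ), ψ v ∉ K → f (ψ v) = a := hψ.continuous.continuousAt.eventually ha
    obtain ⟨r, hr, hb⟩ := Metric.mem_nhds_iff.1 h3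
    have m1 : ((x:ℂ) + ((r/2 : ℝ):ℂ) * Complex.I) ∈ ball (x:ℂ) r := by
      rw [mem_ball, dist_eq_norm]; simp [abs_of_pos hr]; linarith
    have m2 : ((x:ℂ) - ((r/2 : ℝ):ℂ) * Complex.I) ∈ ball (x:ℂ) r := by
      rw [mem_ball, dist_eq_norm]; simp [abs_of_pos hr]; linarith
    have e1 := hb m1 (by rw [hK]; simp; exact hr.ne')
    have e2 := hb m2 (by rw [hK]; simp; exact hr.ne')
    rw [h1 _ (by simp; exact hr)] at e1
    rw [h2 _ (by simp; exact hr)] at e2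
    rw [e1, e2]
  · intro he
    refine ⟨f (ψ Complex.I), ?_⟩
    filter_upwards [hψ.isOpen_range.mem_nhds (mem_range_self (x:ℂ))]
    rintro _ ⟨z, rfl⟩ hz
    rw [hK] at hz
    rcases lt_or_gt_of_ne hz with h | h
    · rw [h2 z h, he]
    · exact h1 z h

lemma Flat.mem_closure {H : Set S} {x : S} (h : Flat H x) : x ∈ closure Hᶜ := by
  obtain ⟨ψ, hψ, h0, hH⟩ := h
  have h1 : Tendsto (fun n : ℕ => ψ ((1 / ((n:ℝ) + 1) : ℝ) * Complex.I)) atTop (𝓝 x) := by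
    rw [← h0]
    refine (hψ.continuous.tendsto 0).comp ?_
    have : Tendsto (fun n : ℕ => (((1 / ((n:ℝ) + 1) : ℝ) : ℂ) * Complex.I)) atTop (𝓝 (((0:ℝ):ℂ) * Complex.I)) :=
      ((Complex.continuous_ofReal.tendsto 0).comp tendsto_one_div_add_atTop_nhds_zero_nat).mul_const _
    simpa using this
  refine mem_closure_of_tendsto h1 (Eventually.of_forall fun n => ?_)
  rw [mem_compl_iff, hH, Complex.im_ofReal_mul, Complex.I_im, mul_one]
  have : (0:ℝ) < 1 / ((n:ℝ) + 1) := by positivity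
  exact this.ne'

end Jump

open Set Metric Filter Topology
set_option linter.unusedSectionVars false

section ArcEnd
variable {S : Type*} [MetricSpace S] {α : Type*}

/-- A continuous map on the punctured plane which vanishes far away lifts. -/
lemma lift_punct {F : ℂ → Circ1} {p : ℂ} (hp : ‖p‖ < 1) (hF : ContinuousOn F {p}ᶜ) (h0 : ∀ z, 1 ≤ ‖z‖ → F z = 0) :
    LiftOn F {p}ᶜ := by
  have hpos : ∀ z ∈ ({p}ᶜ : Set ℂ), 0 < ‖z - p‖ := fun z hz => norm_pos_iff.2 (sub_ne_zero.2 hz)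
  refine liftOn_of_homotopy (fun t z => p + ((1 + (1 - t) * (2 / ‖z - p‖) : ℝ) : ℂ) * (z - p)) ?_ ?_ ?_ 0 ?_ hF
  · have : ∀ q ∈ Icc (0:ℝ) 1 ×ˢ ({p}ᶜ : Set ℂ), ‖q.2 - p‖ ≠ 0 := fun q hq => (hpos _ hq.2).ne'
    refine ContinuousOn.add continuousOn_const (ContinuousOn.mul ?_ (by fun_prop))
    refine Complex.continuous_ofReal.comp_continuousOn ?_
    refine ContinuousOn.add continuousOn_const (ContinuousOn.mul (by fun_prop) (ContinuousOn.div continuousOn_const (by fun_prop) this))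
  · intro t ht z hz
    have h1 := hpos z hz
    have h2 : 0 < 1 + (1 - t) * (2 / ‖z - p‖) := by
      have : 0 ≤ (1 - t) * (2 / ‖z - p‖) := mul_nonneg (by linarith [ht.2]) (by positivity)
      linarith
    intro h
    simp only [mem_singleton_iff, add_eq_left, mul_eq_zero] at h
    rcases h with h | h
    · rw [Complex.ofReal_eq_zero] at h; linarith
    · rw [h] at h1; simp at h1
  · intro z hz; simp
  · intro z hz
    apply h0
    have h1 := hpos z hz
    have h2 : ‖((1 + (1 - 0) * (2 / ‖z - p‖) : ℝ) : ℂ) * (z - p)‖ = ‖z - p‖ + 2 := by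
      rw [norm_mul, Complex.norm_real, Real.norm_of_nonneg (by positivity)]
      field_simp
      ring
    have h3 := norm_sub_le (p + ((1 + (1 - 0) * (2 / ‖z - p‖) : ℝ) : ℂ) * (z - p)) p
    rw [add_sub_cancel_left, h2] at h3
    linarith

/-- The planar core of the arc lemma. -/
lemma planar_core {g : ℂ → Circ1} {p q : ℂ} {V V' J : Set ℂ} (hV : IsOpen V) (hV' : IsOpen V')
    (hd : Disjoint V V') (hcov : ∀ z, z ∉ J → z ∈ V ∨ z ∈ V') (hVJ : Disjoint V J) (hVJ' : Disjoint V' J)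
    (hp : ‖p‖ < 1) (hpV : p ∈ V) (hqV : q ∈ V') (hg : ContinuousOn g {p, q}ᶜ) (hg1 : ∀ z, 1 ≤ ‖z‖ → g z = 0)
    {θ : ℂ → ℝ} (hθ : Continuous θ) (hθJ : ∀ z ∈ J, ‖z‖ ≤ 1 → ((θ z : ℝ) : Circ1) = g z)
    (hθ1 : ∀ z, ‖z‖ = 1 → ((θ z : ℝ) : Circ1) = 0) : ∃ r > 0, LiftOn g (ball p r \ {p}) := by
  classical
  let F : ℂ → Circ1 := fun z => if 1 ≤ ‖z‖ then 0 else if z ∈ V' then ((θ z : ℝ) : Circ1) else g z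
  have hθc : Continuous (fun z => ((θ z : ℝ) : Circ1)) := continuous_coe_circ.comp hθ
  have hgat : ∀ z, z ≠ p → z ≠ q → ContinuousAt g z := by
    intro z h1 h2
    exact hg.continuousAt ((Set.toFinite {p, q}).isClosed.isOpen_compl.mem_nhds (by simp [h1, h2]))
  have hF : ContinuousOn F {p}ᶜ := by
    intro z hz
    apply ContinuousAt.continuousWithinAt
    rcases lt_trichotomy ‖z‖ 1 with h | h | h
    · have hb : ∀ᶠ w in 𝓝 z, ¬ 1 ≤ ‖w‖ := by
        filter_upwards [(isOpen_lt continuous_norm continuous_const).mem_nhds h] with w hw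
        exact not_le.2 hw
      by_cases hzJ : z ∈ J
      · have hzV' : z ∉ V' := fun h => hVJ'.le_bot ⟨h, hzJ⟩
        have hzq : z ≠ q := fun h => hzV' (h ▸ hqV)
        have e1 : F z = g z := by simp only [F]; rw [if_neg hb.self_of_nhds, if_neg hzV']
        have e2 : ((θ z : ℝ) : Circ1) = g z := hθJ z hzJ h.le
        have c1 : Tendsto g (𝓝 z) (𝓝 (g z)) := hgat z hz hzq
        have c2 : Tendsto (fun z => ((θ z : ℝ) : Circ1)) (𝓝 z) (𝓝 (g z)) := e2 ▸ hθc.continuousAt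
        rw [ContinuousAt, e1]
        intro O hO
        rw [mem_map]
        filter_upwards [hb, c1 hO, c2 hO] with w h1 h2 h3
        simp only [mem_preimage, F]
        rw [if_neg h1]
        split_ifs
        · exact h3
        · exact h2
      · rcases hcov z hzJ with hzV | hzV'
        · have hzq : z ≠ q := fun h => hd.le_bot ⟨hzV, h ▸ hqV⟩
          refine (hgat z hz hzq).congr ?_
          filter_upwards [hb, hV.mem_nhds hzV] with w h1 h2
          simp only [F]
          rw [if_neg h1, if_neg fun h => hd.le_bot ⟨h2, h⟩]
        · refine hθc.continuousAt.congr ?_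
          filter_upwards [hb, hV'.mem_nhds hzV'] with w h1 h2
          simp only [F]
          rw [if_neg h1, if_pos h2]
    · have hzp : z ≠ p := hz
      have hg0 : ∀ᶠ O in 𝓝 z, True := by simp
      have e1 : F z = 0 := by simp only [F]; rw [if_pos h.ge]
      have c2 : Tendsto (fun z => ((θ z : ℝ) : Circ1)) (𝓝 z) (𝓝 0) := (hθ1 z h) ▸ hθc.continuousAt
      rw [ContinuousAt, e1]
      by_cases hzq : z = q
      · intro O hO
        rw [mem_map]
        filter_upwards [hV'.mem_nhds (hzq ▸ hqV), c2 hO] with w h2 h3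
        simp only [mem_preimage, F]
        split_ifs
        · exact mem_of_mem_nhds hO
        · exact h3
      have c1 : Tendsto g (𝓝 z) (𝓝 0) := (hg1 z h.ge) ▸ hgat z hz hzq
      intro O hO
      rw [mem_map]
      filter_upwards [c1 hO, c2 hO] with w h2 h3
      simp only [mem_preimage, F]
      split_ifs
      · exact mem_of_mem_nhds hO
      · exact h3
      · exact h2
    · refine ContinuousAt.congr (f := fun _ => (0:Circ1)) continuousAt_const ?_
      filter_upwards [(isOpen_lt continuous_const continuous_norm).mem_nhds h] with w hw
      simp only [F]
      rw [if_pos (le_of_lt hw)]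
  have hL := lift_punct hp hF (fun z hz => by simp only [F]; rw [if_pos hz])
  have hN : V ∩ {z | ‖z‖ < 1} ∈ 𝓝 p := Filter.inter_mem (hV.mem_nhds hpV) ((isOpen_lt continuous_norm continuous_const).mem_nhds hp)
  obtain ⟨r, hr, hb⟩ := Metric.mem_nhds_iff.1 hN
  refine ⟨r, hr, (hL.mono (fun z hz => hz.2)).congr fun z hz => ?_⟩
  have h1 := hb hz.1
  simp only [F]
  rw [if_neg (not_le.2 h1.2), if_neg fun h => hd.le_bot ⟨h1.1, h⟩]

end ArcEnd

open Set Metric Filter Topology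
set_option linter.unusedSectionVars false

section ArcEnd2
variable {S : Type*} [MetricSpace S] {α : Type*}

lemma arc_end (hS : LocallyEuclidean2 S) {c : ℝ → S} (h : TArc c) {τ : ℝ} (hτ : τ ∈ Ioo (0:ℝ) 1) {f : S → α}
    (hloc : LocOff f (arc c) (c τ)) {ε : ℝ} (hε : 0 < ε)
    (hr : ∀ t ∈ Ioo τ (τ + ε), t < 1 → Flat (arc c) (c t) ∧ NoJump f (arc c) (c t))
    (hl : ∀ δ > 0, ∃ t ∈ Ioo (τ - δ) τ, 0 < t ∧ Flat (arc c) (c t) ∧ ¬ NoJump f (arc c) (c t)) : False := by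
  classical
  obtain ⟨Ω, hΩ, hΩ0, hΩr⟩ := exists_chart hS (c τ) (hloc.and (h.away hτ (Ioo_mem_nhds (show τ - ε < τ by linarith) (show τ < τ + ε by linarith))))
  have hball : Ω '' ball 0 1 ∈ 𝓝 (c τ) := by
    rw [← hΩ0]; exact (hΩ.isOpenMap _ isOpen_ball).mem_nhds ⟨0, by simp, rfl⟩
  have hcat : ∀ᶠ s in 𝓝 τ, s ∈ Ioo (0:ℝ) 1 ∧ c s ∈ Ω '' ball 0 1 :=
    (show ∀ᶠ s in 𝓝 τ, s ∈ Ioo (0:ℝ) 1 from isOpen_Ioo.mem_nhds hτ).and ((h.cont.continuousAt (Icc_mem_nhds hτ.1 hτ.2)).eventually hball)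
  obtain ⟨δ', hδ', hb'⟩ := Metric.eventually_nhds_iff.1 hcat
  obtain ⟨δ, hδ, hδb⟩ : ∃ δ > 0, ∀ s ∈ Icc (τ - δ) τ, s ∈ Ioo (0:ℝ) 1 ∧ c s ∈ Ω '' ball 0 1 := by
    refine ⟨δ' / 2, by positivity, fun s hs => hb' ?_⟩
    rw [Real.dist_eq, abs_lt]; constructor <;> linarith [hs.1, hs.2]
  obtain ⟨t0, ht0, -, hfl, hj⟩ := hl δ hδ
  have ht0I : t0 ∈ Ioo (0:ℝ) 1 := (hδb t0 ⟨ht0.1.le, ht0.2.le⟩).1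
  have hbt0 : Ω '' ball 0 1 ∈ 𝓝 (c t0) := (hΩ.isOpenMap _ isOpen_ball).mem_nhds (hδb t0 ⟨ht0.1.le, ht0.2.le⟩).2
  obtain ⟨ψ, hψ, hψ0, hψK, hψr⟩ := hfl.shrink (Filter.inter_mem hbt0 (h.away ht0I (isOpen_Ioo.mem_nhds ht0)))
  have hψΩ : ∀ w, ψ w ∈ Ω '' ball 0 1 := fun w => (hψr (mem_range_self w)).1
  have hψs : ∀ w, ∀ s ∈ Icc (0:ℝ) 1, c s = ψ w → s ∈ Ioo (τ - δ) τ := fun w => (hψr (mem_range_self w)).2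
  have hδ0 : 0 < τ - δ := (hδb (τ - δ) ⟨le_rfl, by linarith⟩).1.1
  have hc0 : c 0 ∉ range ψ := by
    rintro ⟨w, hw⟩
    have := hψs w 0 (by norm_num) hw.symm
    linarith [this.1]
  have hc1 : c 1 ∉ range ψ := by
    rintro ⟨w, hw⟩
    have := hψs w 1 (by norm_num) hw.symm
    linarith [this.2, hτ.2]
  obtain ⟨t1, t2, h01, h12, h21, hψc, hz, -⟩ := spot_arc h hψ hψK hc0 hc1
  have ht1 : t1 ∈ Ioo (τ - δ) τ := by
    obtain ⟨w, -, hw⟩ := hψc ⟨t1, ⟨le_rfl, h12.le⟩, rfl⟩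
    exact hψs w t1 ⟨h01.le, by linarith⟩ hw.symm
  -- lift along the arc
  have hIψ : ∀ s ∈ Icc (0:ℝ) 1, c s ∈ ({ψ Complex.I, ψ (-Complex.I)}ᶜ : Set S) := by
    intro s hs
    have hss : ∀ w : ℂ, w.im ≠ 0 → c s ≠ ψ w := by
      intro w hw he
      have := hψs w s hs he
      exact hw ((hψK w).1 (he ▸ ⟨s, ⟨by linarith [this.1], by linarith [this.2, hτ.2]⟩, rfl⟩))
    rintro (h | h)
    · exact hss _ (by norm_num) h
    · exact hss _ (by norm_num) h
  obtain ⟨l, hlc, hle⟩ : LiftOn (fun s => spotF ψ (c s)) (Icc (0:ℝ) 1) :=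
    liftable_star ((convex_Icc (0:ℝ) 1).starConvex (left_mem_Icc.2 zero_le_one)) _
      ((continuousOn_spotF hψ).comp h.cont hIψ)
  have hle : ∀ s ∈ Icc (0:ℝ) 1, ((l s : ℝ) : Circ1) = spotF ψ (c s) := hle
  have hl1 : ∀ s ∈ Icc (0:ℝ) t1, l s = l t1 := by
    intro s hs
    have hss : Icc 0 t1 ⊆ Icc (0:ℝ) 1 := Icc_subset_Icc le_rfl (by linarith)
    refine lift_const (Z := Icc 0 t1) isPreconnected_Icc (hlc.mono hss) ?_ hs ⟨h01.le, le_rfl⟩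
    intro t ht
    rw [hle t (hss ht), hz t (hss ht) (fun h => not_lt.2 ht.2 h.1)]
  -- partial inverse of `c`
  set I1 := Icc (τ - δ) τ with hI1
  have hI1s : I1 ⊆ Ioo 0 1 := fun s hs => (hδb s hs).1
  let s : S → ℝ := Function.invFunOn c I1
  have hsm : ∀ w ∈ c '' I1, s w ∈ I1 ∧ c (s w) = w := fun w hw =>
    ⟨Function.invFunOn_mem hw, Function.invFunOn_eq hw⟩
  have hsc : ContinuousOn s (c '' I1) := by
    intro w hw O hO
    obtain ⟨hs1, hs2⟩ := hsm w hw
    have h2 := h.away (hI1s hs1) hO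
    rw [hs2] at h2
    rw [mem_map]
    filter_upwards [self_mem_nhdsWithin, mem_nhdsWithin_of_mem_nhds h2] with y hy hy2
    exact hy2 _ (Ioo_subset_Icc_self (hI1s (hsm y hy).1)) (hsm y hy).2
  have hcI1 : ContinuousOn c I1 := h.cont.mono (hI1s.trans Ioo_subset_Icc_self)
  set Q1 : Set ℂ := Ω ⁻¹' (c '' I1)
  set Q2 : Set ℂ := sphere 0 1 ∪ (Ω ⁻¹' (c '' Icc 0 (τ - δ)) ∩ closedBall 0 1)
  have hQ1 : IsClosed Q1 := (isCompact_Icc.image_of_continuousOn hcI1).isClosed.preimage hΩ.continuous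
  have hQ2 : IsClosed Q2 := isClosed_sphere.union (((isCompact_Icc.image_of_continuousOn (h.cont.mono (Icc_subset_Icc le_rfl (by linarith [hτ.2])))).isClosed.preimage hΩ.continuous).inter isClosed_closedBall)
  let θ0 : ℂ → ℝ := fun z => if z ∈ Q1 then l (s (Ω z)) else l t1
  have hθ02 : ∀ z ∈ Q2, θ0 z = l t1 := by
    intro z hz2
    simp only [θ0]
    split_ifs with hz1
    · obtain ⟨hs1, hs2⟩ := hsm _ hz1
      apply hl1
      refine ⟨(hI1s hs1).1.le, ?_⟩
      rcases hz2 with hz2 | ⟨⟨s', hs', he⟩, -⟩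
      · exfalso
        obtain ⟨w, hw, he⟩ := (hδb _ hs1).2
        rw [hs2] at he
        rw [hΩ.injective he] at hw
        rw [mem_sphere_zero_iff_norm] at hz2
        rw [mem_ball_zero_iff] at hw
        linarith
      · have := h.inj' (hI1s hs1) ⟨hs'.1, by linarith [hs'.2, hτ.2]⟩ (hs2.trans he.symm)
        rw [this]; linarith [hs'.2, ht1.1]
    · rfl
  have hθ0c : ContinuousOn θ0 (Q1 ∪ Q2) := by
    refine ContinuousOn.union_of_isClosed ?_ ?_ hQ1 hQ2
    · refine ContinuousOn.congr (f := fun z => l (s (Ω z))) ?_ fun z hz => by simp only [θ0]; rw [if_pos hz]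
      refine (hlc.comp hsc fun w hw => Ioo_subset_Icc_self (hI1s (hsm w hw).1)).comp hΩ.continuous.continuousOn fun z hz => hz
    · exact ContinuousOn.congr (f := fun z => l t1) continuousOn_const hθ02
  obtain ⟨θ, hθ⟩ := ContinuousMap.exists_restrict_eq (hQ1.union hQ2) (⟨_, hθ0c.restrict⟩ : C(↥(Q1 ∪ Q2), ℝ))
  have hθe : ∀ z ∈ Q1 ∪ Q2, θ z = θ0 z := fun z hz => by
    have := congrArg (fun g : C(↥(Q1 ∪ Q2), ℝ) => g ⟨z, hz⟩) hθ
    simpa using this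
  have hlt1 : ((l t1 : ℝ) : Circ1) = 0 := by
    rw [hle t1 ⟨h01.le, by linarith⟩, hz t1 ⟨h01.le, by linarith⟩ (fun h => lt_irrefl _ h.1)]
  -- the open sets
  have hJcl : IsClosed (Ω ⁻¹' (c '' Icc 0 τ)) := (isCompact_Icc.image_of_continuousOn (h.cont.mono (Icc_subset_Icc le_rfl hτ.2.le))).isClosed.preimage hΩ.continuous
  have hev : ∀ P : S → Prop, IsOpen {z : ℂ | ∀ᶠ x in 𝓝 (Ω z), P x} := fun P =>
    (isOpen_setOf_eventually_nhds (p := P)).preimage hΩ.continuous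
  set a := f (ψ Complex.I)
  obtain ⟨sd1, sd2, sd3⟩ := spot_sides (f := f) hψ hψK (fun z hz => (hΩr (image_subset_range _ _ (hψΩ z))).1 hz)
  have hne : f (ψ (-Complex.I)) ≠ a := by
    intro he
    apply hj
    have := (sd3 0).2 he.symm
    rwa [Complex.ofReal_zero, hψ0] at this
  have hΩs : ∀ z, ∀ s ∈ Icc (0:ℝ) 1, c s = Ω z → s ∈ Ioo (τ - ε) (τ + ε) := fun z => (hΩr (mem_range_self z)).2
  have hright : ∀ z, Ω z ∈ arc c → Ω z ∉ c '' Icc 0 τ → Flat (arc c) (Ω z) ∧ NoJump f (arc c) (Ω z) := by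
    rintro z ⟨t, ht, he⟩ hn
    have htτ : τ < t := by
      by_contra hc
      exact hn ⟨t, ⟨ht.1.le, not_lt.1 hc⟩, he⟩
    rw [← he]
    exact hr t ⟨htτ, (hΩs z t (Ioo_subset_Icc_self ht) he).2⟩ ht.2
  have hψJ : ∀ w : ℂ, w.im ≠ 0 → ψ w ∉ c '' Icc 0 τ := by
    rintro w hw ⟨t, ht, he⟩
    have h3 := hψs w t ⟨ht.1, by linarith [ht.2, hτ.2]⟩ he
    exact hw ((hψK w).1 (he ▸ ⟨t, ⟨by linarith [h3.1], by linarith [h3.2, hτ.2]⟩, rfl⟩))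
  have hψlc : ∀ w : ℂ, w.im ≠ 0 → ∀ᶠ x in 𝓝 (ψ w), f x = f (ψ w) := fun w hw =>
    (hΩr (image_subset_range _ _ (hψΩ w))).1 fun hm => hw ((hψK w).1 hm)
  obtain ⟨p, hp, hpe⟩ := hψΩ Complex.I
  obtain ⟨q, hq, hqe⟩ := hψΩ (-Complex.I)
  rw [mem_ball_zero_iff] at hp
  obtain ⟨r, hr0, L, hLc, hLe⟩ := planar_core (g := fun z => spotF ψ (Ω z)) (p := p) (q := q)
    (V := {z | ∀ᶠ x in 𝓝 (Ω z), x ∉ arc c → f x = a} \ Ω ⁻¹' (c '' Icc 0 τ))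
    (V' := {z | ∀ᶠ x in 𝓝 (Ω z), x ∉ arc c → f x ≠ a} \ Ω ⁻¹' (c '' Icc 0 τ))
    (J := Ω ⁻¹' (c '' Icc 0 τ)) ((hev _).sdiff hJcl) ((hev _).sdiff hJcl)
    (by
      rw [Set.disjoint_left]
      rintro z ⟨hz1, hzJ⟩ ⟨hz2, -⟩
      have hcl : Ω z ∈ closure (arc c)ᶜ := by
        by_cases hm : Ω z ∈ arc c
        · exact (hright z hm hzJ).1.mem_closure
        · exact subset_closure hm
      obtain ⟨y, hy, hyH⟩ := mem_closure_iff_nhds.1 hcl _ (hz1.and hz2)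
      exact hy.2 hyH (hy.1 hyH))
    (by
      intro z hzJ
      have hnj : NoJump f (arc c) (Ω z) := by
        by_cases hm : Ω z ∈ arc c
        · exact (hright z hm hzJ).2
        · exact ⟨f (Ω z), ((hΩr (mem_range_self z)).1 hm).mono fun y hy _ => hy⟩
      obtain ⟨b, hb⟩ := hnj
      by_cases hba : b = a
      · left; exact ⟨hb.mono fun y hy h => (hy h).trans hba, hzJ⟩
      · right; exact ⟨hb.mono fun y hy h h' => hba ((hy h).symm.trans h'), hzJ⟩)
    disjoint_sdiff_left disjoint_sdiff_left hp
    (by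
      refine ⟨?_, ?_⟩
      · change ∀ᶠ x in 𝓝 (Ω p), _
        rw [hpe]
        exact (hψlc _ (by norm_num)).mono fun y hy _ => hy
      · rw [mem_preimage, hpe]; exact hψJ _ (by norm_num))
    (by
      refine ⟨?_, ?_⟩
      · change ∀ᶠ x in 𝓝 (Ω q), _
        rw [hqe]
        exact (hψlc _ (by norm_num)).mono fun y hy _ => by rw [hy]; exact hne
      · rw [mem_preimage, hqe]; exact hψJ _ (by norm_num))
    ((continuousOn_spotF hψ).comp hΩ.continuous.continuousOn (by
      rintro z hz (h | h)
      · rw [← hpe] at h; exact hz (Or.inl (hΩ.injective h))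
      · rw [mem_singleton_iff, ← hqe] at h; exact hz (Or.inr (hΩ.injective h))))
    (by
      intro z hz1
      refine spotF_off ?_
      rintro ⟨w, hw⟩
      obtain ⟨z', hz', he⟩ := hψΩ w
      rw [hw] at he
      rw [hΩ.injective he, mem_ball_zero_iff] at hz'
      linarith)
    (θ := θ) θ.continuous
    (by
      rintro z ⟨t, ht, he⟩ hz1
      by_cases hzQ : z ∈ Q1
      · rw [hθe z (Or.inl hzQ)]
        simp only [θ0]
        rw [if_pos hzQ]
        obtain ⟨hs1, hs2⟩ := hsm _ hzQ
        rw [hle _ (Ioo_subset_Icc_self (hI1s hs1)), hs2]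
      · have htδ : t ≤ τ - δ := by
          by_contra hc
          exact hzQ ⟨t, ⟨(not_le.1 hc).le, ht.2⟩, he⟩
        have hzQ2 : z ∈ Q2 := Or.inr ⟨⟨t, ⟨ht.1, htδ⟩, he⟩, by simpa using hz1⟩
        rw [hθe z (Or.inr hzQ2), hθ02 z hzQ2, hlt1, ← he, hz t ⟨ht.1, by linarith [hτ.2]⟩]
        intro h; linarith [h.1, ht1.1])
    (by
      intro z hz1
      have hzQ2 : z ∈ Q2 := Or.inl (by simpa using hz1)
      rw [hθe z (Or.inr hzQ2), hθ02 z hzQ2, hlt1])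
  -- transport to the spot
  have hLe : ∀ z ∈ ball p r \ {p}, ((L z : ℝ) : Circ1) = spotF ψ (Ω z) := hLe
  let ω : ℂ → ℂ := fun w => Function.invFun Ω (ψ w)
  have hω : ∀ w, Ω (ω w) = ψ w := fun w => Function.invFun_eq (by obtain ⟨z, -, hz⟩ := hψΩ w; exact ⟨z, hz⟩)
  have hωc : Continuous ω := by
    rw [← continuousOn_univ]
    exact (continuousOn_invFun_range hΩ.isEmbedding).comp hψ.continuous.continuousOn fun w _ => image_subset_range _ _ (hψΩ w)
  have hωI : ω Complex.I = p := hΩ.injective (by rw [hω, hpe])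
  have hN : ω ⁻¹' ball p r ∈ 𝓝 Complex.I := hωc.continuousAt (by rw [hωI]; exact ball_mem_nhds p hr0)
  obtain ⟨r', hr', hb⟩ := Metric.mem_nhds_iff.1 hN
  have hmaps : ∀ w ∈ ball Complex.I r' \ {Complex.I}, ω w ∈ ball p r \ {p} := by
    rintro w ⟨hw, hwI⟩
    refine ⟨hb hw, fun he => hwI ?_⟩
    rw [mem_singleton_iff] at he ⊢
    apply hψ.injective
    rw [← hω, ← hω, hωI, he]
  refine not_liftOn_F0 hr' ⟨fun w => L (ω w), hLc.comp hωc.continuousOn hmaps, fun w hw => ?_⟩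
  rw [hLe _ (hmaps w hw), hω, spotF_apply hψ]

end ArcEnd2

open Set Metric Filter Topology
set_option linter.unusedSectionVars false

section JumpAll
variable {S : Type*} [MetricSpace S] {α : Type*}

lemma arc_rev (c : ℝ → S) : arc (subarc c 1 0) = arc c := by
  rw [arc_subarc c one_ne_zero]; simp [arc]

lemma rev_apply (c : ℝ → S) (t : ℝ) : subarc c 1 0 t = c (1 - t) := by
  simp only [subarc]; congr 1; ring

lemma TArc.rev {c : ℝ → S} (h : TArc c) : TArc (subarc c 1 0) := h.sub one_ne_zero (by norm_num) (by norm_num)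

lemma status_flat {c : ℝ → S} (h : TArc c) {f : S → α} {t : ℝ} (ht : t ∈ Ioo (0:ℝ) 1)
    (hloc : LocOff f (arc c) (c t)) (hfl : Flat (arc c) (c t)) :
    ∀ᶠ s in 𝓝 t, (NoJump f (arc c) (c s) ↔ NoJump f (arc c) (c t)) := by
  obtain ⟨ψ, hψ, h0, hK, hr⟩ := hfl.shrink hloc
  obtain ⟨-, -, h3⟩ := spot_sides (f := f) hψ hK fun z hz => hr (mem_range_self z) hz
  have h1 : ∀ᶠ s in 𝓝 t, c s ∈ range ψ := (h.cont.continuousAt (Icc_mem_nhds ht.1 ht.2)).eventually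
    (hψ.isOpen_range.mem_nhds (h0 ▸ mem_range_self _))
  have h2 : ∀ᶠ s in 𝓝 t, s ∈ Ioo (0:ℝ) 1 := isOpen_Ioo.mem_nhds ht
  filter_upwards [h1, h2] with s hs hs2
  obtain ⟨z, hz⟩ := hs
  have hz0 : z.im = 0 := (hK z).1 (hz ▸ ⟨s, hs2, rfl⟩)
  have hzr : z = (z.re : ℂ) := Complex.ext (by simp) (by simp [hz0])
  have e1 := h3 z.re
  have e2 := h3 0
  rw [← hzr, hz] at e1
  rw [Complex.ofReal_zero, h0] at e2
  rw [e1, e2]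

lemma status_end (hS : LocallyEuclidean2 S) {c : ℝ → S} (h : TArc c) {f : S → α}
    (hloc : ∀ t ∈ Ioo (0:ℝ) 1, LocOff f (arc c) (c t)) {τ δ : ℝ} (hτ : τ ∈ Ioo (0:ℝ) 1) (hδ : 0 < δ)
    (hI : Ioo (τ - δ) (τ + δ) ⊆ Ioo 0 1)
    (hfl : ∀ t ∈ Ioo (τ - δ) (τ + δ), t ≠ τ → Flat (arc c) (c t)) {t t' : ℝ}
    (ht : t ∈ Ioo τ (τ + δ)) (ht' : t' ∈ Ioo (τ - δ) τ) (hj : NoJump f (arc c) (c t)) : NoJump f (arc c) (c t') := by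
  by_contra hj'
  have cst : ∀ a b : ℝ, τ - δ ≤ a → b ≤ τ + δ → τ ∉ Ioo a b → ∀ s ∈ Ioo a b, ∀ s' ∈ Ioo a b,
      NoJump f (arc c) (c s) = NoJump f (arc c) (c s') := by
    intro a b ha hb hab s hs s' hs'
    refine nojump_const (f := fun s => NoJump f (arc c) (c s)) (H := ∅) (isPreconnected_Ioo (a := a) (b := b)) ?_ (by simp) hs hs' (by simp) (by simp)
    intro u hu
    have hu2 : u ∈ Ioo (τ - δ) (τ + δ) := ⟨by linarith [hu.1], by linarith [hu.2]⟩
    refine ⟨NoJump f (arc c) (c u), ?_⟩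
    filter_upwards [status_flat h (hI hu2) (hloc u (hI hu2)) (hfl u hu2 fun he => hab (he ▸ hu))] with v hv _
    exact propext hv
  have hτ' : τ ∈ Ioo (τ - δ) (τ + δ) := ⟨by linarith, by linarith⟩
  refine arc_end hS h hτ (hloc τ hτ) hδ (fun s hs _ => ⟨hfl s ⟨by linarith [hs.1], hs.2⟩ hs.1.ne', ?_⟩) ?_
  · rw [cst τ (τ + δ) (by linarith) le_rfl (by simp) s hs t ht]; exact hj
  · intro δ' hδ'
    refine ⟨max (τ - δ) (τ - δ') / 2 + τ / 2, ⟨?_, ?_⟩, ?_⟩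
    · linarith [le_max_right (τ - δ) (τ - δ')]
    · have : max (τ - δ) (τ - δ') < τ := max_lt (by linarith) (by linarith)
      linarith
    · have hm : max (τ - δ) (τ - δ') / 2 + τ / 2 ∈ Ioo (τ - δ) τ := by
        have : max (τ - δ) (τ - δ') < τ := max_lt (by linarith) (by linarith)
        constructor <;> linarith [le_max_left (τ - δ) (τ - δ')]
      have hm2 : max (τ - δ) (τ - δ') / 2 + τ / 2 ∈ Ioo (τ - δ) (τ + δ) := ⟨hm.1, by linarith [hm.2]⟩
      refine ⟨(hI hm2).1, hfl _ hm2 hm.2.ne, ?_⟩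
      rw [cst (τ - δ) τ le_rfl (by linarith) (by simp) _ hm t' ht']
      exact hj'

lemma jumpall (hS : LocallyEuclidean2 S) {c : ℝ → S} (h : TArc c) {f : S → α}
    (hloc : ∀ t ∈ Ioo (0:ℝ) 1, LocOff f (arc c) (c t)) {t0 : ℝ} (ht0 : t0 ∈ Ioo (0:ℝ) 1)
    (hf0 : Flat (arc c) (c t0)) (hj0 : NoJump f (arc c) (c t0)) : ∀ t ∈ Ioo (0:ℝ) 1, NoJump f (arc c) (c t) := by
  set Φ : Set ℝ := {t | t ∈ Ioo (0:ℝ) 1 ∧ ¬ Flat (arc c) (c t)} with hΦ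
  have hΦf : Φ.Finite := by
    obtain ⟨Φ', hf, hfl⟩ := h.flat
    refine hf.subset fun t ht => ?_
    by_contra hn
    exact ht.2 (hfl t ⟨ht.1, hn⟩)
  have hiso : ∀ τ ∈ Ioo (0:ℝ) 1, ∃ δ > 0, Ioo (τ - δ) (τ + δ) ⊆ Ioo 0 1 ∧
      ∀ t ∈ Ioo (τ - δ) (τ + δ), t ≠ τ → Flat (arc c) (c t) := by
    intro τ hτ
    have h1 : (Φ \ {τ})ᶜ ∩ Ioo 0 1 ∈ 𝓝 τ := Filter.inter_mem
      ((hΦf.subset sdiff_subset).isClosed.isOpen_compl.mem_nhds (by simp)) (isOpen_Ioo.mem_nhds hτ)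
    obtain ⟨δ, hδ, hb⟩ := Metric.mem_nhds_iff.1 h1
    rw [Real.ball_eq_Ioo] at hb
    refine ⟨δ, hδ, fun t ht => (hb ht).2, fun t ht hne => ?_⟩
    by_contra hn
    exact (hb ht).1 ⟨⟨(hb ht).2, hn⟩, hne⟩
  have hst : ∀ τ ∈ Ioo (0:ℝ) 1, NoJump (fun s => NoJump f (arc c) (c s)) Φ τ := by
    intro τ hτ
    by_cases hτΦ : τ ∈ Φ
    · obtain ⟨δ, hδ, hI, hfl⟩ := hiso τ hτ
      have r1 : ∀ t ∈ Ioo τ (τ + δ), ∀ t' ∈ Ioo (τ - δ) τ, (NoJump f (arc c) (c t) ↔ NoJump f (arc c) (c t')) := by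
        intro t ht t' ht'
        refine ⟨status_end hS h hloc hτ hδ hI hfl ht ht', fun hj => ?_⟩
        have := status_end (f := f) hS h.rev (τ := 1 - τ) (δ := δ) (t := 1 - t') (t' := 1 - t) ?_ ⟨by linarith [hτ.2], by linarith [hτ.1]⟩ hδ ?_ ?_ ?_ ?_ ?_
        · rw [arc_rev, rev_apply] at this; simpa using this
        · intro s hs
          rw [arc_rev, rev_apply]
          exact hloc _ ⟨by linarith [hs.2], by linarith [hs.1]⟩
        · intro s hs
          have := hI (show 1 - s ∈ _ from ⟨by linarith [hs.2], by linarith [hs.1]⟩)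
          exact ⟨by linarith [this.2], by linarith [this.1]⟩
        · intro s hs hne
          rw [arc_rev, rev_apply]
          exact hfl _ ⟨by linarith [hs.2], by linarith [hs.1]⟩ fun he => hne (by linarith)
        · exact ⟨by linarith [ht'.2], by linarith [ht'.1]⟩
        · exact ⟨by linarith [ht.2], by linarith [ht.1]⟩
        · rw [arc_rev, rev_apply]; simpa using hj
      have m1 : τ + δ / 2 ∈ Ioo τ (τ + δ) := ⟨by linarith, by linarith⟩
      have m2 : τ - δ / 2 ∈ Ioo (τ - δ) τ := ⟨by linarith, by linarith⟩
      refine ⟨NoJump f (arc c) (c (τ + δ / 2)), ?_⟩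
      filter_upwards [Ioo_mem_nhds (show τ - δ < τ by linarith) (show τ < τ + δ by linarith)] with s hs hsΦ
      rcases lt_trichotomy s τ with hlt | heq | hgt
      · exact propext (r1 _ m1 s ⟨hs.1, hlt⟩).symm
      · exact absurd (heq ▸ hτΦ) hsΦ
      · exact propext ((r1 s ⟨hgt, hs.2⟩ _ m2).trans (r1 _ m1 _ m2).symm)
    · have hfl : Flat (arc c) (c τ) := by
        by_contra hn; exact hτΦ ⟨hτ, hn⟩
      exact ⟨NoJump f (arc c) (c τ), (status_flat h hτ (hloc τ hτ) hfl).mono fun s hs _ => propext hs⟩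
  have hcl : ∀ x ∈ Ioo (0:ℝ) 1, x ∈ closure Φᶜ := by
    intro x _
    have : Dense Φᶜ := hΦf.countable.dense_compl ℝ
    exact this x
  have hflat : ∀ t ∈ Ioo (0:ℝ) 1, Flat (arc c) (c t) → NoJump f (arc c) (c t) := by
    intro t ht hfl
    have := nojump_const isPreconnected_Ioo hst hcl ht ht0 (fun hn => hn.2 hfl) (fun hn => hn.2 hf0)
    beta_reduce at this
    rw [this]; exact hj0
  intro τ hτ
  by_cases hfl : Flat (arc c) (c τ)
  · exact hflat τ hτ hfl
  obtain ⟨δ, hδ, hI, hflδ⟩ := hiso τ hτ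
  obtain ⟨Ω, hΩ, hΩ0, hΩr⟩ := exists_chart hS (c τ) ((hloc τ hτ).and (h.away hτ (Ioo_mem_nhds (show τ - δ < τ by linarith) (show τ < τ + δ by linarith))))
  have hconn : IsPreconnected (range Ω \ {c τ}) :=
    preconnected_diff_point hS hΩ.isOpen_range (isPreconnected_range hΩ.continuous) _
  have hK : ∀ x ∈ range Ω \ {c τ}, x ∈ arc c → Flat (arc c) x ∧ NoJump f (arc c) x := by
    rintro x ⟨hx, hxτ⟩ ⟨s, hs, rfl⟩
    have := (hΩr hx).2 s (Ioo_subset_Icc_self hs) rfl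
    have h2 := hflδ s this fun he => hxτ (by rw [he]; rfl)
    exact ⟨h2, hflat s hs h2⟩
  have key : ∀ x ∈ range Ω \ {c τ}, ∀ y ∈ range Ω \ {c τ}, x ∉ arc c → y ∉ arc c → f x = f y := by
    intro x hx y hy hxK hyK
    refine nojump_const hconn ?_ ?_ hx hy hxK hyK
    · intro z hz
      by_cases hzK : z ∈ arc c
      · exact (hK z hz hzK).2
      · exact ⟨f z, ((hΩr hz.1).1 hzK).mono fun w hw _ => hw⟩
    · intro z hz
      by_cases hzK : z ∈ arc c
      · exact (hK z hz hzK).1.mem_closure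
      · exact subset_closure hzK
  have hnh : range Ω ∈ 𝓝 (c τ) := hΩ.isOpen_range.mem_nhds (hΩ0 ▸ mem_range_self _)
  by_cases hex : ∃ x ∈ range Ω \ {c τ}, x ∉ arc c
  · obtain ⟨x, hx, hxK⟩ := hex
    refine ⟨f x, ?_⟩
    filter_upwards [hnh] with y hy hyK
    exact key y ⟨hy, fun he => hyK (by rw [mem_singleton_iff.1 he]; exact ⟨τ, hτ, rfl⟩)⟩ x hx hyK hxK
  · push Not at hex
    refine ⟨f (c τ), ?_⟩
    filter_upwards [hnh] with y hy hyK
    exact absurd (hex y ⟨hy, fun he => hyK (by rw [mem_singleton_iff.1 he]; exact ⟨τ, hτ, rfl⟩)⟩) hyK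

end JumpAll

open Set Metric Filter Topology
set_option linter.unusedSectionVars false

section Qf
variable {S : Type*} [MetricSpace S] {α : Type*}

/-- locally constant at every point of `O` -/
def LCon (f : S → α) (O : Set S) : Prop := ∀ x ∈ O, ∀ᶠ y in 𝓝 x, f y = f x

lemma LCon.mono {f : S → α} {O O' : Set S} (h : LCon f O) (hs : O' ⊆ O) : LCon f O' := fun x hx => h x (hs hx)

lemma LCon.locOff {f : S → α} {U K : Set S} (hU : IsOpen U) (h : LCon f (U \ K)) {x : S} (hx : x ∈ U) : LocOff f K x := by
  filter_upwards [hU.mem_nhds hx] with y hy hyK using h y ⟨hy, hyK⟩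

lemma NoJump.congr_set {f : S → α} {H H' : Set S} {x : S} (h : NoJump f H x) (hN : ∀ᶠ y in 𝓝 x, (y ∈ H ↔ y ∈ H')) : NoJump f H' x := by
  obtain ⟨a, ha⟩ := h
  refine ⟨a, ?_⟩
  filter_upwards [ha, hN] with y hy hy2 hy3 using hy fun h => hy3 (hy2.1 h)

lemma NoJump.of_const {f : S → α} {H : Set S} {x : S} (h : ∀ᶠ y in 𝓝 x, f y = f x) : NoJump f H x :=
  ⟨f x, h.mono fun _ hy _ => hy⟩

lemma NoJump.add {f g : S → ZMod 2} {H : Set S} {x : S} (hf : NoJump f H x) (hg : NoJump g H x) :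
    NoJump (fun y => f y + g y) H x := by
  obtain ⟨a, ha⟩ := hf
  obtain ⟨b, hb⟩ := hg
  exact ⟨a + b, (ha.and hb).mono fun y hy h => by beta_reduce; rw [hy.1 h, hy.2 h]⟩

lemma jump_add {f g : S → ZMod 2} {K : Set S} {x : S} (hfl : Flat K x) (hf : LocOff f K x) (hg : LocOff g K x)
    (hjf : ¬ NoJump f K x) (hjg : ¬ NoJump g K x) : NoJump (fun y => f y + g y) K x := by
  obtain ⟨ψ, hψ, h0, hK, hr⟩ := hfl.shrink (hf.and hg)
  obtain ⟨-, -, h3⟩ := spot_sides (f := f) hψ hK fun z hz => (hr (mem_range_self z)).1 hz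
  obtain ⟨-, -, h4⟩ := spot_sides (f := g) hψ hK fun z hz => (hr (mem_range_self z)).2 hz
  obtain ⟨-, -, h5⟩ := spot_sides (f := fun y => f y + g y) hψ hK fun z hz => by
    filter_upwards [(hr (mem_range_self z)).1 hz, (hr (mem_range_self z)).2 hz] with y h1 h2
    rw [h1, h2]
  have e3 := h3 0
  have e4 := h4 0
  have e5 := h5 0
  rw [Complex.ofReal_zero, h0] at e3 e4 e5
  rw [e3] at hjf
  rw [e4] at hjg
  rw [e5]
  generalize f (ψ Complex.I) = a at *
  generalize g (ψ Complex.I) = b at *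
  generalize f (ψ (-Complex.I)) = a' at *
  generalize g (ψ (-Complex.I)) = b' at *
  clear e3 e4 e5 h3 h4 h5
  revert a b a' b'
  decide

lemma TArc.dense_flat {c : ℝ → S} (h : TArc c) {t : ℝ} (ht : t ∈ Icc (0:ℝ) 1) {N : Set S} (hN : N ∈ 𝓝 (c t)) :
    ∃ s ∈ Ioo (0:ℝ) 1, Flat (arc c) (c s) ∧ c s ∈ N := by
  obtain ⟨Φ, hf, hfl⟩ := h.flat
  have h1 := h.cont t ht hN
  obtain ⟨O, hO, hO2⟩ := mem_nhdsWithin.1 h1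
  have hcl : t ∈ closure (Ioo (0:ℝ) 1) := by rw [closure_Ioo zero_ne_one]; exact ht
  obtain ⟨s, hs⟩ := mem_closure_iff.1 hcl O hO hO2.1
  obtain ⟨s', hs', hs2⟩ := (hf.countable.dense_compl ℝ).inter_open_nonempty _ (hO.inter isOpen_Ioo) ⟨s, hs⟩
  exact ⟨s', hs'.2, hfl s' ⟨hs'.2, hs2⟩, hO2.2 ⟨hs'.1, Ioo_subset_Icc_self hs'.2⟩⟩

lemma TArc.closure_compl {c : ℝ → S} (h : TArc c) {x : S} (hx : x ∈ arc c) : x ∈ closure (arc c)ᶜ := by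
  obtain ⟨t, ht, rfl⟩ := hx
  rw [mem_closure_iff_nhds]
  intro N hN
  obtain ⟨O, hON, hO, hcO⟩ := _root_.mem_nhds_iff.1 hN
  obtain ⟨s, hs, hfl, hsN⟩ := h.dense_flat (Ioo_subset_Icc_self ht) (hO.mem_nhds hcO)
  obtain ⟨y, hy, hyK⟩ := mem_closure_iff.1 hfl.mem_closure O hO hsN
  exact ⟨y, hON hy, hyK⟩

lemma cut_const (hS : LocallyEuclidean2 S) {U : Set S} (hU : IsOpen U) (hUc : IsPreconnected U) {c : ℝ → S} (hc : Cut U c)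
    {f : S → α} (hf : LCon f (U \ arc c)) {t0 : ℝ} (ht0 : t0 ∈ Ioo (0:ℝ) 1) (hfl : Flat (arc c) (c t0))
    (hj : NoJump f (arc c) (c t0)) {x y : S} (hx : x ∈ U \ arc c) (hy : y ∈ U \ arc c) : f x = f y := by
  have h1 := jumpall hS hc.tarc (fun t ht => hf.locOff hU (hc.sub ⟨t, ht, rfl⟩)) ht0 hfl hj
  refine nojump_const hUc (H := arc c) ?_ ?_ hx.1 hy.1 hx.2 hy.2
  · intro z hz
    by_cases hzK : z ∈ arc c
    · obtain ⟨t, ht, rfl⟩ := hzK; exact h1 t ht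
    · exact NoJump.of_const (hf z ⟨hz, hzK⟩)
  · intro z hz
    by_cases hzK : z ∈ arc c
    · exact hc.tarc.closure_compl hzK
    · exact subset_closure hzK

open Classical in
noncomputable def qf (U K E : Set S) (x : S) : ZMod 2 :=
  if (connectedComponentIn (U \ K) x ∩ E).Nonempty then 0 else 1

lemma qf_eq_zero {U K E : Set S} {x : S} : qf U K E x = 0 ↔ (connectedComponentIn (U \ K) x ∩ E).Nonempty := by
  unfold qf; split_ifs with h <;> simp [h]

lemma qf_ne_zero {U K E : Set S} {x : S} : qf U K E x ≠ 0 ↔ qf U K E x = 1 := by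
  unfold qf; split_ifs with h <;> simp

lemma qf_mem {U K E : Set S} {x : S} (hx : x ∈ U \ K) (hE : x ∈ E) : qf U K E x = 0 :=
  qf_eq_zero.2 ⟨x, mem_connectedComponentIn hx, hE⟩

lemma qf_eq {U K E : Set S} {x y : S} (h : y ∈ connectedComponentIn (U \ K) x) : qf U K E y = qf U K E x := by
  unfold qf; rw [connectedComponentIn_eq h]

lemma qf_preconn {U K E Z : Set S} (hZ : IsPreconnected Z) (hZU : Z ⊆ U \ K) {x y : S} (hx : x ∈ Z) (hy : y ∈ Z) :
    qf U K E x = qf U K E y := (qf_eq (hZ.subset_connectedComponentIn hx hZU hy)).symm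

lemma comp_lcon (hS : LocallyEuclidean2 S) {O : Set S} (hO : IsOpen O) {x : S} (hx : x ∈ O) :
    ∀ᶠ y in 𝓝 x, y ∈ connectedComponentIn O x := by
  haveI := locConn hS
  exact hO.connectedComponentIn.mem_nhds (mem_connectedComponentIn hx)

lemma qf_lcon (hS : LocallyEuclidean2 S) {U K E : Set S} (hO : IsOpen (U \ K)) : LCon (qf U K E) (U \ K) := fun x hx =>
  (comp_lcon hS hO hx).mono fun _ hy => qf_eq hy

lemma q_jump (hS : LocallyEuclidean2 S) {U E : Set S} (hU : IsOpen U) (hUc : IsPreconnected U) {c : ℝ → S} (hc : Cut U c)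
    (hd : Disjoint (arc c) E) (hE : (U ∩ E).Nonempty) (hs : SepK U (arc c) E) {x : S}
    (hfl : Flat (arc c) x) : ¬ NoJump (qf U (arc c) E) (arc c) x := by
  intro hj
  obtain ⟨t, ht, rfl⟩ := hfl.mem
  obtain ⟨ψ, hψ, h0, hK, hr⟩ := hfl.shrink (hU.mem_nhds (hc.sub ⟨t, ht, rfl⟩))
  obtain ⟨e, heU, heE⟩ := hE
  have he : e ∈ U \ arc c := ⟨heU, fun h => disjoint_left.1 hd h heE⟩
  have hall : ∀ y ∈ U \ arc c, qf U (arc c) E y = 0 := by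
    intro y hy
    rw [cut_const hS hU hUc hc (qf_lcon hS (hc.open hU)) ht hfl hj hy he, qf_mem he heE]
  have hm : ∀ z : ℂ, z.im ≠ 0 → ψ z ∈ U \ arc c := fun z hz => ⟨hr (mem_range_self z), fun h => hz ((hK z).1 h)⟩
  exact hs ψ hψ hr hK ⟨qf_eq_zero.1 (hall _ (hm _ (by norm_num))), qf_eq_zero.1 (hall _ (hm _ (by norm_num)))⟩

lemma SepK.mono {U K E E' : Set S} (h : SepK U K E') (hE : E ⊆ E') : SepK U K E := fun ψ h1 h2 h3 h4 =>
  h ψ h1 h2 h3 ⟨h4.1.mono (inter_subset_inter_right _ hE), h4.2.mono (inter_subset_inter_right _ hE)⟩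

lemma q_mono (hS : LocallyEuclidean2 S) {U E E' : Set S} (hU : IsOpen U) (hUc : IsPreconnected U) {c : ℝ → S} (hc : Cut U c)
    (hd : Disjoint (arc c) E') (hEE : E ⊆ E') (hE : (U ∩ E).Nonempty) (hs : SepK U (arc c) E') {x : S} (hx : x ∈ U \ arc c) :
    qf U (arc c) E x = qf U (arc c) E' x := by
  have hl := qf_lcon (E := E) hS (hc.open hU)
  have hl' := qf_lcon (E := E') hS (hc.open hU)
  obtain ⟨t, ht, hfl, -⟩ := hc.tarc.dense_flat (t := 0) (by norm_num) univ_mem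
  have hcU : c t ∈ U := hc.sub ⟨t, ht, rfl⟩
  have hj := jump_add hfl (hl.locOff hU hcU) (hl'.locOff hU hcU)
    (q_jump hS hU hUc hc (hd.mono_right hEE) hE (hs.mono hEE) hfl)
    (q_jump hS hU hUc hc hd (hE.mono (inter_subset_inter_right _ hEE)) hs hfl)
  obtain ⟨e, heU, heE⟩ := hE
  have he : e ∈ U \ arc c := ⟨heU, fun h => disjoint_left.1 hd h (hEE heE)⟩
  have := cut_const hS hU hUc hc (f := fun y => qf U (arc c) E y + qf U (arc c) E' y)
    (fun y hy => by filter_upwards [hl y hy, hl' y hy] with z h1 h2; rw [h1, h2]) ht hfl hj hx he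
  beta_reduce at this
  rw [qf_mem he heE, qf_mem he (hEE heE)] at this
  revert this
  generalize qf U (arc c) E x = a
  generalize qf U (arc c) E' x = b
  revert a b; decide

/-- every shadow of a tame cut contains the first end point -/
lemma cut_shadow (hS : LocallyEuclidean2 S) {U : Set S} (hU : IsOpen U) (hUc : IsPreconnected U) {c : ℝ → S} (hc : Cut U c)
    {x : S} (hx : x ∈ U \ arc c) : c 0 ∈ closure (connectedComponentIn (U \ arc c) x) := by
  set V := connectedComponentIn (U \ arc c) x with hV
  rw [mem_closure_iff_nhds]
  intro N hN
  obtain ⟨O, hON, hO, hcO⟩ := _root_.mem_nhds_iff.1 hN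
  obtain ⟨t, ht, hfl, htO⟩ := hc.tarc.dense_flat (t := 0) (by norm_num) (hO.mem_nhds hcO)
  by_contra hem
  have hcU : c t ∈ U := hc.sub ⟨t, ht, rfl⟩
  have hev : ∀ᶠ y in 𝓝 (c t), y ∉ V := by
    filter_upwards [hO.mem_nhds htO] with y hy hyV using hem ⟨y, hON hy, hyV⟩
  have hl : LCon (fun y => y ∈ V) (U \ arc c) := by
    intro y hy
    filter_upwards [comp_lcon hS (hc.open hU) hy] with z hz
    have h2 := connectedComponentIn_eq hz
    refine propext ⟨fun h => ?_, fun h => ?_⟩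
    · rw [hV, connectedComponentIn_eq h, ← h2]; exact mem_connectedComponentIn hy
    · rw [hV, connectedComponentIn_eq h]; exact hz
  have hj : NoJump (fun y => y ∈ V) (arc c) (c t) := ⟨False, hev.mono fun y hy _ => by simp [hy]⟩
  obtain ⟨y, hy, hyK⟩ := mem_closure_iff_nhds.1 hfl.mem_closure _ (hev.and (hU.mem_nhds hcU))
  have := cut_const hS hU hUc hc hl ht hfl hj hx ⟨hy.2, hyK⟩
  beta_reduce at this
  exact hy.1 (this ▸ mem_connectedComponentIn hx)

end Qf

open Set Metric Filter Topology
set_option linter.unusedSectionVars false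

section ThetaSec
variable {S : Type*} [MetricSpace S]

structure Theta (U : Set S) (c0 c1 c2 : ℝ → S) (L0 L1 L2 : Set S) (p : S) : Prop where
  cut0 : Cut U c0
  cut1 : Cut U c1
  cut2 : Cut U c2
  a0 : arc c0 = insert p (L1 ∪ L2)
  a1 : arc c1 = insert p (L0 ∪ L2)
  a2 : arc c2 = insert p (L0 ∪ L1)
  d01 : Disjoint L0 L1
  d02 : Disjoint L0 L2
  d12 : Disjoint L1 L2
  p0 : p ∉ L0
  p1 : p ∉ L1
  p2 : p ∉ L2
  n0 : IsPreconnected L0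
  n1 : IsPreconnected L1
  n2 : IsPreconnected L2
  i0 : L0.Infinite
  i1 : L1.Infinite
  i2 : L2.Infinite

variable {U : Set S} {c0 c1 c2 : ℝ → S} {L0 L1 L2 : Set S} {p : S}

lemma Theta.swap12 (h : Theta U c0 c1 c2 L0 L1 L2 p) : Theta U c0 c2 c1 L0 L2 L1 p :=
  ⟨h.cut0, h.cut2, h.cut1, by rw [h.a0, union_comm], h.a2, h.a1, h.d02, h.d01, h.d12.symm, h.p0, h.p2, h.p1,
    h.n0, h.n2, h.n1, h.i0, h.i2, h.i1⟩

lemma Theta.swap01 (h : Theta U c0 c1 c2 L0 L1 L2 p) : Theta U c1 c0 c2 L1 L0 L2 p :=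
  ⟨h.cut1, h.cut0, h.cut2, h.a1, h.a0, by rw [h.a2, union_comm], h.d01.symm, h.d12, h.d02, h.p1, h.p0, h.p2,
    h.n1, h.n0, h.n2, h.i1, h.i0, h.i2⟩

def HH (L0 L1 L2 : Set S) (p : S) : Set S := insert p (L0 ∪ L1 ∪ L2)

lemma HH_swap12 : HH L0 L2 L1 p = HH L0 L1 L2 p := by
  unfold HH; rw [union_assoc, union_comm L2, union_assoc]
lemma HH_swap01 : HH L1 L0 L2 p = HH L0 L1 L2 p := by
  unfold HH; rw [union_comm L1]

lemma Theta.notin0 (h : Theta U c0 c1 c2 L0 L1 L2 p) {x : S} (hx : x ∈ L0) : x ∈ U \ arc c0 := by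
  refine ⟨h.cut1.sub (by rw [h.a1]; exact Or.inr (Or.inl hx)), ?_⟩
  rw [h.a0]
  rintro (rfl | hx' | hx')
  · exact h.p0 hx
  · exact disjoint_left.1 h.d01 hx hx'
  · exact disjoint_left.1 h.d02 hx hx'

lemma Theta.near0 (h : Theta U c0 c1 c2 L0 L1 L2 p) (hU : IsOpen U) {x : S} (hx : x ∈ L0) :
    ∀ᶠ y in 𝓝 x, (y ∈ arc c1 ↔ y ∈ HH L0 L1 L2 p) ∧ (y ∈ arc c2 ↔ y ∈ HH L0 L1 L2 p) := by
  filter_upwards [(h.cut0.open hU).mem_nhds (h.notin0 hx)] with y hy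
  have := hy.2
  rw [h.a0] at this
  rw [h.a1, h.a2]
  simp only [HH, mem_insert_iff, mem_union] at this ⊢
  tauto

lemma Theta.sub1 (h : Theta U c0 c1 c2 L0 L1 L2 p) : arc c1 ⊆ HH L0 L1 L2 p := by
  rw [h.a1]; unfold HH; apply insert_subset_insert
  exact union_subset (fun x hx => Or.inl (Or.inl hx)) fun x hx => Or.inr hx

lemma Theta.sub0 (h : Theta U c0 c1 c2 L0 L1 L2 p) : arc c0 ⊆ HH L0 L1 L2 p := by
  have := h.swap01.sub1; rwa [HH_swap01] at this
lemma Theta.sub2 (h : Theta U c0 c1 c2 L0 L1 L2 p) : arc c2 ⊆ HH L0 L1 L2 p := by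
  have := h.swap12.sub1; rwa [HH_swap12] at this

lemma Theta.fin0 (h : Theta U c0 c1 c2 L0 L1 L2 p) (hU : IsOpen U) : {x | x ∈ L0 ∧ ¬ Flat (HH L0 L1 L2 p) x}.Finite := by
  obtain ⟨Φ, hf, hfl⟩ := h.cut1.tarc.flat
  refine (hf.image c1).subset ?_
  rintro x ⟨hx, hn⟩
  have hx1 : x ∈ arc c1 := by rw [h.a1]; exact Or.inr (Or.inl hx)
  obtain ⟨t, ht, rfl⟩ := hx1
  refine ⟨t, ?_, rfl⟩
  by_contra htΦ
  exact hn ((hfl t ⟨ht, htΦ⟩).congr ((h.near0 hU hx).mono fun y hy => hy.1))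

lemma Theta.exflat0 (h : Theta U c0 c1 c2 L0 L1 L2 p) (hU : IsOpen U) : ∃ x ∈ L0, Flat (HH L0 L1 L2 p) x := by
  by_contra hn
  push Not at hn
  exact h.i0 ((h.fin0 hU).subset fun x hx => ⟨hx, hn x hx⟩)

lemma Theta.nj0 (h : Theta U c0 c1 c2 L0 L1 L2 p) (hS : LocallyEuclidean2 S) (hU : IsOpen U) (hUc : IsPreconnected U)
    {E : Set S} (hd : Disjoint (HH L0 L1 L2 p) E) (hE : (U ∩ E).Nonempty) (hs1 : SepK U (arc c1) E) (hs2 : SepK U (arc c2) E)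
    {x : S} (hx : x ∈ L0) (hfl : Flat (HH L0 L1 L2 p) x) :
    NoJump (fun y => qf U (arc c0) E y + (qf U (arc c1) E y + qf U (arc c2) E y)) (HH L0 L1 L2 p) x := by
  have hn := h.near0 hU hx
  have hn1 : ∀ᶠ y in 𝓝 x, (y ∈ HH L0 L1 L2 p ↔ y ∈ arc c1) := hn.mono fun y hy => hy.1.symm
  have hn2 : ∀ᶠ y in 𝓝 x, (y ∈ HH L0 L1 L2 p ↔ y ∈ arc c2) := hn.mono fun y hy => hy.2.symm
  have hxU := (h.notin0 hx).1
  refine NoJump.add (NoJump.of_const (qf_lcon hS (h.cut0.open hU) x (h.notin0 hx))) ?_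
  refine jump_add hfl ?_ ?_ ?_ ?_
  · exact ((qf_lcon hS (h.cut1.open hU)).mono (sdiff_subset_sdiff_right h.sub1)).locOff hU hxU
  · exact ((qf_lcon hS (h.cut2.open hU)).mono (sdiff_subset_sdiff_right h.sub2)).locOff hU hxU
  · exact fun hj => q_jump hS hU hUc h.cut1 (hd.mono_left h.sub1) hE hs1 (hfl.congr hn1) (hj.congr_set hn1)
  · exact fun hj => q_jump hS hU hUc h.cut2 (hd.mono_left h.sub2) hE hs2 (hfl.congr hn2) (hj.congr_set hn2)

lemma theta_sum (h : Theta U c0 c1 c2 L0 L1 L2 p) (hS : LocallyEuclidean2 S) (hU : IsOpen U) (hUc : IsPreconnected U)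
    {E : Set S} (hd : Disjoint (HH L0 L1 L2 p) E) (hE : (U ∩ E).Nonempty) (hs0 : SepK U (arc c0) E) (hs1 : SepK U (arc c1) E)
    (hs2 : SepK U (arc c2) E) {x : S} (hx : x ∈ U \ HH L0 L1 L2 p) :
    qf U (arc c0) E x + (qf U (arc c1) E x + qf U (arc c2) E x) = 0 := by
  obtain ⟨e, heU, heE⟩ := hE
  have he : e ∈ U \ HH L0 L1 L2 p := ⟨heU, fun h' => disjoint_left.1 hd h' heE⟩
  set N : Set S := insert p (({x | x ∈ L0 ∧ ¬ Flat (HH L0 L1 L2 p) x} ∪ {x | x ∈ L1 ∧ ¬ Flat (HH L0 L1 L2 p) x}) ∪ {x | x ∈ L2 ∧ ¬ Flat (HH L0 L1 L2 p) x}) with hN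
  have h01 := h.swap01
  have h02 := h.swap12.swap01
  have e01 : HH L1 L0 L2 p = HH L0 L1 L2 p := HH_swap01
  have e02 : HH L2 L0 L1 p = HH L0 L1 L2 p := by rw [HH_swap01, HH_swap12]
  have hNf : N.Finite := by
    refine ((((h.fin0 hU)).union ?_).union ?_).insert p
    · have := h01.fin0 hU; rwa [e01] at this
    · have := h02.fin0 hU; rwa [e02] at this
  have hNH : N ⊆ HH L0 L1 L2 p := by
    unfold HH
    refine insert_subset_insert (union_subset_union (union_subset_union ?_ ?_) ?_) <;> exact fun x hx => hx.1
  have hflat : ∀ z ∈ HH L0 L1 L2 p, z ∉ N → Flat (HH L0 L1 L2 p) z ∧ (z ∈ L0 ∨ z ∈ L1 ∨ z ∈ L2) := by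
    intro z hz hzN
    by_contra hc
    have hz' := hz
    simp only [HH, mem_insert_iff, mem_union] at hz'
    simp only [hN, mem_insert_iff, mem_union, mem_ofPred_eq] at hzN
    tauto
  have := nojump_const (f := fun y => qf U (arc c0) E y + (qf U (arc c1) E y + qf U (arc c2) E y)) (H := HH L0 L1 L2 p)
    (preconnected_diff_finite hS hU hUc hNf) ?_ ?_ (x := x) (y := e) ⟨hx.1, fun h' => hx.2 (hNH h')⟩ ⟨heU, fun h' => he.2 (hNH h')⟩ hx.2 he.2
  · beta_reduce at this
    rw [this, qf_mem ⟨heU, fun h' => he.2 (h.sub0 h')⟩ heE, qf_mem ⟨heU, fun h' => he.2 (h.sub1 h')⟩ heE, qf_mem ⟨heU, fun h' => he.2 (h.sub2 h')⟩ heE]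
    rfl
  · rintro z ⟨hzU, hzN⟩
    by_cases hzH : z ∈ HH L0 L1 L2 p
    · obtain ⟨hfl, hz | hz | hz⟩ := hflat z hzH hzN
      · exact h.nj0 hS hU hUc hd ⟨e, heU, heE⟩ hs1 hs2 hz hfl
      · have := h01.nj0 hS hU hUc (E := E) (by rwa [e01]) ⟨e, heU, heE⟩ hs0 hs2 hz (by rwa [e01])
        rw [e01] at this
        refine cast ?_ this
        congr 1; funext y; ring
      · have := h02.nj0 hS hU hUc (E := E) (by rwa [e02]) ⟨e, heU, heE⟩ hs0 hs1 hz (by rwa [e02])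
        rw [e02] at this
        refine cast ?_ this
        congr 1; funext y; ring
    · exact ((NoJump.of_const (qf_lcon hS (h.cut0.open hU) z ⟨hzU, fun h' => hzH (h.sub0 h')⟩)).add
        ((NoJump.of_const (qf_lcon hS (h.cut1.open hU) z ⟨hzU, fun h' => hzH (h.sub1 h')⟩)).add
        (NoJump.of_const (qf_lcon hS (h.cut2.open hU) z ⟨hzU, fun h' => hzH (h.sub2 h')⟩))))
  · rintro z ⟨hzU, hzN⟩
    by_cases hzH : z ∈ HH L0 L1 L2 p
    · exact (hflat z hzH hzN).1.mem_closure
    · exact subset_closure hzH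

def Wd (U K E : Set S) : Set S := {x | x ∈ U \ K ∧ qf U K E x = 0}

lemma Theta.eqH (h : Theta U c0 c1 c2 L0 L1 L2 p) : HH L0 L1 L2 p = arc c0 ∪ L0 := by
  rw [h.a0, HH]; ext z; simp only [mem_insert_iff, mem_union]; tauto

lemma theta_aux (h : Theta U c0 c1 c2 L0 L1 L2 p) (hS : LocallyEuclidean2 S) (hU : IsOpen U) (hUc : IsPreconnected U)
    {E : Set S} (hd : Disjoint (HH L0 L1 L2 p) E) (hE : (U ∩ E).Nonempty)
    (h0 : ∀ x ∈ L0, qf U (arc c0) E x = 0) (h1 : ∀ x ∈ L1, qf U (arc c1) E x = 1) :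
    Wd U (arc c1) E ⊆ Wd U (arc c0) E ∧ Disjoint (Wd U (arc c1) E) (HH L0 L1 L2 p) := by
  have e01 : HH L1 L0 L2 p = HH L0 L1 L2 p := HH_swap01
  have hdis : Disjoint (Wd U (arc c1) E) (HH L0 L1 L2 p) := by
    rw [disjoint_left]
    rintro x ⟨hx, hx0⟩ hxH
    rw [← e01, h.swap01.eqH] at hxH
    rcases hxH with hxH | hxH
    · exact hx.2 hxH
    · rw [h1 x hxH] at hx0; exact absurd hx0 (by decide)
  refine ⟨?_, hdis⟩
  have hl : LCon (fun y => qf U (arc c0) E y = 1 ∧ qf U (arc c1) E y = 0) (U \ arc c0) := by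
    intro y hy
    have q0 := qf_lcon (E := E) hS (h.cut0.open hU) y hy
    by_cases hyH : y ∈ HH L0 L1 L2 p
    · rw [h.eqH] at hyH
      have hy0 : y ∈ L0 := hyH.resolve_left hy.2
      filter_upwards [q0] with z hz
      rw [hz, h0 y hy0]; simp
    · filter_upwards [q0, qf_lcon (E := E) hS (h.cut1.open hU) y ⟨hy.1, fun h' => hyH (h.sub1 h')⟩] with z hz hz1
      rw [hz, hz1]
  obtain ⟨x, hx, hfl⟩ := h.swap01.exflat0 hU
  rw [e01] at hfl
  have hfl0 : Flat (arc c0) x := hfl.congr (by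
    have := h.swap01.near0 hU hx
    rw [e01] at this
    exact this.mono fun y hy => hy.1.symm)
  obtain ⟨t, ht, rfl⟩ := hfl0.mem
  have hj : NoJump (fun y => qf U (arc c0) E y = 1 ∧ qf U (arc c1) E y = 0) (arc c0) (c0 t) := by
    refine ⟨False, ?_⟩
    filter_upwards [qf_lcon (E := E) hS (h.cut1.open hU) _ (h.swap01.notin0 hx)] with y hy _
    rw [hy, h1 _ hx]; simp
  rintro y ⟨hy, hy0⟩
  have hyH : y ∉ HH L0 L1 L2 p := fun h' => disjoint_left.1 hdis ⟨hy, hy0⟩ h'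
  have hyc : y ∈ U \ arc c0 := ⟨hy.1, fun h' => hyH (h.sub0 h')⟩
  refine ⟨hyc, ?_⟩
  obtain ⟨e, heU, heE⟩ := hE
  have he : e ∈ U \ HH L0 L1 L2 p := ⟨heU, fun h' => disjoint_left.1 hd h' heE⟩
  have := cut_const hS hU hUc h.cut0 hl ht hfl0 hj hyc (y := e) ⟨heU, fun h' => he.2 (h.sub0 h')⟩
  beta_reduce at this
  rw [qf_mem ⟨heU, fun h' => he.2 (h.sub0 h')⟩ heE] at this
  by_contra hn
  rw [← ne_eq, qf_ne_zero] at hn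
  rw [hn, hy0] at this
  simp at this

lemma theta_last (h : Theta U c0 c1 c2 L0 L1 L2 p) (hS : LocallyEuclidean2 S) (hU : IsOpen U) (hUc : IsPreconnected U)
    {E : Set S} (hd : Disjoint (HH L0 L1 L2 p) E) (hE : (U ∩ E).Nonempty) (hs0 : SepK U (arc c0) E) (hs1 : SepK U (arc c1) E)
    (hs2 : SepK U (arc c2) E)
    (h0 : ∀ x ∈ L0, qf U (arc c0) E x = 0) (h1 : ∀ x ∈ L1, qf U (arc c1) E x = 0) (h2 : ∀ x ∈ L2, qf U (arc c2) E x = 0) : False := by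
  have e01 : HH L1 L0 L2 p = HH L0 L1 L2 p := HH_swap01
  have e02 : HH L2 L0 L1 p = HH L0 L1 L2 p := by rw [HH_swap01, HH_swap12]
  have h02 := h.swap12.swap01
  have hl : LCon (fun y => qf U (arc c0) E y = 0 ∧ qf U (arc c1) E y = 1 ∧ qf U (arc c2) E y = 1) (U \ arc c1) := by
    intro y hy
    have q1 := qf_lcon (E := E) hS (h.cut1.open hU) y hy
    by_cases hyH : y ∈ HH L0 L1 L2 p
    · rw [← e01, h.swap01.eqH] at hyH
      have hy0 : y ∈ L1 := hyH.resolve_left hy.2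
      filter_upwards [q1] with z hz
      rw [hz, h1 y hy0]; simp
    · filter_upwards [q1, qf_lcon (E := E) hS (h.cut0.open hU) y ⟨hy.1, fun h' => hyH (h.sub0 h')⟩,
        qf_lcon (E := E) hS (h.cut2.open hU) y ⟨hy.1, fun h' => hyH (h.sub2 h')⟩] with z hz hz1 hz2
      rw [hz, hz1, hz2]
  obtain ⟨x, hx, hfl⟩ := h02.exflat0 hU
  have hfl1 : Flat (arc c1) x := hfl.congr ((h02.near0 hU hx).mono fun y hy => hy.2.symm)
  obtain ⟨t, ht, rfl⟩ := hfl1.mem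
  have hj : NoJump (fun y => qf U (arc c0) E y = 0 ∧ qf U (arc c1) E y = 1 ∧ qf U (arc c2) E y = 1) (arc c1) (c1 t) := by
    refine ⟨False, ?_⟩
    filter_upwards [qf_lcon (E := E) hS (h.cut2.open hU) _ (h02.notin0 hx)] with y hy _
    rw [hy, h2 _ hx]; simp
  have hall := jumpall hS h.cut1.tarc (fun t ht => hl.locOff hU (h.cut1.sub ⟨t, ht, rfl⟩)) ht hfl1 hj
  obtain ⟨x', hx', hfl'⟩ := h.exflat0 hU
  have hn1 : ∀ᶠ y in 𝓝 x', (y ∈ HH L0 L1 L2 p ↔ y ∈ arc c1) := (h.near0 hU hx').mono fun y hy => hy.1.symm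
  have hflx : Flat (arc c1) x' := hfl'.congr hn1
  obtain ⟨t', ht', rfl⟩ := hflx.mem
  obtain ⟨a, ha⟩ := hall t' ht'
  have hx'0 := h.notin0 hx'
  refine q_jump hS hU hUc h.cut1 (hd.mono_left h.sub1) hE hs1 hflx ⟨open Classical in if a then 1 else 0, ?_⟩
  filter_upwards [ha, hn1, qf_lcon (E := E) hS (h.cut0.open hU) _ hx'0, hU.mem_nhds hx'0.1] with y hy hy1 hy2 hyU hyK
  have hs := theta_sum h hS hU hUc hd hE hs0 hs1 hs2 (x := y) ⟨hyU, fun h' => hyK (hy1.1 h')⟩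
  have hy := hy hyK
  rw [hy2, h0 _ hx'] at hs hy
  rw [← hy]
  revert hs
  generalize qf U (arc c1) E y = u
  generalize qf U (arc c2) E y = v
  intro hs
  have huv : u = v := by revert hs; revert u v; decide
  subst huv
  by_cases hu : u = 1
  · simp [hu]
  · have : u = 0 := by revert hu; revert u; decide
    simp [this]

lemma theta_pick (h : Theta U c0 c1 c2 L0 L1 L2 p) (hS : LocallyEuclidean2 S) (hU : IsOpen U) (hUc : IsPreconnected U)
    {E : Set S} (hd : Disjoint (HH L0 L1 L2 p) E) (hE : (U ∩ E).Nonempty) (hs0 : SepK U (arc c0) E) (hs1 : SepK U (arc c1) E)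
    (hs2 : SepK U (arc c2) E) (h0 : ∀ x ∈ L0, qf U (arc c0) E x = 0) :
    (Wd U (arc c1) E ⊆ Wd U (arc c0) E ∧ Disjoint (Wd U (arc c1) E) (HH L0 L1 L2 p)) ∨
    (Wd U (arc c2) E ⊆ Wd U (arc c0) E ∧ Disjoint (Wd U (arc c2) E) (HH L0 L1 L2 p)) := by
  by_cases h1 : ∀ x ∈ L1, qf U (arc c1) E x = 1
  · exact Or.inl (theta_aux h hS hU hUc hd hE h0 h1)
  by_cases h2 : ∀ x ∈ L2, qf U (arc c2) E x = 1
  · have := theta_aux h.swap12 hS hU hUc (by rwa [HH_swap12]) hE h0 h2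
    rw [HH_swap12] at this
    exact Or.inr this
  exfalso
  push Not at h1 h2
  obtain ⟨x1, hx1, hq1⟩ := h1
  obtain ⟨x2, hx2, hq2⟩ := h2
  refine theta_last h hS hU hUc hd hE hs0 hs1 hs2 h0 ?_ ?_
  · intro x hx
    rw [qf_preconn h.n1 (fun z hz => h.swap01.notin0 hz) hx hx1]
    by_contra hn; exact hq1 (qf_ne_zero.1 hn)
  · intro x hx
    rw [qf_preconn h.n2 (fun z hz => h.swap12.swap01.notin0 hz) hx hx2]
    by_contra hn; exact hq2 (qf_ne_zero.1 hn)

lemma TArc.infinite_image {c : ℝ → S} (h : TArc c) {a b : ℝ} (hab : a < b) (hs : Ioo a b ⊆ Ioo 0 1) : (c '' Ioo a b).Infinite :=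
  (Ioo_infinite hab).image (h.inj.mono hs)

lemma TArc.preconn_image {c : ℝ → S} (h : TArc c) {a b : ℝ} (hs : Ioo a b ⊆ Ioo 0 1) : IsPreconnected (c '' Ioo a b) :=
  isPreconnected_Ioo.image _ (h.cont.mono (hs.trans Ioo_subset_Icc_self))

lemma theta_mk {c γ : ℝ → S} (hc : Cut U c) {s : ℝ} (hs : s ∈ Ioo (0:ℝ) 1) (hγ : TArc γ) (h0 : γ 0 = c s) (hγU : arc γ ⊆ U)
    (hd : Disjoint (arc γ) (arc c)) (h1 : γ 1 ∉ U) :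
    Theta U c (cat (subarc c 1 s) γ) (cat (subarc c 0 s) γ) (arc γ) (c '' Ioo 0 s) (c '' Ioo s 1) (c s) := by
  have hcs : c s ∈ arc c := ⟨s, hs, rfl⟩
  have s1 : Ioo 0 s ⊆ Ioo (0:ℝ) 1 := Ioo_subset_Ioo le_rfl hs.2.le
  have s2 : Ioo s 1 ⊆ Ioo (0:ℝ) 1 := Ioo_subset_Ioo hs.1.le le_rfl
  have hsI : s ∈ Icc (0:ℝ) 1 := Ioo_subset_Icc_self hs
  have A1 : arc (subarc c 1 s) = c '' Ioo s 1 := by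
    rw [arc_subarc c hs.2.ne', min_eq_right hs.2.le, max_eq_left hs.2.le]
  have A2 : arc (subarc c 0 s) = c '' Ioo 0 s := by
    rw [arc_subarc c hs.1.ne, min_eq_left hs.1.le, max_eq_right hs.1.le]
  have k1 : c '' Ioo s 1 ⊆ arc c := image_mono s2
  have k2 : c '' Ioo 0 s ⊆ arc c := image_mono s1
  have key : ∀ a : ℝ, a = 0 ∨ a = 1 → Cut U (cat (subarc c a s) γ) := by
    intro a ha
    have haI : a ∈ Icc (0:ℝ) 1 := by rcases ha with rfl | rfl <;> norm_num
    have hcaU : c a ∉ U := by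
      rcases ha with rfl | rfl
      · exact hc.left
      · exact hc.right
    have hne : a ≠ s := by
      rcases ha with rfl | rfl
      · exact hs.1.ne
      · exact hs.2.ne'
    have hsub : arc (subarc c a s) ⊆ arc c := arc_subarc_sub hne haI hsI
    refine ⟨TArc.cat (hc.tarc.sub hne haI hsI) hγ (by rw [subarc_one, h0]) (hd.symm.mono_left hsub) ?_ ?_ ?_ ?_, ?_, ?_, ?_⟩
    · rw [subarc_zero]; exact fun h => hcaU (hγU h)
    · rw [subarc_zero, subarc_one]; exact fun h => hcaU (h ▸ hc.sub hcs)
    · exact fun h => h1 (hc.sub (hsub h))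
    · rw [h0]; exact fun h => h1 (h ▸ hc.sub hcs)
    · rw [arc_cat, subarc_one]
      exact union_subset (union_subset (hsub.trans hc.sub) hγU) (singleton_subset_iff.2 (hc.sub hcs))
    · rw [cat_zero, subarc_zero]; exact hcaU
    · rw [cat_one]; exact h1
  refine ⟨hc, key 1 (Or.inr rfl), key 0 (Or.inl rfl), ?_, ?_, ?_, hd.mono_right k2, hd.mono_right k1, ?_, ?_, ?_, ?_, ?_, ?_, ?_, ?_, ?_, ?_⟩
  · rw [arc, ← Ioo_union_Ico_eq_Ioo hs.1 hs.2.le, ← Ioo_insert_left hs.2, image_union, image_insert_eq]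
    simp [union_insert]
  · rw [arc_cat, A1, subarc_one]; ext z; simp only [mem_union, mem_insert_iff, mem_singleton_iff]; tauto
  · rw [arc_cat, A2, subarc_one]; ext z; simp only [mem_union, mem_insert_iff, mem_singleton_iff]; tauto
  · rw [disjoint_left]
    rintro _ ⟨t, ht, rfl⟩ ⟨t', ht', he⟩
    have := hc.tarc.inj' (s2 ht') (Ioo_subset_Icc_self (s1 ht)) he
    linarith [ht.2, ht'.1]
  · exact fun h => disjoint_left.1 hd h hcs
  · rintro ⟨t, ht, he⟩
    have := hc.tarc.inj' (s1 ht) hsI he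
    linarith [ht.2]
  · rintro ⟨t, ht, he⟩
    have := hc.tarc.inj' (s2 ht) hsI he
    linarith [ht.1]
  · exact hγ.preconn_image le_rfl
  · exact hc.tarc.preconn_image s1
  · exact hc.tarc.preconn_image s2
  · exact hγ.infinite_image one_pos le_rfl
  · exact hc.tarc.infinite_image hs.1 s1
  · exact hc.tarc.infinite_image hs.2 s2

end ThetaSec

open Set Metric Filter Topology
set_option linter.unusedSectionVars false

section TripodSec
variable {S : Type*} [MetricSpace S]

structure Good (U B P : Set S) (c : ℝ → S) : Prop where
  cut : Cut U c
  b0 : c 0 ∈ B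
  b1 : c 1 ∈ B
  sub : arc c ⊆ P

lemma wd_preconn {U K E Z : Set S} (hZ : IsPreconnected Z) (hZU : Z ⊆ U \ K) (h : (Z ∩ Wd U K E).Nonempty) : Z ⊆ Wd U K E := by
  obtain ⟨x, hx, hx2⟩ := h
  intro y hy
  exact ⟨hZU hy, by rw [qf_preconn hZ hZU hy hx]; exact hx2.2⟩

lemma tripod (hS : LocallyEuclidean2 S) {U E B P : Set S} (hU : IsOpen U) (hUc : IsPreconnected U) (hN : Nonexc U E B)
    (hPU : P ⊆ U) (hPE : Disjoint P E) (hE : (U ∩ E).Nonempty) {c γ : ℝ → S} (hc : Good U B P c) {s : ℝ} (hs : s ∈ Ioo (0:ℝ) 1)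
    (hγ : TArc γ) (h0 : γ 0 = c s) (hγP : arc γ ⊆ P) (hγW : arc γ ⊆ Wd U (arc c) E) (h1 : γ 1 ∉ U) (h1B : γ 1 ∈ B) :
    ∃ c', Good U B P c' ∧ arc c' ⊆ arc c ∪ arc γ ∧ Wd U (arc c') E ⊆ Wd U (arc c) E ∧
      Disjoint (Wd U (arc c') E) (arc c ∪ arc γ) := by
  have hth := theta_mk hc.cut hs hγ h0 (hγP.trans hPU)
    (disjoint_left.2 fun x hx hxc => (hγW hx).1.2 hxc) h1
  have hH := hth.eqH
  have hHP : arc c ∪ arc γ ⊆ P := union_subset hc.sub hγP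
  have hd : Disjoint (HH (arc γ) (c '' Ioo 0 s) (c '' Ioo s 1) (c s)) E := by rw [hH]; exact hPE.mono_left hHP
  have sub1 := hth.sub1
  have sub2 := hth.sub2
  rw [hH] at sub1 sub2
  have g1 : Good U B P (cat (subarc c 1 s) γ) := ⟨hth.cut1, by rw [cat_zero, subarc_zero]; exact hc.b1, by rw [cat_one]; exact h1B, sub1.trans hHP⟩
  have g2 : Good U B P (cat (subarc c 0 s) γ) := ⟨hth.cut2, by rw [cat_zero, subarc_zero]; exact hc.b0, by rw [cat_one]; exact h1B, sub2.trans hHP⟩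
  have sep : ∀ c', Good U B P c' → SepK U (arc c') E := fun c' h => hN c' h.cut h.b0 h.b1 (hPE.mono_left h.sub)
  rcases theta_pick hth hS hU hUc hd hE (sep _ hc) (sep _ g1) (sep _ g2) (fun x hx => (hγW hx).2) with h | h
  · rw [hH] at h
    exact ⟨_, g1, sub1, h.1, h.2⟩
  · rw [hH] at h
    exact ⟨_, g2, sub2, h.1, h.2⟩

lemma line_tarc {φ : ℂ → S} (hφ : IsOpenEmbedding φ) : TArc (fun t : ℝ => φ t) := by
  have hinj : ∀ s t : ℝ, φ s = φ t → s = t := fun s t h => Complex.ofReal_injective (hφ.injective h)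
  refine ⟨(hφ.continuous.comp Complex.continuous_ofReal).continuousOn, fun s _ t _ h => hinj s t h, ?_, ?_, ∅, finite_empty, ?_⟩
  · rintro ⟨t, ht, he⟩
    have := hinj _ _ he; linarith [ht.1]
  · rintro ⟨t, ht, he⟩
    have := hinj _ _ he; linarith [ht.2]
  · rintro u ⟨hu, -⟩
    have hρ : 0 < min u (1 - u) := lt_min hu.1 (by linarith [hu.2])
    refine ⟨fun z => φ (u + mu (min u (1 - u)) z), ?_, by simp [mu_zero], fun z => ?_⟩
    · exact hφ.comp ((Homeomorph.addLeft (u:ℂ)).isOpenEmbedding.comp (mu_emb hρ))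
    · rw [← mu_im hρ z]
      have hnorm := mu_norm hρ z
      beta_reduce
      generalize mu (min u (1 - u)) z = w at *
      constructor
      · rintro ⟨t, -, he⟩
        have := hφ.injective he
        have := congrArg Complex.im this
        simpa using this.symm
      · intro hw
        have hwr : w = (w.re : ℂ) := Complex.ext (by simp) (by simp [hw])
        have habs : |w.re| < min u (1 - u) := (Complex.abs_re_le_norm w).trans_lt hnorm
        have h1 := habs.trans_le (min_le_left _ _)
        have h2 := habs.trans_le (min_le_right _ _)
        rw [abs_lt] at h1 h2
        refine ⟨u + w.re, ⟨by linarith, by linarith⟩, ?_⟩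
        beta_reduce
        rw [hwr]; simp

structure InvF (U E B P : Set S) (F : Set (Set S)) (c : ℝ → S) : Prop where
  good : Good U B P c
  disj : ∀ κ ∈ F, (κ ∩ Wd U (arc c) E).Nonempty → Disjoint κ (arc c)

lemma inv_step (hS : LocallyEuclidean2 S) {U E B P : Set S} (hU : IsOpen U) (hUc : IsPreconnected U) (hN : Nonexc U E B)
    (hP : IsOpen P) (hPc : IsPreconnected P)
    (hPU : P ⊆ U) (hPE : Disjoint P E) (hE : (U ∩ E).Nonempty) {F : Set (Set S)} (hFf : F.Finite)
    (hF : ∀ κ ∈ F, ∃ k, Good U B P k ∧ arc k = κ) (hFd : ∀ κ ∈ F, ∀ κ' ∈ F, κ ≠ κ' → Disjoint κ κ')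
    {c : ℝ → S} (hc : InvF U E B P F c) (hex : ∃ κ ∈ F, (κ ∩ Wd U (arc c) E).Nonempty) :
    ∃ c', InvF U E B P F c' ∧ Wd U (arc c') E ⊆ Wd U (arc c) E ∧
      ∃ κ ∈ F, (κ ∩ Wd U (arc c) E).Nonempty ∧ ¬ (κ ∩ Wd U (arc c') E).Nonempty := by
  set G : Set (Set S) := {κ ∈ F | (κ ∩ Wd U (arc c) E).Nonempty} with hG
  have hGW : ∀ κ ∈ G, κ ⊆ Wd U (arc c) E := by
    rintro κ ⟨hκ, hne⟩
    obtain ⟨k, hk, rfl⟩ := hF κ hκ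
    exact wd_preconn (hk.cut.tarc.preconn_image le_rfl)
      (fun x hx => ⟨hk.cut.sub hx, disjoint_left.1 (hc.disj _ hκ hne) hx⟩) hne
  have hGcl : IsClosed (Uᶜ ∪ ⋃₀ G) := by
    have : Uᶜ ∪ ⋃₀ G = Uᶜ ∪ ⋃ κ ∈ G, (Uᶜ ∪ κ) := by
      ext z; simp only [mem_union, mem_sUnion, mem_iUnion, exists_prop]
      constructor
      · rintro (h | ⟨κ, h1, h2⟩)
        · exact Or.inl h
        · exact Or.inr ⟨κ, h1, Or.inr h2⟩
      · rintro (h | ⟨κ, h1, h2 | h2⟩)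
        · exact Or.inl h
        · exact Or.inl h2
        · exact Or.inr ⟨κ, h1, h2⟩
    rw [this]
    refine hU.isClosed_compl.union ((hFf.subset (sep_subset _ _)).isClosed_biUnion fun κ hκ => ?_)
    obtain ⟨k, hk, rfl⟩ := hF κ hκ.1
    exact hk.cut.closed hU
  obtain ⟨κ0, hκ0F, x, hxκ, hxW⟩ := hex
  have hκ0 : κ0 ∈ G := ⟨hκ0F, x, hxκ, hxW⟩
  have hxP : x ∈ P := by
    obtain ⟨k, hk, rfl⟩ := hF κ0 hκ0F; exact hk.sub hxκ
  have hyK : c (1/2) ∈ arc c := ⟨1/2, by norm_num, rfl⟩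
  obtain ⟨φ, hφ, hφP, hφ0, hφ1⟩ := common_chart hS hP hPc hxP (hc.good.sub hyK) (fun h => hxW.1.2 (h ▸ hyK))
  have hφU : ∀ z, φ z ∈ U := fun z => hPU (hφP (mem_range_self z))
  have hφc : Continuous (fun t : ℝ => φ t) := hφ.continuous.comp Complex.continuous_ofReal
  -- first hit of the cut
  obtain ⟨s1, ⟨hs1I, hs1⟩, hs1min⟩ := (isCompact_Icc.inter_right ((hc.good.cut.closed hU).preimage hφc)).exists_isLeast
    (s := Icc (0:ℝ) 1 ∩ (fun t : ℝ => φ t) ⁻¹' (Uᶜ ∪ arc c)) ⟨1, by norm_num, Or.inr (by simpa [hφ1] using hyK)⟩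
  have hs1 : φ s1 ∈ arc c := hs1.resolve_left fun h => h (hφU _)
  obtain ⟨s0, ⟨hs0I, hs0⟩, hs0max⟩ := (isCompact_Icc.inter_right (hGcl.preimage hφc)).exists_isGreatest
    (s := Icc (0:ℝ) s1 ∩ (fun t : ℝ => φ t) ⁻¹' (Uᶜ ∪ ⋃₀ G)) ⟨0, ⟨le_rfl, hs1I.1⟩, Or.inr ⟨κ0, hκ0, by simpa [hφ0] using hxκ⟩⟩
  obtain ⟨κ, hκ, hs0⟩ : φ s0 ∈ ⋃₀ G := hs0.resolve_left fun h => h (hφU _)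
  have hκW := hGW κ hκ
  obtain ⟨k, hk, hkκ⟩ := hF κ hκ.1
  have hs01 : s0 < s1 := lt_of_le_of_ne hs0I.2 fun h => (hκW hs0).1.2 (h ▸ hs1)
  have hs0I1 : s0 ∈ Icc (0:ℝ) 1 := ⟨hs0I.1, hs0I.2.trans hs1I.2⟩
  have hnK : ∀ t ∈ Ico s0 s1, φ t ∉ arc c := fun t ht h => by
    have := hs1min ⟨⟨hs0I.1.trans ht.1, ht.2.le.trans hs1I.2⟩, Or.inr h⟩
    linarith [ht.2]
  have hnG : ∀ t ∈ Ioo s0 s1, φ t ∉ ⋃₀ G := fun t ht h => by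
    have := hs0max ⟨⟨hs0I.1.trans ht.1.le, ht.2.le⟩, Or.inr h⟩
    linarith [ht.1]
  have hstemW : (fun t : ℝ => φ t) '' Ico s0 s1 ⊆ Wd U (arc c) E := by
    refine wd_preconn (isPreconnected_Ico.image _ hφc.continuousOn) ?_ ⟨φ s0, ⟨s0, ⟨le_rfl, hs01⟩, rfl⟩, hκW hs0⟩
    rintro _ ⟨t, ht, rfl⟩
    exact ⟨hφU _, hnK t ht⟩
  rw [← hkκ] at hs0
  obtain ⟨τ, hτ, hτe⟩ := hs0
  have hτI : τ ∈ Icc (0:ℝ) 1 := Ioo_subset_Icc_self hτ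
  obtain ⟨s, hs, hse⟩ := hs1
  set σ : ℝ → S := subarc (fun t : ℝ => φ t) s1 s0 with hσ
  have hσT : TArc σ := (line_tarc hφ).sub hs01.ne' hs1I hs0I1
  have hσarc : arc σ = (fun t : ℝ => φ t) '' Ioo s0 s1 := by
    rw [hσ, arc_subarc _ hs01.ne', min_eq_right hs01.le, max_eq_left hs01.le]
  have hσ0 : σ 0 = c s := by rw [hσ, subarc_zero, hse]
  have hσ1 : σ 1 = k τ := by rw [hσ, subarc_one, hτe]
  have hσP : arc σ ⊆ P := by rw [hσarc]; rintro _ ⟨t, -, rfl⟩; exact hφP (mem_range_self _)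
  have hσG : ∀ κ' ∈ G, Disjoint κ' (arc σ) := by
    intro κ' hκ'
    rw [hσarc, disjoint_left]
    rintro _ hx ⟨t, ht, rfl⟩
    exact hnG t ht ⟨κ', hκ', hx⟩
  have hτ1 : arc (subarc k τ 1) = k '' Ioo τ 1 := by rw [arc_subarc k hτ.2.ne, min_eq_left hτ.2.le, max_eq_right hτ.2.le]
  have hτ0 : arc (subarc k τ 0) = k '' Ioo 0 τ := by rw [arc_subarc k hτ.1.ne', min_eq_right hτ.1.le, max_eq_left hτ.1.le]
  have hk1 : k '' Ioo τ 1 ⊆ arc k := image_mono (Ioo_subset_Ioo hτ.1.le le_rfl)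
  have hk0 : k '' Ioo 0 τ ⊆ arc k := image_mono (Ioo_subset_Ioo le_rfl hτ.2.le)
  have hkτ : k τ ∈ arc k := ⟨τ, hτ, rfl⟩
  have hkd : Disjoint (arc k) (arc σ) := hkκ ▸ hσG κ hκ
  have hkW : arc k ⊆ Wd U (arc c) E := hkκ ▸ hκW
  have hγT : TArc (cat σ (subarc k τ 1)) := by
    refine TArc.cat hσT (hk.cut.tarc.sub hτ.2.ne hτI (by norm_num)) (by rw [hσ1, subarc_zero]) ?_ ?_ ?_ ?_ ?_
    · rw [hτ1]; exact hkd.symm.mono_right hk1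
    · rw [hτ1, hσ0]; exact fun h => (hkW (hk1 h)).1.2 ⟨s, hs, rfl⟩
    · rw [hσ0, hσ1]; exact fun h => (hkW hkτ).1.2 (h ▸ ⟨s, hs, rfl⟩)
    · rw [subarc_one]; exact fun h => hk.cut.right (hPU (hσP h))
    · rw [subarc_one, subarc_zero]; exact fun h => hk.cut.right (h ▸ hk.cut.sub hkτ)
  have hγarc : arc (cat σ (subarc k τ 1)) = arc σ ∪ k '' Ioo τ 1 ∪ {k τ} := by rw [arc_cat, hτ1, hσ1]
  obtain ⟨c1, hg1, hsub1, hW1, hd1⟩ := tripod hS hU hUc hN hPU hPE hE hc.good hs hγT (by rw [cat_zero, hσ0])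
    (by rw [hγarc]; exact union_subset (union_subset hσP (hk1.trans hk.sub)) (singleton_subset_iff.2 (hk.sub hkτ)))
    (by
      rw [hγarc]
      refine union_subset (union_subset ?_ (hk1.trans hkW)) (singleton_subset_iff.2 (hkW hkτ))
      rw [hσarc]; exact (image_mono Ioo_subset_Ico_self).trans hstemW)
    (by rw [cat_one, subarc_one]; exact hk.cut.right) (by rw [cat_one, subarc_one]; exact hk.b1)
  rw [hγarc] at hsub1 hd1
  have hsubA : arc c1 ⊆ arc c ∪ arc σ ∪ arc k := by
    intro z hz
    rcases hsub1 hz with h | (h | h) | h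
    · exact Or.inl (Or.inl h)
    · exact Or.inl (Or.inr h)
    · exact Or.inr (hk1 h)
    · exact Or.inr (by rw [mem_singleton_iff.1 h]; exact hkτ)
  -- disjointness of the other walls
  have hother : ∀ κ' ∈ F, κ' ≠ κ → (κ' ∩ Wd U (arc c) E).Nonempty → Disjoint κ' (arc c ∪ arc σ ∪ arc k) := by
    intro κ' hκ' hne hm
    rw [disjoint_union_right, disjoint_union_right]
    exact ⟨⟨hc.disj κ' hκ' hm, hσG κ' ⟨hκ', hm⟩⟩, hkκ ▸ hFd κ' hκ' κ hκ.1 hne⟩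
  by_cases hmeet : (κ ∩ Wd U (arc c1) E).Nonempty
  swap
  · refine ⟨c1, ⟨hg1, fun κ' hκ' hm => ?_⟩, hW1, κ, hκ.1, hκ.2, hmeet⟩
    have hne : κ' ≠ κ := fun h => hmeet (h ▸ hm)
    exact (hother κ' hκ' hne (hm.mono (inter_subset_inter_right _ hW1))).mono_right hsubA
  have hksplit : ∀ z ∈ arc k, z ∈ k '' Ioo 0 τ ∨ z ∈ k '' Ioo τ 1 ∪ {k τ} := by
    rintro _ ⟨t, ht, rfl⟩
    rcases lt_trichotomy t τ with h | h | h
    · exact Or.inl ⟨t, ⟨ht.1, h⟩, rfl⟩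
    · exact Or.inr (Or.inr (by rw [h]; rfl))
    · exact Or.inr (Or.inl ⟨t, ⟨h, ht.2⟩, rfl⟩)
  have hnot : ∀ z ∈ k '' Ioo τ 1 ∪ {k τ}, z ∉ Wd U (arc c1) E := by
    intro z hz hzW
    refine disjoint_left.1 hd1 hzW (Or.inr ?_)
    rcases hz with h | h
    · exact Or.inl (Or.inr h)
    · exact Or.inr h
  have hk0d : ∀ z ∈ k '' Ioo 0 τ, z ∉ arc c1 := by
    intro z hz hz1
    rcases hsub1 hz1 with h | (h | h) | h
    · exact (hkW (hk0 hz)).1.2 h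
    · exact disjoint_left.1 hkd (hk0 hz) h
    · obtain ⟨t, ht, rfl⟩ := hz
      obtain ⟨t', ht', he⟩ := h
      have := hk.cut.tarc.inj' ⟨hτ.1.trans ht'.1, ht'.2⟩ ⟨ht.1.le, ht.2.le.trans hτ.2.le⟩ he
      linarith [ht.2, ht'.1]
    · obtain ⟨t, ht, rfl⟩ := hz
      have := hk.cut.tarc.inj' ⟨ht.1, ht.2.trans hτ.2⟩ hτI h
      linarith [ht.2]
  obtain ⟨z, hzκ, hzW⟩ := hmeet
  rw [← hkκ] at hzκ
  have hz0 : z ∈ k '' Ioo 0 τ := (hksplit z hzκ).resolve_right fun h => hnot z h hzW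
  have hk0W : k '' Ioo 0 τ ⊆ Wd U (arc c1) E :=
    wd_preconn (hk.cut.tarc.preconn_image (Ioo_subset_Ioo le_rfl hτ.2.le)) (fun y hy => ⟨hk.cut.sub (hk0 hy), hk0d y hy⟩) ⟨z, hz0, hzW⟩
  have hkτ1 : k τ ∈ arc c1 := by
    by_contra hn
    have : k '' Ioc 0 τ ⊆ Wd U (arc c1) E := by
      refine wd_preconn (isPreconnected_Ioc.image _ (hk.cut.tarc.cont.mono fun t ht => ⟨ht.1.le, ht.2.trans hτ.2.le⟩)) ?_
        ⟨z, image_mono Ioo_subset_Ioc_self hz0, hzW⟩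
      rintro _ ⟨t, ht, rfl⟩
      rcases ht.2.lt_or_eq with h | h
      · exact ⟨hk.cut.sub (hk0 ⟨t, ⟨ht.1, h⟩, rfl⟩), hk0d _ ⟨t, ⟨ht.1, h⟩, rfl⟩⟩
      · rw [h]; exact ⟨hk.cut.sub hkτ, hn⟩
    exact hnot (k τ) (Or.inr rfl) (this ⟨τ, ⟨hτ.1, le_rfl⟩, rfl⟩)
  obtain ⟨s', hs', hse'⟩ := hkτ1
  obtain ⟨c2, hg2, hsub2, hW2, hd2⟩ := tripod hS hU hUc hN hPU hPE hE hg1 hs' (hk.cut.tarc.sub hτ.1.ne' hτI (by norm_num))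
    (by rw [subarc_zero, hse']) (by rw [hτ0]; exact hk0.trans hk.sub) (by rw [hτ0]; exact hk0W)
    (by rw [subarc_one]; exact hk.cut.left) (by rw [subarc_one]; exact hk.b0)
  rw [hτ0] at hsub2 hd2
  have hmeet2 : ¬ (κ ∩ Wd U (arc c2) E).Nonempty := by
    rintro ⟨w, hw, hwW⟩
    rw [← hkκ] at hw
    rcases hksplit w hw with h | h
    · exact disjoint_left.1 hd2 hwW (Or.inr h)
    · exact hnot w h (hW2 hwW)
  refine ⟨c2, ⟨hg2, fun κ' hκ' hm => ?_⟩, hW2.trans hW1, κ, hκ.1, hκ.2, hmeet2⟩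
  have hne : κ' ≠ κ := fun h => hmeet2 (h ▸ hm)
  refine (hother κ' hκ' hne (hm.mono (inter_subset_inter_right _ (hW2.trans hW1)))).mono_right ?_
  exact hsub2.trans (union_subset hsubA (fun z hz => Or.inr (hk0 hz)))

lemma inv_end (hS : LocallyEuclidean2 S) {U E B P : Set S} (hU : IsOpen U) (hUc : IsPreconnected U) (hN : Nonexc U E B)
    (hP : IsOpen P) (hPc : IsPreconnected P)
    (hPU : P ⊆ U) (hPE : Disjoint P E) (hE : (U ∩ E).Nonempty) {F : Set (Set S)} (hFf : F.Finite) (hFne : F.Nonempty)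
    (hF : ∀ κ ∈ F, ∃ k, Good U B P k ∧ arc k = κ) (hFd : ∀ κ ∈ F, ∀ κ' ∈ F, κ ≠ κ' → Disjoint κ κ') :
    ∃ c, Good U B P c ∧ ∀ κ ∈ F, Disjoint κ (Wd U (arc c) E) := by
  have key : ∀ n : ℕ, ∀ c, InvF U E B P F c → {κ ∈ F | (κ ∩ Wd U (arc c) E).Nonempty}.ncard ≤ n →
      ∃ c, Good U B P c ∧ ∀ κ ∈ F, Disjoint κ (Wd U (arc c) E) := by
    intro n
    induction n with
    | zero =>
      intro c hc hn
      have hem := (Set.ncard_eq_zero (hFf.subset (sep_subset _ _))).1 (Nat.le_zero.1 hn)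
      refine ⟨c, hc.good, fun κ hκ => ?_⟩
      rw [disjoint_iff_inter_eq_empty, ← not_nonempty_iff_eq_empty]
      intro hne
      have : κ ∈ {κ ∈ F | (κ ∩ Wd U (arc c) E).Nonempty} := ⟨hκ, hne⟩
      rw [hem] at this; exact this
    | succ n ih =>
      intro c hc hn
      by_cases hex : ∃ κ ∈ F, (κ ∩ Wd U (arc c) E).Nonempty
      · obtain ⟨c', hc', hW, κ, hκ, h1, h2⟩ := inv_step hS hU hUc hN hP hPc hPU hPE hE hFf hF hFd hc hex
        refine ih c' hc' ?_
        have : {κ ∈ F | (κ ∩ Wd U (arc c') E).Nonempty} ⊂ {κ ∈ F | (κ ∩ Wd U (arc c) E).Nonempty} := by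
          refine (ssubset_iff_of_subset ?_).2 ⟨κ, ⟨hκ, h1⟩, fun h => h2 h.2⟩
          exact fun κ' h => ⟨h.1, h.2.mono (inter_subset_inter_right _ hW)⟩
        have := Set.ncard_lt_ncard this (hFf.subset (sep_subset _ _))
        omega
      · push Not at hex
        exact ⟨c, hc.good, fun κ hκ => disjoint_iff_inter_eq_empty.2 (hex κ hκ)⟩
  obtain ⟨κ0, hκ0⟩ := hFne
  obtain ⟨k, hk, hke⟩ := hF κ0 hκ0
  refine key _ k ⟨hk, fun κ hκ hne => ?_⟩ le_rfl
  rw [hke]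
  refine hFd κ hκ κ0 hκ0 ?_
  rintro rfl
  obtain ⟨z, hz, hzW⟩ := hne
  exact hzW.1.2 (hke ▸ hz)

end TripodSec

open Set Metric Filter Topology
set_option linter.unusedSectionVars false

section WallSec

lemma exp_isOpenMap : IsOpenMap Complex.exp := by
  rw [isOpenMap_iff_nhds_le]
  intro z
  exact ((Complex.hasStrictDerivAt_exp z).map_nhds_eq (Complex.exp_ne_zero z)).ge

lemma exp_I_inj {s t : ℝ} (h : |s - t| < 2 * Real.pi) (he : Complex.exp (s * Complex.I) = Complex.exp (t * Complex.I)) : s = t := by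
  rw [Complex.exp_eq_exp_iff_exists_int] at he
  obtain ⟨n, hn⟩ := he
  have him := congrArg Complex.im hn
  simp at him
  have hst : s - t = n * (2 * Real.pi) := by linarith
  rw [hst, abs_mul, abs_of_pos Real.two_pi_pos] at h
  have : |(n:ℝ)| < 1 := by
    by_contra hc
    push Not at hc
    nlinarith [Real.two_pi_pos]
  have hn0 : n = 0 := by
    rw [← Int.cast_abs] at this
    have : |n| < 1 := by exact_mod_cast this
    exact Int.abs_lt_one_iff.1 this
  rw [hn0] at hst; simp at hst; linarith

variable {S : Type*} [MetricSpace S]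

/-- the parametrised circle of radius `ρ` in a chart -/
noncomputable def gc (Ω : ℂ → S) (ρ α : ℝ) : S := Ω (ρ * Complex.exp (α * Complex.I))

structure Wall (U C : Set S) (c : ℝ → S) : Prop where
  cut : Cut U c
  flat : ∀ x ∈ arc c, Flat (arc c) x
  loc : ∀ x ∈ arc c, ∀ᶠ y in 𝓝 x, (y ∈ C ↔ y ∈ arc c)

variable {Ω : ℂ → S} {ρ : ℝ} {U C : Set S}

lemma Wall.subC {c : ℝ → S} (h : Wall U C c) : arc c ⊆ C := fun x hx => (h.loc x hx).self_of_nhds.2 hx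

lemma gc_cont (hΩ : IsOpenEmbedding Ω) : Continuous (gc Ω ρ) := by
  unfold gc
  exact hΩ.continuous.comp (by fun_prop)

lemma gc_mem (hρ : 0 < ρ) (α : ℝ) : gc Ω ρ α ∈ Ω '' sphere 0 ρ :=
  ⟨_, by simp [Complex.norm_exp, abs_of_pos hρ], rfl⟩

lemma gc_surj {p : S} (hp : p ∈ Ω '' sphere 0 ρ) : ∃ α ∈ Icc (-Real.pi) Real.pi, gc Ω ρ α = p := by
  obtain ⟨z, hz, rfl⟩ := hp
  refine ⟨Complex.arg z, ⟨(Complex.neg_pi_lt_arg z).le, Complex.arg_le_pi z⟩, ?_⟩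
  rw [mem_sphere_zero_iff_norm] at hz
  rw [gc, ← hz, Complex.norm_mul_exp_arg_mul_I]

lemma gc_period (α : ℝ) (n : ℤ) : gc Ω ρ (α + n * (2 * Real.pi)) = gc Ω ρ α := by
  unfold gc
  congr 2
  rw [Complex.exp_eq_exp_iff_exists_int]
  exact ⟨n, by push_cast; ring⟩

lemma gc_inj (hΩ : IsOpenEmbedding Ω) (hρ : 0 < ρ) {s t : ℝ} (h : |s - t| < 2 * Real.pi) (he : gc Ω ρ s = gc Ω ρ t) : s = t := by
  have := hΩ.injective he
  exact exp_I_inj h (mul_left_cancel₀ (by exact_mod_cast hρ.ne') this)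

lemma gc_interval (hΩ : IsOpenEmbedding Ω) (hU : IsOpen U) {α : ℝ} (hα : gc Ω ρ α ∈ U)
    (hβ : ∃ β, gc Ω ρ β ∉ U) : ∃ l r, l < α ∧ α < r ∧ r - l ≤ 2 * Real.pi ∧ gc Ω ρ l ∉ U ∧ gc Ω ρ r ∉ U ∧
      ∀ t ∈ Ioo l r, gc Ω ρ t ∈ U := by
  obtain ⟨β, hβ⟩ := hβ
  have hcl : IsClosed {t | gc Ω ρ t ∉ U} := (hU.preimage (gc_cont hΩ)).isClosed_compl
  have hpi := Real.two_pi_pos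
  have hL : ({t | gc Ω ρ t ∉ U} ∩ Iic α).Nonempty := by
    obtain ⟨n, hn⟩ := exists_nat_gt ((β - α) / (2 * Real.pi))
    rw [div_lt_iff₀ hpi] at hn
    refine ⟨β + ((-n : ℤ):ℝ) * (2 * Real.pi), ?_, ?_⟩
    · show gc Ω ρ _ ∉ U
      rw [gc_period]; exact hβ
    · rw [mem_Iic]
      push_cast; linarith
  have hR : ({t | gc Ω ρ t ∉ U} ∩ Ici α).Nonempty := by
    obtain ⟨n, hn⟩ := exists_nat_gt ((α - β) / (2 * Real.pi))
    rw [div_lt_iff₀ hpi] at hn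
    refine ⟨β + ((n : ℤ):ℝ) * (2 * Real.pi), ?_, ?_⟩
    · show gc Ω ρ _ ∉ U
      rw [gc_period]; exact hβ
    · rw [mem_Ici]
      push_cast; linarith
  have bL : BddAbove ({t | gc Ω ρ t ∉ U} ∩ Iic α) := ⟨α, fun t ht => ht.2⟩
  have bR : BddBelow ({t | gc Ω ρ t ∉ U} ∩ Ici α) := ⟨α, fun t ht => ht.2⟩
  have mL := (hcl.inter isClosed_Iic).csSup_mem hL bL
  have mR := (hcl.inter isClosed_Ici).csInf_mem hR bR
  set l := sSup ({t | gc Ω ρ t ∉ U} ∩ Iic α)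
  set r := sInf ({t | gc Ω ρ t ∉ U} ∩ Ici α)
  have hl : l < α := lt_of_le_of_ne mL.2 fun h => mL.1 (h ▸ hα)
  have hr : α < r := lt_of_le_of_ne mR.2 fun h => mR.1 (h ▸ hα)
  have hin : ∀ t ∈ Ioo l r, gc Ω ρ t ∈ U := by
    intro t ht
    by_contra hc
    rcases le_total t α with h | h
    · exact absurd (le_csSup bL ⟨hc, h⟩) (not_le.2 ht.1)
    · exact absurd (csInf_le bR ⟨hc, h⟩) (not_le.2 ht.2)
  refine ⟨l, r, hl, hr, ?_, mL.1, mR.1, hin⟩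
  by_contra hc
  push Not at hc
  refine absurd (hin (l + ((1:ℤ):ℝ) * (2 * Real.pi)) ⟨by push_cast; linarith, by push_cast; linarith⟩) ?_
  rw [gc_period]; exact mL.1

lemma gc_flat (hΩ : IsOpenEmbedding Ω) (hρ : 0 < ρ) {l r α : ℝ} (hl : l < α) (hr : α < r) (hlr : r - l ≤ 2 * Real.pi) :
    ∃ ψ : ℂ → S, IsOpenEmbedding ψ ∧ ψ 0 = gc Ω ρ α ∧ (∀ z, ψ z ∈ gc Ω ρ '' Ioo l r ↔ z.im = 0) ∧
      (∀ z, ψ z ∈ Ω '' sphere 0 ρ ↔ z.im = 0) := by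
  have hm : 0 < min (α - l) (r - α) := lt_min (by linarith) (by linarith)
  have hρ' : (ρ:ℂ) ≠ 0 := by exact_mod_cast hρ.ne'
  set m := min (α - l) (r - α) with hmdef
  have hm1 : m ≤ α - l := min_le_left _ _
  have hm2 : m ≤ r - α := min_le_right _ _
  have hpi := Real.pi_pos
  have hemb : IsOpenEmbedding (fun z => Complex.exp ((α + mu m z) * Complex.I)) := by
    refine IsOpenEmbedding.of_continuous_injective_isOpenMap ?_ ?_ ?_
    · have := (mu_emb hm).continuous
      fun_prop
    · intro z w h
      beta_reduce at h
      rw [Complex.exp_eq_exp_iff_exists_int] at h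
      obtain ⟨n, hn⟩ := h
      have e1 : mu m z = mu m w + n * (2 * Real.pi) := by
        have : (α + mu m z) * Complex.I = (α + (mu m w + n * (2 * Real.pi))) * Complex.I := by rw [hn]; ring
        have := mul_right_cancel₀ Complex.I_ne_zero this
        exact add_left_cancel this
      have e2 := congrArg Complex.re e1
      simp at e2
      have z1 := (Complex.abs_re_le_norm _).trans_lt (mu_norm hm z)
      have w1 := (Complex.abs_re_le_norm _).trans_lt (mu_norm hm w)
      rw [abs_lt] at z1 w1
      have : |(n:ℝ)| < 1 := by
        rw [abs_lt]; constructor <;> nlinarith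
      have hn0 : n = 0 := by
        rw [← Int.cast_abs] at this
        have : |n| < 1 := by exact_mod_cast this
        exact Int.abs_lt_one_iff.1 this
      rw [hn0] at e1
      exact (mu_emb hm).injective (by simpa using e1)
    · have h1 : IsOpenMap (fun w : ℂ => (α + w) * Complex.I) :=
        ((Homeomorph.addLeft (α:ℂ)).trans (Homeomorph.mulRight₀ Complex.I Complex.I_ne_zero)).isOpenMap
      exact exp_isOpenMap.comp (h1.comp (mu_emb hm).isOpenMap)
  have hnorm : ∀ z, ‖(ρ:ℂ) * Complex.exp ((α + mu m z) * Complex.I)‖ = ρ ↔ z.im = 0 := by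
    intro z
    rw [← mu_im hm z, norm_mul, Complex.norm_exp, Complex.norm_real, Real.norm_of_nonneg hρ.le]
    have : ((α + mu m z) * Complex.I).re = - (mu m z).im := by simp
    rw [this]
    constructor
    · intro h
      have : Real.exp (-(mu m z).im) = 1 := mul_left_cancel₀ hρ.ne' (by linarith)
      rw [Real.exp_eq_one_iff] at this; linarith
    · intro h; simp [h]
  have hsph : ∀ z, Ω (ρ * Complex.exp ((α + mu m z) * Complex.I)) ∈ Ω '' sphere 0 ρ ↔ z.im = 0 := by
    intro z
    rw [hΩ.injective.mem_set_image, mem_sphere_zero_iff_norm]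
    exact hnorm z
  refine ⟨fun z => Ω (ρ * Complex.exp ((α + mu m z) * Complex.I)),
    hΩ.comp ((Homeomorph.mulLeft₀ (ρ:ℂ) hρ').isOpenEmbedding.comp hemb), by simp [mu_zero, gc], ?_, hsph⟩
  intro z
  constructor
  · rintro ⟨t, -, ht⟩
    beta_reduce at ht
    rw [← hsph z, ← ht]
    exact gc_mem hρ t
  · intro hz
    have hz' := (mu_im hm z).2 hz
    have z1 := (Complex.abs_re_le_norm _).trans_lt (mu_norm hm z)
    rw [abs_lt] at z1
    refine ⟨α + (mu m z).re, ⟨by linarith, by linarith⟩, ?_⟩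
    have hre : mu m z = ((mu m z).re : ℂ) := Complex.ext (by simp) (by simp [hz'])
    beta_reduce
    rw [gc]
    push_cast
    rw [← hre]

lemma circ_wall (hΩ : IsOpenEmbedding Ω) (hρ : 0 < ρ) (hU : IsOpen U) {α : ℝ} (hα : gc Ω ρ α ∈ U)
    (hβ : ∃ β, gc Ω ρ β ∉ U) : ∃ l r, l < α ∧ α < r ∧ r - l ≤ 2 * Real.pi ∧
      Wall U (Ω '' sphere 0 ρ) (fun t => gc Ω ρ (l + (r - l) * t)) ∧
      arc (fun t => gc Ω ρ (l + (r - l) * t)) = gc Ω ρ '' Ioo l r := by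
  obtain ⟨l, r, hl, hr, hlr, hlU, hrU, hin⟩ := gc_interval hΩ hU hα hβ
  have hrl : 0 < r - l := by linarith
  have harc : arc (fun t => gc Ω ρ (l + (r - l) * t)) = gc Ω ρ '' Ioo l r := by
    ext y; constructor
    · rintro ⟨t, ht, rfl⟩
      exact ⟨_, ⟨by nlinarith [ht.1], by nlinarith [ht.2]⟩, rfl⟩
    · rintro ⟨t, ht, rfl⟩
      refine ⟨(t - l) / (r - l), ⟨div_pos (by linarith [ht.1]) hrl, by rw [div_lt_one hrl]; linarith [ht.2]⟩, ?_⟩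
      beta_reduce
      congr 1
      field_simp; ring
  have hsub : gc Ω ρ '' Ioo l r ⊆ U := by rintro _ ⟨t, ht, rfl⟩; exact hin t ht
  have hfl : ∀ x ∈ gc Ω ρ '' Ioo l r, Flat (gc Ω ρ '' Ioo l r) x := by
    rintro _ ⟨t, ht, rfl⟩
    obtain ⟨ψ, h1, h2, h3, -⟩ := gc_flat hΩ hρ ht.1 ht.2 hlr
    exact ⟨ψ, h1, h2, h3⟩
  have h0 : gc Ω ρ (l + (r - l) * 0) = gc Ω ρ l := by simp
  have h1 : gc Ω ρ (l + (r - l) * 1) = gc Ω ρ r := by simp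
  refine ⟨l, r, hl, hr, hlr, ⟨⟨⟨?_, ?_, ?_, ?_, ∅, finite_empty, ?_⟩, ?_, ?_, ?_⟩, ?_, ?_⟩, harc⟩
  · exact ((gc_cont hΩ).comp (by fun_prop)).continuousOn
  · intro s hs t ht he
    have := gc_inj hΩ hρ (by
      rw [show l + (r - l) * s - (l + (r - l) * t) = (r - l) * (s - t) by ring, abs_mul, abs_of_pos hrl]
      have : |s - t| < 1 := by rw [abs_lt]; constructor <;> linarith [hs.1, hs.2, ht.1, ht.2]
      nlinarith) he
    have := mul_left_cancel₀ hrl.ne' (add_left_cancel this)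
    exact this
  · rw [harc]; beta_reduce; rw [h0]; exact fun h => hlU (hsub h)
  · rw [harc]; beta_reduce; rw [h1]; exact fun h => hrU (hsub h)
  · rintro t ⟨ht, -⟩
    have : gc Ω ρ (l + (r - l) * t) ∈ gc Ω ρ '' Ioo l r := harc ▸ ⟨t, ht, rfl⟩
    rw [harc]; exact hfl _ this
  · rw [harc]; exact hsub
  · beta_reduce; rw [h0]; exact hlU
  · beta_reduce; rw [h1]; exact hrU
  · rw [harc]; exact hfl
  · rw [harc]
    rintro _ ⟨t, ht, rfl⟩
    obtain ⟨ψ, h1, h2, h3, h4⟩ := gc_flat hΩ hρ ht.1 ht.2 hlr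
    have : range ψ ∈ 𝓝 (gc Ω ρ t) := by rw [← h2]; exact h1.isOpen_range.mem_nhds (mem_range_self 0)
    filter_upwards [this]
    rintro _ ⟨z, rfl⟩
    rw [h3, h4]

lemma wall_eq (hU : IsOpen U) {c c' : ℝ → S} (h : Wall U C c) (h' : Wall U C c') {p : S} (hp : p ∈ arc c) (hp' : p ∈ arc c') :
    arc c = arc c' := by
  have key : ∀ c c' : ℝ → S, Wall U C c → Wall U C c' → p ∈ arc c → p ∈ arc c' → arc c ⊆ arc c' := by
    intro c c' h h' hp hp'
    have hpc : IsPreconnected (arc c) := h.cut.tarc.preconn_image le_rfl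
    have hex : ∃ O : Set S, IsOpen O ∧ O ∩ C ⊆ arc c' ∧ arc c' ⊆ O := by
      refine ⟨interior {y | y ∈ C → y ∈ arc c'}, isOpen_interior, ?_, ?_⟩
      · rintro y ⟨h1, h2⟩; exact interior_subset h1 h2
      · intro y hy
        rw [mem_interior_iff_mem_nhds]
        filter_upwards [h'.loc y hy] with w hw using hw.1
    obtain ⟨O, hO, hO1, hO2⟩ := hex
    have hcl := h'.cut.closed hU
    by_contra hne
    obtain ⟨q, hq, hq'⟩ := not_subset.1 hne
    obtain ⟨w, hw, hwO, hwc⟩ := hpc O (Uᶜ ∪ arc c')ᶜ hO hcl.isOpen_compl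
      (fun y hy => by
        by_cases hy' : y ∈ arc c'
        · exact Or.inl (hO2 hy')
        · exact Or.inr (by rintro (h1 | h1); exacts [h1 (h.cut.sub hy), hy' h1])) ⟨p, hp, hO2 hp'⟩
      ⟨q, hq, by rintro (h1 | h1); exacts [h1 (h.cut.sub hq), hq' h1]⟩
    exact hwc (Or.inr (hO1 ⟨hwO, h.subC hw⟩))
  exact (key c c' h h' hp hp').antisymm (key c' c h' h hp' hp)

lemma circ_hits {X : Set S} (hΩ : IsOpenEmbedding Ω) (hX : IsPreconnected X) (h1 : (X ∩ Ω '' ball 0 ρ).Nonempty)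
    (h2 : (X ∩ (Ω '' closedBall 0 ρ)ᶜ).Nonempty) : (X ∩ Ω '' sphere 0 ρ).Nonempty := by
  by_contra hc
  have hcl : IsClosed (Ω '' closedBall 0 ρ) := ((isCompact_closedBall _ _).image hΩ.continuous).isClosed
  obtain ⟨w, -, ⟨z, hz, rfl⟩, hw2⟩ := hX (Ω '' ball 0 ρ) (Ω '' closedBall 0 ρ)ᶜ (hΩ.isOpenMap _ isOpen_ball) hcl.isOpen_compl
    (fun y hy => by
      by_cases hy' : y ∈ Ω '' closedBall 0 ρ
      · left
        obtain ⟨z, hz, rfl⟩ := hy'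
        rcases (mem_closedBall.1 hz).lt_or_eq with h | h
        · exact ⟨z, h, rfl⟩
        · exact absurd ⟨_, hy, z, h, rfl⟩ hc
      · exact Or.inr hy') h1 h2
  exact hw2 ⟨z, ball_subset_closedBall hz, rfl⟩

end WallSec

open Set Metric Filter Topology
set_option linter.unusedSectionVars false

section ParitySec
variable {S : Type*} [MetricSpace S] {U C : Set S}

lemma NoJump.add_const {f g : S → ZMod 2} {H : Set S} {x : S} (hf : NoJump f H x) (hg : ∀ᶠ y in 𝓝 x, g y = g x) :
    NoJump (fun y => f y + g y) H x := hf.add (NoJump.of_const hg)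

lemma lcon_sum {ι : Type*} (F : Finset ι) (q : ι → S → ZMod 2) {x : S} (h : ∀ i ∈ F, ∀ᶠ y in 𝓝 x, q i y = q i x) :
    ∀ᶠ y in 𝓝 x, ∑ i ∈ F, q i y = ∑ i ∈ F, q i x := by
  have : ∀ᶠ y in 𝓝 x, ∀ i ∈ F, q i y = q i x := (Filter.eventually_all_finset F).2 h
  filter_upwards [this] with y hy
  exact Finset.sum_congr rfl hy

def QQ (U : Set S) (f0 : S → ZMod 2) (x y : S) (κ : Set S) (q : S → ZMod 2) : Prop :=
  LCon q (U \ κ) ∧ q x = q y ∧ ∀ p ∈ κ, NoJump (fun z => f0 z + q z) κ p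

lemma wall_parity (hS : LocallyEuclidean2 S) (hU : IsOpen U) (hUc : IsPreconnected U) (hC : IsClosed C) {f0 : S → ZMod 2}
    (hf0 : LCon f0 (U \ C)) {x y : S} (hx : x ∈ U \ C) (hy : y ∈ U \ C)
    (h : ∀ p ∈ U ∩ C, ∃ c, Wall U C c ∧ p ∈ arc c ∧ ∃ q, QQ U f0 x y (arc c) q) : f0 x = f0 y := by
  classical
  by_cases hxy : x = y
  · rw [hxy]
  obtain ⟨φ, hφ, hφU, hφ0, hφ1⟩ := common_chart hS hU hUc hx.1 hy.1 hxy
  set Γ : Set S := (fun t : ℝ => φ t) '' Icc 0 1 with hΓ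
  have hφc : Continuous (fun t : ℝ => φ t) := hφ.continuous.comp Complex.continuous_ofReal
  have hΓk : IsCompact Γ := isCompact_Icc.image hφc
  have hΓc : IsPreconnected Γ := isPreconnected_Icc.image _ hφc.continuousOn
  have hΓU : Γ ⊆ U := by rintro _ ⟨t, -, rfl⟩; exact hφU (mem_range_self _)
  have hxΓ : x ∈ Γ := ⟨0, by simp, by simpa using hφ0⟩
  have hyΓ : y ∈ Γ := ⟨1, by simp, by simpa using hφ1⟩
  choose! c hcW hpc hq using h
  have hnb : ∀ p ∈ Γ ∩ C, {z | z ∈ C ↔ z ∈ arc (c p)} ∈ 𝓝 p := fun p hp =>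
    (hcW p ⟨hΓU hp.1, hp.2⟩).loc p (hpc p ⟨hΓU hp.1, hp.2⟩)
  obtain ⟨t, htΓ, htc⟩ := (hΓk.inter_right hC).elim_nhds_subcover _ hnb
  have hqq : ∀ κ : Set S, ∃ q : S → ZMod 2, (∃ p ∈ t, arc (c p) = κ) → QQ U f0 x y κ q := by
    intro κ
    by_cases hk : ∃ p ∈ t, arc (c p) = κ
    · obtain ⟨p, hp, rfl⟩ := hk
      obtain ⟨q, hq⟩ := hq p ⟨hΓU (htΓ p hp).1, (htΓ p hp).2⟩
      exact ⟨q, fun _ => hq⟩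
    · exact ⟨0, fun h => absurd h hk⟩
  choose q hq using hqq
  set F : Finset (Set S) := t.image fun p => arc (c p) with hF
  have hFm : ∀ κ ∈ F, ∃ p ∈ t, arc (c p) = κ := fun κ hκ => by simpa [hF] using hκ
  have hFC : ∀ κ ∈ F, κ ⊆ C := by
    intro κ hκ
    obtain ⟨p, hp, rfl⟩ := hFm κ hκ
    exact (hcW p ⟨hΓU (htΓ p hp).1, (htΓ p hp).2⟩).subC
  -- unique wall through each crossing
  have hcov : ∀ z ∈ Γ ∩ C, ∃ p ∈ t, z ∈ arc (c p) ∧ Wall U C (c p) := by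
    intro z hz
    obtain ⟨p, hp, hzp⟩ := mem_iUnion₂.1 (htc hz)
    exact ⟨p, hp, hzp.1 hz.2, hcW p ⟨hΓU (htΓ p hp).1, (htΓ p hp).2⟩⟩
  have hmain : (fun z => f0 z + ∑ κ ∈ F, q κ z) x = (fun z => f0 z + ∑ κ ∈ F, q κ z) y := by
    refine nojump_const (f := fun z => f0 z + ∑ κ ∈ F, q κ z) (H := C) hΓc ?_ ?_ hxΓ hyΓ hx.2 hy.2
    · intro z hz
      by_cases hzC : z ∈ C
      · obtain ⟨p, hp, hzp, hW⟩ := hcov z ⟨hz, hzC⟩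
        have hmem : arc (c p) ∈ F := Finset.mem_image_of_mem _ hp
        have h1 := (hq (arc (c p)) ⟨p, hp, rfl⟩).2.2 z hzp
        have h2 : ∀ᶠ w in 𝓝 z, ∑ κ ∈ F.erase (arc (c p)), q κ w = ∑ κ ∈ F.erase (arc (c p)), q κ z := by
          refine lcon_sum _ q fun κ hκ => ?_
          have hκF := Finset.mem_of_mem_erase hκ
          obtain ⟨p', hp', rfl⟩ := hFm κ hκF
          refine (hq _ ⟨p', hp', rfl⟩).1 z ⟨hΓU hz, fun hz' => Finset.ne_of_mem_erase hκ ?_⟩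
          exact wall_eq hU (hcW p' ⟨hΓU (htΓ p' hp').1, (htΓ p' hp').2⟩) hW hz' hzp
        have h3 := (h1.add_const (g := fun w => ∑ κ ∈ F.erase (arc (c p)), q κ w) h2).congr_set (H' := C)
          ((hW.loc z hzp).mono fun w hw => hw.symm)
        convert h3 using 2 with w
        rw [← Finset.add_sum_erase F _ hmem, add_assoc]
      · refine NoJump.of_const ?_
        have h2 := lcon_sum F q (x := z) fun κ hκ => by
          obtain ⟨p, hp, rfl⟩ := hFm κ hκ
          exact (hq _ ⟨p, hp, rfl⟩).1 z ⟨hΓU hz, fun hz' => hzC (hFC _ hκ hz')⟩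
        filter_upwards [h2, hf0 z ⟨hΓU hz, hzC⟩] with w hw1 hw2
        rw [hw1, hw2]
    · intro z hz
      by_cases hzC : z ∈ C
      · obtain ⟨p, hp, hzp, hW⟩ := hcov z ⟨hz, hzC⟩
        exact ((hW.flat z hzp).congr ((hW.loc z hzp).mono fun w hw => hw.symm)).mem_closure
      · exact subset_closure hzC
  have hs : ∑ κ ∈ F, q κ x = ∑ κ ∈ F, q κ y :=
    Finset.sum_congr rfl fun κ hκ => by
      obtain ⟨p, hp, rfl⟩ := hFm κ hκ
      exact (hq _ ⟨p, hp, rfl⟩).2.1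
  beta_reduce at hmain
  rw [hs] at hmain
  exact add_right_cancel hmain

/-- a separating wall provides a correction function -/
lemma wall_q (hS : LocallyEuclidean2 S) (hU : IsOpen U) (hUc : IsPreconnected U) {f0 : S → ZMod 2}
    (hf0 : LCon f0 (U \ C)) {x y : S} {c : ℝ → S} (hc : Wall U C c) {E : Set S} (hd : Disjoint (arc c) E)
    (hE : (U ∩ E).Nonempty) (hs : SepK U (arc c) E) (hxy : qf U (arc c) E x = qf U (arc c) E y) :
    ∃ q, QQ U f0 x y (arc c) q := by
  have hl : ∀ p ∈ arc c, LocOff f0 (arc c) p := by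
    intro p hp
    filter_upwards [hU.mem_nhds (hc.cut.sub hp), hc.loc p hp] with y hyU hy hyc
    exact hf0 y ⟨hyU, fun h => hyc (hy.1 h)⟩
  have ht0 : (1/2 : ℝ) ∈ Ioo (0:ℝ) 1 := by norm_num
  by_cases hj : ∃ p ∈ arc c, NoJump f0 (arc c) p
  · refine ⟨0, fun z _ => by simp, rfl, ?_⟩
    obtain ⟨_, ⟨s, hs, rfl⟩, hp⟩ := hj
    rintro _ ⟨t, ht, rfl⟩
    simp only [Pi.zero_apply, add_zero]
    exact jumpall hS hc.cut.tarc (fun t ht => hl _ ⟨t, ht, rfl⟩) hs (hc.flat _ ⟨s, hs, rfl⟩) hp t ht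
  · push Not at hj
    have hql := qf_lcon (E := E) hS (hc.cut.open hU)
    refine ⟨qf U (arc c) E, hql, hxy, fun p hp => ?_⟩
    exact jump_add (hc.flat p hp) (hl p hp) (hql.locOff hU (hc.cut.sub hp)) (hj p hp)
      (q_jump hS hU hUc hc.cut hd hE hs (hc.flat p hp))

end ParitySec

open Set Metric Filter Topology
set_option linter.unusedSectionVars false

section StarSec
variable {S : Type*} [MetricSpace S]

lemma ulc {T : Set S} (hT : IsCompact T) [LocallyConnectedSpace T] {ε : ℝ} (hε : 0 < ε) :
    ∃ δ > 0, ∀ p ∈ T, ∀ p' ∈ T, dist p p' < δ → ∃ Z ⊆ T, IsPreconnected Z ∧ p ∈ Z ∧ p' ∈ Z ∧ Z ⊆ ball p ε := by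
  haveI : CompactSpace T := isCompact_iff_compactSpace.1 hT
  have h1 : ∀ x : T, ∃ V : Set T, V ⊆ ball x (ε / 2) ∧ IsOpen V ∧ x ∈ V ∧ IsConnected V := fun x =>
    locallyConnectedSpace_iff_subsets_isOpen_isConnected.1 inferInstance x _ (ball_mem_nhds x (half_pos hε))
  choose V hV1 hV2 hV3 hV4 using h1
  obtain ⟨δ, hδ, hl⟩ := lebesgue_number_lemma_of_metric (isCompact_univ (X := T)) hV2 fun x _ => mem_iUnion.2 ⟨x, hV3 x⟩
  refine ⟨δ, hδ, fun p hp p' hp' hd => ?_⟩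
  obtain ⟨i, hi⟩ := hl ⟨p, hp⟩ (mem_univ _)
  have hpi : (⟨p, hp⟩ : T) ∈ V i := hi (mem_ball_self hδ)
  refine ⟨Subtype.val '' V i, by rintro _ ⟨x, -, rfl⟩; exact x.2, (hV4 i).isPreconnected.image _ continuous_subtype_val.continuousOn,
    ⟨_, hpi, rfl⟩, ⟨⟨p', hp'⟩, hi ?_, rfl⟩, ?_⟩
  · rw [mem_ball, dist_comm]; exact hd
  · rintro _ ⟨x, hx, rfl⟩
    have e1 := mem_ball.1 (hV1 i hx)
    have e2 := mem_ball.1 (hV1 i hpi)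
    rw [mem_ball]
    calc dist (x : S) p ≤ dist (x:S) i + dist (i:S) p := dist_triangle _ _ _
      _ < ε := by
        rw [dist_comm (i:S) p]
        have e1' : dist (x:S) (i:S) < ε / 2 := e1
        have e2' : dist p (i:S) < ε / 2 := e2
        linarith

variable {Ω : ℂ → S} {ρ : ℝ} {U C : Set S}

lemma gc_unif (hΩ : IsOpenEmbedding Ω) (hρ : 0 < ρ) {ε : ℝ} (hε : 0 < ε) :
    ∃ δ > 0, ∀ s t, |s - t| < δ → dist (gc Ω ρ s) (gc Ω ρ t) < ε := by
  have h1 := (isCompact_sphere (0:ℂ) ρ).uniformContinuousOn_of_continuous hΩ.continuous.continuousOn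
  obtain ⟨δ, hδ, h⟩ := Metric.uniformContinuousOn_iff.1 h1 ε hε
  have hu := (lipschitzWith_circleMap (0:ℂ) ρ).uniformContinuous
  obtain ⟨δ', hδ', h'⟩ := Metric.uniformContinuous_iff.1 hu δ hδ
  refine ⟨δ', hδ', fun s t hst => ?_⟩
  have := h' (a := s) (b := t) (by rw [Real.dist_eq]; exact hst)
  have hc : ∀ t, gc Ω ρ t = Ω (circleMap 0 ρ t) := fun t => by simp [gc, circleMap]
  rw [hc, hc]
  exact h _ (circleMap_mem_sphere _ hρ.le _) _ (circleMap_mem_sphere _ hρ.le _) this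

lemma short_walls (hΩ : IsOpenEmbedding Ω) {T : Set S} (hT : IsCompact T) [LocallyConnectedSpace T] :
    ∃ ε > 0, ∀ l r, l < r → r - l < ε → gc Ω (1/2) l ∈ T → gc Ω (1/2) r ∈ T → ∃ z ∈ sphere (0:ℂ) (1/2),
      gc Ω (1/2) '' Icc l r ⊆ Ω '' closedBall z (1/8) ∧
      ∃ Z ⊆ T, IsPreconnected Z ∧ gc Ω (1/2) l ∈ Z ∧ gc Ω (1/2) r ∈ Z ∧ Z ⊆ Ω '' closedBall z (1/8) := by
  have hh : (0:ℝ) < 1/2 := by norm_num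
  obtain ⟨ε, hε, hl⟩ := lebesgue_number_lemma_of_metric (ι := sphere (0:ℂ) (1/2)) (c := fun z => Ω '' ball (z:ℂ) (1/8))
    ((isCompact_sphere (0:ℂ) (1/2)).image hΩ.continuous) (fun z => hΩ.isOpenMap _ isOpen_ball) (by
      rintro _ ⟨z, hz, rfl⟩
      exact mem_iUnion.2 ⟨⟨z, hz⟩, z, mem_ball_self (by norm_num), rfl⟩)
  obtain ⟨δ1, hδ1, h1⟩ := ulc hT hε
  obtain ⟨δ2, hδ2, h2⟩ := gc_unif hΩ hh (lt_min hε hδ1)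
  refine ⟨δ2, hδ2, fun l r hlr hsm hlT hrT => ?_⟩
  obtain ⟨⟨z, hz⟩, hb⟩ := hl (gc Ω (1/2) l) (gc_mem hh l)
  have hb' : ball (gc Ω (1/2) l) ε ⊆ Ω '' closedBall z (1/8) := hb.trans (image_mono ball_subset_closedBall)
  refine ⟨z, hz, ?_, ?_⟩
  · rintro _ ⟨t, ht, rfl⟩
    refine hb' (mem_ball.2 ((h2 t l ?_).trans_le (min_le_left _ _)))
    rw [abs_of_nonneg] <;> linarith [ht.1, ht.2]
  · obtain ⟨Z, hZ1, hZ2, hZ3, hZ4, hZ5⟩ := h1 _ hlT _ hrT ((h2 l r (by rw [abs_sub_comm, abs_of_pos] <;> linarith)).trans_le (min_le_right _ _))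
    exact ⟨Z, hZ1, hZ2, hZ3, hZ4, hZ5.trans hb'⟩

lemma Cut.end0 {c : ℝ → S} (h : Cut U c) (hU : IsOpen U) : c 0 ∈ frontier U := by
  have h0 : c 0 ∈ closure (arc c) := by
    have : (0:ℝ) ∈ closure (Ioo (0:ℝ) 1) := by rw [closure_Ioo (by norm_num)]; simp
    exact ((h.tarc.cont 0 (by simp)).mono Ioo_subset_Icc_self).mem_closure_image this
  rw [hU.frontier_eq]
  exact ⟨closure_mono h.sub h0, h.left⟩

lemma Cut.end1 {c : ℝ → S} (h : Cut U c) (hU : IsOpen U) : c 1 ∈ frontier U := by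
  have h0 : c 1 ∈ closure (arc c) := by
    have : (1:ℝ) ∈ closure (Ioo (0:ℝ) 1) := by rw [closure_Ioo (by norm_num)]; simp
    exact ((h.tarc.cont 1 (by simp)).mono Ioo_subset_Icc_self).mem_closure_image this
  rw [hU.frontier_eq]
  exact ⟨closure_mono h.sub h0, h.right⟩

structure Cfg (X A B : Set S) (Ωa Ωb : ℂ → S) : Prop where
  hX : IsClosed X
  hXc : IsPreconnected X
  AX : A ⊆ X
  BX : B ⊆ X
  Ac : IsPreconnected A
  Bc : IsPreconnected B
  ea : IsOpenEmbedding Ωa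
  eb : IsOpenEmbedding Ωb
  disj : Disjoint (range Ωa) (range Ωb)
  a0 : Ωa 0 ∈ X
  b0 : Ωb 0 ∈ X
  XA : X ∩ range Ωa ⊆ A
  XB : X ∩ range Ωb ⊆ B
  AE : Disjoint A (range Ωb)
  BE : Disjoint B (range Ωa)

variable {X A B : Set S} {Ωa Ωb : ℂ → S}

lemma obox_norm {z : ℂ} (hz : z ∈ obox) : ‖z‖ < 2 := by
  have := Complex.norm_le_abs_re_add_abs_im z
  linarith [hz.1, hz.2]

lemma circ_exit (hΩ : IsOpenEmbedding Ω) (hρ : 0 < ρ) (hXc : IsPreconnected X) (h0 : Ω 0 ∈ X) {b : S} (hb : b ∈ X)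
    (hbΩ : b ∉ Ω '' closedBall 0 ρ) (hUX : U ⊆ Xᶜ) : ∃ β, gc Ω ρ β ∉ U := by
  obtain ⟨p, hp, hps⟩ := circ_hits (ρ := ρ) hΩ hXc ⟨_, h0, 0, mem_ball_self hρ, rfl⟩ ⟨b, hb, hbΩ⟩
  obtain ⟨β, -, rfl⟩ := gc_surj hps
  exact ⟨β, fun h => hUX h hp⟩

lemma isClosed_im (hΩ : IsOpenEmbedding Ω) {K : Set ℂ} (hK : IsCompact K) : IsClosed (Ω '' K) :=
  (hK.image hΩ.continuous).isClosed

lemma lemY (hS : LocallyEuclidean2 S) (h : Cfg X A B Ωa Ωb) (hU : IsComplementaryDomain X U) (hN : Nonexc U (Ωb '' obox) A)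
    {x y : S} (hx : x ∈ U ∩ Ωb '' obox) (hy : y ∈ U ∩ Ωb '' obox) :
    y ∈ connectedComponentIn (U \ Ωa '' closedBall 0 2) x := by
  classical
  have hUo := dom_open hS h.hX hU
  have hUc := (dom_conn hU).isPreconnected
  have h2 : (0:ℝ) < 2 := by norm_num
  have hO : IsOpen (U \ Ωa '' closedBall 0 2) := hUo.sdiff (isClosed_im h.ea (isCompact_closedBall _ _))
  have hoff : ∀ z ∈ Ωb '' obox, z ∉ range Ωa := fun z hz hz' =>
    disjoint_left.1 h.disj hz' (image_subset_range _ _ hz)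
  set O := U \ Ωa '' closedBall 0 2 with hOd
  have hxO : x ∈ O := ⟨hx.1, fun hh => hoff x hx.2 (image_subset_range _ _ hh)⟩
  have hyO : y ∈ O := ⟨hy.1, fun hh => hoff y hy.2 (image_subset_range _ _ hh)⟩
  set f0 : S → ZMod 2 := fun z => if z ∈ connectedComponentIn O x then 1 else 0 with hf0
  have hlc : LCon f0 (U \ Ωa '' sphere 0 2) := by
    rintro z ⟨hzU, hzC⟩
    by_cases hz : z ∈ Ωa '' closedBall 0 2
    · have hzb : z ∈ Ωa '' ball 0 2 := by
        obtain ⟨w, hw, rfl⟩ := hz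
        rcases (mem_closedBall.1 hw).lt_or_eq with h' | h'
        · exact ⟨w, h', rfl⟩
        · exact absurd ⟨w, h', rfl⟩ hzC
      have hno : ∀ w ∈ Ωa '' ball 0 2, f0 w = 0 := by
        intro w hw
        simp only [hf0]
        rw [if_neg]
        intro hw'
        exact (connectedComponentIn_subset _ _ hw').2 (image_mono ball_subset_closedBall hw)
      filter_upwards [(h.ea.isOpenMap _ isOpen_ball).mem_nhds hzb] with w hw
      rw [hno w hw, hno z hzb]
    · have hzO : z ∈ O := ⟨hzU, hz⟩
      filter_upwards [comp_lcon hS hO hzO] with w hw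
      simp only [hf0]
      have he : w ∈ connectedComponentIn O x ↔ z ∈ connectedComponentIn O x := by
        have e1 := connectedComponentIn_eq hw
        constructor
        · intro h'
          rw [connectedComponentIn_eq h', ← e1]; exact mem_connectedComponentIn hzO
        · intro h'
          rw [connectedComponentIn_eq h']; exact hw
      by_cases hz' : z ∈ connectedComponentIn O x
      · rw [if_pos hz', if_pos (he.2 hz')]
      · rw [if_neg hz', if_neg (fun h' => hz' (he.1 h'))]
  have hCoff : ∀ z ∈ Ωb '' obox, z ∉ Ωa '' sphere 0 2 := fun z hz hz' => hoff z hz (image_subset_range _ _ hz')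
  have key : f0 x = f0 y := by
    refine wall_parity hS hUo hUc (isClosed_im h.ea (isCompact_sphere _ _)) hlc ⟨hx.1, hCoff x hx.2⟩ ⟨hy.1, hCoff y hy.2⟩ ?_
    rintro p ⟨hpU, hpC⟩
    obtain ⟨α, -, rfl⟩ := gc_surj hpC
    obtain ⟨l, r, hl, hr, hlr, hW, harc⟩ := circ_wall h.ea h2 hUo hpU (circ_exit h.ea h2 h.hXc h.a0 h.b0
      (fun hh => disjoint_left.1 h.disj (image_subset_range _ _ hh) (mem_range_self 0)) (dom_sub hU))
    refine ⟨_, hW, harc ▸ ⟨α, ⟨hl, hr⟩, rfl⟩, ?_⟩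
    have hd : Disjoint (arc fun t => gc Ωa 2 (l + (r - l) * t)) (Ωb '' obox) :=
      disjoint_left.2 fun z hz hz' => hCoff z hz' (hW.subC hz)
    have hfr := dom_frontier hS h.hX hU
    refine wall_q hS hUo hUc hlc hW hd ⟨x, hx⟩ (hN _ hW.cut ?_ ?_ hd) ?_
    · exact h.XA ⟨hfr (hW.cut.end0 hUo), mem_range_self _⟩
    · exact h.XA ⟨hfr (hW.cut.end1 hUo), mem_range_self _⟩
    · rw [qf_mem ⟨hx.1, fun hh => disjoint_left.1 hd hh hx.2⟩ hx.2, qf_mem ⟨hy.1, fun hh => disjoint_left.1 hd hh hy.2⟩ hy.2]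
  by_contra hny
  simp only [hf0] at key
  rw [if_pos (mem_connectedComponentIn hxO), if_neg hny] at key
  exact one_ne_zero key

lemma star (hS : LocallyEuclidean2 S) [CompactSpace S] (h : Cfg X A B Ωa Ωb) (hU : IsComplementaryDomain X U)
    (hlcT : LocallyConnectedSpace (frontier U)) (hN : Nonexc U (Ωa '' obox) B) :
    ∃ F : Set (Set S), F.Finite ∧ (∀ κ ∈ F, ∃ k, Wall U (Ωb '' sphere 0 (1/2)) k ∧ arc k = κ) ∧
      ∀ Z : Set S, IsPreconnected Z → Z ⊆ U → (∀ κ ∈ F, Disjoint Z κ) → (Z ∩ Ωa '' obox).Nonempty →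
        (Z ∩ Ωb '' ball 0 (1/4)).Nonempty → False := by
  classical
  have hUo := dom_open hS h.hX hU
  have hUc := (dom_conn hU).isPreconnected
  have hh : (0:ℝ) < 1/2 := by norm_num
  obtain ⟨ε, hε, hsw⟩ := short_walls (T := frontier U) h.eb isClosed_frontier.isCompact
  obtain ⟨J, hJ⟩ := exists_nat_gt (4 * Real.pi / (ε / 2))
  rw [div_lt_iff₀ (half_pos hε)] at hJ
  set Net : Set S := (fun j : ℤ => gc Ωb (1/2) (j * (ε / 2))) '' (Icc (-(J:ℤ)) J) with hNet
  have hNetf : Net.Finite := (finite_Icc _ _).image _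
  set C := Ωb '' sphere 0 (1/2) with hC
  set F : Set (Set S) := {κ | ∃ k, Wall U C k ∧ arc k = κ ∧ (κ ∩ Net).Nonempty} with hF
  have hFf : F.Finite := by
    haveI : Nonempty S := ⟨Ωa 0⟩
    have : ∀ κ ∈ F, ∃ p ∈ Net, p ∈ κ := fun κ ⟨k, _, _, p, h1, h2⟩ => ⟨p, h2, h1⟩
    choose! g hg1 hg2 using this
    refine Set.Finite.of_finite_image (hNetf.subset (image_subset_iff.2 fun κ hκ => hg1 κ hκ)) ?_
    intro κ hκ κ' hκ' he
    have h1 := hg2 κ hκ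
    have h2 := hg2 κ' hκ'
    obtain ⟨k, hk, hk2, -⟩ := hκ
    obtain ⟨k', hk', hk2', -⟩ := hκ'
    subst hk2 hk2'
    rw [← he] at h2
    exact wall_eq hUo hk hk' h1 h2
  refine ⟨F, hFf, fun κ ⟨k, hk, hk2, _⟩ => ⟨k, hk, hk2⟩, ?_⟩
  rintro Z hZ hZU hZF ⟨x, hxZ, hxa⟩ ⟨y, hyZ, hyb⟩
  have hxr : x ∉ range Ωb := fun hh => disjoint_left.1 h.disj (image_subset_range _ _ hxa) hh
  have hxC : x ∉ C := fun hh => hxr (image_subset_range _ _ hh)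
  have hyC : y ∉ C := by
    rintro ⟨w, hw, hwy⟩
    obtain ⟨v, hv, rfl⟩ := hyb
    have := h.eb.injective hwy
    subst this
    rw [mem_sphere_zero_iff_norm] at hw
    rw [mem_ball_zero_iff] at hv
    linarith
  set f0 : S → ZMod 2 := fun z => if z ∈ Ωb '' ball 0 (1/2) then 1 else 0 with hf0
  have hlc : LCon f0 (U \ C) := by
    rintro z ⟨hzU, hzC⟩
    by_cases hz : z ∈ Ωb '' ball 0 (1/2)
    · filter_upwards [(h.eb.isOpenMap _ isOpen_ball).mem_nhds hz] with w hw
      simp only [hf0]; rw [if_pos hz, if_pos hw]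
    · have hz' : z ∈ (Ωb '' closedBall 0 (1/2))ᶜ := by
        rintro ⟨w, hw, rfl⟩
        rcases (mem_closedBall.1 hw).lt_or_eq with h' | h'
        · exact hz ⟨w, h', rfl⟩
        · exact hzC ⟨w, h', rfl⟩
      filter_upwards [(isClosed_im h.eb (isCompact_closedBall _ _)).isOpen_compl.mem_nhds hz'] with w hw
      simp only [hf0]; rw [if_neg hz, if_neg (fun h' => hw (image_mono ball_subset_closedBall h'))]
  have hfr := dom_frontier hS h.hX hU
  have key : f0 x = f0 y := by
    refine wall_parity hS hUo hUc (isClosed_im h.eb (isCompact_sphere _ _)) hlc ⟨hZU hxZ, hxC⟩ ⟨hZU hyZ, hyC⟩ ?_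
    rintro p ⟨hpU, hpC⟩
    obtain ⟨α, hα, rfl⟩ := gc_surj hpC
    obtain ⟨l, r, hl, hr, hlr, hW, harc⟩ := circ_wall h.eb hh hUo hpU (circ_exit h.eb hh h.hXc h.b0 h.a0
      (fun hh => disjoint_left.1 h.disj (mem_range_self 0) (image_subset_range _ _ hh)) (dom_sub hU))
    refine ⟨_, hW, harc ▸ ⟨α, ⟨hl, hr⟩, rfl⟩, ?_⟩
    have e0 := hW.cut.end0 hUo
    have e1 := hW.cut.end1 hUo
    have hda : Disjoint (arc fun t => gc Ωb (1/2) (l + (r - l) * t)) (Ωa '' obox) := by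
      refine (h.disj.symm.mono (hW.subC.trans (image_subset_range _ _)) (image_subset_range _ _))
    by_cases hsm : r - l < ε
    · -- short wall
      beta_reduce at e0 e1
      rw [show l + (r - l) * 0 = l by ring] at e0
      rw [show l + (r - l) * 1 = r by ring] at e1
      obtain ⟨z, hz, hzI, T, hT1, hT2, hT3, hT4, hT5⟩ := hsw l r (hl.trans hr) hsm e0 e1
      have hsub : (arc fun t => gc Ωb (1/2) (l + (r - l) * t)) ⊆ Ωb '' closedBall z (1/8) := by
        rw [harc]; exact (image_mono Ioo_subset_Icc_self).trans hzI
      have hs := sep_small (Z := T) hS hUo (isClosed_im h.eb (isCompact_closedBall z (1/8)))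
        ((liftable_star (p := z) ((convex_closedBall z (1/8)).starConvex (mem_closedBall_self (by norm_num)))).image h.eb.isEmbedding)
        hW.cut hsub hT2
        (disjoint_left.2 fun w hw hwU => dom_sub hU hwU (hfr (hT1 hw))) hT5
        (by beta_reduce; rw [show l + (r - l) * 0 = l by ring]; exact hT3)
        (by beta_reduce; rw [show l + (r - l) * 1 = r by ring]; exact hT4)
      have hxΔ : x ∈ (Ωb '' closedBall z (1/8))ᶜ := fun hh => hxr (image_subset_range _ _ hh)
      have hyΔ : y ∈ (Ωb '' closedBall z (1/8))ᶜ := by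
        rintro ⟨w, hw, hwy⟩
        obtain ⟨v, hv, rfl⟩ := hyb
        have := h.eb.injective hwy
        subst this
        rw [mem_sphere_zero_iff_norm] at hz
        rw [mem_ball_zero_iff] at hv
        rw [mem_closedBall_iff_norm] at hw
        have := norm_sub_norm_le z w
        rw [norm_sub_rev] at this
        linarith
      refine wall_q (E := (Ωb '' closedBall z (1/8))ᶜ) hS hUo hUc hlc hW (disjoint_left.2 fun w hw hw' => hw' (hsub hw)) ⟨x, hZU hxZ, hxΔ⟩ hs ?_
      rw [qf_mem ⟨hZU hxZ, fun hh => hxΔ (hsub hh)⟩ hxΔ, qf_mem ⟨hZU hyZ, fun hh => hyΔ (hsub hh)⟩ hyΔ]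
    · -- long wall
      push Not at hsm
      have hmem : (arc fun t => gc Ωb (1/2) (l + (r - l) * t)) ∈ F := by
        refine ⟨_, hW, rfl, ?_⟩
        have hpos := half_pos hε
        set j : ℤ := ⌊l / (ε / 2)⌋ + 1 with hj
        have j1 : l < j * (ε / 2) := by
          rw [← div_lt_iff₀ hpos, hj]; push_cast; exact Int.lt_floor_add_one _
        have j2 : j * (ε / 2) ≤ l + ε / 2 := by
          have := Int.floor_le (l / (ε / 2))
          rw [le_div_iff₀ hpos] at this
          rw [hj]; push_cast; linarith
        have hjr : (j:ℝ) * (ε / 2) < r := by linarith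
        refine ⟨gc Ωb (1/2) (j * (ε / 2)), harc ▸ ⟨_, ⟨j1, hjr⟩, rfl⟩, j, ?_, rfl⟩
        have hpi := Real.pi_pos
        constructor
        · have : -(J:ℝ) ≤ j := by
            by_contra hc; push Not at hc
            nlinarith [hα.1]
          exact_mod_cast this
        · have : (j:ℝ) ≤ J := by
            by_contra hc; push Not at hc
            nlinarith [hα.2]
          exact_mod_cast this
      refine wall_q hS hUo hUc hlc hW hda ⟨x, hZU hxZ, hxa⟩ (hN _ hW.cut ?_ ?_ hda) ?_
      · exact h.XB ⟨hfr e0, mem_range_self _⟩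
      · exact h.XB ⟨hfr e1, mem_range_self _⟩
      · exact qf_preconn hZ (fun w hw => ⟨hZU hw, fun hh => disjoint_left.1 (hZF _ hmem) hw hh⟩) hxZ hyZ
  simp only [hf0] at key
  rw [if_neg (fun hh => hxr (image_subset_range _ _ hh)), if_pos (image_mono (ball_subset_ball (by norm_num)) hyb)] at key
  exact zero_ne_one key

/-- the good cut with possibly coinciding ends -/
lemma good_cut (hS : LocallyEuclidean2 S) [CompactSpace S] (h : Cfg X A B Ωa Ωb) (hU : IsComplementaryDomain X U)
    (hlcT : LocallyConnectedSpace (frontier U)) (hN : Nonexc U (Ωa '' obox) B) (hN' : Nonexc U (Ωb '' obox) A)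
    (ha : (U ∩ Ωa '' obox).Nonempty) (hb : (U ∩ Ωb '' ball 0 (1/4)).Nonempty) :
    ∃ c, Cut U c ∧ c 0 ∈ Ωb '' sphere 0 (1/2) ∧ c 1 ∈ Ωb '' sphere 0 (1/2) ∧ Disjoint (arc c) (Ωa '' obox) ∧
      Disjoint (Wd U (arc c) (Ωa '' obox)) (Ωb '' ball 0 (1/4)) ∧ SepK U (arc c) (Ωa '' obox) := by
  have hUo := dom_open hS h.hX hU
  have hUc := (dom_conn hU).isPreconnected
  have hfr := dom_frontier hS h.hX hU
  haveI := locConn hS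
  obtain ⟨F, hFf, hFW, hF⟩ := star hS h hU hlcT hN
  have hqb : Ωb '' ball 0 (1/4) ⊆ Ωb '' obox := by
    refine image_mono fun z hz => ?_
    rw [mem_ball_zero_iff] at hz
    exact ⟨(Complex.abs_re_le_norm z).trans_lt (by linarith), (Complex.abs_im_le_norm z).trans_lt (by linarith)⟩
  have hsb : Ωb '' sphere 0 (1/2) ⊆ Ωb '' obox := by
    refine image_mono fun z hz => ?_
    rw [mem_sphere_zero_iff_norm] at hz
    exact ⟨(Complex.abs_re_le_norm z).trans_lt (by linarith), (Complex.abs_im_le_norm z).trans_lt (by linarith)⟩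
  obtain ⟨y, hyU, hyb⟩ := hb
  have hO : IsOpen (U \ Ωa '' closedBall 0 2) := hUo.sdiff (isClosed_im h.ea (isCompact_closedBall _ _))
  set P := connectedComponentIn (U \ Ωa '' closedBall 0 2) y with hP
  have hPU : P ⊆ U := (connectedComponentIn_subset _ _).trans sdiff_subset
  have hPE : Disjoint P (Ωa '' obox) := disjoint_left.2 fun z hz hz' => (connectedComponentIn_subset _ _ hz).2
    (image_mono (fun w hw => mem_closedBall_zero_iff.2 (obox_norm hw).le) hz')
  have hUP : U ∩ Ωb '' obox ⊆ P := fun z hz => lemY hS h hU hN' ⟨hyU, hqb hyb⟩ hz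
  have hFne : F.Nonempty := by
    by_contra hne
    rw [not_nonempty_iff_eq_empty] at hne
    exact hF U hUc subset_rfl (by simp [hne]) ha ⟨y, hyU, hyb⟩
  have hA : ∀ κ ∈ F, ∃ k, Good U (B ∩ Ωb '' sphere 0 (1/2)) P k ∧ arc k = κ := by
    intro κ hκ
    obtain ⟨k, hk, rfl⟩ := hFW κ hκ
    have hcl : IsClosed (Ωb '' sphere 0 (1/2)) := isClosed_im h.eb (isCompact_sphere _ _)
    have hend : ∀ t ∈ Icc (0:ℝ) 1, k t ∈ Ωb '' sphere 0 (1/2) := by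
      intro t ht
      have : t ∈ closure (Ioo (0:ℝ) 1) := by rw [closure_Ioo (by norm_num)]; exact ht
      have := ((hk.cut.tarc.cont t ht).mono Ioo_subset_Icc_self).mem_closure_image this
      exact closure_minimal hk.subC hcl this
    have k0 := hend 0 (by simp)
    have k1 := hend 1 (by simp)
    refine ⟨k, ⟨hk.cut, ⟨h.XB ⟨hfr (hk.cut.end0 hUo), image_subset_range _ _ k0⟩, k0⟩,
      ⟨h.XB ⟨hfr (hk.cut.end1 hUo), image_subset_range _ _ k1⟩, k1⟩, ?_⟩, rfl⟩
    exact fun z hz => hUP ⟨hk.cut.sub hz, hsb (hk.subC hz)⟩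
  have hB : ∀ κ ∈ F, ∀ κ' ∈ F, κ ≠ κ' → Disjoint κ κ' := by
    intro κ hκ κ' hκ' hne
    obtain ⟨k, hk, rfl⟩ := hFW κ hκ
    obtain ⟨k', hk', rfl⟩ := hFW κ' hκ'
    rw [disjoint_left]
    intro z hz hz'
    exact hne (wall_eq hUo hk hk' hz hz')
  obtain ⟨c, hc, hcF⟩ := inv_end (B := B ∩ Ωb '' sphere 0 (1/2)) hS hUo hUc (E := Ωa '' obox) (P := P)
    (fun c h1 h2 h3 h4 => hN c h1 h2.1 h3.1 h4) hO.connectedComponentIn isPreconnected_connectedComponentIn hPU hPE ha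
    hFf hFne hA hB
  · refine ⟨c, hc.cut, hc.b0.2, hc.b1.2, hPE.mono_left hc.sub, ?_, hN c hc.cut hc.b0.1 hc.b1.1 (hPE.mono_left hc.sub)⟩
    rw [disjoint_left]
    intro z hz hzb
    have hsub : connectedComponentIn (U \ arc c) z ⊆ Wd U (arc c) (Ωa '' obox) :=
      wd_preconn isPreconnected_connectedComponentIn (connectedComponentIn_subset _ _) ⟨z, mem_connectedComponentIn hz.1, hz⟩
    refine hF (connectedComponentIn (U \ arc c) z) isPreconnected_connectedComponentIn
      ((connectedComponentIn_subset _ _).trans sdiff_subset) ?_ (qf_eq_zero.1 hz.2) ⟨z, mem_connectedComponentIn hz.1, hzb⟩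
    intro κ hκ
    exact (hcF κ hκ).symm.mono_left hsub

end StarSec

open Set Metric Filter Topology
set_option linter.unusedSectionVars false

section FootSec
variable {S : Type*} [MetricSpace S] {U X A B : Set S} {Ω Ωa Ωb : ℂ → S}

lemma Cut.rev {c : ℝ → S} (h : Cut U c) : Cut U (subarc c 1 0) :=
  ⟨h.tarc.rev, by rw [arc_rev]; exact h.sub, by rw [rev_apply]; simpa using h.right, by rw [rev_apply]; simpa using h.left⟩

lemma foot1 (hU : IsOpen U) {c : ℝ → S} (hc : Cut U c) {e : S} (h0 : c 0 = e) (h1 : c 1 = e) (hΩ : IsOpenEmbedding Ω)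
    (hΩe : Ω 0 = e) (hXc : IsPreconnected X) (heX : e ∈ X) {b : S} (hb : b ∈ X) (hbΩ : b ∉ range Ω) (hUX : U ⊆ Xᶜ)
    {δ : ℝ} (hδ : 0 < δ) : ∃ s ∈ Ioo (0:ℝ) 1, ∃ η : ℝ → S, TArc η ∧ η 0 = c s ∧ arc η ⊆ U ∧ Disjoint (arc η) (arc c) ∧
      η 1 ∉ U ∧ η 1 ≠ e ∧ arc η ⊆ Ω '' ball 0 δ ∧ η 1 ∈ Ω '' ball 0 δ ∧
      (c '' Ioc 0 s ⊆ Ω '' ball 0 δ ∨ c '' Ico s 1 ⊆ Ω '' ball 0 δ) := by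
  have hO : IsOpen (Ω '' ball 0 δ) := hΩ.isOpenMap _ isOpen_ball
  have heO : e ∈ Ω '' ball 0 δ := ⟨0, mem_ball_self hδ, hΩe⟩
  have q0 : ∀ᶠ t in 𝓝[Icc 0 1] (0:ℝ), c t ∈ Ω '' ball 0 δ :=
    (hc.tarc.cont 0 (by norm_num)).eventually (by rw [h0]; exact hO.mem_nhds heO)
  have q1 : ∀ᶠ t in 𝓝[Icc 0 1] (1:ℝ), c t ∈ Ω '' ball 0 δ :=
    (hc.tarc.cont 1 (by norm_num)).eventually (by rw [h1]; exact hO.mem_nhds heO)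
  rw [eventually_nhdsWithin_iff, Metric.eventually_nhds_iff] at q0 q1
  obtain ⟨ε0, hε0, q0⟩ := q0
  obtain ⟨ε1, hε1, q1⟩ := q1
  obtain ⟨κ, hκ, hκ2, hκ0, hκ1⟩ : ∃ κ > 0, κ < 1/2 ∧ κ < ε0 ∧ κ < ε1 := by
    refine ⟨min (1/4) (min (ε0/2) (ε1/2)), by positivity, ?_, ?_, ?_⟩
    · exact lt_of_le_of_lt (min_le_left _ _) (by norm_num)
    · exact lt_of_le_of_lt (min_le_right _ _ |>.trans (min_le_left _ _)) (by linarith)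
    · exact lt_of_le_of_lt (min_le_right _ _ |>.trans (min_le_right _ _)) (by linarith)
  have Q0 : ∀ t ∈ Icc 0 κ, c t ∈ Ω '' ball 0 δ := fun t ht => q0
    (by rw [Real.dist_eq, abs_of_nonneg (by linarith [ht.1])]; linarith [ht.2]) ⟨ht.1, by linarith [ht.2]⟩
  have Q1 : ∀ t ∈ Icc (1-κ) 1, c t ∈ Ω '' ball 0 δ := fun t ht => q1
    (by rw [Real.dist_eq, abs_of_nonpos (by linarith [ht.2])]; linarith [ht.1]) ⟨by linarith [ht.1], ht.2⟩
  have heA : e ∉ arc c := h0 ▸ hc.tarc.left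
  -- small radius
  have hM : IsClosed (c '' Icc κ (1-κ)) := (isCompact_Icc.image_of_continuousOn
    (hc.tarc.cont.mono (Icc_subset_Icc hκ.le (by linarith)))).isClosed
  have hMA : c '' Icc κ (1-κ) ⊆ arc c := image_mono fun t ht => ⟨by linarith [ht.1], by linarith [ht.2]⟩
  have hr : ∃ r > 0, r < δ ∧ Disjoint (Ω '' closedBall 0 r) (c '' Icc κ (1-κ)) := by
    have : Ω ⁻¹' (c '' Icc κ (1-κ))ᶜ ∈ 𝓝 (0:ℂ) := hΩ.continuous.continuousAt
      (hM.isOpen_compl.mem_nhds (by rw [hΩe]; exact fun h => heA (hMA h)))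
    obtain ⟨r, hr, hb⟩ := Metric.mem_nhds_iff.1 this
    refine ⟨min (r/2) (δ/2), by positivity, lt_of_le_of_lt (min_le_right _ _) (by linarith), ?_⟩
    rw [disjoint_left]
    rintro _ ⟨z, hz, rfl⟩
    exact hb (closedBall_subset_ball (lt_of_le_of_lt (min_le_left _ _) (by linarith)) hz)
  obtain ⟨r, hr, hrδ, hrd⟩ := hr
  have hsph : Ω '' sphere 0 r ⊆ Ω '' ball 0 δ := image_mono (sphere_subset_closedBall.trans (closedBall_subset_ball hrδ))
  have hes : e ∉ Ω '' sphere 0 r := by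
    rintro ⟨z, hz, hze⟩
    rw [← hΩe] at hze
    have := hΩ.injective hze
    subst this
    simp at hz; linarith
  obtain ⟨p, ⟨t, ht, rfl⟩, hps⟩ := circ_hits (ρ := r) (X := c '' Icc 0 κ) hΩ
    (isPreconnected_Icc.image _ (hc.tarc.cont.mono (Icc_subset_Icc le_rfl (by linarith))))
    ⟨e, ⟨0, ⟨le_rfl, hκ.le⟩, h0⟩, 0, mem_ball_self hr, hΩe⟩
    ⟨c κ, ⟨κ, ⟨hκ.le, le_rfl⟩, rfl⟩, fun h => disjoint_left.1 hrd h ⟨κ, ⟨le_rfl, by linarith⟩, rfl⟩⟩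
  have ht0 : 0 < t := lt_of_le_of_ne ht.1 (by rintro rfl; exact hes (h0 ▸ hps))
  have htA : c t ∈ arc c := ⟨t, ⟨ht0, by linarith [ht.2]⟩, rfl⟩
  obtain ⟨α, -, hα⟩ := gc_surj hps
  obtain ⟨l, r', hl, hr', -, hw, hwa⟩ := circ_wall hΩ hr hU (α := α) (by rw [hα]; exact hc.sub htA)
    (circ_exit hΩ hr hXc (by rwa [hΩe]) hb (fun h => hbΩ (image_subset_range _ _ h)) hUX)
  have hws : ∀ t, (fun t => gc Ω r (l + (r' - l) * t)) t ∈ Ω '' sphere 0 r := fun t => gc_mem hr _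
  have hpw : c t ∈ arc (fun t => gc Ω r (l + (r' - l) * t)) := by rw [hwa]; exact ⟨α, ⟨hl, hr'⟩, hα⟩
  generalize (fun t => gc Ω r (l + (r' - l) * t)) = w at hw hpw hws
  obtain ⟨τ0, hτ0, hwτ0⟩ := hpw
  have hcc : c '' Icc 0 1 = insert e (arc c) := by
    rw [image_Icc01, h0, h1]; simp
  have hT : IsCompact (Icc (0:ℝ) 1 ∩ w ⁻¹' (c '' Icc 0 1)) :=
    isCompact_Icc.of_isClosed_subset (hw.cut.tarc.cont.preimage_isClosed_of_isClosed isClosed_Icc hc.tarc.isCompact.isClosed)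
      inter_subset_left
  obtain ⟨τ, ⟨hτI, hτc⟩, hτm⟩ := hT.exists_isGreatest ⟨τ0, Ioo_subset_Icc_self hτ0, by
    rw [mem_preimage, hwτ0]; exact arc_subset c htA⟩
  have hτge : τ0 ≤ τ := hτm ⟨Ioo_subset_Icc_self hτ0, by rw [mem_preimage, hwτ0]; exact arc_subset c htA⟩
  have hin : w τ ∈ arc c := by
    rw [mem_preimage, hcc] at hτc
    exact hτc.resolve_left fun h => hes (h ▸ hws τ)
  have hτ1 : τ < 1 := lt_of_le_of_ne hτI.2 (by rintro rfl; exact hw.cut.right (hc.sub hin))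
  have hτ0' : 0 < τ := hτ0.1.trans_le hτge
  obtain ⟨s, hs, hsw⟩ := hin
  have hsub : arc (subarc w τ 1) ⊆ arc w := arc_subarc_sub hτ1.ne hτI (by norm_num)
  refine ⟨s, hs, subarc w τ 1, hw.cut.tarc.sub hτ1.ne hτI (by norm_num), by rw [subarc_zero, hsw], hsub.trans hw.cut.sub, ?_,
    by rw [subarc_one]; exact hw.cut.right, by rw [subarc_one]; exact fun h => hes (h ▸ hws 1),
    (hsub.trans hw.subC).trans hsph, by rw [subarc_one]; exact hsph (hws 1), ?_⟩
  · rw [disjoint_left, arc_subarc w hτ1.ne, min_eq_left hτ1.le, max_eq_right hτ1.le]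
    rintro _ ⟨v, hv, rfl⟩ hvc
    have := hτm (a := v) ⟨⟨by linarith [hv.1], hv.2.le⟩, arc_subset c hvc⟩
    linarith [hv.1]
  · have hns : s ∉ Icc κ (1-κ) := fun h => disjoint_left.1 hrd (image_mono sphere_subset_closedBall (hws τ)) ⟨s, h, hsw⟩
    by_cases hsk : s < κ
    · left
      rintro _ ⟨v, hv, rfl⟩
      exact Q0 v ⟨hv.1.le, by linarith [hv.2]⟩
    · right
      have : 1 - κ < s := by
        by_contra h
        exact hns ⟨by linarith, by linarith⟩
      rintro _ ⟨v, hv, rfl⟩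
      exact Q1 v ⟨by linarith [hv.1], hv.2.le⟩

lemma foot (hU : IsOpen U) {c : ℝ → S} (hc : Cut U c) {e : S} (h0 : c 0 = e) (h1 : c 1 = e) (hΩ : IsOpenEmbedding Ω)
    (hΩe : Ω 0 = e) (hXc : IsPreconnected X) (heX : e ∈ X) {b : S} (hb : b ∈ X) (hbΩ : b ∉ range Ω) (hUX : U ⊆ Xᶜ)
    {δ : ℝ} (hδ : 0 < δ) : ∃ c' : ℝ → S, Cut U c' ∧ arc c' = arc c ∧ c' 0 = e ∧ c' 1 = e ∧
      ∃ s ∈ Ioo (0:ℝ) 1, ∃ η : ℝ → S, TArc η ∧ η 0 = c' s ∧ arc η ⊆ U ∧ Disjoint (arc η) (arc c') ∧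
      η 1 ∉ U ∧ η 1 ≠ e ∧ arc η ⊆ Ω '' ball 0 δ ∧ η 1 ∈ Ω '' ball 0 δ ∧ c' '' Ioc 0 s ⊆ Ω '' ball 0 δ := by
  obtain ⟨s, hs, η, k1, k2, k3, k4, k5, k6, k7, k8, k9 | k9⟩ := foot1 hU hc h0 h1 hΩ hΩe hXc heX hb hbΩ hUX hδ
  · exact ⟨c, hc, rfl, h0, h1, s, hs, η, k1, k2, k3, k4, k5, k6, k7, k8, k9⟩
  · refine ⟨subarc c 1 0, hc.rev, arc_rev c, by rw [rev_apply]; simpa using h1, by rw [rev_apply]; simpa using h0, 1 - s,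
      ⟨by linarith [hs.2], by linarith [hs.1]⟩, η, k1, by rw [rev_apply, k2]; congr 1; ring, k3, by rwa [arc_rev], k5, k6, k7, k8, ?_⟩
    rintro _ ⟨v, hv, rfl⟩
    rw [rev_apply]
    exact k9 ⟨1 - v, ⟨by linarith [hv.2], by linarith [hv.1]⟩, rfl⟩

end FootSec

open Set Metric Filter Topology
set_option linter.unusedSectionVars false

section MainCut
variable {S : Type*} [MetricSpace S] {U X A B : Set S} {Ω Ωa Ωb : ℂ → S}

lemma main_cut (hS : LocallyEuclidean2 S) [CompactSpace S] (h : Cfg X A B Ωa Ωb) (hU : IsComplementaryDomain X U)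
    (hlcT : LocallyConnectedSpace (frontier U)) (hN : Nonexc U (Ωa '' obox) B) (hN' : Nonexc U (Ωb '' obox) A)
    (ha : (U ∩ Ωa '' obox).Nonempty) (hb : (U ∩ Ωb '' ball 0 (1/4)).Nonempty) :
    ∃ c, Cut U c ∧ c 0 ≠ c 1 ∧ ∀ x ∈ U \ arc c, Disjoint (connectedComponentIn (U \ arc c) x) (Ωa '' obox) ∨
      Disjoint (connectedComponentIn (U \ arc c) x) (Ωb '' ball 0 (1/4)) := by
  have hUo := dom_open hS h.hX hU
  have hUc := (dom_conn hU).isPreconnected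
  have hfr := dom_frontier hS h.hX hU
  have red : ∀ c : ℝ → S, Disjoint (Wd U (arc c) (Ωa '' obox)) (Ωb '' ball 0 (1/4)) → ∀ x ∈ U \ arc c,
      Disjoint (connectedComponentIn (U \ arc c) x) (Ωa '' obox) ∨
      Disjoint (connectedComponentIn (U \ arc c) x) (Ωb '' ball 0 (1/4)) := by
    intro c hd x hx
    by_contra hcon
    push Not at hcon
    obtain ⟨q1, q2⟩ := hcon
    rw [not_disjoint_iff_nonempty_inter] at q1 q2
    obtain ⟨y, hy, hyb⟩ := q2
    exact disjoint_left.1 hd ⟨connectedComponentIn_subset _ _ hy, by rw [qf_eq hy]; exact qf_eq_zero.2 q1⟩ hyb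
  obtain ⟨c, hc, c0, c1, cd, cW, cS⟩ := good_cut hS h hU hlcT hN hN' ha hb
  by_cases hne : c 0 = c 1
  swap
  · exact ⟨c, hc, hne, red c cW⟩
  obtain ⟨e, he⟩ : ∃ e, c 0 = e := ⟨_, rfl⟩
  have he1 : c 1 = e := by rw [← hne, he]
  have hefr : e ∈ frontier U := he ▸ hc.end0 hUo
  have hNo : IsOpen (Ωb '' (closedBall 0 (1/4))ᶜ) := h.eb.isOpenMap _ isClosed_closedBall.isOpen_compl
  have heN : e ∈ Ωb '' (closedBall 0 (1/4))ᶜ := by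
    rw [← he]
    obtain ⟨z, hz, hz'⟩ := c0
    refine ⟨z, ?_, hz'⟩
    simp at hz ⊢
    rw [hz]; norm_num
  obtain ⟨Ωe, hΩe, hΩe0, hΩeN⟩ := exists_chart hS e (hNo.mem_nhds heN)
  have hNb : Ωb '' (closedBall 0 (1/4))ᶜ ⊆ range Ωb := image_subset_range _ _
  have offb : ∀ y ∈ Ωb '' closedBall 0 (1/4), y ∉ range Ωe := by
    rintro _ ⟨z, hz, rfl⟩ hy
    obtain ⟨z', hz', hzz⟩ := hΩeN hy
    have := h.eb.injective hzz
    subst this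
    exact hz' hz
  have offa : ∀ y ∈ Ωa '' obox, y ∉ range Ωe := by
    rintro y hy hy'
    exact disjoint_left.1 h.disj (image_subset_range _ _ hy) (hNb (hΩeN hy'))
  obtain ⟨ε, hε, hεb⟩ : ∃ ε > 0, ball e ε ⊆ Ωe '' ball 0 1 :=
    Metric.mem_nhds_iff.1 ((hΩe.isOpenMap _ isOpen_ball).mem_nhds ⟨0, mem_ball_self one_pos, hΩe0⟩)
  obtain ⟨δ, hδ, hul⟩ := ulc (T := frontier U) isClosed_frontier.isCompact hε
  obtain ⟨δ1, hδ1, hδ1b⟩ : ∃ δ1 > 0, ball (0:ℂ) δ1 ⊆ Ωe ⁻¹' ball e δ :=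
    Metric.mem_nhds_iff.1 (hΩe.continuous.continuousAt (by rw [hΩe0]; exact ball_mem_nhds _ hδ))
  obtain ⟨c', hc', hcc, hc0, hc1, s, hs, η, k1, k2, k3, k4, k5, k6, k7, k8, k9⟩ :=
    foot (δ := min δ1 1) hUo hc he he1 hΩe hΩe0 h.hXc (hfr hefr) h.b0 (offb _ ⟨0, by simp, rfl⟩) (dom_sub hU) (by positivity)
  have hbr : Ωe '' ball 0 (min δ1 1) ⊆ range Ωe := image_subset_range _ _
  have hb1 : Ωe '' ball 0 (min δ1 1) ⊆ Ωe '' closedBall 0 1 :=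
    image_mono ((ball_subset_ball (min_le_right _ _)).trans ball_subset_closedBall)
  have th := theta_mk hc' hs k1 k2 k3 k4 k5
  have z1 : cat (subarc c' 1 s) η 0 = e := by rw [cat_zero, subarc_zero, hc1]
  have z2 : cat (subarc c' 0 s) η 0 = e := by rw [cat_zero, subarc_zero, hc0]
  have o1 : cat (subarc c' 1 s) η 1 = η 1 := cat_one _ _
  have o2 : cat (subarc c' 0 s) η 1 = η 1 := cat_one _ _
  have hη1 : η 1 ∈ frontier U := o2 ▸ th.cut2.end1 hUo
  have cut1 := th.cut1
  have cut2 := th.cut2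
  have a1 := th.a1
  have a2 := th.a2
  obtain ⟨Z, hZ1, hZ2, hZ3, hZ4, hZ5⟩ := hul e hefr (η 1) hη1 (by
    obtain ⟨z, hz, hz'⟩ := k8
    have := hδ1b (ball_subset_ball (min_le_left _ _) hz)
    rw [mem_preimage, hz', mem_ball, dist_comm] at this
    exact this)
  have hfrU : Disjoint (frontier U) U := by
    rw [hUo.frontier_eq]; exact disjoint_left.2 fun x hx => hx.2
  have Kssub : arc (cat (subarc c' 0 s) η) ⊆ Ωe '' closedBall 0 1 := by
    rw [a2]
    refine (insert_subset ?_ (union_subset k7 ?_)).trans hb1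
    · exact k9 ⟨s, ⟨hs.1, le_rfl⟩, rfl⟩
    · exact (image_mono Ioo_subset_Ioc_self).trans k9
  have sK := sep_small (Z := Z) hS hUo (isClosed_im hΩe (isCompact_closedBall 0 1))
    (Liftable.image (liftable_star ((convex_closedBall (0:ℂ) 1).starConvex (mem_closedBall_self zero_le_one))) hΩe.isEmbedding)
    cut2 Kssub hZ2 (hfrU.mono_left hZ1) (hZ5.trans (hεb.trans (image_mono ball_subset_closedBall))) (z2 ▸ hZ3) (o2 ▸ hZ4)
  have hDa : Ωa '' obox ⊆ (Ωe '' closedBall 0 1)ᶜ := fun y hy hy' => offa y hy (image_subset_range _ _ hy')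
  have s2 : SepK U (arc (cat (subarc c' 0 s) η)) (Ωa '' obox) := sK.mono hDa
  have hηd : Disjoint (arc η) (Ωa '' obox) := disjoint_right.2 fun y hy hy' => offa y hy (hbr (k7 hy'))
  have hHd : Disjoint (HH (arc η) (c' '' Ioo 0 s) (c' '' Ioo s 1) (c' s)) (Ωa '' obox) := by
    rw [th.eqH, hcc]; exact cd.union_left hηd
  have s1 : SepK U (arc (cat (subarc c' 1 s) η)) (Ωa '' obox) := by
    refine hN _ cut1 (h.XB ⟨?_, ?_⟩) (h.XB ⟨?_, ?_⟩) (hHd.mono_left th.sub1)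
    · rw [z1]; exact hfr hefr
    · rw [z1]; exact hNb heN
    · rw [o1]; exact hfr hη1
    · rw [o1]; exact hNb (hΩeN (hbr k8))
  have s0 : SepK U (arc c') (Ωa '' obox) := by rw [hcc]; exact cS
  refine ⟨_, cut1, by rw [z1, o1]; exact k6.symm, red _ ?_⟩
  rw [disjoint_left]
  rintro y ⟨hy, hy0⟩ hyb
  have hyo : y ∉ range Ωe := offb y (image_mono ball_subset_closedBall hyb)
  have hyH : y ∉ HH (arc η) (c' '' Ioo 0 s) (c' '' Ioo s 1) (c' s) := by
    intro hyH
    have hy2 := hy.2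
    rw [a1] at hy2
    rcases hyH with q | (q | q) | q
    · exact hy2 (Or.inl q)
    · exact hy2 (Or.inr (Or.inl q))
    · exact hyo (hbr (k9 (image_mono Ioo_subset_Ioc_self q)))
    · exact hy2 (Or.inr (Or.inr q))
  have sum := theta_sum th hS hUo hUc hHd ha s0 s1 s2 ⟨hy.1, hyH⟩
  have hyK : y ∈ U \ arc (cat (subarc c' 0 s) η) := ⟨hy.1, fun q => hyH (th.sub2 q)⟩
  have qs : qf U (arc (cat (subarc c' 0 s) η)) (Ωa '' obox) y = 0 := by
    rw [q_mono hS hUo hUc cut2 (E' := (Ωe '' closedBall 0 1)ᶜ) (disjoint_left.2 fun x hx hx' => hx' (Kssub hx)) hDa ha sK hyK]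
    exact qf_mem hyK fun hy' => hyo (image_subset_range _ _ hy')
  rw [hy0, qs, add_zero, add_zero, hcc] at sum
  exact disjoint_left.1 cW ⟨⟨hy.1, fun q => hyH (th.sub0 (hcc ▸ q))⟩, sum⟩ hyb

lemma any_cut (hS : LocallyEuclidean2 S) [PreconnectedSpace S] (hX : IsClosed X) (hXc : IsPreconnected X) (hXn : X.Nontrivial)
    (hU : IsComplementaryDomain X U) : ∃ c, Cut U c ∧ c 0 ≠ c 1 := by
  have hUo := dom_open hS hX hU
  have hUX := dom_sub hU
  have hUc := dom_conn hU
  have hfr := dom_frontier hS hX hU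
  obtain ⟨e, he⟩ : (frontier U).Nonempty := by
    by_contra hne
    rw [not_nonempty_iff_eq_empty, ← isClopen_iff_frontier_eq_empty, isClopen_iff] at hne
    obtain ⟨x, hx⟩ := hXn.nonempty
    obtain ⟨u, hu⟩ := hUc.nonempty
    rcases hne with q | q
    · rw [q] at hu; exact hu
    · exact hUX (q ▸ mem_univ x) hx
  obtain ⟨b, hb, hbe⟩ := hXn.exists_ne e
  obtain ⟨u, hu⟩ := hUc.nonempty
  have hue : u ≠ e := by rintro rfl; exact hUX hu (hfr he)
  obtain ⟨Ω, hΩ, hΩ0, hΩN⟩ := exists_chart hS e (N := {b}ᶜ ∩ {u}ᶜ)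
    (inter_mem (isOpen_compl_singleton.mem_nhds hbe.symm) (isOpen_compl_singleton.mem_nhds hue.symm))
  have hbΩ : b ∉ range Ω := fun q => (hΩN q).1 rfl
  have huΩ : u ∉ range Ω := fun q => (hΩN q).2 rfl
  obtain ⟨p, hpU, hps⟩ := circ_hits (ρ := 1) hΩ hUc.isPreconnected (by
    have := mem_closure_iff.1 (frontier_subset_closure he) _ (hΩ.isOpenMap _ (isOpen_ball : IsOpen (ball (0:ℂ) 1)))
      ⟨0, mem_ball_self one_pos, hΩ0⟩
    rwa [inter_comm] at this) ⟨u, hu, fun q => huΩ (image_subset_range _ _ q)⟩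
  obtain ⟨α, -, rfl⟩ := gc_surj hps
  obtain ⟨l, r, -, -, -, hw, -⟩ := circ_wall hΩ one_pos hUo hpU
    (circ_exit hΩ one_pos hXc (by rw [hΩ0]; exact hfr he) hb (fun q => hbΩ (image_subset_range _ _ q)) hUX)
  have hc := hw.cut
  generalize (fun t => gc Ω 1 (l + (r - l) * t)) = c at hc
  by_cases hne : c 0 = c 1
  swap
  · exact ⟨c, hc, hne⟩
  obtain ⟨b', hb', hbe'⟩ := hXn.exists_ne (c 0)
  obtain ⟨Ω', hΩ', hΩ0', hΩN'⟩ := exists_chart hS (c 0) (N := {b'}ᶜ) (isOpen_compl_singleton.mem_nhds hbe'.symm)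
  obtain ⟨c', hc', hcc, hc0, hc1, s, hs, η, k1, k2, k3, k4, k5, k6, k7, k8, k9⟩ :=
    foot (δ := 1) hUo hc rfl hne.symm hΩ' hΩ0' hXc (hfr (hc.end0 hUo)) hb' (fun q => hΩN' q rfl) hUX one_pos
  refine ⟨_, (theta_mk hc' hs k1 k2 k3 k4 k5).cut1, ?_⟩
  rw [cat_zero, cat_one, subarc_zero, hc1]
  exact k6.symm

lemma cut_crosscut (hU : IsOpen U) {c : ℝ → S} (hc : Cut U c) (hne : c 0 ≠ c 1) : IsCrosscut U (arc c) := by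
  have hinj : InjOn c (Icc 0 1) := by
    intro s hs t ht hst
    by_cases hs' : s ∈ Ioo (0:ℝ) 1
    · exact hc.tarc.inj' hs' ht hst
    by_cases ht' : t ∈ Ioo (0:ℝ) 1
    · exact (hc.tarc.inj' ht' hs hst.symm).symm
    have e1 : s = 0 ∨ s = 1 := by
      by_contra hcon; push Not at hcon
      exact hs' ⟨lt_of_le_of_ne hs.1 hcon.1.symm, lt_of_le_of_ne hs.2 hcon.2⟩
    have e2 : t = 0 ∨ t = 1 := by
      by_contra hcon; push Not at hcon
      exact ht' ⟨lt_of_le_of_ne ht.1 hcon.1.symm, lt_of_le_of_ne ht.2 hcon.2⟩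
    rcases e1 with rfl | rfl <;> rcases e2 with rfl | rfl
    · rfl
    · exact absurd hst hne
    · exact absurd hst.symm hne
    · rfl
  have hcl : closure (arc c) = c '' Icc 0 1 := by
    apply Subset.antisymm
    · exact closure_minimal (arc_subset c) hc.tarc.isCompact.isClosed
    · have := hc.tarc.cont
      rw [← closure_Ioo zero_ne_one] at this ⊢
      exact this.image_closure
  have hf1 : Continuous (fun t : Icc (0:ℝ) 1 => c t) := continuousOn_iff_continuous_restrict.1 hc.tarc.cont
  have hf2 : Function.Injective (fun t : Icc (0:ℝ) 1 => c t) := fun s t hst => Subtype.ext (hinj s.2 t.2 hst)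
  have hemb : IsEmbedding (fun t : Icc (0:ℝ) 1 => c t) := (hf1.isClosedEmbedding hf2).isEmbedding
  have hemb2 : IsEmbedding (fun t : Ioo (0:ℝ) 1 => c t) :=
    hemb.comp (IsEmbedding.inclusion (Ioo_subset_Icc_self (a := (0:ℝ)) (b := 1)))
  have hra : range (fun t : Ioo (0:ℝ) 1 => c t) = arc c := by
    ext y; simp [arc]
  refine ⟨hc.sub, ⟨((hemb2.toHomeomorph).trans (Homeomorph.setCongr hra)).symm⟩, c 0, c 1,
    ⟨fun t => c t, hf1, hf2, ?_, rfl, rfl⟩, ?_⟩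
  · rw [hcl]; ext y; simp
  · rw [hcl, image_Icc01]
    ext y
    constructor
    · rintro ⟨rfl | rfl | q, hy⟩
      · exact Or.inl rfl
      · exact Or.inr rfl
      · rw [hU.frontier_eq] at hy; exact absurd (hc.sub q) hy.2
    · rintro (rfl | rfl)
      · exact ⟨Or.inl rfl, hc.end0 hU⟩
      · exact ⟨Or.inr (Or.inl rfl), hc.end1 hU⟩

end MainCut

open Set Metric Filter Topology
set_option linter.unusedSectionVars false

section Backward
variable {S : Type*} [MetricSpace S] {U X A B : Set S} {Ω Ωa Ωb : ℂ → S}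

lemma far [CompactSpace S] {T : Set S} (hT : T.Nonempty) {x : S} (hx : x ∈ X) {r : ℝ} (hd : Disjoint T (ball x r)) :
    r ≤ hausdorffDist T X := by
  have hfin : hausdorffEDist X T ≠ ⊤ := hausdorffEDist_ne_top_of_nonempty_of_bounded ⟨x, hx⟩ hT
    (isCompact_univ.isBounded.subset (subset_univ _)) (isCompact_univ.isBounded.subset (subset_univ _))
  rw [hausdorffDist_comm]
  refine le_trans ((le_infDist hT).2 fun y hy => ?_) (infDist_le_hausdorffDist_of_mem hx hfin)
  by_contra hlt
  push Not at hlt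
  exact disjoint_left.1 hd hy (by rwa [mem_ball, dist_comm])

lemma small_ball {O : Set S} (hO : IsOpen O) {x : S} (hx : x ∈ O) : ∀ᶠ r in 𝓝[>] (0:ℝ), ball x r ⊆ O := by
  obtain ⟨r, hr, hb⟩ := Metric.isOpen_iff.1 hO x hx
  filter_upwards [Ioo_mem_nhdsGT hr] with s hs
  exact (ball_subset_ball hs.2.le).trans hb

lemma uniform_cut [CompactSpace S] [PreconnectedSpace S] (hS : LocallyEuclidean2 S) (hX : IsClosed X) (hXc : IsPreconnected X)
    (hXn : X.Nontrivial) (hsh : IsShielded X)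
    (hlc : ∀ U : Set S, IsComplementaryDomain X U → LocallyConnectedSpace (frontier U)) (hdec : IsDecomposable X) :
    ∃ r > 0, ∀ V, IsComplementaryDomain X V → ∃ K, IsCrosscut V K ∧ ∀ T, IsShadowOf V K T → r ≤ hausdorffDist T X := by
  obtain ⟨A, B, ⟨hA0, hAc, hAcon, hAX, hAne⟩, ⟨hB0, hBc, hBcon, hBX, hBne⟩, hAB⟩ := hdec
  obtain ⟨a, ha, haB⟩ : ∃ a ∈ X, a ∉ B := by
    by_contra hcon; push Not at hcon; exact hBne (hBX.antisymm hcon)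
  obtain ⟨b, hb, hbA⟩ : ∃ b ∈ X, b ∉ A := by
    by_contra hcon; push Not at hcon; exact hAne (hAX.antisymm hcon)
  have hab : a ≠ b := by
    rintro rfl
    rw [← hAB] at ha
    exact ha.elim hbA haB
  obtain ⟨Na, Nb, hNa, hNb, haN, hbN, hNN⟩ := t2_separation hab
  obtain ⟨Ωa, ea, ea0, era⟩ := exists_chart hS a ((hNa.inter hBc.isOpen_compl).mem_nhds ⟨haN, haB⟩)
  obtain ⟨Ωb, eb, eb0, erb⟩ := exists_chart hS b ((hNb.inter hAc.isOpen_compl).mem_nhds ⟨hbN, hbA⟩)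
  have cfg : Cfg X A B Ωa Ωb :=
    { hX := hX, hXc := hXc, AX := hAX, BX := hBX, Ac := hAcon.isPreconnected, Bc := hBcon.isPreconnected, ea := ea, eb := eb
      disj := hNN.mono (fun x hx => (era hx).1) (fun x hx => (erb hx).1)
      a0 := by rwa [ea0]
      b0 := by rwa [eb0]
      XA := fun x hx => by
        have := hx.1; rw [← hAB] at this
        exact this.resolve_right (era hx.2).2
      XB := fun x hx => by
        have := hx.1; rw [← hAB] at this
        exact this.resolve_left (erb hx.2).2
      AE := disjoint_left.2 fun x hx hx' => (erb hx').2 hx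
      BE := disjoint_left.2 fun x hx hx' => (era hx').2 hx }
  have oa : IsOpen (Ωa '' obox) := ea.isOpenMap _ isOpen_obox
  have ob : IsOpen (Ωb '' obox) := eb.isOpenMap _ isOpen_obox
  have ob' : IsOpen (Ωb '' ball 0 (1/4)) := eb.isOpenMap _ isOpen_ball
  have haO : a ∈ Ωa '' obox := ⟨0, by simp [obox], ea0⟩
  have hbO : b ∈ Ωb '' ball 0 (1/4) := ⟨0, by simp, eb0⟩
  obtain ⟨N1, hN1⟩ := rank_lemma oa.isClosed_compl.isCompact (nice_compl_box hS ea)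
  obtain ⟨N2, hN2⟩ := rank_lemma ob.isClosed_compl.isCompact (nice_compl_box hS eb)
  have f1 := exc_finite hS hX oa hN1 hBX hBcon.isPreconnected (cfg.BE.mono_right (image_subset_range _ _))
  have f2 := exc_finite hS hX ob hN2 hAX hAcon.isPreconnected (cfg.AE.mono_right (image_subset_range _ _))
  have hF := f1.union f2
  have hev : ∀ᶠ r in 𝓝[>] (0:ℝ), ∀ V ∈ {U | IsComplementaryDomain X U ∧ ¬ Nonexc U (Ωa '' obox) B} ∪
      {U | IsComplementaryDomain X U ∧ ¬ Nonexc U (Ωb '' obox) A}, ∃ x ∈ X, ball x r ⊆ (frontier V)ᶜ := by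
    rw [eventually_all_finite hF]
    intro V hV
    have hVd : IsComplementaryDomain X V := by
      rcases hV with q | q
      · exact q.1
      · exact q.1
    obtain ⟨x, hx, hxV⟩ : ∃ x ∈ X, x ∉ frontier V := by
      by_contra hcon; push Not at hcon
      exact hsh V hVd ((dom_frontier hS hX hVd).antisymm hcon)
    filter_upwards [small_ball isClosed_frontier.isOpen_compl hxV] with r hr
    exact ⟨x, hx, hr⟩
  obtain ⟨r, ⟨⟨hr, hra⟩, hrb⟩, hr0⟩ := (((hev.and (small_ball oa haO)).and (small_ball ob' hbO)).and self_mem_nhdsWithin).exists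
  refine ⟨r, hr0, fun V hV => ?_⟩
  have hVo := dom_open hS hX hV
  have hVc := (dom_conn hV).isPreconnected
  have hne : ∀ c, Cut V c → ∀ T, IsShadowOf V (arc c) T → T.Nonempty := by
    rintro c hc T ⟨x, hx, rfl⟩
    exact ⟨c 0, cut_shadow hS hVo hVc hc hx, hc.end0 hVo⟩
  by_cases hex : V ∈ {U | IsComplementaryDomain X U ∧ ¬ Nonexc U (Ωa '' obox) B} ∪
      {U | IsComplementaryDomain X U ∧ ¬ Nonexc U (Ωb '' obox) A}
  · obtain ⟨c, hc, hc01⟩ := any_cut hS hX hXc hXn hV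
    refine ⟨arc c, cut_crosscut hVo hc hc01, fun T hT => ?_⟩
    obtain ⟨x, hx, hxr⟩ := hr V hex
    refine far (hne c hc T hT) hx ?_
    obtain ⟨y, hy, rfl⟩ := hT
    exact disjoint_left.2 fun z hz hz' => hxr hz' hz.2
  · have n1 : Nonexc V (Ωa '' obox) B := by
      by_contra q; exact hex (Or.inl ⟨hV, q⟩)
    have n2 : Nonexc V (Ωb '' obox) A := by
      by_contra q; exact hex (Or.inr ⟨hV, q⟩)
    have key : ∀ c, Cut V c → (∀ x ∈ V \ arc c, Disjoint (connectedComponentIn (V \ arc c) x) (Ωa '' obox) ∨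
        Disjoint (connectedComponentIn (V \ arc c) x) (Ωb '' ball 0 (1/4))) →
        ∀ T, IsShadowOf V (arc c) T → r ≤ hausdorffDist T X := by
      intro c hc hd T hT
      have hTn := hne c hc T hT
      obtain ⟨y, hy, rfl⟩ := hT
      rcases hd y hy with q | q
      · exact far hTn ha (((q.closure_left oa).mono_right hra).mono_left inter_subset_left)
      · exact far hTn hb (((q.closure_left ob').mono_right hrb).mono_left inter_subset_left)
    by_cases m1 : (V ∩ Ωa '' obox).Nonempty
    · by_cases m2 : (V ∩ Ωb '' ball 0 (1/4)).Nonempty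
      · obtain ⟨c, hc, hc01, hcd⟩ := main_cut hS cfg hV (hlc V hV) n1 n2 m1 m2
        exact ⟨arc c, cut_crosscut hVo hc hc01, key c hc hcd⟩
      · obtain ⟨c, hc, hc01⟩ := any_cut hS hX hXc hXn hV
        refine ⟨arc c, cut_crosscut hVo hc hc01, key c hc fun x hx => Or.inr ?_⟩
        rw [← not_disjoint_iff_nonempty_inter, not_not] at m2
        exact m2.mono_left ((connectedComponentIn_subset _ _).trans sdiff_subset)
    · obtain ⟨c, hc, hc01⟩ := any_cut hS hX hXc hXn hV
      refine ⟨arc c, cut_crosscut hVo hc hc01, key c hc fun x hx => Or.inl ?_⟩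
      rw [← not_disjoint_iff_nonempty_inter, not_not] at m1
      exact m1.mono_left ((connectedComponentIn_subset _ _).trans sdiff_subset)

lemma shielded_nontrivial [CompactSpace S] [ConnectedSpace S] (hS : LocallyEuclidean2 S) (hX : IsContinuum X) (hsh : IsShielded X) :
    X.Nontrivial := by
  by_contra hnt
  rw [not_nontrivial_iff] at hnt
  obtain ⟨p, hp⟩ := hX.2.nonempty
  have hXp : X = {p} := hnt.eq_singleton_of_mem hp
  have hpre : IsPreconnected ({p}ᶜ : Set S) := by
    rw [compl_eq_univ_sdiff]; exact preconnected_diff_point hS isOpen_univ isPreconnected_univ p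
  obtain ⟨Ω, hΩ, hΩ0, -⟩ := exists_chart hS p univ_mem
  have hq : Ω 1 ≠ p := by
    rw [← hΩ0]; exact fun h => one_ne_zero (hΩ.injective h)
  have hU : IsComplementaryDomain X {p}ᶜ := by
    refine ⟨Ω 1, by rw [hXp]; exact hq, ?_⟩
    rw [hXp]
    exact (hpre.connectedComponentIn (show Ω 1 ∈ ({p}ᶜ : Set S) from hq)).symm
  refine hsh _ hU ?_
  have h1 := dom_frontier hS hX.1.isClosed hU
  rw [hXp] at h1 ⊢
  refine h1.antisymm ?_
  rw [singleton_subset_iff]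
  by_contra hpf
  have hemp : frontier ({p}ᶜ : Set S) = ∅ := by
    rw [eq_empty_iff_forall_notMem]
    intro x hx
    have := h1 hx
    rw [mem_singleton_iff] at this
    exact hpf (this ▸ hx)
  rw [← isClopen_iff_frontier_eq_empty, isClopen_iff] at hemp
  rcases hemp with q | q
  · have : Ω 1 ∈ ({p}ᶜ : Set S) := hq
    rw [q] at this; exact this
  · have : p ∈ ({p}ᶜ : Set S) := q ▸ mem_univ p
    exact this rfl

end Backward

/-- A shielded continuum in a closed surface, all of whose complementary
domains have locally connected frontier, is indecomposable if and only if it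
has a sequence of complementary domains satisfying the double-pass condition
with crosscuts. -/
theorem shielded_locallyConnected_indecomposable_iff_doublePass_crosscuts
    {S : Type*} [MetricSpace S] [CompactSpace S] [ConnectedSpace S] [Nonempty S]
    (hS : LocallyEuclidean2 S)
    (X : Set S) (hX : IsContinuum X) (hsh : IsShielded X)
    (hlc : ∀ U : Set S, IsComplementaryDomain X U →
      LocallyConnectedSpace (frontier U)) :
    ¬ IsDecomposable X ↔
      ∃ U : ℕ → Set S, (∀ n, IsComplementaryDomain X (U n)) ∧
        DoublePassConditionCrosscuts X U := by
  have hXn := shielded_nontrivial hS hX hsh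
  constructor
  · intro h
    exact forward hS ⟨hX.1, hX.2.isPreconnected, h, hXn⟩
  · rintro ⟨U, hU, hD⟩ hdec
    obtain ⟨r, hr, hK⟩ := uniform_cut hS hX.1.isClosed hX.2.isPreconnected hXn hsh hlc hdec
    choose K hK1 hK2 using fun n => hK (U n) (hU n)
    obtain ⟨Sh, hSh, hlim⟩ := hD K hK1
    have := (tendsto_order.1 hlim).2 r hr
    obtain ⟨n, hn⟩ := this.exists
    exact absurd hn (not_lt.2 (hK2 n _ (hSh n)))
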